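/- Let K = ℚ(√−7) with ring of integers 𝒪_K = ℤ[(1+√−7)/2]. The graded ℂ-algebra M_*^{sym}(Γ_K) of symmetric Hermitian modular forms of degree two for 𝒪_K is generated by nine symmetric Hermitian modular forms of weights 4, 6, 7, 8, 9, 10, 10, 11 and 12; that is, there exist symmetric Hermitian modular forms of these weights such that every symmetric Hermitian modular form is a polynomial in them with complex coefficients. -/

import Mathlib

noncomputable section

open Matrix Filter Topology
open scoped ComplexOrder

attribute [local instance] Matrix.normedAddCommGroup Matrix.normedSpace

/-- The algebraic number (1 + √(-d))/2 = (1 + i·√d)/2 , viewed in ℂ. -/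
def omg (d : ℕ) : ℂ := (1 + Complex.I * (Real.sqrt d : ℝ)) / 2

/-- The ring of integers ℤ[(1+√(-d))/2] of ℚ(√(-d)) (for d ≡ 3 mod 4), as a subset of ℂ. -/
def ringInts (d : ℕ) : Set ℂ := {z | ∃ a b : ℤ, z = (a : ℂ) + (b : ℂ) * omg d}

/-- The Hermitian upper half-space of degree two: 2×2 complex matrices τ such that
(τ - conj(τ)ᵀ)/(2i) is positive definite. -/
def HH2 : Set (Matrix (Fin 2) (Fin 2) ℂ) :=
  {τ | (Matrix.of fun i j => (τ i j - (starRingEnd ℂ) (τ j i)) / (2 * Complex.I)).PosDef}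

/-- The matrix J = [[0, -I₂],[I₂, 0]]. -/
def Jmat : Matrix (Fin 4) (Fin 4) ℂ :=
  !![0,0,-1,0; 0,0,0,-1; 1,0,0,0; 0,1,0,0]

/-- Upper-left 2×2 block. -/
def blkA (M : Matrix (Fin 4) (Fin 4) ℂ) : Matrix (Fin 2) (Fin 2) ℂ :=
  !![M 0 0, M 0 1; M 1 0, M 1 1]
/-- Upper-right 2×2 block. -/
def blkB (M : Matrix (Fin 4) (Fin 4) ℂ) : Matrix (Fin 2) (Fin 2) ℂ :=
  !![M 0 2, M 0 3; M 1 2, M 1 3]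
/-- Lower-left 2×2 block. -/
def blkC (M : Matrix (Fin 4) (Fin 4) ℂ) : Matrix (Fin 2) (Fin 2) ℂ :=
  !![M 2 0, M 2 1; M 3 0, M 3 1]
/-- Lower-right 2×2 block. -/
def blkD (M : Matrix (Fin 4) (Fin 4) ℂ) : Matrix (Fin 2) (Fin 2) ℂ :=
  !![M 2 2, M 2 3; M 3 2, M 3 3]

/-- Membership in SU_{2,2}(𝒪_K): entries in 𝒪_K, determinant 1, and Mᵀ·J·conj(M) = J. -/
def inSU (d : ℕ) (M : Matrix (Fin 4) (Fin 4) ℂ) : Prop :=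
  (∀ i j, M i j ∈ ringInts d) ∧ M.det = 1 ∧
    Mᵀ * Jmat * M.map (starRingEnd ℂ) = Jmat

/-- Möbius action M·τ = (aτ+b)(cτ+d)⁻¹. -/
def moebius (M : Matrix (Fin 4) (Fin 4) ℂ) (τ : Matrix (Fin 2) (Fin 2) ℂ) :
    Matrix (Fin 2) (Fin 2) ℂ :=
  (blkA M * τ + blkB M) * (blkC M * τ + blkD M)⁻¹

/-- A Hermitian modular form of weight k for 𝒪_K, K = ℚ(√(-d)): a holomorphic function on
𝐇₂ satisfying F(M·τ) = det(cτ+d)^k·F(τ) for all M ∈ SU_{2,2}(𝒪_K). -/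
def IsHMF (d k : ℕ) (F : Matrix (Fin 2) (Fin 2) ℂ → ℂ) : Prop :=
  DifferentiableOn ℂ F HH2 ∧
    ∀ M, inSU d M → ∀ τ ∈ HH2,
      F (moebius M τ) = (blkC M * τ + blkD M).det ^ k * F τ

/-- A symmetric Hermitian modular form: F(τᵀ) = (-1)^k F(τ). -/
def IsSymHMF (d k : ℕ) (F : Matrix (Fin 2) (Fin 2) ℂ → ℂ) : Prop :=
  IsHMF d k F ∧ ∀ τ ∈ HH2, F τᵀ = (-1) ^ k * F τ

/-- A skew-symmetric Hermitian modular form: F(τᵀ) = -(-1)^k F(τ). -/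
def IsSkewHMF (d k : ℕ) (F : Matrix (Fin 2) (Fin 2) ℂ → ℂ) : Prop :=
  IsHMF d k F ∧ ∀ τ ∈ HH2, F τᵀ = -((-1) ^ k * F τ)

/-- The embedding φ_λ of the Siegel upper half-space into 𝐇₂ given by
[[τ, z],[z, w]] ↦ [[τ, conj(λ)z],[λz, ℓw]] with ℓ = λ·conj(λ). -/
def phiLam (lam : ℂ) (τ : Matrix (Fin 2) (Fin 2) ℂ) : Matrix (Fin 2) (Fin 2) ℂ :=
  !![τ 0 0, (starRingEnd ℂ) lam * τ 0 1;
     lam * τ 0 1, (lam * (starRingEnd ℂ) lam) * τ 1 1]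

section AnalysisLemmas

variable {E E₁ E₂ : Type*} [NormedAddCommGroup E] [NormedSpace ℂ E]
  [NormedAddCommGroup E₁] [NormedSpace ℂ E₁] [NormedAddCommGroup E₂] [NormedSpace ℂ E₂]

/-- Cauchy estimate for the Fréchet derivative. -/
theorem norm_fderiv_le_of_forall_ball {f : E → ℂ} {x : E} {r C : ℝ} (hr : 0 < r)
    (hf : ∀ y ∈ Metric.ball x r, DifferentiableAt ℂ f y)
    (hC : ∀ y ∈ Metric.ball x r, ‖f y‖ ≤ C) : ‖fderiv ℂ f x‖ ≤ 2 * C / r := by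
  refine Complex.norm_fderiv_le_div_of_mapsTo_ball
    (fun y hy => (hf y hy).differentiableWithinAt) (fun y hy => ?_) hr
  rw [mem_closedBall_iff_norm]
  have h1 := hC y hy
  have h2 := hC x (Metric.mem_ball_self hr)
  have h3 := norm_sub_le (f y) (f x)
  linarith

/-- Weierstrass' theorem on uniform limits, in any number of variables. -/
theorem differentiableAt_of_tendstoUniformlyOn_ball {ι : Type*} {l : Filter ι} [l.NeBot]
    {f : ι → E → ℂ} {g : E → ℂ} {x : E} {r : ℝ} (hr : 0 < r)
    (hT : TendstoUniformlyOn f g l (Metric.ball x r))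
    (hf : ∀ᶠ i in l, ∀ y ∈ Metric.ball x r, DifferentiableAt ℂ (f i) y) :
    DifferentiableAt ℂ g x := by
  have hsub : ∀ y ∈ Metric.ball x (r / 2), Metric.ball y (r / 2) ⊆ Metric.ball x r := by
    intro y hy z hz
    rw [Metric.mem_ball] at *
    linarith [dist_triangle z y x]
  have hC : UniformCauchySeqOn (fun i => fderiv ℂ (f i)) l (Metric.ball x (r / 2)) := by
    intro u hu
    obtain ⟨ε, hε, hεu⟩ := Metric.mem_uniformity_dist.mp hu
    have h1 := hT.uniformCauchySeqOn _ (Metric.dist_mem_uniformity (ε := ε * r / 8) (by positivity))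
    filter_upwards [h1, hf.prod_mk hf] with p hp hp' y hy
    refine hεu ?_
    have hd : ∀ z ∈ Metric.ball y (r / 2),
        DifferentiableAt ℂ (f p.1) z ∧ DifferentiableAt ℂ (f p.2) z :=
      fun z hz => ⟨hp'.1 z (hsub y hy hz), hp'.2 z (hsub y hy hz)⟩
    have h2 := norm_fderiv_le_of_forall_ball (f := f p.1 - f p.2) (x := y) (r := r / 2)
      (C := ε * r / 8) (by positivity) (fun z hz => (hd z hz).1.sub (hd z hz).2) (fun z hz => by
        have := hp z (hsub y hy hz)
        simp only [dist_eq_norm] at this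
        exact this.le)
    obtain ⟨hd1, hd2⟩ := hd y (Metric.mem_ball_self (by positivity))
    rw [fderiv_sub hd1 hd2] at h2
    rw [dist_eq_norm]
    refine h2.trans_lt ?_
    rw [div_lt_iff₀ (by positivity)]
    nlinarith [mul_pos hε hr]
  have hlim : ∀ y ∈ Metric.ball x (r / 2), ∃ L, Tendsto (fun i => fderiv ℂ (f i) y) l (𝓝 L) :=
    fun y hy => cauchy_map_iff_exists_tendsto.mp (hC.cauchy_map hy)
  choose! G hG using hlim
  have hT' := hC.tendstoUniformlyOn_of_tendsto hG
  refine (hasFDerivAt_of_tendstoUniformlyOnFilter (g' := G) (f := f)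
    (f' := fun i => fderiv ℂ (f i)) (l := l) ?_ ?_ ?_).differentiableAt
  · have := tendstoUniformlyOn_iff_tendstoUniformlyOnFilter.mp hT'
    exact this.mono_right (le_principal_iff.mpr (Metric.ball_mem_nhds _ (by positivity)))
  · filter_upwards [hf.prod_mk (Metric.ball_mem_nhds x hr)] with p hp
    exact (hp.1 _ hp.2).hasFDerivAt
  · filter_upwards [Metric.ball_mem_nhds x hr] with y hy
    exact hT.tendsto_at hy

/-- The derivative of a complex differentiable function is jointly continuous, also in a
parameter. -/
theorem continuousAt_fderiv_of_continuous {X : Type*} [TopologicalSpace X] {f : X → E → ℂ}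
    {x₀ : X} {y₀ : E} [ProperSpace E]
    (hc : ∀ᶠ p in 𝓝 (x₀, y₀), ContinuousAt (fun p : X × E => f p.1 p.2) p)
    (hd : ∀ᶠ p in 𝓝 (x₀, y₀), DifferentiableAt ℂ (f p.1) p.2) :
    ContinuousAt (fun p : X × E => fderiv ℂ (f p.1) p.2) (x₀, y₀) := by
  obtain ⟨u, hu, v, hv, huv⟩ := mem_nhds_prod_iff.mp (hc.and hd)
  obtain ⟨r, hr, hrv⟩ := Metric.mem_nhds_iff.mp hv
  have hsub : ∀ x ∈ u, ∀ y ∈ Metric.ball y₀ r, ContinuousAt (fun p : X × E => f p.1 p.2) (x, y) ∧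
      DifferentiableAt ℂ (f x) y := fun x hx y hy => @huv (x, y) ⟨hx, hrv hy⟩
  have hx₀ := mem_of_mem_nhds hu
  rw [ContinuousAt, Metric.tendsto_nhds]
  intro ε hε
  -- uniform closeness of `h ↦ f p.1 (p.2 + h)` to `h ↦ f x₀ (y₀ + h)` on a small ball
  have key : ∀ᶠ p in 𝓝 (x₀, y₀), ∀ h ∈ Metric.closedBall (0 : E) (r / 2),
      dist (f p.1 (p.2 + h)) (f x₀ (y₀ + h)) < ε * r / 8 := by
    refine (isCompact_closedBall (0 : E) (r / 2)).eventually_forall_of_forall_eventually ?_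
    intro h hh
    have hy : y₀ + h ∈ Metric.ball y₀ r := by
      rw [mem_closedBall_zero_iff] at hh
      simp only [Metric.mem_ball, dist_self_add_left]; linarith
    have h1 : ContinuousAt (fun q : (X × E) × E => f q.1.1 (q.1.2 + q.2)) ((x₀, y₀), h) :=
      ContinuousAt.comp (g := fun p : X × E => f p.1 p.2)
        (f := fun q : (X × E) × E => (q.1.1, q.1.2 + q.2)) (hsub x₀ hx₀ _ hy).1 (by fun_prop)
    have h2 : ContinuousAt (fun q : (X × E) × E => f x₀ (y₀ + q.2)) ((x₀, y₀), h) :=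
      ContinuousAt.comp (g := fun p : X × E => f p.1 p.2)
        (f := fun q : (X × E) × E => (x₀, y₀ + q.2)) (hsub x₀ hx₀ _ hy).1 (by fun_prop)
    have h3 := h1.dist h2
    have := Tendsto.eventually_lt_const (u := ε * r / 8) (by simp; positivity) h3
    exact this
  have hnear : ∀ᶠ p in 𝓝 (x₀, y₀), p.1 ∈ u ∧ p.2 ∈ Metric.ball y₀ (r / 2) :=
    (prod_mem_nhds hu (Metric.ball_mem_nhds y₀ (by positivity : 0 < r / 2)))
  filter_upwards [key, hnear] with p hp hpu
  have hd1 : ∀ h ∈ Metric.ball (0 : E) (r / 2), DifferentiableAt ℂ (fun h => f p.1 (p.2 + h)) h := by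
    intro h hh
    refine DifferentiableAt.comp (g := f p.1) h (hsub _ hpu.1 _ ?_).2 (by fun_prop)
    have h1 := hpu.2
    rw [Metric.mem_ball] at *
    have := dist_triangle (p.2 + h) p.2 y₀
    simp at this hh ⊢
    linarith
  have hd2 : ∀ h ∈ Metric.ball (0 : E) (r / 2), DifferentiableAt ℂ (fun h => f x₀ (y₀ + h)) h := by
    intro h hh
    refine DifferentiableAt.comp (g := f x₀) h (hsub _ hx₀ _ ?_).2 (by fun_prop)
    rw [Metric.mem_ball] at *
    simp at hh ⊢
    linarith
  have h2 := norm_fderiv_le_of_forall_ball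
    (f := (fun h => f p.1 (p.2 + h)) - (fun h => f x₀ (y₀ + h))) (x := (0 : E)) (r := r / 2)
      (C := ε * r / 8) (by positivity) (fun z hz => (hd1 z hz).sub (hd2 z hz)) (fun z hz => by
        have := hp z (Metric.ball_subset_closedBall hz)
        rw [dist_eq_norm] at this
        exact this.le)
  have h00 : (0 : E) ∈ Metric.ball (0 : E) (r / 2) := Metric.mem_ball_self (by positivity)
  rw [fderiv_sub (hd1 0 h00) (hd2 0 h00), fderiv_comp_add_left, fderiv_comp_add_left] at h2
  rw [dist_eq_norm]
  simp only [add_zero] at h2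
  refine h2.trans_lt ?_
  rw [div_lt_iff₀ (by positivity)]
  nlinarith [mul_pos hε hr]

/-- A circle integral depends holomorphically on parameters. -/
theorem differentiableAt_circleIntegral [ProperSpace E] {H : E → ℂ → ℂ} {p₀ : E} {c : ℂ} {R : ℝ}
    (hH : ∀ ζ ∈ Metric.sphere c |R|, ∀ᶠ q in 𝓝 (p₀, ζ),
      DifferentiableAt ℂ (fun q : E × ℂ => H q.1 q.2) q) :
    DifferentiableAt ℂ (fun p => ∮ ζ in C(c, R), H p ζ) p₀ := by
  have hp : ∀ q : E × ℂ, DifferentiableAt ℂ (fun q : E × ℂ => H q.1 q.2) q →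
      DifferentiableAt ℂ (fun p => H p q.2) q.1 := fun q hq =>
    DifferentiableAt.comp (g := fun q : E × ℂ => H q.1 q.2) (f := fun p => (p, q.2)) q.1 hq
      (by fun_prop)
  have hsw : ∀ ζ, Tendsto (Prod.swap : ℂ × E → E × ℂ) (𝓝 (ζ, p₀)) (𝓝 (p₀, ζ)) :=
    fun ζ => continuous_swap.tendsto (ζ, p₀)
  have hcf : ∀ ζ ∈ Metric.sphere c |R|,
      ContinuousAt (fun q : E × ℂ => fderiv ℂ (fun p => H p q.2) q.1) (p₀, ζ) := by
    intro ζ hζ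
    have := continuousAt_fderiv_of_continuous (f := fun (z : ℂ) (p : E) => H p z)
      (x₀ := ζ) (y₀ := p₀)
      (((hsw ζ).eventually (hH ζ hζ)).mono fun q hq =>
        ContinuousAt.comp (g := fun p : E × ℂ => H p.1 p.2) (f := Prod.swap) hq.continuousAt
          (by fun_prop))
      (((hsw ζ).eventually (hH ζ hζ)).mono fun q hq => hp q.swap hq)
    exact ContinuousAt.comp (g := fun q : ℂ × E => fderiv ℂ (fun p => H p q.1) q.2)
      (f := (Prod.swap : E × ℂ → ℂ × E)) this (by fun_prop)
  have hK := isCompact_sphere c |R|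
  obtain ⟨M, hM⟩ : ∃ M : ℝ, ∀ ζ ∈ Metric.sphere c |R|, ‖fderiv ℂ (fun p => H p ζ) p₀‖ ≤ M := by
    refine hK.exists_bound_of_continuousOn (f := fun ζ => fderiv ℂ (fun p => H p ζ) p₀) ?_
    intro ζ hζ
    exact (ContinuousAt.comp (g := fun q : E × ℂ => fderiv ℂ (fun p => H p q.2) q.1)
      (f := fun ζ => (p₀, ζ)) (hcf ζ hζ) (by fun_prop)).continuousWithinAt
  have key : ∀ᶠ p in 𝓝 p₀, ∀ ζ ∈ Metric.sphere c |R|,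
      DifferentiableAt ℂ (fun q : E × ℂ => H q.1 q.2) (p, ζ) ∧
        ‖fderiv ℂ (fun p => H p ζ) p‖ ≤ M + 1 := by
    refine hK.eventually_forall_of_forall_eventually ?_
    intro ζ hζ
    have h1 := Tendsto.eventually_lt_const
      ((hM ζ hζ).trans_lt (lt_add_one M)) (hcf ζ hζ).norm
    filter_upwards [hH ζ hζ, h1] with q hq1 hq2
    exact ⟨hq1, hq2.le⟩
  have hmem : ∀ θ : ℝ, circleMap c R θ ∈ Metric.sphere c |R| := circleMap_mem_sphere' c R
  have hcont : ∀ p, (∀ ζ ∈ Metric.sphere c |R|,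
      DifferentiableAt ℂ (fun q : E × ℂ => H q.1 q.2) (p, ζ)) →
      Continuous fun θ : ℝ => deriv (circleMap c R) θ • H p (circleMap c R θ) := by
    intro p hp
    have h1 : Continuous fun θ : ℝ => H p (circleMap c R θ) :=
      continuous_iff_continuousAt.mpr fun θ =>
      ContinuousAt.comp (g := fun q : E × ℂ => H q.1 q.2) (f := fun θ : ℝ => (p, circleMap c R θ))
        (hp _ (hmem θ)).continuousAt (by fun_prop)
    simp only [deriv_circleMap]
    exact ((continuous_circleMap 0 R).mul continuous_const).smul h1
  have := intervalIntegral.hasFDerivAt_integral_of_dominated_of_fderiv_le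
    (μ := MeasureTheory.volume) (a := 0) (b := 2 * Real.pi) (x₀ := p₀)
    (F := fun p θ => deriv (circleMap c R) θ • H p (circleMap c R θ))
    (F' := fun p θ => deriv (circleMap c R) θ • fderiv ℂ (fun p => H p (circleMap c R θ)) p)
    (bound := fun _ => |R| * (M + 1)) key
    (key.mono fun p hp => (hcont p fun ζ hζ => (hp ζ hζ).1).aestronglyMeasurable)
    ((hcont p₀ fun ζ hζ => (key.self_of_nhds ζ hζ).1).intervalIntegrable _ _)
    (by
      refine Continuous.aestronglyMeasurable ?_
      have h1 : Continuous fun θ : ℝ => fderiv ℂ (fun p => H p (circleMap c R θ)) p₀ :=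
        continuous_iff_continuousAt.mpr fun θ =>
        ContinuousAt.comp (g := fun q : E × ℂ => fderiv ℂ (fun p => H p q.2) q.1)
          (f := fun θ : ℝ => (p₀, circleMap c R θ)) (hcf _ (hmem θ)) (by fun_prop)
      simp only [deriv_circleMap]
      exact ((continuous_circleMap 0 R).mul continuous_const).smul h1)
    (MeasureTheory.ae_of_all _ fun θ _ p hp' => by
      rw [norm_smul]
      have : ‖deriv (circleMap c R) θ‖ = |R| := by simp
      rw [this]
      exact mul_le_mul_of_nonneg_left (hp' _ (hmem θ)).2 (abs_nonneg R))
    (by simp)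
    (MeasureTheory.ae_of_all _ fun θ _ p hp' => by
      have hd : DifferentiableAt ℂ (fun p => H p (circleMap c R θ)) p :=
        DifferentiableAt.comp (g := fun q : E × ℂ => H q.1 q.2) (f := fun p => (p, circleMap c R θ))
          p (hp' _ (hmem θ)).1 (by fun_prop)
      exact hd.hasFDerivAt.const_smul (deriv (circleMap c R) θ))
  exact this.differentiableAt

/-- Division of a holomorphic function by a holomorphic function with simple zeros in the last
variable. -/
theorem exists_div_of_simple_zeros [ProperSpace E] {U : Set (E × ℂ)} (hU : IsOpen U)
    {f g : E → ℂ → ℂ} (hf : ∀ p ∈ U, DifferentiableAt ℂ (fun p : E × ℂ => f p.1 p.2) p)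
    (hg : ∀ p ∈ U, DifferentiableAt ℂ (fun p : E × ℂ => g p.1 p.2) p)
    (h0 : ∀ p ∈ U, g p.1 p.2 = 0 → f p.1 p.2 = 0 ∧ deriv (g p.1) p.2 ≠ 0) :
    ∃ h : E → ℂ → ℂ, (∀ p ∈ U, DifferentiableAt ℂ (fun p : E × ℂ => h p.1 p.2) p) ∧
      ∀ p ∈ U, f p.1 p.2 = g p.1 p.2 * h p.1 p.2 := by
  classical
  let h : E → ℂ → ℂ := fun z w => if g z w = 0 then deriv (f z) w / deriv (g z) w else f z w / g z w
  have hfg : ∀ p ∈ U, f p.1 p.2 = g p.1 p.2 * h p.1 p.2 := by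
    intro p hp
    by_cases hz : g p.1 p.2 = 0
    · simp [hz, (h0 p hp hz).1]
    · simp only [h, hz, if_false]; field_simp
  have slice : ∀ {F : E → ℂ → ℂ} {p : E × ℂ}, DifferentiableAt ℂ (fun p : E × ℂ => F p.1 p.2) p →
      DifferentiableAt ℂ (F p.1) p.2 := fun {F p} hp =>
    DifferentiableAt.comp (g := fun q : E × ℂ => F q.1 q.2) (f := fun w => (p.1, w)) p.2 hp
      (by fun_prop)
  have sliceU : ∀ p ∈ U, ∀ᶠ w in 𝓝 p.2, (p.1, w) ∈ U := fun p hp =>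
    (Continuous.tendsto (by fun_prop : Continuous fun w => (p.1, w)) p.2).eventually
      (hU.mem_nhds hp)
  -- differentiability in the last variable
  have h1 : ∀ p ∈ U, DifferentiableAt ℂ (h p.1) p.2 := by
    intro p hp
    by_cases hz : g p.1 p.2 = 0
    · obtain ⟨hf0, hg0⟩ := h0 p hp hz
      have dsl : ∀ F : ℂ → ℂ, (∀ᶠ w in 𝓝 p.2, DifferentiableAt ℂ F w) →
          DifferentiableAt ℂ (dslope F p.2) p.2 := by
        intro F hF
        have : DifferentiableOn ℂ F {w | DifferentiableAt ℂ F w} :=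
          fun w hw => hw.differentiableWithinAt
        exact ((Complex.differentiableOn_dslope hF).mpr this).differentiableAt hF
      have df := dsl (f p.1) ((sliceU p hp).mono fun w hw => slice (p := (p.1, w)) (hf _ hw))
      have dg := dsl (g p.1) ((sliceU p hp).mono fun w hw => slice (p := (p.1, w)) (hg _ hw))
      have hne : dslope (g p.1) p.2 p.2 ≠ 0 := by rwa [dslope_same]
      have hev : h p.1 =ᶠ[𝓝 p.2] fun w => dslope (f p.1) p.2 w / dslope (g p.1) p.2 w := by
        filter_upwards [dg.continuousAt.eventually_ne hne] with w hw
        by_cases hwp : w = p.2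
        · subst hwp; simp [h, hz, dslope_same]
        · have hgw : g p.1 w = (w - p.2) * dslope (g p.1) p.2 w := by
            rw [dslope_of_ne _ hwp, slope_def_field, hz, sub_zero,
                mul_div_cancel₀ _ (sub_ne_zero.mpr hwp)]
          have hfw : f p.1 w = (w - p.2) * dslope (f p.1) p.2 w := by
            rw [dslope_of_ne _ hwp, slope_def_field, hf0, sub_zero,
                mul_div_cancel₀ _ (sub_ne_zero.mpr hwp)]
          have hgw' : g p.1 w ≠ 0 := by
            rw [hgw]; exact mul_ne_zero (sub_ne_zero.mpr hwp) hw
          simp only [h, hgw', if_false]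
          rw [hgw, hfw, mul_div_mul_left _ _ (sub_ne_zero.mpr hwp)]
      exact (df.div dg hne).congr_of_eventuallyEq hev
    · have hev : h p.1 =ᶠ[𝓝 p.2] fun w => f p.1 w / g p.1 w := by
        filter_upwards [(slice (hg p hp)).continuousAt.eventually_ne hz] with w hw
        simp [h, hw]
      exact ((slice (hf p hp)).div (slice (hg p hp)) hz).congr_of_eventuallyEq hev
  refine ⟨h, ?_, hfg⟩
  rintro ⟨z₀, w₀⟩ hp
  -- a circle on which `g` does not vanish
  obtain ⟨R, hR, hRU, hRg⟩ : ∃ R > 0, (∀ w ∈ Metric.closedBall w₀ R, (z₀, w) ∈ U) ∧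
      ∀ w ∈ Metric.sphere w₀ R, g z₀ w ≠ 0 := by
    have hiso : ∀ᶠ w in 𝓝[≠] w₀, g z₀ w ≠ 0 := by
      by_cases hz : g z₀ w₀ = 0
      · have hd := (slice (hg _ hp)).hasDerivAt
        exact hd.eventually_ne (h0 _ hp hz).2
      · exact ((slice (hg _ hp)).continuousAt.eventually_ne hz).filter_mono nhdsWithin_le_nhds
    have := (sliceU _ hp).and (eventually_nhdsWithin_iff.mp hiso)
    obtain ⟨ε, hε, hb⟩ := Metric.eventually_nhds_iff_ball.mp this
    have hsub : Metric.closedBall w₀ (ε / 2) ⊆ Metric.ball w₀ ε :=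
      Metric.closedBall_subset_ball (by linarith)
    refine ⟨ε / 2, by positivity, fun w hw => (hb w (hsub hw)).1, fun w hw => ?_⟩
    refine (hb w (hsub (Metric.sphere_subset_closedBall hw))).2 ?_
    rintro rfl
    simp at hw
    linarith
  have hint : DifferentiableAt ℂ (fun p : E × ℂ => ∮ ζ in C(w₀, R),
      (ζ - p.2)⁻¹ • (f p.1 ζ / g p.1 ζ)) (z₀, w₀) := by
    refine differentiableAt_circleIntegral (E := E × ℂ)
      (H := fun p ζ => (ζ - p.2)⁻¹ • (f p.1 ζ / g p.1 ζ)) ?_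
    rw [abs_of_pos hR]
    intro ζ hζ
    have hζU := hRU ζ (Metric.sphere_subset_closedBall hζ)
    have c1 : ContinuousAt (fun q : (E × ℂ) × ℂ => (q.1.1, q.2)) ((z₀, w₀), ζ) := by fun_prop
    have e1 := c1.eventually (hU.mem_nhds hζU)
    have e2 : ∀ᶠ q : (E × ℂ) × ℂ in 𝓝 ((z₀, w₀), ζ), g q.1.1 q.2 ≠ 0 :=
      (ContinuousAt.comp (g := fun p : E × ℂ => g p.1 p.2)
        (f := fun q : (E × ℂ) × ℂ => (q.1.1,
            q.2)) (hg _ hζU).continuousAt c1).eventually_ne (hRg ζ hζ)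
    have e3 : ∀ᶠ q : (E × ℂ) × ℂ in 𝓝 ((z₀, w₀), ζ), q.2 - q.1.2 ≠ 0 := by
      refine ContinuousAt.eventually_ne (by fun_prop) ?_
      intro h; simp only [sub_eq_zero] at h; rw [h] at hζ
      simp at hζ; exact hR.ne hζ
    filter_upwards [e1, e2, e3] with q q1 q2 q3
    have f1 : DifferentiableAt ℂ (fun q : (E × ℂ) × ℂ => f q.1.1 q.2) q :=
      DifferentiableAt.comp (g := fun p : E × ℂ => f p.1 p.2)
        (f := fun q : (E × ℂ) × ℂ => (q.1.1, q.2)) q (hf _ q1) (by fun_prop)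
    have g1 : DifferentiableAt ℂ (fun q : (E × ℂ) × ℂ => g q.1.1 q.2) q :=
      DifferentiableAt.comp (g := fun p : E × ℂ => g p.1 p.2)
        (f := fun q : (E × ℂ) × ℂ => (q.1.1, q.2)) q (hg _ q1) (by fun_prop)
    have s1 : DifferentiableAt ℂ (fun q : (E × ℂ) × ℂ => (q.2 - q.1.2)⁻¹) q :=
      DifferentiableAt.fun_inv (by fun_prop) q3
    have d1 : DifferentiableAt ℂ (fun q : (E × ℂ) × ℂ => f q.1.1 q.2 / g q.1.1 q.2) q := by
      simp only [div_eq_mul_inv]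
      exact f1.fun_mul (g1.fun_inv q2)
    exact s1.smul d1
  have hev : (fun p : E × ℂ => h p.1 p.2) =ᶠ[𝓝 (z₀, w₀)] fun p : E × ℂ =>
      (2 * Real.pi * Complex.I : ℂ)⁻¹ • ∮ ζ in C(w₀, R), (ζ - p.2)⁻¹ • (f p.1 ζ / g p.1 ζ) := by
    have e1 : ∀ᶠ z in 𝓝 z₀, ∀ w ∈ Metric.closedBall w₀ R, (z, w) ∈ U := by
      refine (isCompact_closedBall w₀ R).eventually_forall_of_forall_eventually fun w hw => ?_
      exact hU.mem_nhds (hRU w hw)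
    have e2 : ∀ᶠ z in 𝓝 z₀, ∀ w ∈ Metric.sphere w₀ R, g z w ≠ 0 := by
      refine (isCompact_sphere w₀ R).eventually_forall_of_forall_eventually fun w hw => ?_
      exact (hg _ (hRU w (Metric.sphere_subset_closedBall hw))).continuousAt.eventually_ne
        (hRg w hw)
    have e3 := (e1.and e2).prod_mk (Metric.ball_mem_nhds w₀ hR)
    rw [← nhds_prod_eq] at e3
    filter_upwards [e3] with p hp'
    obtain ⟨⟨p1, p2⟩, p3⟩ := hp'
    have hd : DiffContOnCl ℂ (h p.1) (Metric.ball w₀ R) := by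
      refine DifferentiableOn.diffContOnCl fun w hw => ?_
      rw [closure_ball _ hR.ne'] at hw
      exact (h1 _ (p1 w hw)).differentiableWithinAt
    have := hd.two_pi_i_inv_smul_circleIntegral_sub_inv_smul p3
    rw [← this]
    congr 1
    refine circleIntegral.integral_congr hR.le fun ζ hζ => ?_
    simp [h, p2 ζ hζ]
  exact (hint.const_smul (2 * Real.pi * Complex.I : ℂ)⁻¹).congr_of_eventuallyEq hev

end AnalysisLemmas

section CuspLemmas

/-- The normalized exponential `exp (2πix)`. -/
def ee (x : ℂ) : ℂ := Complex.exp (2 * Real.pi * Complex.I * x)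

theorem ee_add (x y : ℂ) : ee (x + y) = ee x * ee y := by
  simp only [ee, ← Complex.exp_add]; ring_nf

theorem ee_zero : ee 0 = 1 := by simp [ee]

theorem ee_ne_zero (x : ℂ) : ee x ≠ 0 := Complex.exp_ne_zero _

theorem ee_neg (x : ℂ) : ee (-x) = (ee x)⁻¹ := by
  simp only [ee, ← Complex.exp_neg]; ring_nf

theorem ee_sub (x y : ℂ) : ee (x - y) = ee x / ee y := by
  rw [sub_eq_add_neg, ee_add, ee_neg, div_eq_mul_inv]

theorem ee_intCast (n : ℤ) : ee n = 1 := by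
  rw [ee, Complex.exp_eq_one_iff]; exact ⟨n, by ring⟩

theorem ee_natCast (n : ℕ) : ee n = 1 := by simpa using ee_intCast n

theorem ee_one : ee 1 = 1 := by simpa using ee_intCast 1

theorem ee_half : ee (1 / 2) = -1 := by
  rw [ee, show (2 * Real.pi * Complex.I * (1 / 2) : ℂ) = Real.pi * Complex.I by ring,
    Complex.exp_pi_mul_I]

theorem ee_nat_mul (n : ℕ) (x : ℂ) : ee (n * x) = ee x ^ n := by
  rw [ee, ee, ← Complex.exp_nat_mul]; ring_nf

theorem norm_ee (x : ℂ) : ‖ee x‖ = Real.exp (-2 * Real.pi * x.im) := by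
  simp [ee, Complex.norm_exp]

@[fun_prop]
theorem differentiable_ee : Differentiable ℂ ee := by unfold ee; fun_prop

@[fun_prop]
theorem continuous_ee : Continuous ee := differentiable_ee.continuous

/-- The filter of neighbourhoods of `i∞`. -/
abbrev imInf : Filter ℂ := comap Complex.im atTop

theorem tendsto_ee_imInf : Tendsto ee imInf (𝓝 0) := by
  rw [tendsto_zero_iff_norm_tendsto_zero]
  simp only [norm_ee]
  refine Real.tendsto_exp_atBot.comp ?_
  refine Tendsto.const_mul_atTop_of_neg (by have := Real.pi_pos; linarith) tendsto_comap

instance imInf_neBot : imInf.NeBot := by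
  refine comap_neBot_iff.mpr fun s hs => ?_
  obtain ⟨x, hx⟩ := (atTop_neBot (α := ℝ)).nonempty_of_mem hs
  exact ⟨⟨0, x⟩, hx⟩

theorem eventually_imInf (v : ℝ) : ∀ᶠ w in imInf, v < w.im :=
  tendsto_comap.eventually (eventually_gt_atTop v)

theorem periodic_add_int {X : Type*} {P : ℝ → Prop} {f : ℂ → X} (h : ∀ z, P z.im → f (z + 1) = f z)
    (n : ℤ) (z : ℂ) (hz : P z.im) : f (z + n) = f z := by
  induction n using Int.induction_on with
  | zero => simp
  | succ n ih =>
    rw [← ih]; push_cast; rw [← add_assoc]; exact h _ (by simpa using hz)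
  | pred n ih =>
    rw [← ih, ← h (z + _) (by simpa using hz)]; congr 1; push_cast; ring

/-- A periodic function on a closed upper half plane is determined on the unit strip. -/
theorem exists_re_mem_Icc {X : Type*} {P : ℝ → Prop} {f : ℂ → X}
    (h : ∀ z, P z.im → f (z + 1) = f z) (z : ℂ) (hz : P z.im) :
    ∃ z' : ℂ, z'.im = z.im ∧ z'.re ∈ Set.Icc (0 : ℝ) 1 ∧ f z' = f z := by
  refine ⟨z + (-⌊z.re⌋ : ℤ), by simp, ?_, periodic_add_int h _ z hz⟩
  simp only [Complex.add_re, Complex.intCast_re, Set.mem_Icc]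
  push_cast
  constructor
  · linarith [Int.floor_le z.re]
  · linarith [Int.lt_floor_add_one z.re]

theorem exists_bound_of_periodic {f : ℂ → ℂ} {y₁ y₂ : ℝ}
    (hc : ∀ z : ℂ, y₁ ≤ z.im → z.im ≤ y₂ → ContinuousAt f z)
    (hp : ∀ z : ℂ, y₁ ≤ z.im → z.im ≤ y₂ → ‖f (z + 1)‖ = ‖f z‖) :
    ∃ C, ∀ z : ℂ, y₁ ≤ z.im → z.im ≤ y₂ → ‖f z‖ ≤ C := by
  have hK : IsCompact (Set.Icc (0 : ℝ) 1 ×ℂ Set.Icc y₁ y₂) := isCompact_Icc.reProdIm isCompact_Icc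
  obtain ⟨C, hC⟩ := hK.exists_bound_of_continuousOn (f := f) fun z hz =>
    (hc z hz.2.1 hz.2.2).continuousWithinAt
  refine ⟨C, fun z h1 h2 => ?_⟩
  obtain ⟨z', e1, e2, e3⟩ := exists_re_mem_Icc (P := fun y => y₁ ≤ y ∧ y ≤ y₂)
    (f := fun z => ‖f z‖) (fun z hz => hp z hz.1 hz.2) z ⟨h1, h2⟩
  rw [← e3]
  exact hC z' ⟨e2, by rw [Set.mem_preimage, e1]; exact ⟨h1, h2⟩⟩

/-- Maximum principle on a horizontal strip for functions with periodic modulus. -/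
theorem norm_le_of_periodic_strip {f : ℂ → ℂ} {y₁ y₂ C : ℝ}
    (hd : ∀ z : ℂ, y₁ ≤ z.im → z.im ≤ y₂ → DifferentiableAt ℂ f z)
    (hp : ∀ z : ℂ, y₁ ≤ z.im → z.im ≤ y₂ → ‖f (z + 1)‖ = ‖f z‖)
    (h₁ : ∀ z : ℂ, z.im = y₁ → ‖f z‖ ≤ C) (h₂ : ∀ z : ℂ, z.im = y₂ → ‖f z‖ ≤ C) (z : ℂ)
    (hz₁ : y₁ ≤ z.im) (hz₂ : z.im ≤ y₂) : ‖f z‖ ≤ C := by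
  obtain ⟨M, hM⟩ := exists_bound_of_periodic (fun z h1 h2 => (hd z h1 h2).continuousAt) hp
  rcases (hz₁.trans hz₂).eq_or_lt with h | hlt
  · exact h₁ z (le_antisymm (h ▸ hz₂) hz₁)
  refine PhragmenLindelof.horizontal_strip (a := y₁) (b := y₂) ?_ ?_ h₁ h₂ hz₁ hz₂
  · have hcl : closure (Complex.im ⁻¹' Set.Ioo y₁ y₂) = Complex.im ⁻¹' Set.Icc y₁ y₂ := by
      rw [Complex.closure_preimage_im, closure_Ioo hlt.ne]
    constructor
    · exact fun z hz => (hd z hz.1.le hz.2.le).differentiableWithinAt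
    · rw [hcl]
      exact fun z hz => (hd z hz.1 hz.2).continuousAt.continuousWithinAt
  · refine ⟨0, div_pos Real.pi_pos (sub_pos.mpr hlt), 0, ?_⟩
    refine Asymptotics.IsBigO.of_bound M ?_
    refine eventually_inf_principal.mpr (Eventually.of_forall fun z hz => ?_)
    simpa using hM z hz.1.le hz.2.le

/-- A bounded periodic holomorphic function on a half plane is a holomorphic function of
`exp (2πiw)`. -/
theorem exists_cusp_function {f : ℂ → ℂ} {v V C : ℝ}
    (hd : ∀ w : ℂ, v < w.im → DifferentiableAt ℂ f w)
    (hp : ∀ w : ℂ, v < w.im → f (w + 1) = f w) (hC : ∀ w : ℂ, V < w.im → ‖f w‖ ≤ C) :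
    ∃ F : ℂ → ℂ, DifferentiableOn ℂ F (Metric.ball 0 (Real.exp (-2 * Real.pi * v))) ∧
      ∀ w : ℂ, v < w.im → F (ee w) = f w := by
  let g : ℂ → ℂ := fun w => if v < w.im then f w else 0
  have hg : Function.Periodic g ((1 : ℝ) : ℂ) := by
    intro w
    by_cases h : v < w.im
    · simp [g, h, hp w h]
    · simp [g, h]
  have hq : ∀ w, Function.Periodic.qParam 1 w = ee w := by
    intro w; simp [Function.Periodic.qParam, ee]
  have hgd : ∀ w : ℂ, v < w.im → DifferentiableAt ℂ g w := by
    intro w hw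
    refine (hd w hw).congr_of_eventuallyEq ?_
    filter_upwards [(Complex.continuous_im.isOpen_preimage _ isOpen_Ioi).mem_nhds hw] with z hz
    exact if_pos hz
  refine ⟨Function.Periodic.cuspFunction 1 g, ?_, fun w hw => ?_⟩
  · intro q hqb
    refine DifferentiableAt.differentiableWithinAt ?_
    by_cases hq0 : q = 0
    · subst hq0
      refine Function.Periodic.differentiableAt_cuspFunction_zero one_pos hg ?_ ?_
      · exact (eventually_imInf v).mono hgd
      · refine Asymptotics.IsBigO.of_bound C ?_
        filter_upwards [eventually_imInf v, eventually_imInf V] with w hw hV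
        simpa [g, hw] using hC w hV
    · have e := Function.Periodic.qParam_right_inv one_ne_zero hq0
      rw [← e]
      refine Function.Periodic.differentiableAt_cuspFunction one_ne_zero hg (hgd _ ?_)
      rw [← Function.Periodic.norm_qParam_lt_iff one_pos, e]
      simpa using hqb
  · rw [← hq, Function.Periodic.eq_cuspFunction one_ne_zero hg]
    exact if_pos hw

theorem ee_mem_ball {w : ℂ} {v : ℝ} :
    ee w ∈ Metric.ball (0 : ℂ) (Real.exp (-2 * Real.pi * v)) ↔ v < w.im := by
  rw [mem_ball_zero_iff, norm_ee, Real.exp_lt_exp]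
  have := Real.pi_pos
  constructor <;> intro h <;> nlinarith

theorem exists_ee_eq {q : ℂ} (hq : q ≠ 0) : ∃ w, ee w = q := by
  refine ⟨Function.Periodic.invQParam 1 q, ?_⟩
  have := Function.Periodic.qParam_right_inv (h := 1) one_ne_zero hq
  simpa [Function.Periodic.qParam, ee] using this

/-- A bounded periodic holomorphic function on a half plane converges exponentially at `i∞`. -/
theorem exists_limit_of_periodic {f : ℂ → ℂ} {v C : ℝ}
    (hd : ∀ w : ℂ, v < w.im → DifferentiableAt ℂ f w)
    (hp : ∀ w : ℂ, v < w.im → f (w + 1) = f w) (hC : ∀ w : ℂ, v < w.im → ‖f w‖ ≤ C) :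
    ∃ L, Tendsto f imInf (𝓝 L) ∧ ∀ w : ℂ, v < w.im →
      ‖f w - L‖ ≤ 2 * C * Real.exp (2 * Real.pi * v) * Real.exp (-2 * Real.pi * w.im) := by
  obtain ⟨F, hF, hFf⟩ := exists_cusp_function hd hp hC
  have h0 : (0 : ℂ) ∈ Metric.ball (0 : ℂ) (Real.exp (-2 * Real.pi * v)) := by
    simp [Real.exp_pos]
  have hF0 : ContinuousAt F 0 :=
    (hF.differentiableAt (Metric.isOpen_ball.mem_nhds h0)).continuousAt
  have hlim : Tendsto f imInf (𝓝 (F 0)) := by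
    refine (hF0.tendsto.comp tendsto_ee_imInf).congr' ?_
    filter_upwards [eventually_imInf v] with w hw using hFf w hw
  have hL : ‖F 0‖ ≤ C := le_of_tendsto hlim.norm ((eventually_imInf v).mono hC)
  refine ⟨F 0, hlim, fun w hw => ?_⟩
  have := Complex.dist_le_div_mul_dist_of_mapsTo_ball hF (R₂ := 2 * C) ?_ (ee_mem_ball.mpr hw)
  · rw [dist_eq_norm, dist_eq_norm, hFf w hw, sub_zero, norm_ee] at this
    refine this.trans_eq ?_
    rw [div_eq_mul_inv, ← Real.exp_neg]; ring_nf
  · intro q hq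
    rw [mem_closedBall_iff_norm]
    have hq' : ‖F q‖ ≤ C := by
      by_cases h : q = 0
      · rw [h]; exact hL
      · obtain ⟨w', rfl⟩ := exists_ee_eq h
        rw [hFf _ (ee_mem_ball.mp hq)]; exact hC _ (ee_mem_ball.mp hq)
    exact (norm_sub_le _ _).trans (by linarith)

/-- Maximum principle at the cusp. -/
theorem norm_le_of_periodic_of_tendsto {f : ℂ → ℂ} {v C : ℝ} {L : ℂ}
    (hd : ∀ w : ℂ, v ≤ w.im → DifferentiableAt ℂ f w)
    (hp : ∀ w : ℂ, v ≤ w.im → f (w + 1) = f w) (hL : Tendsto f imInf (𝓝 L))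
    (hC : ∀ w : ℂ, w.im = v → ‖f w‖ ≤ C) {w : ℂ} (hw : v ≤ w.im) : ‖f w‖ ≤ C := by
  obtain ⟨V, hV⟩ : ∃ V, ∀ w : ℂ, V ≤ w.im → ‖f w‖ ≤ ‖L‖ + 1 := by
    have := hL.norm.eventually_le_const (lt_add_one ‖L‖)
    obtain ⟨V, -, hV⟩ := ((atTop_basis (α := ℝ)).comap Complex.im).eventually_iff.mp this
    exact ⟨V, fun w hw => hV hw⟩
  obtain ⟨M, hM⟩ := exists_bound_of_periodic (f := f) (y₁ := v) (y₂ := V)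
    (fun z h _ => (hd z h).continuousAt) (fun z h _ => by rw [hp z h])
  have hb : ∀ w : ℂ, v < w.im → ‖f w‖ ≤ max M (‖L‖ + 1) := fun w hw => by
    rcases le_total w.im V with h | h
    · exact (hM w hw.le h).trans (le_max_left _ _)
    · exact (hV w h).trans (le_max_right _ _)
  obtain ⟨F, hF, hFf⟩ := exists_cusp_function (fun w hw => hd w hw.le) (fun w hw => hp w hw.le) hb
  rcases hw.eq_or_lt with h | hlt
  · exact hC w h.symm
  by_contra! hcon
  -- maximum modulus on discs `Im ≥ v'` with `v' ↓ v`
  have hkey : ∀ v' : ℝ, v < v' → v' ≤ w.im → ∃ z : ℂ, z.im = v' ∧ z.re ∈ Set.Icc (0 : ℝ) 1 ∧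
      ‖f w‖ ≤ ‖f z‖ := by
    intro v' h1 h2
    by_contra! hlt'
    have hne : ∀ z : ℂ, z.im = v' → ‖f z‖ < ‖f w‖ := by
      intro z hz
      obtain ⟨z', e1, e2, e3⟩ := exists_re_mem_Icc (P := fun y => v ≤ y) (f := f) hp z
        (by linarith)
      rw [← e3]; exact hlt' z' (e1.trans hz) e2
    have hsub : Metric.closedBall (0 : ℂ) (Real.exp (-2 * Real.pi * v')) ⊆
        Metric.ball 0 (Real.exp (-2 * Real.pi * v)) := by
      refine Metric.closedBall_subset_ball (Real.exp_lt_exp.mpr ?_)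
      have := Real.pi_pos
      nlinarith
    have hd' : DiffContOnCl ℂ F (Metric.ball 0 (Real.exp (-2 * Real.pi * v'))) := by
      refine DifferentiableOn.diffContOnCl (hF.mono ?_)
      rwa [closure_ball _ (Real.exp_pos _).ne']
    have hcpt : IsCompact (Set.Icc (0 : ℝ) 1 ×ℂ {v'}) := isCompact_Icc.reProdIm isCompact_singleton
    obtain ⟨z₀, hz₀, hmax⟩ := hcpt.exists_isMaxOn ⟨⟨0, v'⟩, by simp [Complex.mem_reProdIm]⟩
      (f := fun z => ‖f z‖) (fun z hz => by
        have : z.im = v' := hz.2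
        exact ((hd z (by linarith)).continuousAt.norm).continuousWithinAt)
    have hmax' : ∀ z : ℂ, z.im = v' → ‖f z‖ ≤ ‖f z₀‖ := by
      intro z hz
      obtain ⟨z', e1, e2, e3⟩ := exists_re_mem_Icc (P := fun y => v ≤ y) (f := f) hp z
        (by linarith)
      rw [← e3]; exact hmax ⟨e2, e1.trans hz⟩
    have := Complex.norm_le_of_forall_mem_frontier_norm_le (f := F) (C := ‖f z₀‖)
      Metric.isBounded_ball hd' (fun q hq => ?_) (z := ee w) ?_
    · rw [hFf w hlt] at this
      exact absurd (hne z₀ hz₀.2) (not_lt.mpr this)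
    · rw [frontier_ball _ (Real.exp_pos _).ne', mem_sphere_zero_iff_norm] at hq
      obtain ⟨z, rfl⟩ := exists_ee_eq (q := q) (by
        rintro rfl; simp at hq; exact (Real.exp_pos _).ne hq)
      have hzv : z.im = v' := by
        rw [norm_ee, Real.exp_eq_exp] at hq
        have := Real.pi_pos
        exact mul_left_cancel₀ (by linarith : (-2 * Real.pi) ≠ 0) hq
      rw [hFf z (by linarith)]; exact hmax' z hzv
    · rw [closure_ball _ (Real.exp_pos _).ne', mem_closedBall_zero_iff, norm_ee, Real.exp_le_exp]
      have := Real.pi_pos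
      nlinarith
  -- compactness argument
  let K : Set ℂ := Set.Icc (0 : ℝ) 1 ×ℂ Set.Icc v w.im
  have hK : IsCompact K := isCompact_Icc.reProdIm isCompact_Icc
  have hseq : ∀ n : ℕ, ∃ z ∈ K, z.im ≤ v + (w.im - v) / (n + 1) ∧ ‖f w‖ ≤ ‖f z‖ := by
    intro n
    have hn : (0 : ℝ) < n + 1 := by positivity
    have h1 : 0 < (w.im - v) / (n + 1) := div_pos (by linarith) hn
    have h2 : (w.im - v) / (n + 1) ≤ w.im - v := div_le_self (by linarith) (by linarith)
    obtain ⟨z, e1, e2, e3⟩ := hkey (v + (w.im - v) / (n + 1)) (by linarith) (by linarith)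
    exact ⟨z, ⟨e2, by rw [Set.mem_preimage, e1]; constructor <;> linarith⟩, e1.le, e3⟩
  choose z hzK hzim hzf using hseq
  obtain ⟨zl, hzl, φ, hφ, hlim⟩ := hK.tendsto_subseq hzK
  have him : zl.im ≤ v := by
    have h1 : Tendsto (fun n : ℕ => v + (w.im - v) / ((φ n : ℝ) + 1)) atTop (𝓝 (v + 0)) := by
      refine tendsto_const_nhds.add ?_
      have : Tendsto (fun n : ℕ => (w.im - v) / ((n : ℝ) + 1)) atTop (𝓝 0) :=
        tendsto_const_nhds.div_atTop (tendsto_natCast_atTop_atTop.atTop_add tendsto_const_nhds)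
      exact this.comp hφ.tendsto_atTop
    rw [add_zero] at h1
    exact le_of_tendsto_of_tendsto ((Complex.continuous_im.tendsto _).comp hlim) h1
      (Eventually.of_forall fun n => hzim _)
  have heq : zl.im = v := le_antisymm him hzl.2.1
  have h3 : ‖f w‖ ≤ ‖f zl‖ := by
    refine le_of_tendsto_of_tendsto tendsto_const_nhds
      (((hd zl heq.ge).continuousAt.norm.tendsto).comp hlim) (Eventually.of_forall fun n => hzf _)
  exact absurd (h3.trans (hC _ heq)) (not_le.mpr hcon)

end CuspLemmas

section ModularForms

open UpperHalfPlane ModularForm MatrixGroups CuspForm EisensteinSeries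

/-- Level one modular forms of weight `k`, as functions on `ℂ` restricted to the upper half plane. -/
structure MF (k : ℤ) (f : ℂ → ℂ) : Prop where
  holo : ∀ t : ℂ, 0 < t.im → DifferentiableAt ℂ f t
  T : ∀ t : ℂ, 0 < t.im → f (t + 1) = f t
  S : ∀ t : ℂ, 0 < t.im → f (-1 / t) = t ^ k * f t
  bdd : ∃ C Y : ℝ, ∀ t : ℂ, 0 < t.im → Y ≤ t.im → ‖f t‖ ≤ C

theorem im_neg_one_div {t : ℂ} (ht : 0 < t.im) : 0 < (-1 / t).im := by
  rw [neg_div, one_div, Complex.neg_im, Complex.inv_im, neg_div, neg_neg]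
  exact div_pos ht (Complex.normSq_pos.mpr fun h => by simp [h] at ht)

theorem ne_zero_of_im_pos {t : ℂ} (ht : 0 < t.im) : t ≠ 0 := fun h => by simp [h] at ht

theorem denom_modularGroup_T (z : ℍ) : denom (ModularGroup.T : SL(2, ℤ)) z = 1 := by
  rw [ModularGroup.denom_apply, ModularGroup.coe_T]; simp

theorem MF.exists_modularForm {k : ℤ} {f : ℂ → ℂ} (hf : MF k f) :
    ∃ F : ModularForm 𝒮ℒ k, ∀ z : ℍ, F z = f z := by
  have hT : (fun z : ℍ => f z) ∣[k] ModularGroup.T = fun z : ℍ => f z := by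
    ext z
    rw [SL_slash_apply, denom_modularGroup_T, modular_T_smul]
    have := hf.T z z.2
    simp [add_comm (1 : ℂ), this]
  have hS : (fun z : ℍ => f z) ∣[k] ModularGroup.S = fun z : ℍ => f z := by
    ext z
    rw [SlashInvariantForm.slash_S_apply]
    have := hf.S z z.2
    have e : (-1 / z : ℂ) = (-(z : ℂ))⁻¹ := by rw [neg_div, one_div, inv_neg]
    rw [e] at this
    change f (-(z : ℂ))⁻¹ * _ = _
    rw [this, _root_.zpow_neg]
    have := zpow_ne_zero k z.ne_zero
    field_simp
  have hγ := SlashInvariantForm.slash_action_generators_SL2Z hS hT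
  refine ⟨{ toFun := fun z : ℍ => f z
            slash_action_eq' := fun _ ⟨γ, h⟩ => h ▸ hγ γ
            holo' := ?_
            bdd_at_cusps' := ?_ }, fun z => rfl⟩
  · rw [UpperHalfPlane.mdifferentiable_iff]
    refine DifferentiableOn.congr (fun z hz => (hf.holo z hz).differentiableWithinAt) fun z hz => ?_
    simp [ofComplex_apply_of_im_pos hz]
  · intro c hc
    rw [Subgroup.IsArithmetic.isCusp_iff_isCusp_SL2Z] at hc
    rw [OnePoint.isBoundedAt_iff_forall_SL2Z hc]
    intro γ _
    rw [hγ γ, isBoundedAtImInfty_iff]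
    obtain ⟨C, Y, h⟩ := hf.bdd
    exact ⟨C, Y, fun z hz => h z z.2 hz⟩

theorem ModularForm.mf {k : ℤ} (F : ModularForm 𝒮ℒ k) : MF k (fun t => F (ofComplex t)) := by
  refine ⟨fun t ht => ?_, fun t ht => ?_, fun t ht => ?_, ?_⟩
  · have := (UpperHalfPlane.mdifferentiable_iff.mp F.holo') t ht
    exact this.differentiableAt (isOpen_upperHalfPlaneSet.mem_nhds ht)
  · have h := SlashInvariantFormClass.slash_action_eq F _ (⟨ModularGroup.T,
      rfl⟩ : (ModularGroup.T : GL (Fin 2) ℝ) ∈ 𝒮ℒ)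
    rw [← SL_slash] at h
    have h := congrFun h ⟨t, ht⟩
    rw [SL_slash_apply, modular_T_smul, denom_modularGroup_T] at h
    have e : (ofComplex (t + 1)) = (1 : ℝ) +ᵥ (⟨t, ht⟩ : ℍ) := by
      ext; rw [ofComplex_apply_of_im_pos (by simpa using ht)]; simp [add_comm]
    rw [e, ofComplex_apply_of_im_pos ht, ← h]
    simp
  · have h := SlashInvariantFormClass.slash_action_eq F _ (⟨ModularGroup.S,
      rfl⟩ : (ModularGroup.S : GL (Fin 2) ℝ) ∈ 𝒮ℒ)
    rw [← SL_slash] at h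
    have h := congrFun h ⟨t, ht⟩
    rw [SlashInvariantForm.slash_S_apply] at h
    rw [ofComplex_apply_of_im_pos ht, ← h, ofComplex_apply_of_im_pos (im_neg_one_div ht)]
    have e : (⟨-1 / t, im_neg_one_div ht⟩ : ℍ) = .mk (-((⟨t, ht⟩ : ℍ) : ℂ))⁻¹ (⟨t,
        ht⟩ : ℍ).im_inv_neg_coe_pos := by
      ext; change -1 / t = (-t)⁻¹; rw [neg_div, one_div, inv_neg]
    have ht0 := zpow_ne_zero k (ne_zero_of_im_pos ht)
    rw [e, _root_.zpow_neg]
    change _ = t ^ k * (_ * (t ^ k)⁻¹)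
    field_simp
  · have h := ModularFormClass.bdd_at_infty F
    rw [isBoundedAtImInfty_iff] at h
    obtain ⟨C, Y, h⟩ := h
    refine ⟨C, Y, fun t ht hY => ?_⟩
    rw [ofComplex_apply_of_im_pos ht]
    exact h _ hY

theorem MF.congr {k : ℤ} {f g : ℂ → ℂ} (hf : MF k f) (h : ∀ t : ℂ, 0 < t.im → g t = f t) :
    MF k g := by
  refine ⟨fun t ht => ?_, fun t ht => ?_, fun t ht => ?_, ?_⟩
  · refine (hf.holo t ht).congr_of_eventuallyEq ?_
    filter_upwards [isOpen_upperHalfPlaneSet.mem_nhds ht] with s hs using h s hs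
  · rw [h t ht, h _ (by simpa using ht), hf.T t ht]
  · rw [h t ht, h _ (im_neg_one_div ht), hf.S t ht]
  · obtain ⟨C, Y, hC⟩ := hf.bdd
    exact ⟨C, Y, fun t ht hY => h t ht ▸ hC t ht hY⟩

theorem MF.add {k : ℤ} {f g : ℂ → ℂ} (hf : MF k f) (hg : MF k g) : MF k (fun t => f t + g t) := by
  refine ⟨fun t ht => (hf.holo t ht).add (hg.holo t ht), fun t ht => ?_, fun t ht => ?_, ?_⟩
  · rw [hf.T t ht, hg.T t ht]
  · rw [hf.S t ht, hg.S t ht, mul_add]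
  · obtain ⟨C, Y, hC⟩ := hf.bdd
    obtain ⟨C', Y', hC'⟩ := hg.bdd
    exact ⟨C + C', max Y Y', fun t ht hY => (norm_add_le _ _).trans
      (add_le_add (hC t ht ((le_max_left _ _).trans hY)) (hC' t ht ((le_max_right _ _).trans hY)))⟩

theorem MF.mul {k l : ℤ} {f g : ℂ → ℂ} (hf : MF k f) (hg : MF l g) :
    MF (k + l) (fun t => f t * g t) := by
  refine ⟨fun t ht => (hf.holo t ht).mul (hg.holo t ht), fun t ht => ?_, fun t ht => ?_, ?_⟩
  · rw [hf.T t ht, hg.T t ht]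
  · rw [hf.S t ht, hg.S t ht, zpow_add₀ (ne_zero_of_im_pos ht)]; ring
  · obtain ⟨C, Y, hC⟩ := hf.bdd
    obtain ⟨C', Y', hC'⟩ := hg.bdd
    refine ⟨C * C', max Y Y', fun t ht hY => ?_⟩
    have h1 := hC t ht ((le_max_left _ _).trans hY)
    have h2 := hC' t ht ((le_max_right _ _).trans hY)
    rw [norm_mul]
    exact mul_le_mul h1 h2 (norm_nonneg _) ((norm_nonneg _).trans h1)

theorem MF.const (c : ℂ) : MF 0 (fun _ => c) :=
  ⟨fun _ _ => differentiableAt_const _, fun _ _ => rfl, fun _ _ => by simp, ‖c‖, 0,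
      fun _ _ _ => le_rfl⟩

theorem MF.smul {k : ℤ} {f : ℂ → ℂ} (c : ℂ) (hf : MF k f) : MF k (fun t => c * f t) := by
  simpa using (MF.const c).mul hf

theorem MF.zero (k : ℤ) : MF k (fun _ => 0) :=
  ⟨fun _ _ => differentiableAt_const _, fun _ _ => rfl, fun _ _ => by simp, 0, 0,
      fun _ _ _ => by simp⟩

theorem MF.pow {k : ℤ} {f : ℂ → ℂ} (hf : MF k f) (n : ℕ) : MF (n * k) (fun t => f t ^ n) := by
  induction n with
  | zero => simpa using MF.const 1
  | succ n ih =>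
    have := ih.mul hf
    rw [show (n : ℤ) * k + k = ((n + 1 : ℕ) : ℤ) * k by push_cast; ring] at this
    simpa only [pow_succ] using this

/-- The normalised Eisenstein series of weight 4. -/
def mE4 (t : ℂ) : ℂ := E₄ (ofComplex t)

/-- The normalised Eisenstein series of weight 6. -/
def mE6 (t : ℂ) : ℂ := E₆ (ofComplex t)

/-- The modular discriminant. -/
def DD (t : ℂ) : ℂ := ModularForm.discriminant (ofComplex t)

theorem mf_mE4 : MF 4 mE4 := ModularForm.mf E₄

theorem mf_mE6 : MF 6 mE6 := ModularForm.mf E₆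

theorem DD_eq (t : ℂ) : DD t = (mE4 t ^ 3 - mE6 t ^ 2) / 1728 := discriminant_eq_E₄_cube_sub_E₆_sq _

theorem DD_ne_zero (t : ℂ) : DD t ≠ 0 := discriminant_ne_zero _

theorem mf_DD : MF 12 DD := by
  have h1 : MF 12 (fun t => mE4 t ^ 3) := mf_mE4.pow 3
  have h2 : MF 12 (fun t => mE6 t ^ 2) := mf_mE6.pow 2
  refine ((h1.add (h2.smul (-1))).smul (1 / 1728)).congr fun t _ => ?_
  rw [DD_eq]; ring

theorem MF.eq_zero_of_neg {k : ℤ} {f : ℂ → ℂ} (hf : MF k f) (hk : k < 0) (t : ℂ) (ht : 0 < t.im) :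
    f t = 0 := by
  obtain ⟨F, hF⟩ := hf.exists_modularForm
  rw [← hF ⟨t, ht⟩, ModularFormClass.levelOne_neg_weight_eq_zero hk F, Pi.zero_apply]

theorem MF.eq_zero_of_odd {k : ℤ} {f : ℂ → ℂ} (hf : MF k f) (hk : Odd k) (t : ℂ) (ht : 0 < t.im) :
    f t = 0 := by
  obtain ⟨F, hF⟩ := hf.exists_modularForm
  rw [← hF ⟨t, ht⟩, levelOne_odd_weight_eq_zero hk F]; rfl

theorem MF.eq_zero_of_two {f : ℂ → ℂ} (hf : MF 2 f) (t : ℂ) (ht : 0 < t.im) :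
    f t = 0 := by
  obtain ⟨F, hF⟩ := hf.exists_modularForm
  have : F = 0 := rank_zero_iff_forall_zero.mp levelOne_weight_two_rank_zero F
  rw [← hF ⟨t, ht⟩, this]; rfl

theorem tendsto_ofComplex_imInf : Tendsto ofComplex imInf atImInfty := by
  rw [atImInfty, tendsto_comap_iff]
  refine tendsto_comap.congr' ?_
  filter_upwards [eventually_imInf 0] with t ht
  rw [Function.comp, ofComplex_apply_of_im_pos ht]; rfl

theorem MF.exists_tendsto {k : ℤ} {f : ℂ → ℂ} (hf : MF k f) : ∃ L, Tendsto f imInf (𝓝 L) := by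
  obtain ⟨C, Y, hC⟩ := hf.bdd
  obtain ⟨L, hL, -⟩ := exists_limit_of_periodic (f := f) (v := max Y 0) (C := C)
    (fun w hw => hf.holo w ((le_max_right _ _).trans_lt hw))
    (fun w hw => hf.T w ((le_max_right _ _).trans_lt hw))
    (fun w hw => hC w ((le_max_right _ _).trans_lt hw) ((le_max_left _ _).trans hw.le))
  exact ⟨L, hL⟩

theorem qExpansion_coeff_zero_eq {k : ℤ} (F : ModularForm 𝒮ℒ k) {f : ℂ → ℂ} {L : ℂ}
    (hF : ∀ z : ℍ, F z = f z) (hL : Tendsto f imInf (𝓝 L)) : (qExpansion 1 F).coeff 0 = L := by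
  rw [UpperHalfPlane.qExpansion_coeff_zero one_pos
    (ModularFormClass.analyticAt_cuspFunction_zero F one_pos one_mem_strictPeriods_SL)
    (SlashInvariantFormClass.periodic_comp_ofComplex F one_mem_strictPeriods_SL)]
  refine Tendsto.limUnder_eq ?_
  exact (hL.comp UpperHalfPlane.tendsto_coe_atImInfty).congr fun z => (hF z).symm

theorem tendsto_eisenstein {k : ℕ} (hk : 3 ≤ k) (hk2 : Even k) :
    Tendsto (fun t : ℂ => E hk (ofComplex t)) imInf (𝓝 1) := by
  obtain ⟨L, hL⟩ := (ModularForm.mf (E hk)).exists_tendsto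
  have := qExpansion_coeff_zero_eq (E hk) (fun z => by rw [ofComplex_apply]) hL
  rw [E_qExpansion_coeff_zero hk hk2] at this
  rwa [this]

theorem tendsto_mE4 : Tendsto mE4 imInf (𝓝 1) := tendsto_eisenstein (by norm_num) ⟨2, rfl⟩

theorem tendsto_mE6 : Tendsto mE6 imInf (𝓝 1) := tendsto_eisenstein (by norm_num) ⟨3, rfl⟩

/-- Division with remainder by the discriminant. -/
theorem MF.exists_eq_add_discriminant {a b : ℕ} {f : ℂ → ℂ} {k : ℤ} (hk : k = 4 * a + 6 * b)
    (hf : MF k f) : ∃ c g, MF (k - 12) g ∧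
      ∀ t : ℂ, 0 < t.im → f t = c * (mE4 t ^ a * mE6 t ^ b) + DD t * g t := by
  obtain ⟨c, hc⟩ := hf.exists_tendsto
  have hE : MF k (fun t => mE4 t ^ a * mE6 t ^ b) := by
    have := (mf_mE4.pow a).mul (mf_mE6.pow b)
    rwa [show (a : ℤ) * 4 + b * 6 = k by rw [hk]; ring] at this
  obtain ⟨G, hG⟩ := (hf.add (hE.smul (-c))).exists_modularForm
  have h0 : (qExpansion 1 G).coeff 0 = 0 := by
    refine qExpansion_coeff_zero_eq G (f := fun t => f t + -c * (mE4 t ^ a * mE6 t ^ b)) hG ?_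
    have := hc.add (((tendsto_mE4.pow a).mul (tendsto_mE6.pow b)).const_mul (-c))
    simpa using this
  refine ⟨c, _, ModularForm.mf (CuspForm.discriminantEquiv (toCuspForm G h0)), fun t ht => ?_⟩
  have h := discriminant_mul_discriminantEquiv_apply (toCuspForm G h0) ⟨t, ht⟩
  rw [toCuspForm_apply, hG] at h
  rw [DD, ofComplex_apply_of_im_pos ht, h]
  ring

theorem MF.induction {P : ℤ → (ℂ → ℂ) → Prop}
    (congr : ∀ k f g, (∀ t : ℂ, 0 < t.im → g t = f t) → P k f → P k g)
    (zero : ∀ k, P k fun _ => 0) (one : P 0 fun _ => 1)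
    (hadd : ∀ k f g, P k f → P k g → P k fun t => f t + g t)
    (smul : ∀ k c f, P k f → P k fun t => c * f t)
    (hE4 : ∀ k f, P k f → P (k + 4) fun t => mE4 t * f t)
    (hE6 : ∀ k f, P k f → P (k + 6) fun t => mE6 t * f t) {k : ℤ} {f : ℂ → ℂ} (hf : MF k f) :
    P k f := by
  have hpow : ∀ a b : ℕ, P (4 * a + 6 * b) fun t => mE4 t ^ a * mE6 t ^ b := by
    intro a b
    induction a with
    | zero =>
      induction b with
      | zero => simpa using one
      | succ b ih =>
        have := hE6 _ _ ih
        rw [show (4 * (0 : ℕ) + 6 * b : ℤ) + 6 = 4 * (0 : ℕ) + 6 * (b + 1 : ℕ) by push_cast; ring] at this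
        exact congr _ _ _ (fun t _ => by ring) this
    | succ a ih =>
      have := hE4 _ _ ih
      rw [show (4 * a + 6 * b : ℤ) + 4 = 4 * (a + 1 : ℕ) + 6 * b by push_cast; ring] at this
      exact congr _ _ _ (fun t _ => by ring) this
  have main : ∀ n : ℕ, ∀ k : ℤ, k < n → ∀ f, MF k f → P k f := by
    intro n
    induction n with
    | zero =>
      intro k hk f hf
      exact congr _ _ _ (fun t ht => hf.eq_zero_of_neg (by simpa using hk) t ht) (zero k)
    | succ n ih =>
      intro k hk f hf
      by_cases hneg : k < 0
      · exact congr _ _ _ (fun t ht => hf.eq_zero_of_neg hneg t ht) (zero k)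
      rcases Int.even_or_odd k with he | ho
      swap
      · exact congr _ _ _ (fun t ht => hf.eq_zero_of_odd ho t ht) (zero k)
      by_cases h2 : k = 2
      · subst h2
        exact congr _ _ _ (fun t ht => hf.eq_zero_of_two t ht) (zero 2)
      obtain ⟨a, b, hab⟩ : ∃ a b : ℕ, k = 4 * a + 6 * b := by
        obtain ⟨r, rfl⟩ := he
        rcases Int.even_or_odd' r with ⟨s, rfl | rfl⟩
        · exact ⟨s.toNat, 0, by omega⟩
        · exact ⟨(s - 1).toNat, 1, by omega⟩
      obtain ⟨c, g, hg, h⟩ := hf.exists_eq_add_discriminant hab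
      have hPg := ih (k - 12) (by push_cast at hk; omega) g hg
      have h3 := hE4 _ _ (hE4 _ _ (hE4 _ _ hPg))
      have h4 := hE6 _ _ (hE6 _ _ hPg)
      rw [show k - 12 + 4 + 4 + 4 = k by ring] at h3
      rw [show k - 12 + 6 + 6 = k by ring] at h4
      have h5 := hpow a b
      rw [← hab] at h5
      refine congr _ _ _ (fun t ht => ?_) (hadd _ _ _ (smul _ c _ h5)
        (hadd _ _ _ (smul _ (1 / 1728) _ h3) (smul _ (-1 / 1728) _ h4)))
      rw [h t ht, DD_eq]; ring
  exact main (k.toNat + 1) k (by omega) f hf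

theorem tendsto_DD : Tendsto (fun t => DD t * ee (-t)) imInf (𝓝 1) := by
  refine (tendsto_atImInfty_tprod_one_sub_eta_q_pow.comp tendsto_ofComplex_imInf).congr' ?_
  filter_upwards [eventually_imInf 0] with t ht
  rw [Function.comp, DD, discriminant_eq_q_prod, mul_right_comm, ofComplex_apply_of_im_pos ht]
  have : Function.Periodic.qParam 1 t * ee (-t) = 1 := by
    rw [ee_neg, Function.Periodic.qParam, ee, Complex.ofReal_one, div_one]
    exact mul_inv_cancel₀ (Complex.exp_ne_zero _)
  rw [this, one_mul]

theorem hasSum_eisenstein {k : ℕ} (hk : 3 ≤ k) (hk2 : Even k) {t : ℂ} (ht : 0 < t.im) :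
    HasSum (fun n : ℕ => -(2 * k / bernoulli k : ℂ) * (ArithmeticFunction.sigma (k - 1) (n + 1) : ℂ) *
      ee ((n + 1) * t)) (E hk (ofComplex t) - 1) := by
  have h := hasSum_qExpansion (f := E hk) one_pos
    (SlashInvariantFormClass.periodic_comp_ofComplex (E hk) one_mem_strictPeriods_SL)
    (ModularFormClass.holo (E hk)) (ModularFormClass.bdd_at_infty (E hk)) ⟨t, ht⟩
  rw [← hasSum_nat_add_iff' 1] at h
  simp only [E_qExpansion_coeff hk hk2] at h
  rw [ofComplex_apply_of_im_pos ht]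
  have e : ∀ n : ℕ, ee (((n : ℂ) + 1) * t) = Function.Periodic.qParam 1 t ^ (n + 1) := fun n => by
    rw [Function.Periodic.qParam, ee, ← Complex.exp_nat_mul]
    congr 1
    push_cast
    ring
  simpa [e] using h

theorem hasSum_mE4 {t : ℂ} (ht : 0 < t.im) :
    HasSum (fun n : ℕ => 240 * (ArithmeticFunction.sigma 3 (n + 1) : ℂ) * ee ((n + 1) * t))
      (mE4 t - 1) := by
  have h := hasSum_eisenstein (k := 4) (by norm_num) ⟨2, rfl⟩ ht
  rw [show bernoulli 4 = -1 / 30 by decide +kernel] at h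
  norm_num at h
  exact h

theorem hasSum_mE6 {t : ℂ} (ht : 0 < t.im) :
    HasSum (fun n : ℕ => -504 * (ArithmeticFunction.sigma 5 (n + 1) : ℂ) * ee ((n + 1) * t))
      (mE6 t - 1) := by
  have h := hasSum_eisenstein (k := 6) (by norm_num) ⟨3, rfl⟩ ht
  rw [show bernoulli 6 = 1 / 42 by decide +kernel] at h
  norm_num at h
  simp only [neg_mul]
  exact h

end ModularForms

section FourierJacobi

/-- The domain of the variables `(t, a, b, w)` parametrising the Hermitian upper half space. -/
def Om (t a b w : ℂ) : Prop :=
  0 < t.im ∧ a.im ^ 2 + a.im * b.im + 2 * b.im ^ 2 < t.im * w.im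

/-- The norm form. -/
def NN (a b : ℂ) : ℂ := a ^ 2 + a * b + 2 * b ^ 2

theorem nn_nonneg (x y : ℝ) : 0 ≤ x ^ 2 + x * y + 2 * y ^ 2 := by
  nlinarith [sq_nonneg (x + y / 2), sq_nonneg y]

theorem Om.im_pos {t a b w : ℂ} (h : Om t a b w) : 0 < w.im := by
  have := (nn_nonneg a.im b.im).trans_lt h.2
  exact (pos_iff_pos_of_mul_pos this).mp h.1

theorem Om.swap {t a b w : ℂ} (h : Om t a b w) : Om w a b t :=
  ⟨h.im_pos, by rw [mul_comm w.im]; exact h.2⟩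

theorem isOpen_Om : IsOpen {p : ℂ × ℂ × ℂ × ℂ | Om p.1 p.2.1 p.2.2.1 p.2.2.2} := by
  have h1 : Continuous fun p : ℂ × ℂ × ℂ × ℂ => p.1.im := by fun_prop
  have h2 : Continuous fun p : ℂ × ℂ × ℂ × ℂ => p.2.1.im := by fun_prop
  have h3 : Continuous fun p : ℂ × ℂ × ℂ × ℂ => p.2.2.1.im := by fun_prop
  have h4 : Continuous fun p : ℂ × ℂ × ℂ × ℂ => p.2.2.2.im := by fun_prop
  exact (isOpen_lt continuous_const h1).inter
    (isOpen_lt (((h2.pow 2).add (h2.mul h3)).add (continuous_const.mul (h3.pow 2))) (h1.mul h4))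

/-- Symmetric Hermitian modular forms, expressed in the coordinates `(t, a, b, w)` through
generators of the modular group. -/
structure SymForm (k : ℤ) (G : ℂ → ℂ → ℂ → ℂ → ℂ) : Prop where
  holo : ∀ t a b w, Om t a b w →
    DifferentiableAt ℂ (fun p : ℂ × ℂ × ℂ × ℂ => G p.1 p.2.1 p.2.2.1 p.2.2.2) (t, a, b, w)
  T : ∀ t a b w, Om t a b w → G (t + 1) a b w = G t a b w
  A : ∀ t a b w, Om t a b w → G t (a + 1) b w = G t a b w
  B : ∀ t a b w, Om t a b w → G t a (b + 1) w = G t a b w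
  HA : ∀ t a b w, Om t a b w → G t (a + t) b (w + 2 * a + b + t) = G t a b w
  HB : ∀ t a b w, Om t a b w → G t a (b + t) (w + a + 4 * b + 2 * t) = G t a b w
  S : ∀ t a b w, Om t a b w → G (-1 / t) (a / t) (b / t) (w - NN a b / t) = t ^ k * G t a b w
  sig : ∀ t a b w, Om t a b w → G t (-a - b) b w = G t a b w
  neg : ∀ t a b w, Om t a b w → G t (-a) (-b) w = (-1) ^ k * G t a b w
  swap : ∀ t a b w, Om t a b w → G w a b t = G t a b w

/-- Fourier-Jacobi coefficients of index less than `m` vanish, uniformly. -/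
def LB (m : ℕ) (G : ℂ → ℂ → ℂ → ℂ → ℂ) : Prop :=
  ∀ Y Y' R : ℝ, 0 < Y → ∃ v C : ℝ, ∀ t a b w : ℂ, Y ≤ t.im → t.im ≤ Y' → |a.im| ≤ R → |b.im| ≤ R →
    v ≤ w.im → Om t a b w ∧ ‖G t a b w‖ ≤ C * Real.exp (-2 * Real.pi * m * w.im)

/-- `φ` is the leading Fourier-Jacobi coefficient, of index `m`. -/
def Lead (m : ℕ) (G : ℂ → ℂ → ℂ → ℂ → ℂ) (φ : ℂ → ℂ → ℂ → ℂ) : Prop :=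
  ∀ t a b : ℂ, 0 < t.im → Tendsto (fun w => G t a b w * ee (-(m * w))) imInf (𝓝 (φ t a b))

variable {k : ℤ} {m : ℕ} {G : ℂ → ℂ → ℂ → ℂ → ℂ} {φ : ℂ → ℂ → ℂ → ℂ}

theorem SymForm.W (hG : SymForm k G) (t a b w : ℂ) (h : Om t a b w) : G t a b (w + 1) = G t a b w := by
  have h' : Om t a b (w + 1) := by simpa [Om] using h
  rw [← hG.swap _ _ _ _ h', hG.T _ _ _ _ h.swap, hG.swap _ _ _ _ h]

theorem SymForm.differentiableAt_comp {E : Type*} [NormedAddCommGroup E] [NormedSpace ℂ E]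
    (hG : SymForm k G) {f₁ f₂ f₃ f₄ : E → ℂ} {x : E} (h : Om (f₁ x) (f₂ x) (f₃ x) (f₄ x))
    (h₁ : DifferentiableAt ℂ f₁ x) (h₂ : DifferentiableAt ℂ f₂ x) (h₃ : DifferentiableAt ℂ f₃ x)
    (h₄ : DifferentiableAt ℂ f₄ x) :
    DifferentiableAt ℂ (fun y => G (f₁ y) (f₂ y) (f₃ y) (f₄ y)) x :=
  DifferentiableAt.comp (g := fun p : ℂ × ℂ × ℂ × ℂ => G p.1 p.2.1 p.2.2.1 p.2.2.2)
    (f := fun y => (f₁ y, f₂ y, f₃ y, f₄ y)) x (hG.holo _ _ _ _ h)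
    (h₁.prodMk (h₂.prodMk (h₃.prodMk h₄)))

theorem SymForm.exists_bound (hG : SymForm k G) {Y Y' R R' V : ℝ}
    (hOm : ∀ t a b w : ℂ, Y ≤ t.im → t.im ≤ Y' → |a.im| ≤ R → |b.im| ≤ R' → w.im = V → Om t a b w) :
    ∃ C, ∀ t a b w : ℂ, Y ≤ t.im → t.im ≤ Y' → |a.im| ≤ R → |b.im| ≤ R' → w.im = V →
      ‖G t a b w‖ ≤ C := by
  have hK := ((isCompact_Icc.reProdIm isCompact_Icc : IsCompact (Set.Icc (0 : ℝ) 1 ×ℂ Set.Icc Y Y')).prod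
    ((isCompact_Icc.reProdIm isCompact_Icc : IsCompact (Set.Icc (0 : ℝ) 1 ×ℂ Set.Icc (-R) R)).prod
    ((isCompact_Icc.reProdIm isCompact_Icc : IsCompact (Set.Icc (0 : ℝ) 1 ×ℂ Set.Icc (-R') R')).prod
    (isCompact_Icc.reProdIm isCompact_Icc : IsCompact (Set.Icc (0 : ℝ) 1 ×ℂ Set.Icc V V)))))
  obtain ⟨C, hC⟩ := hK.exists_bound_of_continuousOn
    (f := fun p : ℂ × ℂ × ℂ × ℂ => G p.1 p.2.1 p.2.2.1 p.2.2.2) fun p hp => by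
      obtain ⟨⟨-, h1⟩, ⟨-, h2⟩, ⟨-, h3⟩, -, h4⟩ := hp
      exact (hG.holo _ _ _ _ (hOm p.1 p.2.1 p.2.2.1 p.2.2.2 h1.1 h1.2 (abs_le.mpr h2) (abs_le.mpr h3)
        (le_antisymm h4.2 h4.1))).continuousAt.continuousWithinAt
  refine ⟨C, fun t a b w h1 h2 h3 h4 h5 => ?_⟩
  obtain ⟨t', e1, r1, g1⟩ := exists_re_mem_Icc (P := fun y => Y ≤ y ∧ y ≤ Y') (f := fun t => G t a b w)
    (fun z hz => hG.T _ _ _ _ (hOm _ _ _ _ hz.1 hz.2 h3 h4 h5)) t ⟨h1, h2⟩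
  rw [← e1] at h1 h2
  obtain ⟨a', e2, r2, g2⟩ := exists_re_mem_Icc (P := fun y => |y| ≤ R) (f := fun a => G t' a b w)
    (fun z hz => hG.A _ _ _ _ (hOm _ _ _ _ h1 h2 hz h4 h5)) a h3
  rw [← e2] at h3
  obtain ⟨b', e3, r3, g3⟩ := exists_re_mem_Icc (P := fun y => |y| ≤ R') (f := fun b => G t' a' b w)
    (fun z hz => hG.B _ _ _ _ (hOm _ _ _ _ h1 h2 h3 hz h5)) b h4
  rw [← e3] at h4
  obtain ⟨w', e4, r4, g4⟩ := exists_re_mem_Icc (P := fun y => y = V) (f := fun w => G t' a' b' w)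
    (fun z hz => hG.W _ _ _ _ (hOm _ _ _ _ h1 h2 h3 h4 hz)) w h5
  rw [← e4] at h5
  have := hC (t', a', b', w') ⟨⟨r1, h1, h2⟩, ⟨r2, abs_le.mp h3⟩, ⟨r3, abs_le.mp h4⟩, r4, h5.ge,
      h5.le⟩
  simp only at g1 g2 g3 g4 this
  rwa [g4, g3, g2, g1] at this

/-- Koecher's principle. -/
theorem SymForm.lb_zero (hG : SymForm k G) : LB 0 G := by
  intro Y Y' R hY
  rcases lt_or_ge R 0 with hR | hR
  · exact ⟨0, 0, fun t a b w _ _ h => absurd ((abs_nonneg _).trans h) (not_le.mpr hR)⟩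
  set V : ℝ := 3 * R ^ 2 / Y + 1 with hV
  have hYV : 3 * R ^ 2 < Y * V := by rw [hV]; field_simp; linarith
  have hV0 : 0 < V := by positivity
  have key : ∀ y β : ℝ, Y ≤ y → |β| ≤ R → 7 / 4 * β ^ 2 < y * V := by
    intro y β h1 h2
    have : β ^ 2 ≤ R ^ 2 := sq_le_sq' (abs_le.mp h2).1 (abs_le.mp h2).2
    nlinarith [mul_le_mul_of_nonneg_right h1 hV0.le]
  have hOm : ∀ (t a b w : ℂ) (l : ℕ), Y ≤ t.im → |b.im| ≤ R → |a.im + b.im / 2| ≤ l * t.im →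
      V + l ^ 2 * t.im ≤ w.im → Om t a b w := by
    intro t a b w l h1 h2 h3 h4
    refine ⟨hY.trans_le h1, ?_⟩
    have := key _ _ h1 h2
    have h5 := sq_le_sq' (abs_le.mp h3).1 (abs_le.mp h3).2
    have h6 := mul_le_mul_of_nonneg_left h4 (hY.trans_le h1).le
    nlinarith
  obtain ⟨C, hC⟩ := hG.exists_bound (Y := Y) (Y' := Y') (R := R / 2) (R' := R) (V := V) (by
    intro t a b w h1 h2 h3 h4 h5
    refine ⟨hY.trans_le h1, ?_⟩
    have h6 : (a.im + b.im / 2) ^ 2 ≤ R ^ 2 := by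
      rw [abs_le] at h3 h4
      exact sq_le_sq' (by linarith) (by linarith)
    have h7 : b.im ^ 2 ≤ R ^ 2 := sq_le_sq' (abs_le.mp h4).1 (abs_le.mp h4).2
    have h8 := mul_le_mul_of_nonneg_right h1 hV0.le
    rw [h5]
    nlinarith)
  -- translate the bound by quasi-periods
  have step : ∀ (l : ℕ) (t a b w : ℂ), Y ≤ t.im → t.im ≤ Y' → |b.im| ≤ R →
      a.im = -b.im / 2 + l * t.im → w.im = V + l ^ 2 * t.im → ‖G t a b w‖ ≤ C := by
    intro l
    induction l with
    | zero =>
      intro t a b w h1 h2 h3 h4 h5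
      refine hC t a b w h1 h2 ?_ h3 (by simpa using h5)
      rw [h4]; simp only [Nat.cast_zero, zero_mul, add_zero]
      rw [abs_div, abs_neg, abs_two]; linarith
    | succ l ih =>
      intro t a b w h1 h2 h3 h4 h5
      push_cast at h4 h5
      have h := ih t (a - t) b (w - 2 * (a - t) - b - t) h1 h2 h3 (by simp [h4]; ring)
        (by simp [h4, h5]; ring)
      rw [← hG.HA _ _ _ _ (hOm t (a - t) b (w - 2 * (a - t) - b - t) l h1 h3 _ _)] at h
      · rwa [sub_add_cancel, show w - 2 * (a - t) - b - t + 2 * (a - t) + b + t = w by ring] at h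
      · rw [show (a - t).im + b.im / 2 = l * t.im by simp [h4]; ring,
          abs_of_nonneg (mul_nonneg l.cast_nonneg (hY.le.trans h1))]
      · simp [h4, h5]; nlinarith
  have step' : ∀ (l : ℕ) (t a b w : ℂ), Y ≤ t.im → t.im ≤ Y' → |b.im| ≤ R →
      |a.im + b.im / 2| ≤ l * t.im → w.im = V + l ^ 2 * t.im → ‖G t a b w‖ ≤ C := by
    intro l t a b w h1 h2 h3 h4 h5
    have hin : ∀ z : ℂ, -b.im / 2 - l * t.im ≤ z.im → z.im ≤ -b.im / 2 + l * t.im → Om t z b w :=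
      fun z hz1 hz2 => hOm t z b w l h1 h3 (abs_le.mpr ⟨by linarith, by linarith⟩) h5.ge
    have hl : 0 ≤ l * t.im := mul_nonneg l.cast_nonneg (hY.le.trans h1)
    rw [abs_le] at h4
    refine norm_le_of_periodic_strip (f := fun a => G t a b w) (y₁ := -b.im / 2 - l * t.im)
      (y₂ := -b.im / 2 + l * t.im) (fun z hz1 hz2 => hG.differentiableAt_comp (hin z hz1 hz2)
        (by fun_prop) (by fun_prop) (by fun_prop) (by fun_prop))
      (fun z hz1 hz2 => congrArg norm (hG.A _ _ _ _ (hin z hz1 hz2))) (fun z hz => ?_)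
      (fun z hz => step l t z b w h1 h2 h3 hz h5) a (by linarith) (by linarith)
    rw [← hG.sig _ _ _ _ (hin z hz.ge (by linarith))]
    exact step l t _ b w h1 h2 h3 (by simp [hz]; ring) h5
  refine ⟨V + (⌈3 * R / (2 * Y)⌉₊ : ℝ) ^ 2 * Y', C, fun t a b w h1 h2 h3 h4 h5 => ?_⟩
  set l₀ := ⌈3 * R / (2 * Y)⌉₊
  have hy : 0 < t.im := hY.trans_le h1
  set l := ⌊Real.sqrt ((w.im - V) / t.im)⌋₊
  have h6 : (l₀ : ℝ) ^ 2 ≤ (w.im - V) / t.im := by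
    rw [le_div_iff₀ hy]; nlinarith [mul_le_mul_of_nonneg_left h2 (sq_nonneg (l₀ : ℝ))]
  have hl0 : l₀ ≤ l := Nat.le_floor (Real.le_sqrt_of_sq_le h6)
  have hnn : 0 ≤ (w.im - V) / t.im := (sq_nonneg _).trans h6
  have hl1 : V + l ^ 2 * t.im ≤ w.im := by
    have : (l : ℝ) ≤ √((w.im - V) / t.im) := Nat.floor_le (Real.sqrt_nonneg _)
    have := (Real.le_sqrt l.cast_nonneg hnn).mp this
    rw [le_div_iff₀ hy] at this; linarith
  have hl2 : w.im ≤ V + ((l + 1 : ℕ) : ℝ) ^ 2 * t.im := by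
    have : √((w.im - V) / t.im) < (l : ℝ) + 1 := Nat.lt_floor_add_one _
    have := (Real.sqrt_lt' (by positivity)).mp this
    rw [div_lt_iff₀ hy] at this; push_cast; linarith
  have h7 : |a.im + b.im / 2| ≤ l * t.im := by
    have e1 : 3 * R / (2 * Y) ≤ l := (Nat.le_ceil _).trans (by exact_mod_cast hl0)
    rw [div_le_iff₀ (by positivity)] at e1
    have e2 : (l : ℝ) * Y ≤ l * t.im := by gcongr
    rw [abs_le] at h3 h4 ⊢
    constructor <;> linarith
  have h8 : |a.im + b.im / 2| ≤ ((l + 1 : ℕ) : ℝ) * t.im := h7.trans (by push_cast; nlinarith)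
  refine ⟨hOm t a b w l h1 h4 h7 hl1, ?_⟩
  have := norm_le_of_periodic_strip (f := fun w => G t a b w) (C := C)
    (fun z hz1 hz2 => hG.differentiableAt_comp (hOm t a b z l h1 h4 h7 hz1)
        (by fun_prop) (by fun_prop) (by fun_prop) (by fun_prop))
    (fun z hz1 hz2 => congrArg norm (hG.W _ _ _ _ (hOm t a b z l h1 h4 h7 hz1)))
    (fun z hz => step' l t a b z h1 h2 h4 h7 hz) (fun z hz => step' (l + 1) t a b z h1 h2 h4 h8 hz)
    w hl1 hl2
  simpa using this

end FourierJacobi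

section FourierJacobi

variable {k : ℤ} {m : ℕ} {G : ℂ → ℂ → ℂ → ℂ → ℂ} {φ : ℂ → ℂ → ℂ → ℂ}

theorem eventually_Om {t : ℂ} (ht : 0 < t.im) (a b : ℂ) : ∀ᶠ w in imInf, Om t a b w := by
  filter_upwards [eventually_imInf ((a.im ^ 2 + a.im * b.im + 2 * b.im ^ 2) / t.im)] with w hw
  exact ⟨ht, by rwa [div_lt_iff₀' ht] at hw⟩

theorem Om.mono {t a b w w' : ℂ} (h : Om t a b w) (hw : w.im ≤ w'.im) : Om t a b w' :=
  ⟨h.1, h.2.trans_le (mul_le_mul_of_nonneg_left hw h.1.le)⟩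

theorem ee_neg_mul_add_one (m : ℕ) (w : ℂ) : ee (-(m * (w + 1))) = ee (-(m * w)) := by
  rw [show -((m : ℂ) * (w + 1)) = -(m * w) - (m : ℕ) by ring, ee_sub, ee_natCast, div_one]

theorem norm_ee_neg_mul (m : ℕ) (w : ℂ) : ‖ee (-(m * w))‖ = Real.exp (2 * Real.pi * m * w.im) := by
  rw [norm_ee]; congr 1; simp; ring

theorem LB.norm_le {C : ℝ} {t a b w : ℂ}
    (h : ‖G t a b w‖ ≤ C * Real.exp (-2 * Real.pi * m * w.im)) : ‖G t a b w * ee (-(m * w))‖ ≤ C := by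
  rw [norm_mul, norm_ee_neg_mul]
  refine (mul_le_mul_of_nonneg_right h (Real.exp_pos _).le).trans_eq ?_
  rw [mul_assoc, ← Real.exp_add]; ring_nf; simp

theorem SymForm.twist_holo (hG : SymForm k G) (m : ℕ) {t a b w : ℂ} (h : Om t a b w) :
    DifferentiableAt ℂ (fun w => G t a b w * ee (-(m * w))) w :=
  (hG.differentiableAt_comp h (by fun_prop) (by fun_prop) (by fun_prop) (by fun_prop)).mul
    (differentiable_ee.comp (by fun_prop)).differentiableAt

theorem SymForm.twist_periodic (hG : SymForm k G) (m : ℕ) {t a b w : ℂ} (h : Om t a b w) :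
    G t a b (w + 1) * ee (-(m * (w + 1))) = G t a b w * ee (-(m * w)) := by
  rw [hG.W _ _ _ _ h, ee_neg_mul_add_one]

theorem SymForm.exists_limit (hG : SymForm k G) (h : LB m G) {Y Y' R : ℝ} (hY : 0 < Y) :
    ∃ v C : ℝ, ∀ t a b : ℂ, Y ≤ t.im → t.im ≤ Y' → |a.im| ≤ R → |b.im| ≤ R →
      ∃ L, Tendsto (fun w => G t a b w * ee (-(m * w))) imInf (𝓝 L) ∧ ∀ w : ℂ, v < w.im →
        Om t a b w ∧ ‖G t a b w * ee (-(m * w)) - L‖ ≤ C * Real.exp (-2 * Real.pi * w.im) := by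
  obtain ⟨v, C, hv⟩ := h Y Y' R hY
  refine ⟨v, 2 * C * Real.exp (2 * Real.pi * v), fun t a b h1 h2 h3 h4 => ?_⟩
  have hv' := fun w hw => hv t a b w h1 h2 h3 h4 hw
  obtain ⟨L, hL, hL'⟩ := exists_limit_of_periodic (v := v) (C := C)
    (fun w hw => hG.twist_holo m (hv' w hw.le).1) (fun w hw => hG.twist_periodic m (hv' w hw.le).1)
    (fun w hw => LB.norm_le (hv' w hw.le).2)
  exact ⟨L, hL, fun w hw => ⟨(hv' w hw.le).1, hL' w hw⟩⟩

theorem SymForm.lead_estimate (hG : SymForm k G) (h : LB m G) (hφ : Lead m G φ) {Y Y' R : ℝ}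
    (hY : 0 < Y) : ∃ v C : ℝ, ∀ t a b w : ℂ, Y ≤ t.im → t.im ≤ Y' → |a.im| ≤ R → |b.im| ≤ R →
      v < w.im → Om t a b w ∧
        ‖G t a b w * ee (-(m * w)) - φ t a b‖ ≤ C * Real.exp (-2 * Real.pi * w.im) := by
  obtain ⟨v, C, hv⟩ := hG.exists_limit h (Y' := Y') (R := R) hY
  refine ⟨v, C, fun t a b w h1 h2 h3 h4 h5 => ?_⟩
  obtain ⟨L, hL, hL'⟩ := hv t a b h1 h2 h3 h4
  rw [tendsto_nhds_unique (hφ t a b (hY.trans_le h1)) hL]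
  exact hL' w h5

theorem SymForm.exists_lead (hG : SymForm k G) (h : LB m G) : ∃ φ, Lead m G φ := by
  have : ∀ t a b : ℂ, ∃ L, 0 < t.im → Tendsto (fun w => G t a b w * ee (-(m * w))) imInf (𝓝 L) := by
    intro t a b
    by_cases ht : 0 < t.im
    · obtain ⟨v, C, hv⟩ := hG.exists_limit h (Y' := t.im) (R := max |a.im| |b.im|) ht
      obtain ⟨L, hL, -⟩ := hv t a b le_rfl le_rfl (le_max_left _ _) (le_max_right _ _)
      exact ⟨L, fun _ => hL⟩
    · exact ⟨0, fun h => absurd h ht⟩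
  choose φ hφ using this
  exact ⟨φ, hφ⟩

theorem SymForm.lb_succ (hG : SymForm k G) (h : LB m G)
    (h0 : Lead m G fun _ _ _ => 0) : LB (m + 1) G := by
  intro Y Y' R hY
  obtain ⟨v, C, hv⟩ := hG.lead_estimate h h0 (Y' := Y') (R := R) hY
  refine ⟨v + 1, C, fun t a b w h1 h2 h3 h4 h5 => ?_⟩
  obtain ⟨h6, h7⟩ := hv t a b w h1 h2 h3 h4 (by linarith)
  refine ⟨h6, ?_⟩
  rw [sub_zero, norm_mul, norm_ee_neg_mul] at h7
  have := mul_le_mul_of_nonneg_right h7 (Real.exp_pos (-(2 * Real.pi * m * w.im))).le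
  rw [mul_assoc, ← Real.exp_add, add_neg_cancel, Real.exp_zero, mul_one, mul_assoc,
    ← Real.exp_add] at this
  refine this.trans_eq ?_
  push_cast; ring_nf

theorem SymForm.lb_of_lead (hG : SymForm k G) (hφ : Lead m G φ) : LB m G := by
  suffices ∀ j ≤ m, LB j G from this m le_rfl
  intro j
  induction j with
  | zero => exact fun _ => hG.lb_zero
  | succ j ih =>
    intro hj
    refine hG.lb_succ (ih (by omega)) fun t a b ht => ?_
    have h1 : Tendsto (fun w => ee (((m - j : ℕ) : ℂ) * w)) imInf (𝓝 0) := by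
      have := tendsto_ee_imInf.pow (m - j)
      rw [zero_pow (by omega)] at this
      simpa only [ee_nat_mul] using this
    have := (hφ t a b ht).mul h1
    rw [mul_zero] at this
    refine this.congr fun w => ?_
    rw [mul_assoc, ← ee_add]
    congr 2
    push_cast [show j ≤ m by omega]; ring

theorem SymForm.eq_zero (hG : SymForm k G) (h : ∀ m, LB m G) {t a b w : ℂ} (hO : Om t a b w) :
    G t a b w = 0 := by
  obtain ⟨v, hv1, hv2⟩ : ∃ v, (a.im ^ 2 + a.im * b.im + 2 * b.im ^ 2) / t.im < v ∧ v < w.im :=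
    exists_between (by rw [div_lt_iff₀' hO.1]; exact hO.2)
  have hOm : ∀ z : ℂ, v ≤ z.im → Om t a b z := fun z hz =>
    ⟨hO.1, by rw [← div_lt_iff₀' hO.1]; exact hv1.trans_le hz⟩
  obtain ⟨C, hC⟩ := exists_bound_of_periodic (f := fun w => G t a b w) (y₁ := v) (y₂ := v)
    (fun z hz _ => (hG.differentiableAt_comp (hOm z hz) (by fun_prop) (by fun_prop) (by fun_prop)
      (by fun_prop)).continuousAt) (fun z hz _ => congrArg norm (hG.W _ _ _ _ (hOm z hz)))
  have key : ∀ m : ℕ, ‖G t a b w‖ ≤ C * (Real.exp (-2 * Real.pi * (w.im - v))) ^ m := by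
    intro m
    obtain ⟨φ, hφ⟩ := hG.exists_lead (h m)
    have := norm_le_of_periodic_of_tendsto (v := v) (C := C * Real.exp (2 * Real.pi * m * v))
      (fun z hz => hG.twist_holo m (hOm z hz))
      (fun z hz => hG.twist_periodic m (hOm z hz)) (hφ t a b hO.1) (fun z hz => by
        rw [norm_mul, norm_ee_neg_mul, hz]
        exact mul_le_mul_of_nonneg_right (hC z hz.ge hz.le) (Real.exp_pos _).le) hv2.le
    rw [norm_mul, norm_ee_neg_mul] at this
    have := mul_le_mul_of_nonneg_right this (Real.exp_pos (-(2 * Real.pi * m * w.im))).le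
    rw [mul_assoc, ← Real.exp_add, add_neg_cancel, Real.exp_zero, mul_one, mul_assoc,
      ← Real.exp_add] at this
    refine this.trans_eq ?_
    rw [← Real.exp_nat_mul]; ring_nf
  have h1 : Tendsto (fun m : ℕ => C * (Real.exp (-2 * Real.pi * (w.im - v))) ^ m) atTop (𝓝 (C * 0)) := by
    refine (tendsto_pow_atTop_nhds_zero_of_lt_one (Real.exp_pos _).le ?_).const_mul C
    rw [Real.exp_lt_one_iff]
    nlinarith [Real.pi_pos]
  rw [mul_zero] at h1
  exact norm_le_zero_iff.mp (ge_of_tendsto' h1 key)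

theorem SymForm.lead_holo (hG : SymForm k G) (hφ : Lead m G φ) {t a b : ℂ} (ht : 0 < t.im) :
    DifferentiableAt ℂ (fun p : ℂ × ℂ × ℂ => φ p.1 p.2.1 p.2.2) (t, a, b) := by
  obtain ⟨v, C, hv⟩ := hG.lead_estimate (hG.lb_of_lead hφ) hφ (Y := t.im / 2) (Y' := 2 * t.im)
    (R := max |a.im| |b.im| + t.im) (by positivity)
  have hbox : ∀ p ∈ Metric.ball ((t, a, b) : ℂ × ℂ × ℂ) (t.im / 2),
      t.im / 2 ≤ p.1.im ∧ p.1.im ≤ 2 * t.im ∧ |p.2.1.im| ≤ max |a.im| |b.im| + t.im ∧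
        |p.2.2.im| ≤ max |a.im| |b.im| + t.im := by
    rintro ⟨t', a', b'⟩ hp
    rw [mem_ball_iff_norm, Prod.mk_sub_mk, Prod.mk_sub_mk, Prod.norm_mk, Prod.norm_mk, max_lt_iff,
      max_lt_iff] at hp
    obtain ⟨h1, h2, h3⟩ := hp
    replace h1 := abs_lt.mp ((Complex.abs_im_le_norm _).trans_lt h1)
    replace h2 := abs_lt.mp ((Complex.abs_im_le_norm _).trans_lt h2)
    replace h3 := abs_lt.mp ((Complex.abs_im_le_norm _).trans_lt h3)
    simp only [Complex.sub_im] at h1 h2 h3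
    have e1 := abs_le.mp (le_max_left |a.im| |b.im|)
    have e2 := abs_le.mp (le_max_right |a.im| |b.im|)
    refine ⟨by linarith, by linarith, abs_le.mpr ⟨?_, ?_⟩, abs_le.mpr ⟨?_,
        ?_⟩⟩ <;> simp only <;> linarith
  refine differentiableAt_of_tendstoUniformlyOn_ball (l := imInf) (r := t.im / 2) (by positivity)
    (f := fun w p => G p.1 p.2.1 p.2.2 w * ee (-(m * w))) ?_ ?_
  · rw [Metric.tendstoUniformlyOn_iff]
    intro ε hε
    have h0 : Tendsto (fun w : ℂ => C * Real.exp (-2 * Real.pi * w.im)) imInf (𝓝 0) := by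
      have := tendsto_ee_imInf.norm.const_mul C
      simpa only [norm_ee, norm_zero, mul_zero] using this
    filter_upwards [h0.eventually (gt_mem_nhds hε), eventually_imInf v] with w hw hwv p hp
    obtain ⟨h1, h2, h3, h4⟩ := hbox p hp
    rw [dist_comm, dist_eq_norm]
    exact (hv _ _ _ w h1 h2 h3 h4 hwv).2.trans_lt hw
  · filter_upwards [eventually_imInf v] with w hwv p hp
    obtain ⟨h1, h2, h3, h4⟩ := hbox p hp
    exact (hG.differentiableAt_comp (hv _ _ _ w h1 h2 h3 h4 hwv).1 (by fun_prop) (by fun_prop)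
      (by fun_prop) (by fun_prop)).mul_const _

theorem tendsto_add_const_imInf (c : ℂ) : Tendsto (fun w => w + c) imInf imInf := by
  rw [tendsto_comap_iff]
  exact tendsto_atTop_add_const_right _ c.im tendsto_comap

theorem Lead.law (hφ : Lead m G φ) {t a b t' a' b' c κ : ℂ} (ht : 0 < t.im) (ht' : 0 < t'.im)
    (h : ∀ w, Om t a b w → G t' a' b' (w + c) = κ * G t a b w) :
    φ t' a' b' = κ * ee (-(m * c)) * φ t a b := by
  refine tendsto_nhds_unique ((hφ t' a' b' ht').comp (tendsto_add_const_imInf c)) ?_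
  refine ((hφ t a b ht).const_mul (κ * ee (-(m * c)))).congr' ?_
  filter_upwards [eventually_Om ht a b] with w hw
  rw [Function.comp, h w hw, mul_add, neg_add, ee_add]
  ring

theorem SymForm.lead_bound (hG : SymForm k G) (hφ : Lead m G φ) (R : ℝ) :
    ∃ C Y : ℝ, ∀ t a b : ℂ, 0 < t.im → Y ≤ t.im → |a.im| ≤ R → |b.im| ≤ R →
      ‖φ t a b‖ ≤ C * Real.exp (-2 * Real.pi * m * t.im) := by
  obtain ⟨v, C, hv⟩ := hG.lb_of_lead hφ 1 1 R one_pos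
  refine ⟨C * Real.exp (2 * Real.pi * m), v, fun t a b h0 h1 h3 h4 => ?_⟩
  have hO : ∀ w : ℂ, w.im = 1 → Om t a b w := fun w hw =>
    (hv w a b t hw.ge hw.le h3 h4 h1).1.swap
  have hO' : ∀ w : ℂ, 1 ≤ w.im → Om t a b w := fun w hw =>
    (hO Complex.I Complex.I_im).mono (by simpa using hw)
  refine le_of_tendsto (hφ t a b h0).norm ?_
  filter_upwards [eventually_imInf 1] with w hw
  refine norm_le_of_periodic_of_tendsto (v := 1) (fun z hz => hG.twist_holo m (hO' z hz))
      (fun z hz => hG.twist_periodic m (hO' z hz)) (hφ t a b h0) (fun z hz => ?_) hw.le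
  have := (hv z a b t hz.ge hz.le h3 h4 h1).2
  rw [hG.swap _ _ _ _ (hO z hz)] at this
  rw [norm_mul, norm_ee_neg_mul, hz, mul_one, mul_right_comm C]
  exact mul_le_mul_of_nonneg_right this (Real.exp_pos _).le

/-- Weak Jacobi forms in two elliptic variables. -/
structure WJ (k : ℤ) (n j : ℕ) (Φ : ℂ → ℂ → ℂ → ℂ) : Prop where
  holo : ∀ t a b : ℂ, 0 < t.im →
    DifferentiableAt ℂ (fun p : ℂ × ℂ × ℂ => Φ p.1 p.2.1 p.2.2) (t, a, b)
  T : ∀ t a b : ℂ, 0 < t.im → Φ (t + 1) a b = Φ t a b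
  A : ∀ t a b : ℂ, 0 < t.im → Φ t (a + 1) b = Φ t a b
  B : ∀ t a b : ℂ, 0 < t.im → Φ t a (b + 1) = (-1) ^ (n + j) * Φ t a b
  HA : ∀ t a b : ℂ, 0 < t.im → Φ t (a + t) b = ee (-(j * (t + 2 * a + b))) * Φ t a b
  HB : ∀ t a b : ℂ, 0 < t.im → Φ t a (b + t) =
    (-1) ^ (n + j) * ee (-(n * (t / 2 + b) + j * (t / 2 + a + b))) * Φ t a b
  S : ∀ t a b : ℂ, 0 < t.im → Φ (-1 / t) (a / t) (b / t) =
    t ^ k * ee ((n * b ^ 2 + j * (a ^ 2 + (a + b) ^ 2)) / (2 * t)) * Φ t a b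
  sig : ∀ t a b : ℂ, 0 < t.im → Φ t (-a - b) b = Φ t a b
  W : ∀ R : ℝ, ∃ C Y : ℝ, ∀ t a b : ℂ, 0 < t.im → Y ≤ t.im → ‖a‖ ≤ R → ‖b‖ ≤ R → ‖Φ t a b‖ ≤ C

theorem mf_pow_DD (m : ℕ) : MF (m * 12) (fun t => DD t ^ m) := mf_DD.pow m

theorem even_three_mul_add (m : ℕ) : (-1 : ℂ) ^ (3 * m + m) = 1 :=
  Even.neg_one_pow ⟨2 * m, by ring⟩

theorem SymForm.exists_wj (hG : SymForm k G) (hφ : Lead m G φ) :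
    ∃ ψ, WJ (k - 12 * m) (3 * m) m ψ ∧ ∀ t a b, φ t a b = DD t ^ m * ψ t a b := by
  refine ⟨fun t a b => (DD t ^ m)⁻¹ * φ t a b, ?_, fun t a b => by
    rw [mul_inv_cancel_left₀ (pow_ne_zero _ (DD_ne_zero t))]⟩
  have hD := mf_pow_DD m
  constructor
  · intro t a b ht
    have h1 : DifferentiableAt ℂ (fun p : ℂ × ℂ × ℂ => DD p.1 ^ m) (t, a, b) :=
      DifferentiableAt.comp (g := fun t => DD t ^ m) (f := Prod.fst) (t, a, b) (hD.holo t ht)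
        differentiableAt_fst
    exact (h1.fun_inv (pow_ne_zero _ (DD_ne_zero t))).fun_mul (hG.lead_holo hφ ht)
  · intro t a b ht
    have := hφ.law (a := a) (b := b) (a' := a) (b' := b) (c := 0) (κ := 1) ht (show 0 < (t + 1).im by simpa)
      fun w hw => by rw [add_zero, one_mul, hG.T _ _ _ _ hw]
    simp only [mul_zero, neg_zero, ee_zero, one_mul] at this
    rw [this, hD.T t ht]
  · intro t a b ht
    have := hφ.law (a := a) (b := b) (a' := a + 1) (b' := b) (c := 0) (κ := 1) ht ht
      fun w hw => by rw [add_zero, one_mul, hG.A _ _ _ _ hw]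
    simp only [mul_zero, neg_zero, ee_zero, one_mul] at this
    rw [this]
  · intro t a b ht
    have := hφ.law (a := a) (b := b) (a' := a) (b' := b + 1) (c := 0) (κ := 1) ht ht
      fun w hw => by rw [add_zero, one_mul, hG.B _ _ _ _ hw]
    simp only [mul_zero, neg_zero, ee_zero, one_mul] at this
    rw [this, even_three_mul_add, one_mul]
  · intro t a b ht
    have := hφ.law (a := a) (b := b) (a' := a + t) (b' := b) (c := 2 * a + b + t) (κ := 1) ht ht
      fun w hw => by rw [one_mul, ← add_assoc, ← add_assoc, hG.HA _ _ _ _ hw]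
    rw [this]; ring_nf
  · intro t a b ht
    have := hφ.law (a := a) (b := b) (a' := a) (b' := b + t) (c := a + 4 * b + 2 * t) (κ := 1) ht ht
      fun w hw => by rw [one_mul, ← add_assoc, ← add_assoc, hG.HB _ _ _ _ hw]
    rw [this, even_three_mul_add]; push_cast; ring_nf
  · intro t a b ht
    have h0 := ne_zero_of_im_pos ht
    have := hφ.law (a := a) (b := b) (a' := a / t) (b' := b / t) (c := -(NN a b / t)) (κ := t ^ k) ht
      (im_neg_one_div ht) fun w hw => by rw [← sub_eq_add_neg, hG.S _ _ _ _ hw]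
    rw [this, hD.S t ht, zpow_sub₀ h0, show (m : ℤ) * 12 = 12 * m by ring, NN]
    push_cast
    rw [show -((m : ℂ) * -((a ^ 2 + a * b + 2 * b ^ 2) / t)) =
      (3 * m * b ^ 2 + m * (a ^ 2 + (a + b) ^ 2)) / (2 * t) by field_simp; ring]
    rw [mul_inv]; ring
  · intro t a b ht
    have := hφ.law (a := a) (b := b) (a' := -a - b) (b' := b) (c := 0) (κ := 1) ht ht
      fun w hw => by rw [add_zero, one_mul, hG.sig _ _ _ _ hw]
    simp only [mul_zero, neg_zero, ee_zero, one_mul] at this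
    rw [this]
  · intro R
    obtain ⟨C, Y, hC⟩ := hG.lead_bound hφ R
    have h1 : ∀ᶠ t in imInf, 1 / 2 < ‖DD t * ee (-t)‖ := by
      have := tendsto_DD.norm
      rw [norm_one] at this
      exact this.eventually (lt_mem_nhds (by norm_num))
    obtain ⟨V, hV⟩ := (eventually_comap.mp h1).exists_forall_of_atTop
    refine ⟨2 ^ m * |C|, max Y V, fun t a b ht hY ha hb => ?_⟩
    have h2 := hC t a b ht ((le_max_left _ _).trans hY) ((Complex.abs_im_le_norm _).trans ha)
      ((Complex.abs_im_le_norm _).trans hb)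
    have h3 := hV t.im ((le_max_right _ _).trans hY) t rfl
    rw [norm_mul, show ee (-t) = ee (-((1 : ℕ) * t)) by simp, norm_ee_neg_mul] at h3
    have h4 : (1 / 2) ^ m * Real.exp (-2 * Real.pi * m * t.im) ≤ ‖DD t‖ ^ m := by
      have : 1 / 2 * Real.exp (-2 * Real.pi * t.im) ≤ ‖DD t‖ := by
        have := mul_le_mul_of_nonneg_right h3.le (Real.exp_pos (-2 * Real.pi * t.im)).le
        rw [mul_assoc ‖DD t‖, ← Real.exp_add] at this
        refine this.trans_eq ?_
        rw [Nat.cast_one]; ring_nf; simp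
      calc _ = (1 / 2 * Real.exp (-2 * Real.pi * t.im)) ^ m := by
            rw [mul_pow, ← Real.exp_nat_mul]; ring_nf
        _ ≤ _ := by gcongr
    rw [norm_mul, norm_inv, norm_pow]
    have h5 : 0 < ‖DD t‖ ^ m := pow_pos (norm_pos_iff.mpr (DD_ne_zero t)) m
    rw [inv_mul_le_iff₀ h5]
    calc ‖φ t a b‖ ≤ |C| * Real.exp (-2 * Real.pi * m * t.im) :=
          h2.trans (mul_le_mul_of_nonneg_right (le_abs_self C) (Real.exp_pos _).le)
      _ = (1 / 2) ^ m * Real.exp (-2 * Real.pi * m * t.im) * (2 ^ m * |C|) := by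
          rw [one_div, inv_pow]; field_simp
      _ ≤ _ := by gcongr

end FourierJacobi

section Sigma

/-- The factors of the product expansion of the sigma function. -/
def sgTerm (t b : ℂ) (n : ℕ) : ℂ :=
  ee ((n + 1 : ℕ) * t) * (2 - ee b - ee (-b)) / (1 - ee ((n + 1 : ℕ) * t)) ^ 2

/-- The infinite product in the sigma function. -/
def sgProd (t b : ℂ) : ℂ := ∏' n, (1 + sgTerm t b n)

/-- The normalised odd theta function, with simple zeros at the lattice points. -/
def sg (t b : ℂ) : ℂ := (ee (b / 2) - ee (-(b / 2))) / (2 * Real.pi * Complex.I) * sgProd t b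

theorem norm_ee_nat_mul_le {t : ℂ} {y : ℝ} (ht : y ≤ t.im) (n : ℕ) :
    ‖ee (n * t)‖ ≤ Real.exp (-2 * Real.pi * y) ^ n := by
  rw [ee_nat_mul, norm_pow, norm_ee]
  have : -2 * Real.pi * t.im ≤ -2 * Real.pi * y := by nlinarith [Real.pi_pos]
  gcongr

theorem exp_neg_lt_one {y : ℝ} (hy : 0 < y) : Real.exp (-2 * Real.pi * y) < 1 := by
  rw [Real.exp_lt_one_iff]; nlinarith [Real.pi_pos]

theorem ee_nat_succ_ne_one {t : ℂ} (ht : 0 < t.im) (n : ℕ) : 1 - ee ((n + 1 : ℕ) * t) ≠ 0 := by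
  intro h
  have h1 := norm_ee_nat_mul_le (le_refl t.im) (n + 1)
  have h2 : Real.exp (-2 * Real.pi * t.im) ^ (n + 1) < 1 :=
    pow_lt_one₀ (Real.exp_pos _).le (exp_neg_lt_one ht) n.succ_ne_zero
  rw [← sub_eq_zero.mp h, norm_one] at h1
  linarith

/-- A summable bound for the factors. -/
def sgBound (y R : ℝ) (n : ℕ) : ℝ :=
  (2 + 2 * Real.exp (2 * Real.pi * R)) / (1 - Real.exp (-2 * Real.pi * y)) ^ 2 *
    Real.exp (-2 * Real.pi * y) ^ n

theorem norm_sgTerm_le_mul {t b : ℂ} {y R : ℝ} (hy : 0 < y) (ht : y ≤ t.im) (hb : |b.im| ≤ R)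
    (n : ℕ) : ‖sgTerm t b n‖ ≤ Real.exp (-2 * Real.pi * t.im) * sgBound y R n := by
  have h1 : ‖ee ((n + 1 : ℕ) * t)‖ ≤
      Real.exp (-2 * Real.pi * y) ^ n * Real.exp (-2 * Real.pi * t.im) := by
    rw [Nat.cast_add_one, add_mul, one_mul, ee_add, norm_mul, norm_ee t]
    exact mul_le_mul_of_nonneg_right (norm_ee_nat_mul_le ht n) (Real.exp_pos _).le
  have h1' := norm_ee_nat_mul_le ht (n + 1)
  have hr := exp_neg_lt_one hy
  set r := Real.exp (-2 * Real.pi * y) with hr'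
  have hr0 : 0 < r := Real.exp_pos _
  have h2 : r ^ (n + 1) ≤ r := pow_le_of_le_one hr0.le hr.le n.succ_ne_zero
  have h3 : 1 - r ≤ ‖1 - ee ((n + 1 : ℕ) * t)‖ := by
    have := norm_sub_norm_le (1 : ℂ) (ee ((n + 1 : ℕ) * t))
    rw [norm_one] at this; linarith
  have h4 : ‖2 - ee b - ee (-b)‖ ≤ 2 + 2 * Real.exp (2 * Real.pi * R) := by
    rw [abs_le] at hb
    have e1 : ‖ee b‖ ≤ Real.exp (2 * Real.pi * R) := by
      rw [norm_ee, Real.exp_le_exp]; nlinarith [Real.pi_pos]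
    have e2 : ‖ee (-b)‖ ≤ Real.exp (2 * Real.pi * R) := by
      rw [norm_ee, Real.exp_le_exp, Complex.neg_im]; nlinarith [Real.pi_pos]
    have e3 := norm_sub_le (2 - ee b) (ee (-b))
    have e4 := norm_sub_le 2 (ee b)
    rw [Complex.norm_ofNat] at e4
    linarith
  rw [sgTerm, sgBound, norm_div, norm_mul, norm_pow, ← hr', div_mul_eq_mul_div, mul_div_assoc',
    show ∀ x y z : ℝ, x * (y * z) = z * x * y from fun x y z => by ring]
  have : 0 < 1 - r := by linarith
  gcongr

theorem sgBound_nonneg (y R : ℝ) (n : ℕ) : 0 ≤ sgBound y R n := by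
  unfold sgBound; positivity

theorem norm_sgTerm_le {t b : ℂ} {y R : ℝ} (hy : 0 < y) (ht : y ≤ t.im) (hb : |b.im| ≤ R) (n : ℕ) :
    ‖sgTerm t b n‖ ≤ sgBound y R n :=
  (norm_sgTerm_le_mul hy ht hb n).trans (mul_le_of_le_one_left (sgBound_nonneg y R n)
    (exp_neg_lt_one (hy.trans_le ht)).le)

theorem summable_sgBound {y : ℝ} (hy : 0 < y) (R : ℝ) : Summable (sgBound y R) :=
  (summable_geometric_of_lt_one (Real.exp_pos _).le (exp_neg_lt_one hy)).mul_left _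

theorem differentiableAt_sgTerm {t : ℂ} (ht : 0 < t.im) (b : ℂ) (n : ℕ) :
    DifferentiableAt ℂ (fun p : ℂ × ℂ => sgTerm p.1 p.2 n) (t, b) := by
  have h1 : Differentiable ℂ fun p : ℂ × ℂ => ee ((n + 1 : ℕ) * p.1) :=
    differentiable_ee.comp (by fun_prop)
  have h2 : Differentiable ℂ fun p : ℂ × ℂ => ee p.2 := differentiable_ee.comp (by fun_prop)
  have h3 : Differentiable ℂ fun p : ℂ × ℂ => ee (-p.2) := differentiable_ee.comp (by fun_prop)
  simp only [sgTerm, div_eq_mul_inv]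
  exact ((h1 _).fun_mul ((h2.const_sub 2).sub h3 _)).fun_mul
    ((((h1 _).const_sub 1).fun_pow 2).fun_inv (pow_ne_zero 2 (ee_nat_succ_ne_one ht n)))

theorem summable_norm_sgTerm {t : ℂ} (ht : 0 < t.im) (b : ℂ) : Summable fun n => ‖sgTerm t b n‖ :=
  (summable_sgBound ht |b.im|).of_nonneg_of_le (fun _ => norm_nonneg _)
    fun n => norm_sgTerm_le ht le_rfl le_rfl n

theorem tendsto_sgProd {t : ℂ} (ht : 0 < t.im) (b : ℂ) :
    Tendsto (fun N => ∏ n ∈ Finset.range N, (1 + sgTerm t b n)) atTop (𝓝 (sgProd t b)) :=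
  (multipliable_one_add_of_summable (summable_norm_sgTerm ht b)).hasProd.tendsto_prod_nat

theorem norm_sgProd_sub_one_le {t b : ℂ} {y R : ℝ} (hy : 0 < y) (ht : y ≤ t.im) (hb : |b.im| ≤ R) :
    ‖sgProd t b - 1‖ ≤ Real.exp (Real.exp (-2 * Real.pi * t.im) * ∑' n, sgBound y R n) - 1 := by
  refine le_of_tendsto ((tendsto_sgProd (hy.trans_le ht) b).sub_const 1).norm
    (Eventually.of_forall fun N => ?_)
  refine ((Finset.range N).norm_prod_one_add_sub_one_le (sgTerm t b)).trans
    (sub_le_sub_right (Real.exp_le_exp.mpr ?_) 1)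
  refine (Finset.sum_le_sum fun n _ => norm_sgTerm_le_mul hy ht hb n).trans ?_
  rw [← Finset.mul_sum]
  gcongr
  exact (summable_sgBound hy R).sum_le_tsum _ fun n _ => sgBound_nonneg y R n

theorem differentiableAt_sgProd {t : ℂ} (ht : 0 < t.im) (b : ℂ) :
    DifferentiableAt ℂ (fun p : ℂ × ℂ => sgProd p.1 p.2) (t, b) := by
  have hball : ∀ p ∈ Metric.closedBall ((t, b) : ℂ × ℂ) (t.im / 2),
      t.im / 2 ≤ p.1.im ∧ |p.2.im| ≤ |b.im| + t.im := by
    rintro ⟨t', b'⟩ hp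
    rw [mem_closedBall_iff_norm, Prod.mk_sub_mk, Prod.norm_mk, max_le_iff] at hp
    obtain ⟨h1, h2⟩ := hp
    replace h1 := abs_le.mp ((Complex.abs_im_le_norm _).trans h1)
    replace h2 := abs_le.mp ((Complex.abs_im_le_norm _).trans h2)
    simp only [Complex.sub_im] at h1 h2
    have e1 := abs_le.mp (le_refl |b.im|)
    refine ⟨by linarith, abs_le.mpr ⟨?_, ?_⟩⟩ <;> simp only <;> linarith
  have hpos : 0 < t.im / 2 := by positivity
  have h1 := (Summable.hasProdUniformlyOn_nat_one_add (isCompact_closedBall ((t,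
      b) : ℂ × ℂ) (t.im / 2))
    (f := fun n p => sgTerm p.1 p.2 n) (summable_sgBound hpos (|b.im| + t.im))
    (Eventually.of_forall fun n p hp => norm_sgTerm_le hpos (hball p hp).1 (hball p hp).2 n)
    (fun n p hp => (differentiableAt_sgTerm (hpos.trans_le (hball p hp).1)
      p.2 n).continuousAt.continuousWithinAt)).tendstoUniformlyOn_finsetRange
  refine differentiableAt_of_tendstoUniformlyOn_ball (l := atTop) hpos
    (h1.mono Metric.ball_subset_closedBall) (Eventually.of_forall fun N p hp => ?_)
  have hp' := hpos.trans_le (hball p (Metric.ball_subset_closedBall hp)).1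
  induction N with
  | zero => simp
  | succ N ih =>
    simp only [Finset.prod_range_succ]
    exact ih.fun_mul ((differentiableAt_sgTerm hp' p.2 N).const_add 1)

theorem differentiableAt_sg {t : ℂ} (ht : 0 < t.im) (b : ℂ) :
    DifferentiableAt ℂ (fun p : ℂ × ℂ => sg p.1 p.2) (t, b) := by
  have h2 : Differentiable ℂ fun p : ℂ × ℂ => ee (p.2 / 2) := differentiable_ee.comp (by fun_prop)
  have h3 : Differentiable ℂ fun p : ℂ × ℂ => ee (-(p.2 / 2)) :=
    differentiable_ee.comp (by fun_prop)
  simp only [sg, div_eq_mul_inv _ (2 * (Real.pi : ℂ) * Complex.I)]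
  exact (((h2 _).fun_sub (h3 _)).mul_const _).fun_mul (differentiableAt_sgProd ht b)

theorem sgTerm_neg (t b : ℂ) : sgTerm t (-b) = sgTerm t b := by
  ext n; rw [sgTerm, sgTerm, neg_neg, sub_right_comm]

theorem sg_neg (t b : ℂ) : sg t (-b) = -sg t b := by
  rw [sg, sg, sgProd, sgTerm_neg, sgProd, neg_div, neg_neg]; ring

theorem sg_T (t b : ℂ) : sg (t + 1) b = sg t b := by
  have : ∀ n, sgTerm (t + 1) b n = sgTerm t b n := fun n => by
    rw [sgTerm, sgTerm, mul_add, mul_one, ee_add, ee_natCast, mul_one]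
  simp only [sg, sgProd, this]

theorem sg_add_one (t b : ℂ) : sg t (b + 1) = -sg t b := by
  have : ∀ n, sgTerm t (b + 1) n = sgTerm t b n := fun n => by
    rw [sgTerm, sgTerm, neg_add, ee_add, ee_add, ee_neg 1, ee_one]; simp
  simp only [sg, sgProd, this]
  rw [add_div, ee_add, ee_half, neg_add, ee_add, ee_neg (1 / 2), ee_half]; ring

theorem one_add_sgTerm {t : ℂ} (ht : 0 < t.im) (b : ℂ) (n : ℕ) : 1 + sgTerm t b n =
    (1 - ee ((n + 1 : ℕ) * t) * ee b) * (1 - ee ((n + 1 : ℕ) * t) * ee (-b)) /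
      (1 - ee ((n + 1 : ℕ) * t)) ^ 2 := by
  have := ee_nat_succ_ne_one ht n
  rw [sgTerm]
  have h2 : ee b * ee (-b) = 1 := by rw [← ee_add, add_neg_cancel, ee_zero]
  field_simp
  linear_combination (-(ee ((n + 1 : ℕ) * t)) ^ 2) * h2

theorem sgProd_add {t : ℂ} (ht : 0 < t.im) (b : ℂ) :
    sgProd t (b + t) * (1 - ee t * ee b) = sgProd t b * (1 - ee (-b)) := by
  have key : ∀ N : ℕ, (∏ n ∈ Finset.range N, (1 + sgTerm t (b + t) n)) *
      ((1 - ee t * ee b) * (1 - ee (N * t) * ee (-b))) =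
      (∏ n ∈ Finset.range N, (1 + sgTerm t b n)) *
        ((1 - ee (N * t) * (ee t * ee b)) * (1 - ee (-b))) := by
    intro N
    induction N with
    | zero => simp [ee_zero]
    | succ N ih =>
      rw [Finset.prod_range_succ, Finset.prod_range_succ, one_add_sgTerm ht, one_add_sgTerm ht]
      have h1 : ee ((N + 1 : ℕ) * t) = ee (N * t) * ee t := by
        rw [← ee_add]; congr 1; push_cast; ring
      have h2 : ee (-(b + t)) = ee (-b) * ee (-t) := by rw [neg_add, ee_add]
      have h3 : ee t * ee (-t) = 1 := by rw [← ee_add, add_neg_cancel, ee_zero]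
      have h4 : ee (N * t) * ee t * (ee (-b) * ee (-t)) = ee (N * t) * ee (-b) := by
        linear_combination ee (N * t) * ee (-b) * h3
      rw [ee_add b t, h2, h1, h4]
      linear_combination (1 - ee (N * t) * ee t * ee (-b)) * (1 - ee (N * t) * ee t * (ee b * ee t)) /
        (1 - ee (N * t) * ee t) ^ 2 * ih
  have h0 : Tendsto (fun N : ℕ => ee (N * t)) atTop (𝓝 0) := by
    simp only [ee_nat_mul]
    refine tendsto_pow_atTop_nhds_zero_of_norm_lt_one ?_
    rw [norm_ee]; exact exp_neg_lt_one ht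
  have hl := (tendsto_sgProd ht (b + t)).mul
    (((h0.mul_const (ee (-b))).const_sub 1).const_mul (1 - ee t * ee b))
  have hr := (tendsto_sgProd ht b).mul
    (((h0.mul_const (ee t * ee b)).const_sub 1).mul_const (1 - ee (-b)))
  simp only [zero_mul, sub_zero, mul_one, one_mul] at hl hr
  exact tendsto_nhds_unique (hl.congr key) hr

theorem sg_add {t : ℂ} (ht : 0 < t.im) (b : ℂ) :
    sg t (b + t) = -ee (-(t / 2) - b) * sg t b := by
  have h := sgProd_add ht b
  rw [sg, sg]
  have e1 : ee ((b + t) / 2) = ee (b / 2) * ee (t / 2) := by rw [← ee_add]; ring_nf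
  have e2 : ee (-((b + t) / 2)) = ee (-(b / 2)) * ee (-(t / 2)) := by rw [← ee_add]; ring_nf
  have e3 : ee (-(t / 2) - b) = ee (-(t / 2)) * ee (-(b / 2)) ^ 2 := by
    rw [sq, ← ee_add, ← ee_add]; ring_nf
  have e4 : ee t = ee (t / 2) ^ 2 := by rw [sq, ← ee_add]; ring_nf
  have e5 : ee b = ee (b / 2) ^ 2 := by rw [sq, ← ee_add]; ring_nf
  have e6 : ee (-b) = ee (-(b / 2)) ^ 2 := by rw [sq, ← ee_add]; ring_nf
  have e7 : ee (b / 2) * ee (-(b / 2)) = 1 := by rw [← ee_add, add_neg_cancel, ee_zero]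
  have e8 : ee (t / 2) * ee (-(t / 2)) = 1 := by rw [← ee_add, add_neg_cancel, ee_zero]
  rw [e1, e2, e3]
  rw [e4, e5, e6] at h
  generalize ee (b / 2) = x at *
  generalize ee (t / 2) = u at *
  generalize ee (-(b / 2)) = x' at *
  generalize ee (-(t / 2)) = u' at *
  have e9 : x * u - x' * u' = -(x' * u') * (1 - u ^ 2 * x ^ 2) := by
    linear_combination (-(u * x)) * e7 * (u * u') - u * x * e8
  have e10 : u' * x' ^ 2 * (x - x') = u' * x' * (1 - x' ^ 2) := by
    linear_combination u' * x' * e7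
  rw [e9, show -(u' * x' ^ 2) * ((x - x') / (2 * Real.pi * Complex.I) * sgProd t b) =
    -(u' * x' ^ 2 * (x - x')) / (2 * Real.pi * Complex.I) * sgProd t b by ring, e10]
  linear_combination (-x' * u' / (2 * Real.pi * Complex.I)) * h

end Sigma

section Sigma

theorem hasDerivAt_ee (x : ℂ) : HasDerivAt ee (2 * Real.pi * Complex.I * ee x) x := by
  exact ((hasDerivAt_id x).const_mul (2 * Real.pi * Complex.I : ℂ)).cexp.congr_deriv
    (by simp [ee, mul_comm])

theorem HasDerivAt.ee_comp {f : ℂ → ℂ} {f' x : ℂ} (hf : HasDerivAt f f' x) :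
    HasDerivAt (fun y => ee (f y)) (2 * Real.pi * Complex.I * f' * ee (f x)) x := by
  exact ((hasDerivAt_ee (f x)).comp x hf).congr_deriv (by ring)

theorem ee_eq_one_iff {x : ℂ} : ee x = 1 ↔ ∃ n : ℤ, x = n := by
  rw [ee, Complex.exp_eq_one_iff]
  refine exists_congr fun n => ?_
  rw [mul_comm (n : ℂ), mul_right_inj' Complex.two_pi_I_ne_zero]

theorem differentiable_sg {t : ℂ} (ht : 0 < t.im) : Differentiable ℂ (sg t) := fun b =>
  DifferentiableAt.comp (g := fun p : ℂ × ℂ => sg p.1 p.2) (f := fun b => (t, b)) b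
    (differentiableAt_sg ht b) (by fun_prop)

theorem hasDerivAt_sg_aux {t : ℂ} (ht : 0 < t.im) {b : ℂ} (hb : ee (b / 2) - ee (-(b / 2)) = 0) :
    HasDerivAt (sg t) (ee (b / 2) * sgProd t b) b := by
  have h0 : HasDerivAt (fun b : ℂ => b / 2) (1 / 2) b := (hasDerivAt_id b).div_const 2
  have h1 := h0.ee_comp
  have h2 := h0.fun_neg.ee_comp
  have h3 : HasDerivAt (sgProd t) (deriv (sgProd t) b) b :=
    (DifferentiableAt.comp (g := fun p : ℂ × ℂ => sgProd p.1 p.2) (f := fun b => (t, b)) b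
      (differentiableAt_sgProd ht b) (by fun_prop)).hasDerivAt
  refine (((h1.sub h2).div_const (2 * Real.pi * Complex.I)).mul h3).congr_deriv ?_
  have h4 : ee (-(b / 2)) = ee (b / 2) := (sub_eq_zero.mp hb).symm
  have := Complex.two_pi_I_ne_zero
  simp only [Pi.sub_apply, h4]
  field_simp
  ring

theorem sgProd_zero (t : ℂ) : sgProd t 0 = 1 := by
  have : ∀ n, sgTerm t 0 n = 0 := fun n => by rw [sgTerm, neg_zero, ee_zero]; norm_num
  simp [sgProd, this]

theorem sg_zero (t : ℂ) : sg t 0 = 0 := by simp [sg]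

theorem hasDerivAt_sg_zero {t : ℂ} (ht : 0 < t.im) : HasDerivAt (sg t) 1 0 := by
  have := hasDerivAt_sg_aux ht (b := 0) (by simp)
  simpa [sgProd_zero, ee_zero] using this

theorem sgProd_ne_zero {t b : ℂ} (hb : |b.im| < t.im) : sgProd t b ≠ 0 := by
  have ht : 0 < t.im := (abs_nonneg _).trans_lt hb
  refine tprod_one_add_ne_zero_of_summable (fun n => ?_) (summable_norm_sgTerm ht b)
  have key : ∀ b : ℂ, |b.im| < t.im → 1 - ee ((n + 1 : ℕ) * t) * ee b ≠ 0 := by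
    intro b hb h
    have h1 : ‖ee ((n + 1 : ℕ) * t) * ee b‖ = 1 := by rw [← sub_eq_zero.mp h, norm_one]
    rw [← ee_add, norm_ee, Real.exp_eq_one_iff] at h1
    have h2 : (n + 1 : ℝ) * t.im + b.im = 0 := by
      have : -2 * Real.pi ≠ 0 := by simp [Real.pi_ne_zero]
      simpa [Real.pi_ne_zero] using h1
    have := abs_lt.mp hb
    have : 0 ≤ (n : ℝ) * t.im := by positivity
    linarith
  rw [one_add_sgTerm ht]
  exact div_ne_zero (mul_ne_zero (key b hb) (key (-b) (by simpa using hb)))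
    (pow_ne_zero 2 (ee_nat_succ_ne_one ht n))

theorem exists_int_abs_im_sub_lt {t : ℂ} (ht : 0 < t.im) (b : ℂ) :
    ∃ l : ℤ, 0 ≤ (b - l * t).im ∧ (b - l * t).im < t.im := by
  refine ⟨⌊b.im / t.im⌋, ?_, ?_⟩
  · have := Int.floor_le (b.im / t.im)
    rw [le_div_iff₀ ht] at this
    simp; linarith
  · have := Int.lt_floor_add_one (b.im / t.im)
    rw [div_lt_iff₀ ht] at this
    simp; linarith

theorem add_int_mul_of_add {X : Type*} {f : ℂ → X} {t : ℂ} (h : ∀ b,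
    f (b + t) = f b) (l : ℤ) (b : ℂ) :
    f (b + l * t) = f b := by
  induction l using Int.induction_on with
  | zero => simp
  | succ n ih => rw [← ih, ← h (b + (n : ℤ) * t)]; congr 1; push_cast; ring
  | pred n ih => rw [← ih, ← h]; congr 1; push_cast; ring

theorem sg_eq_zero {t : ℂ} (ht : 0 < t.im) {b : ℂ} (hb : sg t b = 0) :
    (∃ l n : ℤ, b = l * t + n) ∧ deriv (sg t) b ≠ 0 := by
  set P : ℂ → Prop := fun b => sg t b = 0 → (∃ l n : ℤ, b = l * t + n) ∧ deriv (sg t) b ≠ 0 with hP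
  have hPt : ∀ b, P (b + t) = P b := by
    intro b
    have h1 : HasDerivAt (fun b => ee (-(t / 2) - b)) _ b := ((hasDerivAt_id b).const_sub _).ee_comp
    have h2 := (h1.neg.mul (differentiable_sg ht b).hasDerivAt)
    have h3 : HasDerivAt (fun b => sg t (b + t)) (deriv (sg t) (b + t)) b :=
      HasDerivAt.comp_add_const b t (differentiable_sg ht _).hasDerivAt
    have h4 : HasDerivAt (fun b => sg t (b + t)) _ b :=
      h2.congr_of_eventuallyEq (Eventually.of_forall fun b => sg_add ht b)
    have h5 := h3.unique h4
    have hne := ee_ne_zero (-(t / 2) - b)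
    simp only [hP, sg_add ht, eq_iff_iff]
    have h6 : -ee (-(t / 2) - b) * sg t b = 0 ↔ sg t b = 0 := by simp [hne]
    rw [h6]
    refine imp_congr_right fun h0 => and_congr ?_ ?_
    · constructor
      · rintro ⟨l, n, h⟩; exact ⟨l - 1, n, by push_cast; linear_combination h⟩
      · rintro ⟨l, n, h⟩; exact ⟨l + 1, n, by push_cast; linear_combination h⟩
    · rw [h5, h0]; simp [hne]
  obtain ⟨l, h1, h2⟩ := exists_int_abs_im_sub_lt ht b
  have h3 := add_int_mul_of_add hPt l (b - l * t)
  rw [sub_add_cancel] at h3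
  suffices P (b - l * t) by rw [← h3] at this; exact this hb
  intro h0
  have hpr := sgProd_ne_zero (abs_lt.mpr ⟨by linarith, h2⟩ : |(b - l * t).im| < t.im)
  rw [sg, mul_eq_zero, or_iff_left hpr, div_eq_zero_iff, or_iff_left Complex.two_pi_I_ne_zero] at h0
  refine ⟨⟨0, ?_⟩, ?_⟩
  · have h4 : ee (b - l * t) = 1 := by
      rw [show b - l * t = (b - l * t) / 2 + (b - l * t) / 2 by ring, ee_add]
      nth_rw 1 [sub_eq_zero.mp h0]
      rw [← ee_add, neg_add_cancel, ee_zero]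
    simpa using ee_eq_one_iff.mp h4
  · rw [(hasDerivAt_sg_aux ht h0).deriv]
    exact mul_ne_zero (ee_ne_zero _) hpr

theorem eventually_sg_ne_zero {t : ℂ} (ht : 0 < t.im) (b : ℂ) : ∀ᶠ x in 𝓝[≠] b, sg t x ≠ 0 := by
  by_cases h : sg t b = 0
  · rw [← h]
    exact ((differentiable_sg ht b).hasDerivAt.eventually_ne (sg_eq_zero ht h).2)
  · exact ((differentiable_sg ht b).continuousAt.eventually_ne h).filter_mono nhdsWithin_le_nhds

theorem eq_of_sg_mul_eq {t : ℂ} (ht : 0 < t.im) {f g : ℂ → ℂ} {b c : ℂ} (hf : ContinuousAt f b)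
    (hg : ContinuousAt g b) (h : ∀ x, sg t (x + c) * f x = sg t (x + c) * g x) : f b = g b := by
  refine tendsto_nhds_unique_of_eventuallyEq (l := 𝓝[≠] b) (hf.mono_left nhdsWithin_le_nhds)
    (hg.mono_left nhdsWithin_le_nhds) ?_
  have h1 : Tendsto (fun x => x + c) (𝓝[≠] b) (𝓝[≠] (b + c)) := by
    refine tendsto_nhdsWithin_iff.mpr ⟨(Continuous.tendsto (by fun_prop) b).mono_left
      nhdsWithin_le_nhds, ?_⟩
    filter_upwards [self_mem_nhdsWithin] with x hx
    simpa using hx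
  filter_upwards [h1.eventually (eventually_sg_ne_zero ht (b + c))] with x hx
  exact mul_left_cancel₀ hx (h x)

theorem eq_of_lattice_periodic {f : ℂ → ℂ} {t : ℂ} (ht : 0 < t.im) (hf : Differentiable ℂ f)
    (h1 : ∀ b, ‖f (b + 1)‖ = ‖f b‖) (h2 : ∀ b, ‖f (b + t)‖ = ‖f b‖) (x y : ℂ) : f x = f y := by
  obtain ⟨C, hC⟩ := exists_bound_of_periodic (f := f) (y₁ := 0) (y₂ := t.im)
    (fun z _ _ => (hf z).continuousAt) (fun z _ _ => h1 z)
  refine hf.apply_eq_apply_of_bounded (isBounded_iff_forall_norm_le.mpr ⟨C, ?_⟩) x y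
  rintro _ ⟨b, rfl⟩
  obtain ⟨l, h3, h4⟩ := exists_int_abs_im_sub_lt ht b
  have h5 := add_int_mul_of_add (f := fun b => ‖f b‖) h2 l (b - l * t)
  simp only [sub_add_cancel] at h5
  rw [h5]
  exact hC _ h3 h4.le

theorem sg_int_mul_add {t : ℂ} (ht : 0 < t.im) {f : ℂ → ℂ} (h0 : f 0 = 0)
    (h1 : ∀ b, f (b + 1) = 0 ↔ f b = 0) (h2 : ∀ b, f (b + t) = 0 ↔ f b = 0) {b : ℂ}
    (hb : sg t b = 0) : f b = 0 := by
  obtain ⟨⟨l, n, rfl⟩, -⟩ := sg_eq_zero ht hb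
  have e1 := add_int_mul_of_add (f := fun b => f b = 0) (t := 1) (fun b => propext (h1 b)) n (l * t)
  have e2 := add_int_mul_of_add (f := fun b => f b = 0) (fun b => propext (h2 b)) l 0
  rw [mul_one] at e1
  rw [e1, ← zero_add ((l : ℂ) * t), e2]
  exact h0

theorem sg_sub {t : ℂ} (ht : 0 < t.im) (b : ℂ) : sg t (b - t) = -ee (b - t / 2) * sg t b := by
  have := sg_add ht (b - t)
  rw [sub_add_cancel] at this
  rw [this, ← mul_assoc, neg_mul_neg, ← ee_add, show b - t / 2 + (-(t / 2) - (b - t)) = 0 by ring,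
    ee_zero, one_mul]

theorem sg_S {t : ℂ} (ht : 0 < t.im) (b : ℂ) :
    sg (-1 / t) (b / t) = t⁻¹ * ee (b ^ 2 / (2 * t)) * sg t b := by
  have ht0 := ne_zero_of_im_pos ht
  have ht' := im_neg_one_div ht
  have l1 : ∀ b, sg (-1 / t) ((b + 1) / t) = -ee (b / t + 1 / (2 * t)) * sg (-1 / t) (b / t) := by
    intro b
    rw [show (b + 1) / t = b / t - -1 / t by ring, sg_sub ht']; ring_nf
  have l2 : ∀ b, sg (-1 / t) ((b + t) / t) = -sg (-1 / t) (b / t) := by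
    intro b
    rw [add_div, div_self ht0, sg_add_one]
  obtain ⟨Q, hQ, hQ'⟩ := exists_div_of_simple_zeros (E := ℂ) (f := fun s b => sg (-1 / t) (b / t))
    (g := fun s b => sg t b) (U := Set.univ) isOpen_univ
    (fun p _ => DifferentiableAt.comp (g := sg (-1 / t)) (f := fun p : ℂ × ℂ => p.2 / t) p
      (differentiable_sg ht' _) (by fun_prop))
    (fun p _ => DifferentiableAt.comp (g := sg t) (f := fun p : ℂ × ℂ => p.2) p
      (differentiable_sg ht _) (by fun_prop))
    (fun p _ h => ⟨sg_int_mul_add (f := fun b => sg (-1 / t) (b / t)) ht (by simp [sg_zero])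
      (fun b => by simp [l1, ee_ne_zero]) (fun b => by simp [l2]) h, (sg_eq_zero ht h).2⟩)
  set q : ℂ → ℂ := fun b => Q 0 b * ee (-(b ^ 2 / (2 * t))) with hq
  have hqd : Differentiable ℂ q := fun b =>
    (DifferentiableAt.comp (g := fun p : ℂ × ℂ => Q p.1 p.2) (f := fun b => ((0 : ℂ), b)) b
      (hQ (0, b) trivial) (by fun_prop)).mul (differentiable_ee.comp (by fun_prop) b)
  have hq' : ∀ b, sg (-1 / t) (b / t) = sg t b * q b * ee (b ^ 2 / (2 * t)) := by
    intro b
    rw [hQ' (0, b) trivial, hq]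
    have : ee (-(b ^ 2 / (2 * t))) * ee (b ^ 2 / (2 * t)) = 1 := by
      rw [← ee_add, neg_add_cancel, ee_zero]
    linear_combination (-sg t b * Q 0 b) * this
  clear_value q
  have hqc := eq_of_lattice_periodic ht hqd
    (fun b => congrArg norm (eq_of_sg_mul_eq ht (f := fun b => q (b + 1)) (c := 0) (by
      exact (hqd.comp (differentiable_id.add_const 1)).continuous.continuousAt) hqd.continuous.continuousAt
      (fun x => by
        have h1 := hq' (x + 1)
        rw [l1, hq' x, sg_add_one,
            show (x + 1) ^ 2 / (2 * t) = x ^ 2 / (2 * t) + (x / t + 1 / (2 * t)) by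
          field_simp; ring, ee_add (x ^ 2 / (2 * t))] at h1
        have h2 := mul_ne_zero (ee_ne_zero (x ^ 2 / (2 * t))) (ee_ne_zero (x / t + 1 / (2 * t)))
        rw [ee_add (x / t)] at h1 h2
        rw [add_zero]
        refine mul_right_cancel₀ h2 ?_
        linear_combination h1)))
    (fun b => congrArg norm (eq_of_sg_mul_eq ht (f := fun b => q (b + t)) (c := 0) (by
      exact (hqd.comp (differentiable_id.add_const t)).continuous.continuousAt) hqd.continuous.continuousAt
      (fun x => by
        have h1 := hq' (x + t)
        rw [l2, hq' x, sg_add ht, show (x + t) ^ 2 / (2 * t) = x ^ 2 / (2 * t) + (x + t / 2) by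
          field_simp; ring, ee_add, show -(t / 2) - x = -(x + t / 2) by ring, ee_neg] at h1
        have h2 := ee_ne_zero (x ^ 2 / (2 * t))
        have h3 := ee_ne_zero (x + t / 2)
        rw [add_zero]
        refine mul_right_cancel₀ h2 ?_
        have h4 := inv_mul_cancel₀ h3
        linear_combination h1 - sg t x * q (x + t) * ee (x ^ 2 / (2 * t)) * h4)))
  have hq0 : q 0 = t⁻¹ := by
    have d1 : HasDerivAt (fun b => sg (-1 / t) (b / t)) (1 * t⁻¹) 0 := by
      have e1 : HasDerivAt (fun b : ℂ => b / t) t⁻¹ 0 := by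
        simpa using (hasDerivAt_id (0 : ℂ)).div_const t
      have e2 : HasDerivAt (sg (-1 / t)) 1 (0 / t) := by
        rw [zero_div]; exact hasDerivAt_sg_zero ht'
      exact e2.comp 0 e1
    have d2 : HasDerivAt (fun b => sg t b * (q 0 * ee (b ^ 2 / (2 * t)))) _ 0 :=
      (hasDerivAt_sg_zero ht).mul
        ((differentiable_ee.comp (by fun_prop : Differentiable ℂ fun b : ℂ => b ^ 2 / (2 * t))
          0).hasDerivAt.const_mul (q 0))
    have d3 := d1.unique (d2.congr_of_eventuallyEq (Eventually.of_forall fun b => by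
      simp only; rw [hq' b, hqc b 0, mul_assoc]))
    simp [sg_zero, ee_zero] at d3
    exact d3.symm
  rw [hq', hqc b 0, hq0]; ring

end Sigma

section JacobiForms

/-- Joint holomorphy of a function of `(t, a, b)` for `t` in the upper half-plane. -/
def Holo3 (Φ : ℂ → ℂ → ℂ → ℂ) : Prop := ∀ t a b : ℂ, 0 < t.im →
  DifferentiableAt ℂ (fun p : ℂ × ℂ × ℂ => Φ p.1 p.2.1 p.2.2) (t, a, b)

/-- Boundedness in `(a, b)` on compacta as `t` tends to `i∞`. -/
def BddW (Φ : ℂ → ℂ → ℂ → ℂ) : Prop := ∀ R : ℝ, ∃ C Y : ℝ, ∀ t a b : ℂ, 0 < t.im → Y ≤ t.im →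
  ‖a‖ ≤ R → ‖b‖ ≤ R → ‖Φ t a b‖ ≤ C

variable {k k' : ℤ} {n n' j j' : ℕ} {Φ Ψ : ℂ → ℂ → ℂ → ℂ}

theorem Holo3.comp {E : Type*} [NormedAddCommGroup E] [NormedSpace ℂ E] (h : Holo3 Φ)
    {f₁ f₂ f₃ : E → ℂ} {x : E} (ht : 0 < (f₁ x).im) (h₁ : DifferentiableAt ℂ f₁ x)
    (h₂ : DifferentiableAt ℂ f₂ x) (h₃ : DifferentiableAt ℂ f₃ x) :
    DifferentiableAt ℂ (fun x => Φ (f₁ x) (f₂ x) (f₃ x)) x :=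
  DifferentiableAt.comp (g := fun p : ℂ × ℂ × ℂ => Φ p.1 p.2.1 p.2.2)
    (f := fun x => (f₁ x, f₂ x, f₃ x)) x (h _ _ _ ht) (h₁.prodMk (h₂.prodMk h₃))

theorem Holo3.congr (h : Holo3 Φ) (he : ∀ t a b : ℂ, 0 < t.im → Ψ t a b = Φ t a b) : Holo3 Ψ := by
  intro t a b ht
  refine (h t a b ht).congr_of_eventuallyEq ?_
  have : IsOpen {p : ℂ × ℂ × ℂ | 0 < p.1.im} :=
    isOpen_lt continuous_const (Complex.continuous_im.comp continuous_fst)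
  filter_upwards [this.mem_nhds ht] with p hp using he _ _ _ hp

theorem WJ.holo3 (h : WJ k n j Φ) : Holo3 Φ := h.holo

theorem BddW.add (h : BddW Φ) (h' : BddW Ψ) : BddW fun t a b => Φ t a b + Ψ t a b := by
  intro R
  obtain ⟨C, Y, hC⟩ := h R
  obtain ⟨C', Y', hC'⟩ := h' R
  exact ⟨C + C', max Y Y', fun t a b ht hY ha hb => (norm_add_le _ _).trans
    (add_le_add (hC t a b ht (le_trans (le_max_left _ _) hY) ha hb)
      (hC' t a b ht (le_trans (le_max_right _ _) hY) ha hb))⟩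

theorem BddW.mul (h : BddW Φ) (h' : BddW Ψ) : BddW fun t a b => Φ t a b * Ψ t a b := by
  intro R
  obtain ⟨C, Y, hC⟩ := h R
  obtain ⟨C', Y', hC'⟩ := h' R
  refine ⟨C * C', max Y Y', fun t a b ht hY ha hb => ?_⟩
  have h1 := hC t a b ht (le_trans (le_max_left _ _) hY) ha hb
  rw [norm_mul]
  exact mul_le_mul h1 (hC' t a b ht (le_trans (le_max_right _ _) hY) ha hb) (norm_nonneg _)
    ((norm_nonneg _).trans h1)

theorem BddW.const (c : ℂ) : BddW fun _ _ _ => c := fun _ => ⟨‖c‖, 0, fun _ _ _ _ _ _ _ => le_rfl⟩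

theorem BddW.comp (h : BddW Φ) {f g : ℂ → ℂ → ℂ}
    (hfg : ∀ R : ℝ, ∃ R' : ℝ, ∀ a b : ℂ, ‖a‖ ≤ R → ‖b‖ ≤ R → ‖f a b‖ ≤ R' ∧ ‖g a b‖ ≤ R') :
    BddW fun t a b => Φ t (f a b) (g a b) := by
  intro R
  obtain ⟨R', hR'⟩ := hfg R
  obtain ⟨C, Y, hC⟩ := h R'
  exact ⟨C, Y, fun t a b ht hY ha hb => hC _ _ _ ht hY (hR' a b ha hb).1 (hR' a b ha hb).2⟩

theorem BddW.comp_zero_left (h : BddW Φ) : BddW fun t _ b => Φ t 0 b :=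
  h.comp (f := fun _ _ => 0) (g := fun _ b => b) fun R => ⟨R, fun _ _ ha hb =>
    ⟨by simpa using (norm_nonneg _).trans ha, hb⟩⟩

theorem WJ.congr (h : WJ k n j Φ) (he : ∀ t a b : ℂ, 0 < t.im → Ψ t a b = Φ t a b) :
    WJ k n j Ψ := by
  refine ⟨h.holo3.congr he, ?_, ?_, ?_, ?_, ?_, ?_, ?_, ?_⟩
  · intro t a b ht
    rw [he _ _ _ ht, he _ _ _ (by simpa using ht), h.T _ _ _ ht]
  · intro t a b ht
    rw [he _ _ _ ht, he _ _ _ ht, h.A _ _ _ ht]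
  · intro t a b ht
    rw [he _ _ _ ht, he _ _ _ ht, h.B _ _ _ ht]
  · intro t a b ht
    rw [he _ _ _ ht, he _ _ _ ht, h.HA _ _ _ ht]
  · intro t a b ht
    rw [he _ _ _ ht, he _ _ _ ht, h.HB _ _ _ ht]
  · intro t a b ht
    rw [he _ _ _ ht, he _ _ _ (im_neg_one_div ht), h.S _ _ _ ht]
  · intro t a b ht
    rw [he _ _ _ ht, he _ _ _ ht, h.sig _ _ _ ht]
  · intro R
    obtain ⟨C, Y, hC⟩ := h.W R
    exact ⟨C, Y, fun t a b ht => by rw [he _ _ _ ht]; exact hC t a b ht⟩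

theorem WJ.add (h : WJ k n j Φ) (h' : WJ k n j Ψ) : WJ k n j fun t a b => Φ t a b + Ψ t a b := by
  refine ⟨fun t a b ht => (h.holo t a b ht).fun_add (h'.holo t a b ht), ?_, ?_, ?_, ?_, ?_, ?_, ?_,
    BddW.add h.W h'.W⟩
  · intro t a b ht
    rw [h.T _ _ _ ht, h'.T _ _ _ ht]
  · intro t a b ht
    rw [h.A _ _ _ ht, h'.A _ _ _ ht]
  · intro t a b ht
    rw [h.B _ _ _ ht, h'.B _ _ _ ht]; ring
  · intro t a b ht
    rw [h.HA _ _ _ ht, h'.HA _ _ _ ht]; ring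
  · intro t a b ht
    rw [h.HB _ _ _ ht, h'.HB _ _ _ ht]; ring
  · intro t a b ht
    rw [h.S _ _ _ ht, h'.S _ _ _ ht]; ring
  · intro t a b ht
    rw [h.sig _ _ _ ht, h'.sig _ _ _ ht]

theorem WJ.mul (h : WJ k n j Φ) (h' : WJ k' n' j' Ψ) :
    WJ (k + k') (n + n') (j + j') fun t a b => Φ t a b * Ψ t a b := by
  refine ⟨fun t a b ht => (h.holo t a b ht).fun_mul (h'.holo t a b ht), ?_, ?_, ?_, ?_, ?_, ?_, ?_,
    BddW.mul h.W h'.W⟩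
  · intro t a b ht
    rw [h.T _ _ _ ht, h'.T _ _ _ ht]
  · intro t a b ht
    rw [h.A _ _ _ ht, h'.A _ _ _ ht]
  · intro t a b ht
    rw [h.B _ _ _ ht, h'.B _ _ _ ht, show n + n' + (j + j') = (n + j) + (n' + j') by ring, pow_add]
    ring
  · intro t a b ht
    rw [h.HA _ _ _ ht, h'.HA _ _ _ ht, Nat.cast_add, add_mul, neg_add, ee_add]; ring
  · intro t a b ht
    rw [h.HB _ _ _ ht, h'.HB _ _ _ ht, show n + n' + (j + j') = (n + j) + (n' + j') by ring,
        pow_add,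
      show -(((n + n' : ℕ) : ℂ) * (t / 2 + b) + ((j + j' : ℕ) : ℂ) * (t / 2 + a + b)) =
        -(n * (t / 2 + b) + j * (t / 2 + a + b)) + -(n' * (t / 2 + b) + j' * (t / 2 + a + b)) by
        push_cast; ring, ee_add]
    ring
  · intro t a b ht
    have := ne_zero_of_im_pos ht
    rw [h.S _ _ _ ht, h'.S _ _ _ ht, zpow_add₀ this,
      show (((n + n' : ℕ) : ℂ) * b ^ 2 + ((j + j' : ℕ) : ℂ) * (a ^ 2 + (a + b) ^ 2)) / (2 * t) =
        (n * b ^ 2 + j * (a ^ 2 + (a + b) ^ 2)) / (2 * t) +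
        (n' * b ^ 2 + j' * (a ^ 2 + (a + b) ^ 2)) / (2 * t) by push_cast; ring, ee_add]
    ring
  · intro t a b ht
    rw [h.sig _ _ _ ht, h'.sig _ _ _ ht]

theorem MF.wj {f : ℂ → ℂ} (hf : MF k f) : WJ k 0 0 fun t _ _ => f t := by
  refine ⟨?_, ?_, ?_, ?_, ?_, ?_, ?_, ?_, ?_⟩
  · intro t a b ht
    exact DifferentiableAt.comp (g := f) (f := Prod.fst) (t, a,
        b) (hf.holo t ht) differentiableAt_fst
  · intro t a b ht
    exact hf.T t ht
  · intro t a b ht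
    rfl
  · intro t a b ht
    simp
  · intro t a b ht
    simp [ee_zero]
  · intro t a b ht
    simp [ee_zero]
  · intro t a b ht
    simp [ee_zero, hf.S t ht]
  · intro t a b ht
    rfl
  · intro R
    obtain ⟨C, Y, hC⟩ := hf.bdd
    exact ⟨C, Y, fun t _ _ ht hY _ _ => hC t ht hY⟩

theorem WJ.smul (h : WJ k n j Φ) (c : ℂ) : WJ k n j fun t a b => c * Φ t a b := by
  have := (MF.const c).wj.mul h
  simpa using this

theorem WJ.sub (h : WJ k n j Φ) (h' : WJ k n j Ψ) : WJ k n j fun t a b => Φ t a b - Ψ t a b :=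
  (h.add (h'.smul (-1))).congr fun t a b _ => by ring

theorem WJ.cast (h : WJ k n j Φ) (hk : k = k') (hn : n = n') (hj : j = j') : WJ k' n' j' Φ := by
  subst hk hn hj; exact h

theorem WJ.pow_one (h : WJ k n j Φ) (m : ℕ) : WJ (m * k) (m * n) (m * j) fun t a b => Φ t a b ^ m := by
  induction m with
  | zero =>
    refine ((MF.const 1).wj.cast ?_ ?_ ?_).congr fun t a b _ => pow_zero _ <;> simp
  | succ m ih =>
    refine ((ih.mul h).cast ?_ ?_ ?_).congr fun t a b _ => pow_succ _ _ <;> push_cast <;> ring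

theorem WJ.restrict (h : WJ k n j Φ) : WJ k (n + j) 0 fun t _ b => Φ t 0 b := by
  refine ⟨?_, ?_, ?_, ?_, ?_, ?_, ?_, ?_, BddW.comp_zero_left h.W⟩
  · intro t a b ht
    exact h.holo3.comp (f₁ := fun p : ℂ × ℂ × ℂ => p.1) (f₂ := fun _ => 0) (f₃ := fun p => p.2.2)
      (x := (t, a, b)) ht (by fun_prop) (by fun_prop) (by fun_prop)
  · intro t a b ht
    exact h.T _ _ _ ht
  · intro t a b ht
    rfl
  · intro t a b ht
    exact h.B _ _ _ ht
  · intro t a b ht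
    simp [ee_zero]
  · intro t a b ht
    rw [h.HB _ _ _ ht, add_zero]
    congr 3
    push_cast; ring
  · intro t a b ht
    have := h.S t 0 b ht
    rw [zero_div] at this
    rw [this]
    congr 3
    push_cast; ring
  · intro t a b ht
    rfl

theorem WJ.eq_restrict (h : WJ k n 0 Φ) {t : ℂ} (a b : ℂ) (ht : 0 < t.im) : Φ t a b = Φ t 0 b := by
  refine eq_of_lattice_periodic ht (f := fun a => Φ t a b) (fun a => ?_) (fun a => ?_) (fun a => ?_) a 0
  · exact h.holo3.comp (f₁ := fun _ => t) (f₂ := fun a => a) (f₃ := fun _ => b) ht (by fun_prop)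
      (by fun_prop) (by fun_prop)
  · rw [h.A _ _ _ ht]
  · rw [h.HA _ _ _ ht]; simp [ee_zero]

theorem WJ.eq_const (h : WJ k 0 0 Φ) {t : ℂ} (a b : ℂ) (ht : 0 < t.im) : Φ t a b = Φ t 0 0 := by
  rw [h.eq_restrict a b ht]
  refine eq_of_lattice_periodic ht (f := fun b => Φ t 0 b) (fun b => ?_) (fun b => ?_) (fun b => ?_) b 0
  · exact h.holo3.comp (f₁ := fun _ => t) (f₂ := fun _ => 0) (f₃ := fun b => b) ht (by fun_prop)
      (by fun_prop) (by fun_prop)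
  · rw [h.B _ _ _ ht]; simp
  · rw [h.HB _ _ _ ht]; simp [ee_zero]

theorem WJ.mf (h : WJ k n j Φ) : MF k fun t => Φ t 0 0 := by
  refine ⟨?_, ?_, ?_, ?_⟩
  · intro t ht
    exact h.holo3.comp (f₁ := fun t => t) (f₂ := fun _ => 0) (f₃ := fun _ => 0) ht (by fun_prop)
      (by fun_prop) (by fun_prop)
  · intro t ht
    exact h.T _ _ _ ht
  · intro t ht
    simpa [ee_zero] using h.S t 0 0 ht
  · obtain ⟨C, Y, hC⟩ := h.W 0
    exact ⟨C, Y, fun t ht hY => hC t 0 0 ht hY (by simp) (by simp)⟩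

theorem WJ.neg (h : WJ k n j Φ) {t : ℂ} (a b : ℂ) (ht : 0 < t.im) :
    Φ t (-a) (-b) = (-1) ^ k * Φ t a b := by
  have h0 := ne_zero_of_im_pos ht
  have h1 := h.S (-1 / t) (a / t) (b / t) (im_neg_one_div ht)
  rw [h.S t a b ht] at h1
  rw [show -1 / (-1 / t) = t by field_simp, show a / t / (-1 / t) = -a by field_simp,
    show b / t / (-1 / t) = -b by field_simp,
    show (n * (b / t) ^ 2 + j * ((a / t) ^ 2 + (a / t + b / t) ^ 2)) / (2 * (-1 / t)) =
      -((n * b ^ 2 + j * (a ^ 2 + (a + b) ^ 2)) / (2 * t)) by field_simp, ee_neg] at h1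
  rw [h1]
  have h2 := inv_mul_cancel₀ (ee_ne_zero ((n * b ^ 2 + j * (a ^ 2 + (a + b) ^ 2)) / (2 * t)))
  have h3 : (-1 / t) ^ k * t ^ k = (-1) ^ k := by
    rw [← mul_zpow, div_mul_cancel₀ _ h0]
  linear_combination (-1 / t) ^ k * t ^ k * Φ t a b * h2 + Φ t a b * h3

/-- Quotients of Jacobi forms are Jacobi forms as soon as they are holomorphic and bounded. -/
theorem WJ.div (h : WJ (k + k') (n + n') (j + j') Φ) (h' : WJ k' n' j' Ψ) {Q : ℂ → ℂ → ℂ → ℂ}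
    (hQ : Holo3 Q) (hW : BddW Q) (he : ∀ t a b : ℂ, 0 < t.im → Φ t a b = Ψ t a b * Q t a b)
    (h0 : ∀ t a b : ℂ, 0 < t.im → ∀ᶠ x in 𝓝[≠] (0 : ℂ), Ψ t (a + x) (b + x) ≠ 0) : WJ k n j Q := by
  have key : ∀ {t : ℂ} (_ : 0 < t.im) {f g : ℂ → ℂ → ℂ},
      (∀ a b, DifferentiableAt ℂ (fun x => f (a + x) (b + x)) 0) →
      (∀ a b, DifferentiableAt ℂ (fun x => g (a + x) (b + x)) 0) →
      (∀ a b, Ψ t a b * f a b = Ψ t a b * g a b) → ∀ a b, f a b = g a b := by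
    intro t ht f g hf hg hfg a b
    have h1 := (hf a b).continuousAt.tendsto.mono_left (nhdsWithin_le_nhds (s := {0}ᶜ))
    have h2 := (hg a b).continuousAt.tendsto.mono_left (nhdsWithin_le_nhds (s := {0}ᶜ))
    simp only [add_zero] at h1 h2
    refine tendsto_nhds_unique_of_eventuallyEq h1 h2 ?_
    filter_upwards [h0 t a b ht] with x hx using mul_left_cancel₀ hx (hfg _ _)
  have dQ : ∀ {t : ℂ} (_ : 0 < t.im) {f g : ℂ → ℂ}, DifferentiableAt ℂ f 0 → DifferentiableAt ℂ g 0 →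
      DifferentiableAt ℂ (fun x => Q t (f x) (g x)) 0 := fun {t} ht {f g} hf hg =>
    hQ.comp (f₁ := fun _ => t) ht (by fun_prop) hf hg
  refine ⟨hQ, ?_, ?_, ?_, ?_, ?_, ?_, ?_, hW⟩
  · intro t a b ht
    have ht' : 0 < (t + 1).im := by simpa using ht
    refine key ht (f := fun a b => Q (t + 1) a b) (g := fun a b => Q t a b)
      (fun a b => dQ ht' (by fun_prop) (by fun_prop)) (fun a b => dQ ht (by fun_prop) (by fun_prop))
      (fun a b => ?_) a b
    rw [← he t a b ht, ← h'.T t a b ht, ← he _ _ _ ht', h.T _ _ _ ht]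
  · intro t a b ht
    refine key ht (f := fun a b => Q t (a + 1) b) (g := fun a b => Q t a b)
      (fun a b => dQ ht (by fun_prop) (by fun_prop)) (fun a b => dQ ht (by fun_prop) (by fun_prop))
      (fun a b => ?_) a b
    rw [← he t a b ht, ← h'.A t a b ht, ← he _ _ _ ht, h.A _ _ _ ht]
  · intro t a b ht
    refine key ht (f := fun a b => Q t a (b + 1)) (g := fun a b => (-1) ^ (n + j) * Q t a b)
      (fun a b => dQ ht (by fun_prop) (by fun_prop))
      (fun a b => (dQ ht (by fun_prop) (by fun_prop)).const_mul _) (fun a b => ?_) a b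
    have h1 := h.B t a b ht
    rw [he _ _ _ ht, he _ _ _ ht, h'.B t a b ht,
      show n + n' + (j + j') = (n + j) + (n' + j') by ring, pow_add] at h1
    refine mul_left_cancel₀ (pow_ne_zero (n' + j') (show (-1 : ℂ) ≠ 0 by simp)) ?_
    linear_combination h1
  · intro t a b ht
    refine key ht (f := fun a b => Q t (a + t) b) (g := fun a b => ee (-(j * (t + 2 * a + b))) * Q t a b)
      (fun a b => dQ ht (by fun_prop) (by fun_prop)) (fun a b => ?_) (fun a b => ?_) a b
    · exact (differentiable_ee _ |>.comp (0 : ℂ) (by fun_prop)).fun_mul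
        (dQ ht (by fun_prop) (by fun_prop))
    have h1 := h.HA t a b ht
    rw [he _ _ _ ht, he _ _ _ ht, h'.HA t a b ht, Nat.cast_add, add_mul, neg_add, ee_add] at h1
    refine mul_left_cancel₀ (ee_ne_zero (-(j' * (t + 2 * a + b)))) ?_
    linear_combination h1
  · intro t a b ht
    refine key ht (f := fun a b => Q t a (b + t)) (g := fun a b =>
      (-1) ^ (n + j) * ee (-(n * (t / 2 + b) + j * (t / 2 + a + b))) * Q t a b)
      (fun a b => dQ ht (by fun_prop) (by fun_prop)) (fun a b => ?_) (fun a b => ?_) a b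
    · exact ((differentiable_ee _ |>.comp (0 : ℂ) (by fun_prop)).const_mul _).fun_mul
        (dQ ht (by fun_prop) (by fun_prop))
    have h1 := h.HB t a b ht
    rw [he _ _ _ ht, he _ _ _ ht, h'.HB t a b ht,
      show n + n' + (j + j') = (n + j) + (n' + j') by ring, pow_add,
      show -(((n + n' : ℕ) : ℂ) * (t / 2 + b) + ((j + j' : ℕ) : ℂ) * (t / 2 + a + b)) =
        -(n * (t / 2 + b) + j * (t / 2 + a + b)) + -(n' * (t / 2 + b) + j' * (t / 2 + a + b)) by
        push_cast; ring, ee_add] at h1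
    refine mul_left_cancel₀ (mul_ne_zero (pow_ne_zero (n' + j') (show (-1 : ℂ) ≠ 0 by simp))
      (ee_ne_zero (-(n' * (t / 2 + b) + j' * (t / 2 + a + b))))) ?_
    linear_combination h1
  · intro t a b ht
    refine key ht (f := fun a b => Q (-1 / t) (a / t) (b / t)) (g := fun a b =>
      t ^ k * ee ((n * b ^ 2 + j * (a ^ 2 + (a + b) ^ 2)) / (2 * t)) * Q t a b)
      (fun a b => dQ (im_neg_one_div ht) (by fun_prop) (by fun_prop)) (fun a b => ?_) (fun a b => ?_) a b
    · exact ((differentiable_ee _ |>.comp (0 : ℂ) (by fun_prop)).const_mul _).fun_mul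
        (dQ ht (by fun_prop) (by fun_prop))
    have ht0 := ne_zero_of_im_pos ht
    have h1 := h.S t a b ht
    rw [he _ _ _ ht, he _ _ _ (im_neg_one_div ht), h'.S t a b ht, zpow_add₀ ht0,
      show (((n + n' : ℕ) : ℂ) * b ^ 2 + ((j + j' : ℕ) : ℂ) * (a ^ 2 + (a + b) ^ 2)) / (2 * t) =
        (n * b ^ 2 + j * (a ^ 2 + (a + b) ^ 2)) / (2 * t) +
        (n' * b ^ 2 + j' * (a ^ 2 + (a + b) ^ 2)) / (2 * t) by push_cast; ring, ee_add] at h1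
    refine mul_left_cancel₀ (mul_ne_zero (zpow_ne_zero k' ht0)
      (ee_ne_zero ((n' * b ^ 2 + j' * (a ^ 2 + (a + b) ^ 2)) / (2 * t)))) ?_
    linear_combination h1
  · intro t a b ht
    refine key ht (f := fun a b => Q t (-a - b) b) (g := fun a b => Q t a b)
      (fun a b => dQ ht (by fun_prop) (by fun_prop)) (fun a b => dQ ht (by fun_prop) (by fun_prop))
      (fun a b => ?_) a b
    rw [← he t a b ht, ← h'.sig t a b ht, ← he _ _ _ ht, h.sig _ _ _ ht]

end JacobiForms

section Division

variable {k k' : ℤ} {n n' j j' : ℕ} {Φ Ψ : ℂ → ℂ → ℂ → ℂ}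

theorem Holo3.sg {E : Type*} [NormedAddCommGroup E] [NormedSpace ℂ E] {f₁ f₂ : E → ℂ} {x : E}
    (ht : 0 < (f₁ x).im) (h₁ : DifferentiableAt ℂ f₁ x) (h₂ : DifferentiableAt ℂ f₂ x) :
    DifferentiableAt ℂ (fun x => sg (f₁ x) (f₂ x)) x :=
  DifferentiableAt.comp (g := fun p : ℂ × ℂ => _root_.sg p.1 p.2) (f := fun x => (f₁ x, f₂ x)) x
    (differentiableAt_sg ht _) (h₁.prodMk h₂)

theorem exists_norm_sgProd_sub_one_le (R : ℝ) : ∃ Y : ℝ, ∀ t b : ℂ, 0 < t.im → Y ≤ t.im → ‖b‖ ≤ R →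
    ‖sgProd t b - 1‖ ≤ 1 / 2 := by
  set S := ∑' n, sgBound 1 R n with hS
  have h1 : Tendsto (fun y : ℝ => Real.exp (Real.exp (-2 * Real.pi * y) * S) - 1) atTop (𝓝 0) := by
    have h2 : Tendsto (fun y : ℝ => Real.exp (-2 * Real.pi * y)) atTop (𝓝 0) :=
      Real.tendsto_exp_atBot.comp
        (tendsto_id.const_mul_atTop_of_neg (by linarith [Real.pi_pos]))
    have h3 := (Real.continuous_exp.tendsto _).comp (h2.mul_const S)
    simpa using h3.sub_const 1
  obtain ⟨Y, hY⟩ := eventually_atTop.mp (h1.eventually_le_const (show (0 : ℝ) < 1 / 2 by norm_num))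
  refine ⟨max Y 1, fun t b ht hy hb => ?_⟩
  exact (norm_sgProd_sub_one_le one_pos ((le_max_right _ _).trans hy)
    ((Complex.abs_im_le_norm b).trans hb)).trans (hY _ ((le_max_left _ _).trans hy))

theorem bddW_sg : BddW fun t _ b => sg t b := by
  intro R
  obtain ⟨Y, hY⟩ := exists_norm_sgProd_sub_one_le R
  have hc : ContinuousOn (fun b : ℂ => (ee (b / 2) - ee (-(b / 2))) / (2 * Real.pi * Complex.I))
      (Metric.closedBall 0 R) := by
    refine Continuous.continuousOn (Continuous.div_const ?_ _)
    exact (continuous_ee.comp (by fun_prop)).sub (continuous_ee.comp (by fun_prop))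
  obtain ⟨C, hC⟩ := (isCompact_closedBall (0 : ℂ) R).exists_bound_of_continuousOn hc
  refine ⟨C * (3 / 2), Y, fun t a b ht hy ha hb => ?_⟩
  have h1 := hC b (by simpa using hb)
  change ‖(ee (b / 2) - ee (-(b / 2))) / (2 * Real.pi * Complex.I) * sgProd t b‖ ≤ _
  rw [norm_mul]
  refine mul_le_mul h1 ?_ (norm_nonneg _) ((norm_nonneg _).trans h1)
  have h2 := hY t b ht hy hb
  have h3 := norm_add_le (sgProd t b - 1) 1
  rw [sub_add_cancel, norm_one] at h3
  linarith

theorem exists_le_norm_sg (R : ℝ) : ∃ ρ : ℝ, R ≤ ρ ∧ 0 < ρ ∧ ∃ δ Y : ℝ, 0 < δ ∧ ∀ t b : ℂ, 0 < t.im →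
    Y ≤ t.im → ‖b‖ = ρ → δ ≤ ‖sg t b‖ := by
  obtain ⟨N, hN⟩ := exists_nat_ge R
  have hρ : (0 : ℝ) < N + 1 / 2 := by positivity
  refine ⟨N + 1 / 2, by linarith, hρ, ?_⟩
  obtain ⟨Y, hY⟩ := exists_norm_sgProd_sub_one_le (N + 1 / 2)
  have hc : ContinuousOn (fun b : ℂ => ‖(ee (b / 2) - ee (-(b / 2))) / (2 * Real.pi * Complex.I)‖)
      (Metric.sphere 0 (N + 1 / 2)) := by
    refine Continuous.continuousOn (Continuous.norm (Continuous.div_const ?_ _))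
    exact (continuous_ee.comp (by fun_prop)).sub (continuous_ee.comp (by fun_prop))
  obtain ⟨b₀, hb₀, hmin⟩ := (isCompact_sphere (0 : ℂ) (N + 1 / 2)).exists_isMinOn
    (NormedSpace.sphere_nonempty.mpr hρ.le) hc
  refine ⟨‖(ee (b₀ / 2) - ee (-(b₀ / 2))) / (2 * Real.pi * Complex.I)‖ * (1 / 2), Y, ?_, ?_⟩
  · refine mul_pos (norm_pos_iff.mpr (div_ne_zero (fun h => ?_) Complex.two_pi_I_ne_zero)) (by norm_num)
    have h1 : ee b₀ = 1 := by
      rw [show b₀ = b₀ / 2 + b₀ / 2 by ring, ee_add]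
      nth_rw 1 [sub_eq_zero.mp h]
      rw [← ee_add, neg_add_cancel, ee_zero]
    obtain ⟨m, rfl⟩ := ee_eq_one_iff.mp h1
    rw [mem_sphere_zero_iff_norm, Complex.norm_intCast] at hb₀
    have h2 : ((2 * |m| : ℤ) : ℝ) = ((2 * N + 1 : ℤ) : ℝ) := by push_cast; linarith
    have h3 := Int.cast_injective h2
    omega
  · intro t b ht hy hb
    rw [sg, norm_mul]
    refine mul_le_mul (hmin (by simpa using hb)) ?_ (by norm_num) (norm_nonneg _)
    have h2 := hY t b ht hy hb.le
    have h3 := norm_add_le (1 - sgProd t b) (sgProd t b)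
    rw [sub_add_cancel, norm_one, norm_sub_rev] at h3
    linarith

/-- Division by `sg t a` with uniform bounds. -/
theorem Holo3.exists_div_sg (hΦ : Holo3 Φ) (hW : BddW Φ)
    (h0 : ∀ t a b : ℂ, 0 < t.im → _root_.sg t a = 0 → Φ t a b = 0) :
    ∃ Q, Holo3 Q ∧ BddW Q ∧ ∀ t a b : ℂ, 0 < t.im → Φ t a b = _root_.sg t a * Q t a b := by
  obtain ⟨h, hd, he⟩ := exists_div_of_simple_zeros (E := ℂ × ℂ) (U := {p : (ℂ × ℂ) × ℂ | 0 < p.1.1.im})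
    (isOpen_lt continuous_const (Complex.continuous_im.comp (continuous_fst.comp continuous_fst)))
    (f := fun p a => Φ p.1 a p.2) (g := fun p a => _root_.sg p.1 a)
    (fun p hp => hΦ.comp (f₁ := fun p : (ℂ × ℂ) × ℂ => p.1.1) (f₂ := fun p => p.2) (f₃ := fun p => p.1.2)
      hp (by fun_prop) (by fun_prop) (by fun_prop))
    (fun p hp => Holo3.sg (f₁ := fun p : (ℂ × ℂ) × ℂ => p.1.1) (f₂ := fun p => p.2) hp (by fun_prop)
      (by fun_prop)) (fun p hp h => ⟨h0 _ _ _ hp h, (sg_eq_zero hp h).2⟩)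
  have hQ : Holo3 fun t a b => h (t, b) a := fun t a b ht =>
    DifferentiableAt.comp (g := fun p : (ℂ × ℂ) × ℂ => h p.1 p.2)
      (f := fun p : ℂ × ℂ × ℂ => ((p.1, p.2.2), p.2.1)) (t, a, b) (hd ((t, b), a) ht) (by fun_prop)
  have hE : ∀ t a b : ℂ, 0 < t.im → Φ t a b = _root_.sg t a * h (t, b) a := fun t a b ht =>
    he ((t, b), a) ht
  refine ⟨_, hQ, fun R => ?_, hE⟩
  obtain ⟨ρ, hRρ, hρ, δ, Y, hδ, hs⟩ := exists_le_norm_sg R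
  obtain ⟨C, Y', hC⟩ := hW ρ
  refine ⟨C / δ, max Y Y', fun t a b ht hy ha hb => ?_⟩
  have hdiff : Differentiable ℂ (fun a => h (t, b) a) := fun a =>
    hQ.comp (f₁ := fun _ => t) (f₂ := fun a => a) (f₃ := fun _ => b) ht (by fun_prop) (by fun_prop)
      (by fun_prop)
  refine Complex.norm_le_of_forall_mem_frontier_norm_le (U := Metric.ball (0 : ℂ) ρ)
    (f := fun a => h (t, b) a) Metric.isBounded_ball hdiff.diffContOnCl (fun z hz => ?_) ?_
  · rw [frontier_ball _ hρ.ne', mem_sphere_zero_iff_norm] at hz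
    have h1 := hs t z ht ((le_max_left _ _).trans hy) hz
    have h2 := hC t z b ht ((le_max_right _ _).trans hy) hz.le (hb.trans hRρ)
    rw [hE _ _ _ ht, norm_mul] at h2
    rw [le_div_iff₀ hδ, mul_comm]
    exact (mul_le_mul_of_nonneg_right h1 (norm_nonneg _)).trans h2
  · rw [closure_ball _ hρ.ne', mem_closedBall_zero_iff]
    exact ha.trans hRρ

theorem wj_sg : WJ (-1) 1 0 fun t _ b => sg t b := by
  refine ⟨?_, ?_, ?_, ?_, ?_, ?_, ?_, ?_, bddW_sg⟩
  · intro t a b ht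
    exact Holo3.sg (f₁ := fun p : ℂ × ℂ × ℂ => p.1) (f₂ := fun p => p.2.2) (x := (t, a, b)) ht
      (by fun_prop) (by fun_prop)
  · intro t a b ht
    exact sg_T t b
  · intro t a b ht
    rfl
  · intro t a b ht
    simp [sg_add_one]
  · intro t a b ht
    simp [ee_zero]
  · intro t a b ht
    rw [sg_add ht]
    simp only [Nat.cast_one, one_mul, Nat.cast_zero, zero_mul, add_zero, pow_one, neg_add',
        neg_one_mul]
  · intro t a b ht
    rw [sg_S ht]
    simp [_root_.zpow_neg]
  · intro t a b ht
    rfl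

/-- The basic form of lattice index attached to the second summand. -/
def fA (t a b : ℂ) : ℂ := sg t a * sg t (a + b)

theorem wj_fA : WJ (-2) 0 1 fA := by
  have hW1 : BddW fun t a b => sg t a :=
    bddW_sg.comp (f := fun _ b => b) (g := fun a _ => a) fun R => ⟨R, fun a b ha hb => ⟨hb, ha⟩⟩
  have hW2 : BddW fun t a b => sg t (a + b) :=
    bddW_sg.comp (f := fun _ _ => 0) (g := fun a b => a + b) fun R => ⟨R + R, fun a b ha hb =>
      ⟨by simpa using add_nonneg ((norm_nonneg _).trans ha) ((norm_nonneg _).trans ha),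
        (norm_add_le _ _).trans (add_le_add ha hb)⟩⟩
  refine ⟨?_, ?_, ?_, ?_, ?_, ?_, ?_, ?_, hW1.mul hW2⟩
  · intro t a b ht
    exact (Holo3.sg (f₁ := fun p : ℂ × ℂ × ℂ => p.1) (f₂ := fun p => p.2.1) (x := (t, a, b)) ht
      (by fun_prop) (by fun_prop)).fun_mul (Holo3.sg (f₁ := fun p : ℂ × ℂ × ℂ => p.1)
      (f₂ := fun p => p.2.1 + p.2.2) (x := (t, a, b)) ht (by fun_prop) (by fun_prop))
  · intro t a b ht
    simp only [fA, sg_T]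
  · intro t a b ht
    rw [fA, fA, add_right_comm, sg_add_one, sg_add_one]; ring
  · intro t a b ht
    rw [fA, fA, ← add_assoc, sg_add_one]; ring
  · intro t a b ht
    rw [fA, fA, add_right_comm, sg_add ht, sg_add ht,
      show -(((1 : ℕ) : ℂ) * (t + 2 * a + b)) = (-(t / 2) - a) + (-(t / 2) - (a + b)) by
        push_cast; ring, ee_add]
    ring
  · intro t a b ht
    rw [fA, fA, ← add_assoc, sg_add ht,
      show -(((0 : ℕ) : ℂ) * (t / 2 + b) + ((1 : ℕ) : ℂ) * (t / 2 + a + b)) = -(t / 2) - (a + b) by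
        push_cast; ring]
    ring
  · intro t a b ht
    have h0 := ne_zero_of_im_pos ht
    rw [fA, fA, ← add_div, sg_S ht, sg_S ht,
      show (((0 : ℕ) : ℂ) * b ^ 2 + ((1 : ℕ) : ℂ) * (a ^ 2 + (a + b) ^ 2)) / (2 * t) =
        a ^ 2 / (2 * t) + (a + b) ^ 2 / (2 * t) by push_cast; ring, ee_add,
      show (t ^ (-2 : ℤ)) = t⁻¹ * t⁻¹ by rw [← _root_.zpow_neg_one, ← zpow_add₀ h0]; norm_num]
    ring
  · intro t a b ht
    rw [fA, fA, show -a - b = -(a + b) by ring, sg_neg, show -(a + b) + b = -a by ring, sg_neg]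
    ring

theorem eventually_sg_comp_ne_zero {t : ℂ} (ht : 0 < t.im) (c : ℂ) {d : ℂ} (hd : d ≠ 0) :
    ∀ᶠ x in 𝓝[≠] (0 : ℂ), sg t (c + d * x) ≠ 0 := by
  have h1 : Tendsto (fun x : ℂ => c + d * x) (𝓝[≠] 0) (𝓝[≠] c) := by
    refine tendsto_nhdsWithin_iff.mpr ⟨?_, ?_⟩
    · have : Tendsto (fun x : ℂ => c + d * x) (𝓝 0) (𝓝 (c + d * 0)) :=
        Continuous.tendsto (by fun_prop) 0
      rw [mul_zero, add_zero] at this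
      exact this.mono_left nhdsWithin_le_nhds
    · filter_upwards [self_mem_nhdsWithin] with x hx
      simpa [hd] using hx
  exact h1.eventually (eventually_sg_ne_zero ht c)

theorem eventually_sg_snd_ne_zero (t _a b : ℂ) (ht : 0 < t.im) :
    ∀ᶠ x in 𝓝[≠] (0 : ℂ), sg t (b + x) ≠ 0 := by
  simpa using eventually_sg_comp_ne_zero ht b one_ne_zero

theorem eventually_fA_ne_zero (t a b : ℂ) (ht : 0 < t.im) :
    ∀ᶠ x in 𝓝[≠] (0 : ℂ), fA t (a + x) (b + x) ≠ 0 := by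
  filter_upwards [eventually_sg_comp_ne_zero ht a one_ne_zero,
    eventually_sg_comp_ne_zero ht (a + b) two_ne_zero] with x h1 h2
  refine mul_ne_zero ?_ ?_
  · rwa [one_mul] at h1
  · rwa [show a + x + (b + x) = a + b + 2 * x by ring]

/-- Division by `sg t b` of a form vanishing at `b = 0`. -/
theorem WJ.exists_div_sg (h : WJ k (n + 1) j Φ) (h0 : ∀ t a : ℂ, 0 < t.im → Φ t a 0 = 0) :
    ∃ Q, WJ (k + 1) n j Q ∧ ∀ t a b : ℂ, 0 < t.im → Φ t a b = sg t b * Q t a b := by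
  obtain ⟨Q, hQ, hW, he⟩ := Holo3.exists_div_sg (Φ := fun t b a => Φ t a b)
    (fun t b a ht => h.holo3.comp (f₁ := fun p : ℂ × ℂ × ℂ => p.1) (f₂ := fun p => p.2.2)
      (f₃ := fun p => p.2.1) (x := (t, b, a)) ht (by fun_prop) (by fun_prop) (by fun_prop))
    (BddW.comp h.W fun R => ⟨R, fun _ _ h h' => ⟨h', h⟩⟩)
    (fun t b a ht hb => sg_int_mul_add ht (f := fun b => Φ t a b) (h0 t a ht)
      (fun b => by rw [h.B _ _ _ ht]; simp) (fun b => by rw [h.HB _ _ _ ht]; simp [ee_ne_zero]) hb)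
  refine ⟨fun t a b => Q t b a, ?_, fun t a b ht => he t b a ht⟩
  refine WJ.div (k := k + 1) (h.cast (by ring) rfl rfl) wj_sg (fun t b a ht => ?_) ?_
    (fun t a b ht => he t b a ht) eventually_sg_snd_ne_zero
  · exact hQ.comp (f₁ := fun p : ℂ × ℂ × ℂ => p.1) (f₂ := fun p => p.2.2)
      (f₃ := fun p => p.2.1) (x := (t, b, a)) ht (by fun_prop) (by fun_prop) (by fun_prop)
  · exact hW.comp (f := fun a b => b) (g := fun a b => a) fun R => ⟨R, fun _ _ h h' => ⟨h', h⟩⟩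

/-- Division by `fA` of a form vanishing at `a = 0`. -/
theorem WJ.exists_div_fA (h : WJ k n (j + 1) Φ) (h0 : ∀ t b : ℂ, 0 < t.im → Φ t 0 b = 0) :
    ∃ Q, WJ (k + 2) n j Q ∧ ∀ t a b : ℂ, 0 < t.im → Φ t a b = fA t a b * Q t a b := by
  have hz : ∀ t a b : ℂ, 0 < t.im → sg t a = 0 → Φ t a b = 0 := fun t a b ht ha =>
    sg_int_mul_add ht (f := fun a => Φ t a b) (h0 t b ht)
      (fun a => by rw [h.A _ _ _ ht]) (fun a => by rw [h.HA _ _ _ ht]; simp [ee_ne_zero]) ha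
  obtain ⟨P, hP, hPW, hPe⟩ := Holo3.exists_div_sg h.holo3 h.W hz
  have hz' : ∀ t c b : ℂ, 0 < t.im → sg t c = 0 → P t (c - b) b = 0 := by
    intro t c b ht hc
    refine eq_of_sg_mul_eq ht (f := fun b => P t (c - b) b) (g := fun _ => 0) (b := b) (c := -c) ?_
      continuousAt_const fun x => ?_
    · exact (hP.comp (f₁ := fun _ => t) (f₂ := fun b => c - b) (f₃ := fun b => b) ht (by fun_prop)
        (by fun_prop) (by fun_prop)).continuousAt
    · have h1 := hPe t (c - x) x ht
      rw [← h.sig _ _ _ ht, show -(c - x) - x = -c by ring, hz t (-c) x ht (by rw [sg_neg, hc,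
          neg_zero])] at h1
      rw [mul_zero, show x + -c = -(c - x) by ring, sg_neg, neg_mul, ← h1, neg_zero]
  obtain ⟨Q, hQ, hW, he⟩ := Holo3.exists_div_sg (Φ := fun t c b => P t (c - b) b)
    (fun t c b ht => hP.comp (f₁ := fun p : ℂ × ℂ × ℂ => p.1) (f₂ := fun p => p.2.1 - p.2.2)
      (f₃ := fun p => p.2.2) (x := (t, c, b)) ht (by fun_prop) (by fun_prop) (by fun_prop))
    (hPW.comp (f := fun c b => c - b) (g := fun _ b => b) fun R => ⟨2 * R, fun c b hc hb =>
      ⟨by linarith [norm_sub_le c b], by linarith [norm_nonneg b]⟩⟩) hz'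
  have hE : ∀ t a b : ℂ, 0 < t.im → Φ t a b = fA t a b * Q t (a + b) b := by
    intro t a b ht
    have h1 := he t (a + b) b ht
    rw [add_sub_cancel_right] at h1
    rw [hPe t a b ht, h1, fA, mul_assoc]
  refine ⟨fun t a b => Q t (a + b) b, ?_, hE⟩
  refine WJ.div (k := k + 2) (h.cast (by ring) rfl rfl) wj_fA (fun t a b ht => ?_) ?_ hE
    eventually_fA_ne_zero
  · exact hQ.comp (f₁ := fun p : ℂ × ℂ × ℂ => p.1) (f₂ := fun p => p.2.1 + p.2.2)
      (f₃ := fun p => p.2.2) (x := (t, a, b)) ht (by fun_prop) (by fun_prop) (by fun_prop)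
  · exact hW.comp (f := fun a b => a + b) (g := fun a b => b) fun R => ⟨2 * R, fun a b ha hb =>
      ⟨by linarith [norm_add_le a b], by linarith [norm_nonneg b]⟩⟩

end Division

section Derivatives

variable {k k' : ℤ} {n n' j j' : ℕ} {Φ Ψ : ℂ → ℂ → ℂ → ℂ}

theorem Holo3.deriv {f : ℂ → ℂ → ℂ} (h : Holo3 fun t _ b => f t b) :
    Holo3 fun t _ b => deriv (f t) b := by
  have key : Holo3 fun t _ b => (2 * Real.pi * Complex.I : ℂ)⁻¹ *
      ∮ ζ in C(0, 1), ((ζ - 0) ^ 2)⁻¹ • f t (b + ζ) := by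
    intro t a b ht
    refine DifferentiableAt.const_mul ?_ _
    refine differentiableAt_circleIntegral (E := ℂ × ℂ × ℂ)
      (H := fun p ζ => ((ζ - 0) ^ 2)⁻¹ • f p.1 (p.2.2 + ζ)) fun ζ hζ => ?_
    have h1 : ∀ᶠ q : (ℂ × ℂ × ℂ) × ℂ in 𝓝 ((t, a, b), ζ), 0 < q.1.1.im :=
      (isOpen_lt continuous_const (by fun_prop)).mem_nhds ht
    have h2 : ∀ᶠ q : (ℂ × ℂ × ℂ) × ℂ in 𝓝 ((t, a, b), ζ), q.2 ≠ 0 := by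
      refine continuous_snd.continuousAt.eventually_ne ?_
      rintro rfl
      simp at hζ
    filter_upwards [h1, h2] with q hq1 hq2
    have d1 : DifferentiableAt ℂ (fun q : (ℂ × ℂ × ℂ) × ℂ => f q.1.1 (q.1.2.2 + q.2)) q :=
      h.comp (f₁ := fun q : (ℂ × ℂ × ℂ) × ℂ => q.1.1) (f₂ := fun q => 0)
        (f₃ := fun q => q.1.2.2 + q.2) hq1 (by fun_prop) (by fun_prop) (by fun_prop)
    have d2 : DifferentiableAt ℂ (fun q : (ℂ × ℂ × ℂ) × ℂ => (q.2 - 0) ^ 2) q := by fun_prop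
    exact (d2.fun_inv (by simpa using hq2)).fun_mul d1
  refine key.congr fun t a b ht => ?_
  have hd : Differentiable ℂ (fun ζ => f t (b + ζ)) := fun ζ =>
    h.comp (f₁ := fun _ => t) (f₂ := fun _ => 0) (f₃ := fun ζ => b + ζ) ht (by fun_prop) (by fun_prop)
      (by fun_prop)
  have := Complex.two_pi_I_inv_smul_circleIntegral_sub_sq_inv_smul_of_differentiable isOpen_univ
    (Set.subset_univ (Metric.closedBall (0 : ℂ) 1)) hd.differentiableOn
    (Metric.mem_ball_self one_pos)
  rw [← smul_eq_mul, this, deriv_comp_const_add, add_zero]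

theorem Holo3.differentiable_snd {f : ℂ → ℂ → ℂ} (h : Holo3 fun t _ b => f t b) {t : ℂ} (ht : 0 < t.im) :
    Differentiable ℂ (f t) := fun b =>
  h.comp (f₁ := fun _ => t) (f₂ := fun _ => 0) (f₃ := fun b => b) ht (by fun_prop) (by fun_prop)
    (by fun_prop)

theorem BddW.deriv {f : ℂ → ℂ → ℂ} (hW : BddW fun t _ b => f t b) (h : Holo3 fun t _ b => f t b) :
    BddW fun t _ b => deriv (f t) b := by
  intro R
  obtain ⟨C, Y, hC⟩ := hW (R + 1)
  refine ⟨C, Y, fun t a b ht hY ha hb => ?_⟩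
  have := Complex.norm_deriv_le_of_forall_mem_sphere_norm_le (c := b) (R := 1) (C := C) (f := f t) one_pos
    (h.differentiable_snd ht).diffContOnCl fun z hz => hC t 0 z ht hY
      (by simpa using by linarith [norm_nonneg a]) (by
        have h1 : ‖z - b‖ = 1 := by simpa [dist_eq_norm] using hz
        have h2 := norm_add_le (z - b) b
        rw [sub_add_cancel] at h2
        linarith)
  simpa using this

theorem holo3_sg : Holo3 fun t _ b => sg t b := wj_sg.holo

/-- The first derivative of `sg` in the elliptic variable. -/
def sg₁ (t b : ℂ) : ℂ := deriv (sg t) b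

/-- The second derivative of `sg` in the elliptic variable. -/
def sg₂ (t b : ℂ) : ℂ := deriv (sg₁ t) b

theorem holo3_sg₁ : Holo3 fun t _ b => sg₁ t b := holo3_sg.deriv
theorem holo3_sg₂ : Holo3 fun t _ b => sg₂ t b := holo3_sg₁.deriv
theorem bddW_sg₁ : BddW fun t _ b => sg₁ t b := bddW_sg.deriv holo3_sg
theorem bddW_sg₂ : BddW fun t _ b => sg₂ t b := bddW_sg₁.deriv holo3_sg₁

theorem hasDerivAt_sg {t : ℂ} (ht : 0 < t.im) (b : ℂ) : HasDerivAt (sg t) (sg₁ t b) b :=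
  (holo3_sg.differentiable_snd ht b).hasDerivAt

theorem hasDerivAt_sg₁ {t : ℂ} (ht : 0 < t.im) (b : ℂ) : HasDerivAt (sg₁ t) (sg₂ t b) b :=
  (holo3_sg₁.differentiable_snd ht b).hasDerivAt

theorem sg₁_zero {t : ℂ} (ht : 0 < t.im) : sg₁ t 0 = 1 := (hasDerivAt_sg_zero ht).deriv

theorem sg₁_T (t b : ℂ) : sg₁ (t + 1) b = sg₁ t b := by
  rw [sg₁, sg₁, show sg (t + 1) = sg t from funext fun b => sg_T t b]

theorem sg₂_T (t b : ℂ) : sg₂ (t + 1) b = sg₂ t b := by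
  rw [sg₂, sg₂, show sg₁ (t + 1) = sg₁ t from funext fun b => sg₁_T t b]

theorem sg₁_neg (t b : ℂ) : sg₁ t (-b) = sg₁ t b := by
  have h : (fun b => sg t (-b)) = fun b => -sg t b := funext fun b => sg_neg t b
  have h1 := congrArg (fun f => deriv f b) h
  simp only [deriv_comp_neg, deriv.fun_neg] at h1
  exact neg_injective h1

theorem sg₁_add_one (t b : ℂ) : sg₁ t (b + 1) = -sg₁ t b := by
  have h : (fun b => sg t (b + 1)) = fun b => -sg t b := funext fun b => sg_add_one t b
  have h1 := congrArg (fun f => deriv f b) h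
  simp only [deriv_comp_add_const, deriv.fun_neg] at h1
  exact h1

theorem sg₂_add_one (t b : ℂ) : sg₂ t (b + 1) = -sg₂ t b := by
  have h : (fun b => sg₁ t (b + 1)) = fun b => -sg₁ t b := funext fun b => sg₁_add_one t b
  have h1 := congrArg (fun f => deriv f b) h
  simp only [deriv_comp_add_const, deriv.fun_neg] at h1
  exact h1

/-- The derivative of a quasi-periodicity relation. -/
theorem deriv_quasi_period {f g : ℂ → ℂ} {t c d m g' : ℂ} {b f' f₁ : ℂ} (hf : HasDerivAt f f' b)
    (h : ∀ b, g (b + t) = c * ee (d - m * b) * f b) (hg : HasDerivAt g g' (b + t))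
    (h₁ : f₁ = f' - 2 * Real.pi * Complex.I * m * f b) :
    g' = c * ee (d - m * b) * f₁ := by
  have h1 : HasDerivAt (fun b => g (b + t)) g' b := hg.comp_add_const b t
  have h2 : HasDerivAt (fun b => ee (d - m * b)) (2 * Real.pi * Complex.I * (-m) * ee (d - m * b)) b :=
    HasDerivAt.ee_comp (f := fun b => d - m * b) (by simpa using ((hasDerivAt_id b).const_mul m).const_sub d)
  rw [show (fun b => g (b + t)) = fun b => c * ee (d - m * b) * f b from funext h] at h1
  rw [h1.unique ((h2.const_mul c).fun_mul hf), h₁]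
  ring

/-- The derivative of the law under inversion. -/
theorem deriv_inversion {f g : ℂ → ℂ} {t c m g' : ℂ} {b f' f₁ : ℂ} (ht : t ≠ 0) (hf : HasDerivAt f f' b)
    (h : ∀ b, g (b / t) = c * ee (m * b ^ 2 / (2 * t)) * f b) (hg : HasDerivAt g g' (b / t))
    (h₁ : f₁ = f' + 2 * Real.pi * Complex.I / t * m * b * f b) :
    g' = t * c * ee (m * b ^ 2 / (2 * t)) * f₁ := by
  have h1 : HasDerivAt (fun b => g (b / t)) (g' * (1 / t)) b :=
    hg.comp b ((hasDerivAt_id b).div_const t)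
  have h2 : HasDerivAt (fun b => ee (m * b ^ 2 / (2 * t)))
      (2 * Real.pi * Complex.I * (m * b / t) * ee (m * b ^ 2 / (2 * t))) b := by
    refine HasDerivAt.ee_comp (f := fun b => m * b ^ 2 / (2 * t)) ?_
    refine ((((hasDerivAt_id b).pow 2).const_mul m).div_const (2 * t)).congr_deriv ?_
    simp only [id, Nat.cast_ofNat]
    field_simp
    norm_num
  rw [show (fun b => g (b / t)) = _ from funext h] at h1
  have h3 := h1.unique ((h2.const_mul c).fun_mul hf)
  have h4 : g' = t * (g' * (1 / t)) := by field_simp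
  rw [h4, h3, h₁]
  field_simp
  ring

theorem sg₁_add {t : ℂ} (ht : 0 < t.im) (b : ℂ) :
    sg₁ t (b + t) = -ee (-(t / 2) - b) * (sg₁ t b - 2 * Real.pi * Complex.I * sg t b) := by
  have := deriv_quasi_period (c := -1) (d := -(t / 2)) (m := 1) (hasDerivAt_sg ht b)
    (fun b => by rw [sg_add ht, one_mul]; ring) (hasDerivAt_sg ht (b + t)) rfl
  rw [this]; simp

theorem sg₂_add {t : ℂ} (ht : 0 < t.im) (b : ℂ) :
    sg₂ t (b + t) = -ee (-(t / 2) - b) * (sg₂ t b - 4 * Real.pi * Complex.I * sg₁ t b +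
      (2 * Real.pi * Complex.I) ^ 2 * sg t b) := by
  have := deriv_quasi_period (f := fun b => sg₁ t b - 2 * Real.pi * Complex.I * sg t b)
    (c := -1) (d := -(t / 2)) (m := 1) ((hasDerivAt_sg₁ ht b).sub ((hasDerivAt_sg ht b).const_mul _))
    (fun b => by rw [sg₁_add ht, one_mul]; ring) (hasDerivAt_sg₁ ht (b + t)) rfl
  rw [this]; simp only [one_mul]; ring

theorem sg₁_S {t : ℂ} (ht : 0 < t.im) (b : ℂ) : sg₁ (-1 / t) (b / t) =
    ee (b ^ 2 / (2 * t)) * (sg₁ t b + 2 * Real.pi * Complex.I / t * b * sg t b) := by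
  have h0 := ne_zero_of_im_pos ht
  have := deriv_inversion (c := t⁻¹) (m := 1) h0 (hasDerivAt_sg ht b)
    (fun b => by rw [sg_S ht, one_mul]) (hasDerivAt_sg (im_neg_one_div ht) (b / t)) rfl
  rw [this, mul_inv_cancel₀ h0]; simp

theorem sg₂_S {t : ℂ} (ht : 0 < t.im) (b : ℂ) : sg₂ (-1 / t) (b / t) =
    t * ee (b ^ 2 / (2 * t)) * (sg₂ t b + 2 * (2 * Real.pi * Complex.I / t * b) * sg₁ t b +
      (2 * Real.pi * Complex.I / t + (2 * Real.pi * Complex.I / t * b) ^ 2) * sg t b) := by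
  have h0 := ne_zero_of_im_pos ht
  have h1 : HasDerivAt (fun b => sg₁ t b + 2 * Real.pi * Complex.I / t * b * sg t b)
      (sg₂ t b + (2 * Real.pi * Complex.I / t * sg t b + 2 * Real.pi * Complex.I / t * b * sg₁ t b)) b := by
    refine (hasDerivAt_sg₁ ht b).add (HasDerivAt.mul ?_ (hasDerivAt_sg ht b))
    simpa using (hasDerivAt_id b).const_mul (2 * Real.pi * Complex.I / t)
  have := deriv_inversion (c := 1) (m := 1) h0 h1
    (fun b => by rw [sg₁_S ht, one_mul, one_mul]) (hasDerivAt_sg₁ (im_neg_one_div ht) (b / t)) rfl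
  rw [this]; simp only [one_mul]; ring

/-- The logarithmic derivative of the discriminant, suitably normalized. -/
def kap (t : ℂ) : ℂ := 2 * Real.pi * Complex.I / 12 * (deriv DD t / DD t)

theorem hasDerivAt_DD {t : ℂ} (ht : 0 < t.im) : HasDerivAt DD (deriv DD t) t :=
  (mf_DD.holo t ht).hasDerivAt

theorem kap_T {t : ℂ} (ht : 0 < t.im) : kap (t + 1) = kap t := by
  have h : (fun t => DD (t + 1)) =ᶠ[𝓝 t] DD := by
    filter_upwards [UpperHalfPlane.isOpen_upperHalfPlaneSet.mem_nhds ht] with s hs using mf_DD.T s hs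
  rw [kap, kap, ← deriv_comp_add_const, h.deriv_eq, mf_DD.T t ht]

theorem kap_S {t : ℂ} (ht : 0 < t.im) : kap (-1 / t) = t ^ 2 * kap t + 2 * Real.pi * Complex.I * t := by
  have h0 := ne_zero_of_im_pos ht
  have h1 : HasDerivAt (fun t : ℂ => -1 / t) (1 / t ^ 2) t := by
    have := (hasDerivAt_inv h0).const_mul (-1)
    simpa [div_eq_mul_inv] using this
  have h2 := (hasDerivAt_DD (im_neg_one_div ht)).comp t h1
  have h3 : DD ∘ (fun t => -1 / t) =ᶠ[𝓝 t] fun t => t ^ 12 * DD t := by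
    filter_upwards [UpperHalfPlane.isOpen_upperHalfPlaneSet.mem_nhds ht] with s hs using mf_DD.S s hs
  have h4 := (h2.congr_of_eventuallyEq h3.symm).unique
    (((hasDerivAt_id t).pow 12).mul (hasDerivAt_DD ht))
  have h5 := mf_DD.S t ht
  have h6 := DD_ne_zero t
  have h7 : DD (-1 / t) = t ^ 12 * DD t := h5
  simp only [Pi.pow_apply, id, Nat.cast_ofNat, mul_one] at h4
  have h8 : deriv DD (-1 / t) = t ^ 2 * (12 * t ^ 11 * DD t + t ^ 12 * deriv DD t) := by
    rw [← h4]; field_simp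
  rw [kap, kap, h7, h8]
  field_simp
  ring

theorem differentiableAt_kap {t : ℂ} (ht : 0 < t.im) : DifferentiableAt ℂ kap t := by
  have h1 : DifferentiableAt ℂ (deriv DD) t :=
    ((DifferentiableOn.deriv (fun s hs => (mf_DD.holo s hs).differentiableWithinAt)
      UpperHalfPlane.isOpen_upperHalfPlaneSet).differentiableAt (UpperHalfPlane.isOpen_upperHalfPlaneSet.mem_nhds ht))
  exact (h1.div (mf_DD.holo t ht) (DD_ne_zero t)).const_mul _

theorem kap_bdd : ∃ C Y : ℝ, ∀ t : ℂ, 0 < t.im → Y ≤ t.im → ‖kap t‖ ≤ C := by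
  have h1 : ∀ᶠ t in imInf, ‖DD t * ee (-t) - 1‖ ≤ 1 / 2 := by
    have := (tendsto_DD.sub_const 1).norm
    rw [sub_self, norm_zero] at this
    exact this.eventually_le_const (by norm_num)
  obtain ⟨Y, hY⟩ := eventually_atTop.mp (eventually_comap.mp h1)
  refine ⟨‖(2 * Real.pi * Complex.I / 12 : ℂ)‖ * (3 + ‖(2 * Real.pi * Complex.I : ℂ)‖), max Y 0 + 2,
    fun t ht hy => ?_⟩
  have hball : ∀ z ∈ Metric.closedBall t 1, max Y 0 + 1 ≤ z.im := fun z hz => by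
    have h2 := (Complex.abs_im_le_norm (z - t)).trans (by simpa [dist_eq_norm] using hz)
    rw [Complex.sub_im, abs_le] at h2
    linarith [h2.1]
  have hpos : ∀ z ∈ Metric.closedBall t 1, 0 < z.im := fun z hz => by
    linarith [hball z hz, le_max_right Y 0]
  have hlow : ∀ z ∈ Metric.closedBall t 1, ‖DD z * ee (-z) - 1‖ ≤ 1 / 2 := fun z hz =>
    hY z.im (by linarith [hball z hz, le_max_left Y 0]) z rfl
  have hd : ∀ z, 0 < z.im → HasDerivAt (fun z => DD z * ee (-z))
      (deriv DD z * ee (-z) + DD z * (2 * Real.pi * Complex.I * (-1) * ee (-z))) z := fun z hz =>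
    (hasDerivAt_DD hz).fun_mul (HasDerivAt.ee_comp (hasDerivAt_neg z))
  have h2 := Complex.norm_deriv_le_of_forall_mem_sphere_norm_le (c := t) (R := 1) (C := 3 / 2)
    (f := fun z => DD z * ee (-z)) one_pos (DifferentiableOn.diffContOnCl_ball
      (U := Metric.closedBall t 1) (fun z hz => (hd z (hpos z hz)).differentiableAt.differentiableWithinAt)
      subset_rfl) fun z hz => by
    have h3 := hlow z (Metric.sphere_subset_closedBall hz)
    have h4 := norm_add_le (DD z * ee (-z) - 1) 1
    rw [sub_add_cancel, norm_one] at h4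
    linarith
  rw [(hd t ht).deriv, div_one] at h2
  have h3 := hlow t (Metric.mem_closedBall_self zero_le_one)
  have h4 : 1 / 2 ≤ ‖DD t * ee (-t)‖ := by
    have h4 := norm_add_le (1 - DD t * ee (-t)) (DD t * ee (-t))
    rw [sub_add_cancel, norm_one, norm_sub_rev] at h4
    linarith
  have h5 : deriv DD t / DD t = (deriv DD t * ee (-t) + DD t * (2 * Real.pi * Complex.I * (-1) * ee (-t))) /
      (DD t * ee (-t)) + 2 * Real.pi * Complex.I := by
    have := DD_ne_zero t
    have := ee_ne_zero (-t)
    field_simp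
    ring
  rw [kap, norm_mul]
  refine mul_le_mul_of_nonneg_left ?_ (norm_nonneg _)
  rw [h5]
  refine (norm_add_le _ _).trans (add_le_add ?_ le_rfl)
  rw [norm_div, div_le_iff₀ (by linarith)]
  linarith

end Derivatives

section Generators

variable {k k' : ℤ} {n n' j j' : ℕ} {Φ Ψ : ℂ → ℂ → ℂ → ℂ}

theorem Holo3.mul (h : Holo3 Φ) (h' : Holo3 Ψ) : Holo3 fun t a b => Φ t a b * Ψ t a b :=
  fun t a b ht => (h t a b ht).fun_mul (h' t a b ht)

theorem Holo3.add (h : Holo3 Φ) (h' : Holo3 Ψ) : Holo3 fun t a b => Φ t a b + Ψ t a b :=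
  fun t a b ht => (h t a b ht).fun_add (h' t a b ht)

theorem Holo3.const (c : ℂ) : Holo3 fun _ _ _ => c := fun _ _ _ _ => differentiableAt_const _

theorem Holo3.sub (h : Holo3 Φ) (h' : Holo3 Ψ) : Holo3 fun t a b => Φ t a b - Ψ t a b :=
  fun t a b ht => (h t a b ht).fun_sub (h' t a b ht)

theorem BddW.sub (h : BddW Φ) (h' : BddW Ψ) : BddW fun t a b => Φ t a b - Ψ t a b := by
  simpa [sub_eq_add_neg] using h.add ((BddW.const (-1)).mul h')

theorem holo3_kap : Holo3 fun t _ _ => kap t := fun t a b ht =>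
  DifferentiableAt.comp (g := kap) (f := Prod.fst) (t, a, b) (differentiableAt_kap ht)
    differentiableAt_fst

theorem bddW_kap : BddW fun t _ _ => kap t := by
  obtain ⟨C, Y, hC⟩ := kap_bdd
  exact fun R => ⟨C, Y, fun t _ _ ht hY _ _ => hC t ht hY⟩

/-- Forms of a single elliptic variable, from their laws in that variable. -/
theorem WJ.of_snd {f : ℂ → ℂ → ℂ} (hh : Holo3 fun t _ b => f t b) (hW : BddW fun t _ b => f t b)
    (hT : ∀ t b : ℂ, 0 < t.im → f (t + 1) b = f t b)
    (h1 : ∀ t b : ℂ, 0 < t.im → f t (b + 1) = (-1) ^ n * f t b)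
    (ht : ∀ t b : ℂ, 0 < t.im → f t (b + t) = ((-1) ^ n * ee (-(t / 2) - b) ^ n) * f t b)
    (hS : ∀ t b : ℂ, 0 < t.im → f (-1 / t) (b / t) = t ^ k * ee (b ^ 2 / (2 * t)) ^ n * f t b) :
    WJ k n 0 fun t _ b => f t b := by
  refine ⟨hh, fun t _ b => hT t b, fun t a b _ => rfl, fun t _ b => h1 t b, fun t a b _ => ?_,
    fun t a b h => ?_, fun t a b h => ?_, fun t a b _ => rfl, hW⟩
  · simp [ee_zero]
  · rw [ht t b h, ← ee_nat_mul]
    congr 3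
    push_cast; ring
  · rw [hS t b h, ← ee_nat_mul]
    congr 3
    push_cast; ring

theorem sg_S' {t : ℂ} (ht : 0 < t.im) (b : ℂ) :
    sg (-1 / t) (b / t) = ee (b ^ 2 / (2 * t)) * (t⁻¹ * sg t b) := by
  rw [sg_S ht]; ring

/-- The form of weight zero and index two of one elliptic variable. -/
def fP (t b : ℂ) : ℂ := sg₁ t b ^ 2 - sg t b * sg₂ t b + kap t * sg t b ^ 2

theorem wj_fP : WJ 0 2 0 fun t _ b => fP t b := by
  have hs := holo3_sg.mul holo3_sg
  have hs' := bddW_sg.mul bddW_sg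
  refine WJ.of_snd ?_ ?_ ?_ ?_ ?_ ?_
  · exact (((holo3_sg₁.mul holo3_sg₁).sub (holo3_sg.mul holo3_sg₂)).add (holo3_kap.mul hs)).congr
      fun t a b _ => by simp only [fP]; ring
  · have := ((bddW_sg₁.mul bddW_sg₁).sub (bddW_sg.mul bddW_sg₂)).add (bddW_kap.mul hs')
    simpa only [fP, sq] using this
  · intro t b ht
    rw [fP, fP, sg_T, sg₁_T, sg₂_T, kap_T ht]
  · intro t b ht
    rw [fP, fP, sg_add_one, sg₁_add_one, sg₂_add_one]; ring
  · intro t b ht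
    rw [fP, fP, sg_add ht, sg₁_add ht, sg₂_add ht]; ring
  · intro t b ht
    have h0 := ne_zero_of_im_pos ht
    rw [fP, fP, sg_S' ht, sg₁_S ht, sg₂_S ht, kap_S ht, zpow_zero]
    field_simp
    ring

theorem fP_zero {t : ℂ} (ht : 0 < t.im) : fP t 0 = 1 := by
  simp [fP, sg_zero, sg₁_zero ht]

/-- The derivative of `fP` in the elliptic variable. -/
def fP₁ (t b : ℂ) : ℂ := deriv (fP t) b

theorem hasDerivAt_fP {t : ℂ} (ht : 0 < t.im) (b : ℂ) : HasDerivAt (fP t) (fP₁ t b) b :=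
  (Holo3.differentiable_snd wj_fP.holo3 ht b).hasDerivAt

theorem holo3_fP₁ : Holo3 fun t _ b => fP₁ t b := Holo3.deriv wj_fP.holo3
theorem bddW_fP₁ : BddW fun t _ b => fP₁ t b := BddW.deriv wj_fP.W wj_fP.holo3

theorem fP_T {t : ℂ} (ht : 0 < t.im) (b : ℂ) : fP (t + 1) b = fP t b := wj_fP.T t 0 b ht

theorem fP_add_one {t : ℂ} (ht : 0 < t.im) (b : ℂ) : fP t (b + 1) = fP t b := by
  simpa using wj_fP.B t 0 b ht

theorem fP_add {t : ℂ} (ht : 0 < t.im) (b : ℂ) : fP t (b + t) = ee (-(t / 2) - b) ^ 2 * fP t b := by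
  have := wj_fP.HB t 0 b ht
  rw [this, ← ee_nat_mul, add_zero, neg_one_sq, one_mul]
  congr 2
  push_cast; ring

theorem fP_S {t : ℂ} (ht : 0 < t.im) (b : ℂ) :
    fP (-1 / t) (b / t) = ee (b ^ 2 / (2 * t)) ^ 2 * fP t b := by
  have := wj_fP.S t 0 b ht
  rw [this, ← ee_nat_mul, zpow_zero, one_mul]
  congr 2
  push_cast; ring

theorem fP₁_T {t : ℂ} (ht : 0 < t.im) (b : ℂ) : fP₁ (t + 1) b = fP₁ t b := by
  rw [fP₁, fP₁, show fP (t + 1) = fP t from funext fun b => fP_T ht b]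

theorem fP₁_add_one {t : ℂ} (ht : 0 < t.im) (b : ℂ) : fP₁ t (b + 1) = fP₁ t b := by
  have h : (fun b => fP t (b + 1)) = fP t := funext fun b => fP_add_one ht b
  rw [fP₁, fP₁, ← deriv_comp_add_const, h]

theorem fP₁_add {t : ℂ} (ht : 0 < t.im) (b : ℂ) : fP₁ t (b + t) =
    ee (-(t / 2) - b) ^ 2 * (fP₁ t b - 4 * Real.pi * Complex.I * fP t b) := by
  have := deriv_quasi_period (c := 1) (d := -t) (m := 2) (hasDerivAt_fP ht b)
    (fun b => by rw [fP_add ht, one_mul, ← ee_nat_mul]; congr 2; push_cast; ring)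
    (hasDerivAt_fP ht (b + t)) rfl
  rw [this, ← ee_nat_mul, show ((2 : ℕ) : ℂ) * (-(t / 2) - b) = -t - 2 * b by push_cast; ring]
  ring

theorem fP₁_S {t : ℂ} (ht : 0 < t.im) (b : ℂ) : fP₁ (-1 / t) (b / t) =
    t * ee (b ^ 2 / (2 * t)) ^ 2 * (fP₁ t b + 2 * (2 * Real.pi * Complex.I / t * b) * fP t b) := by
  have h0 := ne_zero_of_im_pos ht
  have := deriv_inversion (c := 1) (m := 2) h0 (hasDerivAt_fP ht b)
    (fun b => by rw [fP_S ht, one_mul, ← ee_nat_mul]; congr 2; push_cast; ring)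
    (hasDerivAt_fP (im_neg_one_div ht) (b / t)) rfl
  rw [this, ← ee_nat_mul, show ((2 : ℕ) : ℂ) * (b ^ 2 / (2 * t)) = 2 * b ^ 2 / (2 * t) by
    push_cast; ring]
  ring

/-- The form of weight zero and index three of one elliptic variable. -/
def fR (t b : ℂ) : ℂ := sg t b * fP₁ t b - 2 * sg₁ t b * fP t b

theorem wj_fR : WJ 0 3 0 fun t _ b => fR t b := by
  refine WJ.of_snd ?_ ?_ ?_ ?_ ?_ ?_
  · exact (holo3_sg.mul holo3_fP₁).sub (((Holo3.const 2).mul holo3_sg₁).mul wj_fP.holo3)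
  · exact (bddW_sg.mul bddW_fP₁).sub (((BddW.const 2).mul bddW_sg₁).mul wj_fP.W)
  · intro t b ht
    rw [fR, fR, sg_T, sg₁_T, fP_T ht, fP₁_T ht]
  · intro t b ht
    rw [fR, fR, sg_add_one, sg₁_add_one, fP_add_one ht, fP₁_add_one ht]; ring
  · intro t b ht
    rw [fR, fR, sg_add ht, sg₁_add ht, fP_add ht, fP₁_add ht]; ring
  · intro t b ht
    have h0 := ne_zero_of_im_pos ht
    rw [fR, fR, sg_S' ht, sg₁_S ht, fP_S ht, fP₁_S ht, zpow_zero]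
    field_simp
    ring

theorem fR_zero {t : ℂ} (ht : 0 < t.im) : fR t 0 = -2 := by
  simp [fR, sg_zero, sg₁_zero ht, fP_zero ht]

/-- The form of weight `-2` and index `(1, 1)`. -/
def fD (t a b : ℂ) : ℂ :=
  sg₁ t a * (sg t b * sg t (a + b)) + sg t a * (sg₁ t b * sg t (a + b)) -
    sg t a * (sg t b * sg₁ t (a + b))

theorem Holo3.comp_fst {f : ℂ → ℂ → ℂ} (h : Holo3 fun t _ b => f t b) : Holo3 fun t a _ => f t a :=
  fun t a b ht => h.comp (f₁ := fun p : ℂ × ℂ × ℂ => p.1) (f₂ := fun _ => 0) (f₃ := fun p => p.2.1)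
    (x := (t, a, b)) ht (by fun_prop) (by fun_prop) (by fun_prop)

theorem Holo3.comp_add {f : ℂ → ℂ → ℂ} (h : Holo3 fun t _ b => f t b) :
    Holo3 fun t a b => f t (a + b) :=
  fun t a b ht => h.comp (f₁ := fun p : ℂ × ℂ × ℂ => p.1) (f₂ := fun _ => 0)
    (f₃ := fun p => p.2.1 + p.2.2) (x := (t, a, b)) ht (by fun_prop) (by fun_prop) (by fun_prop)

theorem BddW.comp_fst {f : ℂ → ℂ → ℂ} (h : BddW fun t _ b => f t b) : BddW fun t a _ => f t a :=
  h.comp (f := fun a _ => a) (g := fun a _ => a) fun R => ⟨R, fun _ _ h _ => ⟨h, h⟩⟩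

theorem BddW.comp_add {f : ℂ → ℂ → ℂ} (h : BddW fun t _ b => f t b) :
    BddW fun t a b => f t (a + b) :=
  h.comp (f := fun a b => a + b) (g := fun a b => a + b) fun R => ⟨R + R, fun _ _ h h' =>
    ⟨(norm_add_le _ _).trans (add_le_add h h'), (norm_add_le _ _).trans (add_le_add h h')⟩⟩

theorem wj_fD : WJ (-2) 1 1 fD := by
  refine ⟨?_, ?_, ?_, ?_, ?_, ?_, ?_, ?_, ?_⟩
  · exact ((holo3_sg₁.comp_fst.mul (holo3_sg.mul holo3_sg.comp_add)).add
      (holo3_sg.comp_fst.mul (holo3_sg₁.mul holo3_sg.comp_add))).sub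
      (holo3_sg.comp_fst.mul (holo3_sg.mul holo3_sg₁.comp_add))
  · intro t a b ht
    simp only [fD, sg_T, sg₁_T]
  · intro t a b ht
    rw [fD, fD, add_right_comm, sg_add_one, sg_add_one, sg₁_add_one, sg₁_add_one]; ring
  · intro t a b ht
    rw [fD, fD, ← add_assoc, sg_add_one, sg_add_one, sg₁_add_one, sg₁_add_one]; ring
  · intro t a b ht
    rw [fD, fD, add_right_comm, sg_add ht, sg_add ht, sg₁_add ht, sg₁_add ht,
      show -(((1 : ℕ) : ℂ) * (t + 2 * a + b)) = (-(t / 2) - a) + (-(t / 2) - (a + b)) by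
        push_cast; ring, ee_add]
    ring
  · intro t a b ht
    rw [fD, fD, ← add_assoc, sg_add ht, sg_add ht, sg₁_add ht, sg₁_add ht,
      show -(((1 : ℕ) : ℂ) * (t / 2 + b) + ((1 : ℕ) : ℂ) * (t / 2 + a + b)) =
        (-(t / 2) - b) + (-(t / 2) - (a + b)) by push_cast; ring, ee_add]
    ring
  · intro t a b ht
    have h0 := ne_zero_of_im_pos ht
    rw [fD, fD, ← add_div, sg_S' ht, sg_S' ht, sg_S' ht, sg₁_S ht, sg₁_S ht, sg₁_S ht,
      show (((1 : ℕ) : ℂ) * b ^ 2 + ((1 : ℕ) : ℂ) * (a ^ 2 + (a + b) ^ 2)) / (2 * t) =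
        b ^ 2 / (2 * t) + (a ^ 2 / (2 * t) + (a + b) ^ 2 / (2 * t)) by push_cast; ring, ee_add, ee_add,
      show (t ^ (-2 : ℤ)) = t⁻¹ * t⁻¹ by rw [← _root_.zpow_neg_one, ← zpow_add₀ h0]; norm_num]
    field_simp
    ring
  · intro t a b ht
    rw [fD, fD, show -a - b = -(a + b) by ring, show -(a + b) + b = -a by ring, sg_neg, sg_neg,
      sg₁_neg, sg₁_neg]
    ring
  · exact ((bddW_sg₁.comp_fst.mul (bddW_sg.mul bddW_sg.comp_add)).add
      (bddW_sg.comp_fst.mul (bddW_sg₁.mul bddW_sg.comp_add))).sub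
      (bddW_sg.comp_fst.mul (bddW_sg.mul bddW_sg₁.comp_add))

theorem fA_zero_left (t b : ℂ) : fA t 0 b = 0 := by simp [fA, sg_zero]

theorem fA_zero_right (t a : ℂ) : fA t a 0 = sg t a ^ 2 := by rw [fA, add_zero, sq]

theorem fD_zero_left {t : ℂ} (ht : 0 < t.im) (b : ℂ) : fD t 0 b = sg t b ^ 2 := by
  simp [fD, sg_zero, sg₁_zero ht, sq]

theorem fD_zero_right {t : ℂ} (ht : 0 < t.im) (a : ℂ) : fD t a 0 = sg t a ^ 2 := by
  simp [fD, sg_zero, sg₁_zero ht, sq]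

theorem sg_ne_zero_eq {t : ℂ} (ht : 0 < t.im) {f g : ℂ → ℂ} (hf : Differentiable ℂ f)
    (hg : Differentiable ℂ g) (h : ∀ b, sg t b * f b = sg t b * g b) (b : ℂ) : f b = g b :=
  eq_of_sg_mul_eq ht (c := 0) hf.continuous.continuousAt hg.continuous.continuousAt fun x => by
    simpa using h x

theorem WJ.differentiable_zero_left (h : WJ k n j Φ) {t : ℂ} (ht : 0 < t.im) :
    Differentiable ℂ fun b => Φ t 0 b := fun b =>
  h.holo3.comp (f₁ := fun _ => t) (f₂ := fun _ => 0) (f₃ := fun b => b) ht (by fun_prop)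
    (by fun_prop) (by fun_prop)

/-- The seven Jacobi forms of index `(3, 1)` with their restrictions to `a = 0`. -/
theorem exists_fY : ∃ Y, WJ 0 1 1 Y ∧ ∀ t b : ℂ, 0 < t.im → Y t 0 b = fP t b := by
  obtain ⟨Y₁, h1, e1⟩ := WJ.exists_div_sg (k := -2) (n := 2) (j := 1)
    (Φ := fun t a b => fP t b * fD t a b + 1 / 2 * (fA t a b * fR t b))
    ((wj_fP.mul wj_fD).cast (by norm_num) (by norm_num) (by norm_num) |>.add
      (((wj_fA.mul wj_fR).cast (by norm_num) (by norm_num) (by norm_num)).smul (1 / 2)))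
    fun t a ht => by rw [fP_zero ht, fR_zero ht, fA_zero_right, fD_zero_right ht]; ring
  obtain ⟨Y, h2, e2⟩ := WJ.exists_div_sg (n := 1) h1 fun t a ht => by
    have h3 := h1.neg a 0 ht
    have h4 := h1.sig t a 0 ht
    rw [neg_zero] at h3
    rw [sub_zero, h3] at h4
    norm_num at h4
    linear_combination -1 / 2 * h4
  refine ⟨Y, h2.cast (by norm_num) rfl rfl, fun t b ht => ?_⟩
  refine sg_ne_zero_eq ht (h2.differentiable_zero_left ht) (wj_fP.differentiable_zero_left ht) ?_ b
  refine sg_ne_zero_eq ht ?_ ?_ fun b => ?_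
  · exact (wj_sg.differentiable_zero_left ht).mul (h2.differentiable_zero_left ht)
  · exact (wj_sg.differentiable_zero_left ht).mul (wj_fP.differentiable_zero_left ht)
  · rw [← e2 t 0 b ht, ← e1 t 0 b ht, fA_zero_left, fD_zero_left ht]; ring

theorem exists_fX₅ : ∃ X, WJ (-1) 3 1 X ∧ ∀ t b : ℂ, 0 < t.im → X t 0 b = sg t b * fR t b := by
  obtain ⟨X, h1, e1⟩ := WJ.exists_div_sg (k := -2) (n := 3) (j := 1)
    (Φ := fun t a b => fR t b * fD t a b + 2 * (fA t a b * (fP t b * fP t b)))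
    ((wj_fR.mul wj_fD).cast (by norm_num) (by norm_num) (by norm_num) |>.add
      (((wj_fA.mul (wj_fP.mul wj_fP)).cast (by norm_num) (by norm_num) (by norm_num)).smul 2))
    fun t a ht => by rw [fP_zero ht, fR_zero ht, fA_zero_right, fD_zero_right ht]; ring
  refine ⟨X, h1.cast (by norm_num) rfl rfl, fun t b ht => ?_⟩
  refine sg_ne_zero_eq ht (h1.differentiable_zero_left ht)
    ((wj_sg.differentiable_zero_left ht).mul (wj_fR.differentiable_zero_left ht)) (fun b => ?_) b
  rw [← e1 t 0 b ht, fA_zero_left, fD_zero_left ht]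
  simp only [Pi.mul_apply]
  ring

end Generators

section Recursion

/-- The weights of the seven generators of index one. -/
def genWt : Fin 7 → ℤ := ![-5, -4, -3, -2, -2, -1, 0]

/-- The forms generated over modular forms by a family of seven Jacobi forms. -/
inductive GenJ (X : Fin 7 → ℂ → ℂ → ℂ → ℂ) : ℤ → ℕ → (ℂ → ℂ → ℂ → ℂ) → Prop
  | zero (k m) : GenJ X k m fun _ _ _ => 0
  | add {k m φ ψ} : GenJ X k m φ → GenJ X k m ψ → GenJ X k m fun t a b => φ t a b + ψ t a b
  | mul {k k' m m' φ ψ} : GenJ X k m φ → GenJ X k' m' ψ →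
      GenJ X (k + k') (m + m') fun t a b => φ t a b * ψ t a b
  | mf {k f} : MF k f → GenJ X k 0 fun t _ _ => f t
  | gen (i) : GenJ X (genWt i) 1 (X i)
  | congr {k m φ ψ} : GenJ X k m φ → (∀ t a b : ℂ, 0 < t.im → ψ t a b = φ t a b) → GenJ X k m ψ

variable {X : Fin 7 → ℂ → ℂ → ℂ → ℂ} {k k' : ℤ} {m m' n n' i j : ℕ} {Φ Ψ : ℂ → ℂ → ℂ → ℂ}

theorem GenJ.cast (h : GenJ X k m Φ) (hk : k = k') (hm : m = m') : GenJ X k' m' Φ := by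
  subst hk hm; exact h

/-- A monomial of bidegree `(i, j)` in the generators, with prescribed restriction to `a = 0`. -/
def RepJ (X : Fin 7 → ℂ → ℂ → ℂ → ℂ) (i j α β q : ℕ) : Prop :=
  ∃ Φ, WJ (-q) (3 * (i + j)) j Φ ∧ GenJ X (-q - 2 * i) (i + j) (fun t a b => fA t a b ^ i * Φ t a b) ∧
    ∀ t b : ℂ, 0 < t.im → Φ t 0 b = sg t b ^ q * fP t b ^ α * fR t b ^ β

theorem repJ_zero : RepJ X 0 0 0 0 0 :=
  ⟨fun _ _ _ => 1, (MF.const 1).wj, ((GenJ.mf (MF.const 1)).congr fun t a b _ => by simp).cast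
    (by simp) rfl, fun t b _ => by simp⟩

theorem RepJ.bottom {α β q α' β' q' : ℕ} {x : ℂ → ℂ → ℂ → ℂ} (h : RepJ X i j α β q) (l : Fin 7)
    (hx : WJ (-q') 3 0 x) (hl : genWt l = -q' - 2)
    (he : ∀ t a b : ℂ, 0 < t.im → X l t a b = x t a b * fA t a b)
    (hr : ∀ t b : ℂ, 0 < t.im → x t 0 b = sg t b ^ q' * fP t b ^ α' * fR t b ^ β') :
    RepJ X (i + 1) j (α + α') (β + β') (q + q') := by
  obtain ⟨Φ, h1, h2, h3⟩ := h
  refine ⟨_, (h1.mul hx).cast (by push_cast; ring) (by ring) (by ring),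
    ((h2.mul (GenJ.gen l)).cast (by rw [hl]; push_cast; ring) (by ring)).congr fun t a b ht => ?_,
    fun t b ht => ?_⟩
  · rw [he t a b ht]; ring
  · rw [h3 t b ht, hr t b ht]; ring

theorem RepJ.top {α β q α' β' q' : ℕ} (h : RepJ X i j α β q) (l : Fin 7)
    (hx : WJ (genWt l) 3 1 (X l)) (hl : genWt l = -q')
    (hr : ∀ t b : ℂ, 0 < t.im → X l t 0 b = sg t b ^ q' * fP t b ^ α' * fR t b ^ β') :
    RepJ X i (j + 1) (α + α') (β + β') (q + q') := by
  obtain ⟨Φ, h1, h2, h3⟩ := h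
  refine ⟨_, (h1.mul hx).cast (by rw [hl]; push_cast; ring) (by ring) (by ring),
    ((h2.mul (GenJ.gen l)).cast (by rw [hl]; push_cast; ring) (by ring)).congr fun t a b ht => ?_,
    fun t b ht => ?_⟩
  · ring
  · rw [h3 t b ht, hr t b ht]; ring

/-- The properties of the seven generating Jacobi forms used by the recursion. -/
structure IsGen (X : Fin 7 → ℂ → ℂ → ℂ → ℂ) : Prop where
  wj : ∀ i, WJ (genWt i) 3 1 (X i)
  eq₀ : ∀ t a b : ℂ, 0 < t.im → X 0 t a b = sg t b ^ 3 * fA t a b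
  eq₂ : ∀ t a b : ℂ, 0 < t.im → X 2 t a b = sg t b * fP t b * fA t a b
  eq₃ : ∀ t a b : ℂ, 0 < t.im → X 3 t a b = fR t b * fA t a b
  res₁ : ∀ t b : ℂ, 0 < t.im → X 1 t 0 b = sg t b ^ 4
  res₄ : ∀ t b : ℂ, 0 < t.im → X 4 t 0 b = sg t b ^ 2 * fP t b
  res₅ : ∀ t b : ℂ, 0 < t.im → X 5 t 0 b = sg t b * fR t b
  res₆ : ∀ t b : ℂ, 0 < t.im → X 6 t 0 b = fP t b ^ 2

theorem wj_sg_cube : WJ (-3) 3 0 fun t _ b => sg t b ^ 3 := (wj_sg.pow_one 3).cast (by norm_num) rfl rfl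

theorem wj_sg_mul_fP : WJ (-1) 3 0 fun t _ b => sg t b * fP t b :=
  (wj_sg.mul wj_fP).cast (by norm_num) rfl rfl

theorem exists_isGen : ∃ X, IsGen X := by
  obtain ⟨Y, hY, eY⟩ := exists_fY
  obtain ⟨X₅, h5, e5⟩ := exists_fX₅
  refine ⟨![fun t a b => sg t b ^ 3 * fA t a b, fun t a b => sg t b ^ 2 * fD t a b,
    fun t a b => sg t b * fP t b * fA t a b, fun t a b => fR t b * fA t a b,
    fun t a b => fP t b * fD t a b, X₅, fun t a b => fP t b * Y t a b], ?_, ?_, ?_, ?_, ?_, ?_, ?_, ?_⟩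
  · intro i
    fin_cases i
    · exact (wj_sg_cube.mul wj_fA).cast (by norm_num [genWt]) rfl rfl
    · exact ((wj_sg.pow_one 2).mul wj_fD).cast (by norm_num [genWt]) rfl rfl
    · exact (wj_sg_mul_fP.mul wj_fA).cast (by norm_num [genWt]) rfl rfl
    · exact (wj_fR.mul wj_fA).cast (by norm_num [genWt]) rfl rfl
    · exact (wj_fP.mul wj_fD).cast (by norm_num [genWt]) rfl rfl
    · exact h5
    · exact (wj_fP.mul hY).cast (by norm_num [genWt]) rfl rfl
  · intro t a b ht; rfl
  · intro t a b ht; rfl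
  · intro t a b ht; rfl
  · intro t b ht
    change sg t b ^ 2 * fD t 0 b = _
    rw [fD_zero_left ht]; ring
  · intro t b ht
    change fP t b * fD t 0 b = _
    rw [fD_zero_left ht]; ring
  · exact e5
  · intro t b ht
    change fP t b * Y t 0 b = _
    rw [eY t b ht]; ring

theorem IsGen.exists_rep (hX : IsGen X) (i j P q : ℕ) (h1 : P ≠ 1) (hq : P + q = 3 * i + 4 * j) :
    ∃ α β, 2 * α + 3 * β = P ∧ RepJ X i j α β q := by
  induction i generalizing P q with
  | zero =>
    induction j generalizing P q with
    | zero =>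
      obtain rfl : P = 0 := by omega
      obtain rfl : q = 0 := by omega
      exact ⟨0, 0, rfl, repJ_zero⟩
    | succ j ih =>
      obtain h | h | h | h : (P ≠ 1 ∧ 4 ≤ q) ∨ (2 ≤ P ∧ P - 2 ≠ 1 ∧ 2 ≤ q) ∨
        (3 ≤ P ∧ P - 3 ≠ 1 ∧ 1 ≤ q) ∨ (4 ≤ P ∧ P - 4 ≠ 1) := by omega
      · obtain ⟨α, β, h2, h3⟩ := ih P (q - 4) h.1 (by omega)
        refine ⟨α + 0, β + 0, by omega, ?_⟩
        rw [show q = q - 4 + 4 by omega]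
        exact h3.top 1 (hX.wj 1) rfl fun t b ht => by rw [hX.res₁ t b ht]; ring
      · obtain ⟨α, β, h2, h3⟩ := ih (P - 2) (q - 2) h.2.1 (by omega)
        refine ⟨α + 1, β + 0, by omega, ?_⟩
        rw [show q = q - 2 + 2 by omega]
        exact h3.top 4 (hX.wj 4) rfl fun t b ht => by rw [hX.res₄ t b ht]; ring
      · obtain ⟨α, β, h2, h3⟩ := ih (P - 3) (q - 1) h.2.1 (by omega)
        refine ⟨α + 0, β + 1, by omega, ?_⟩
        rw [show q = q - 1 + 1 by omega]
        exact h3.top 5 (hX.wj 5) rfl fun t b ht => by rw [hX.res₅ t b ht]; ring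
      · obtain ⟨α, β, h2, h3⟩ := ih (P - 4) q h.2 (by omega)
        refine ⟨α + 2, β + 0, by omega, ?_⟩
        exact h3.top (q' := 0) 6 (hX.wj 6) rfl fun t b ht => by rw [hX.res₆ t b ht]; ring
  | succ i ih =>
    obtain h | h | h : (P ≠ 1 ∧ 3 ≤ q) ∨ (2 ≤ P ∧ P - 2 ≠ 1 ∧ 1 ≤ q) ∨ (3 ≤ P ∧ P - 3 ≠ 1) := by omega
    · obtain ⟨α, β, h2, h3⟩ := ih P (q - 3) h.1 (by omega)
      refine ⟨α + 0, β + 0, by omega, ?_⟩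
      rw [show q = q - 3 + 3 by omega]
      exact h3.bottom (q' := 3) 0 wj_sg_cube rfl hX.eq₀ fun t b ht => by ring
    · obtain ⟨α, β, h2, h3⟩ := ih (P - 2) (q - 1) h.2.1 (by omega)
      refine ⟨α + 1, β + 0, by omega, ?_⟩
      rw [show q = q - 1 + 1 by omega]
      exact h3.bottom (q' := 1) 2 wj_sg_mul_fP rfl hX.eq₂ fun t b ht => by ring
    · obtain ⟨α, β, h2, h3⟩ := ih (P - 3) q h.2 (by omega)
      refine ⟨α + 0, β + 1, by omega, ?_⟩
      exact h3.bottom (q' := 0) 3 wj_fR rfl hX.eq₃ fun t b ht => by ring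

theorem neg_one_zpow_eq_or (k : ℤ) : ((-1 : ℂ) ^ k = 1) ∨ ((-1 : ℂ) ^ k = -1) := by
  rcases Int.even_or_odd k with h | h
  · exact Or.inl h.neg_one_zpow
  · exact Or.inr h.neg_one_zpow

/-- A form of index one in one elliptic variable vanishes at the origin. -/
theorem WJ.zero_of_index_one (h : WJ k 1 0 Φ) {t : ℂ} (ht : 0 < t.im) : Φ t 0 0 = 0 := by
  have hn := fun b => h.neg (t := t) 0 b ht
  simp only [neg_zero] at hn
  rcases neg_one_zpow_eq_or k with hk | hk
  · rw [hk] at hn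
    set f : ℂ → ℂ := fun b => Φ t 0 (b + 1 / 2) with hf
    have hd : Differentiable ℂ f := fun b =>
      (h.differentiable_zero_left ht (b + 1 / 2)).comp b (by fun_prop)
    have f1 : ∀ b, f (b + 1) = -f b := fun b => by
      have := h.B t 0 (b + 1 / 2) ht
      rw [hf]
      simp only
      rw [show b + 1 + 1 / 2 = b + 1 / 2 + 1 by ring, this]; ring
    have ft : ∀ b, f (b + t) = ee (-(t / 2) - b) * f b := fun b => by
      have := h.HB t 0 (b + 1 / 2) ht
      rw [hf]
      simp only
      rw [show b + t + 1 / 2 = b + 1 / 2 + t by ring, this,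
        show -(((1 : ℕ) : ℂ) * (t / 2 + (b + 1 / 2)) + ((0 : ℕ) : ℂ) * (t / 2 + 0 + (b + 1 / 2))) =
          -(t / 2) - b + -(1 / 2) by push_cast; ring, ee_add, ee_neg (1 / 2), ee_half]
      ring
    have f0 : f 0 = 0 := by
      have h1 := h.B t 0 (-(1 / 2)) ht
      have h2 := hn (1 / 2)
      rw [h2] at h1
      simp only [hf, zero_add]
      rw [show (-(1 / 2) + 1 : ℂ) = 1 / 2 by norm_num] at h1
      norm_num at h1 ⊢
      linear_combination (1 / 2) * h1
    have fh : f (-(1 / 2)) = Φ t 0 0 := by simp [hf]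
    clear_value f
    obtain ⟨g, hg, he⟩ := exists_div_of_simple_zeros (E := ℂ) (U := Set.univ) isOpen_univ
      (f := fun _ b => f b) (g := fun _ b => sg t b)
      (fun p _ => (hd p.2).comp p (by fun_prop)) (fun p _ => (differentiable_sg ht p.2).comp p (by fun_prop))
      (fun p _ hp => ⟨sg_int_mul_add ht f0 (fun b => by rw [f1]; simp)
        (fun b => by rw [ft]; simp [ee_ne_zero]) hp, (sg_eq_zero ht hp).2⟩)
    have hgd : Differentiable ℂ (g 0) := fun b =>
      DifferentiableAt.comp (g := fun p : ℂ × ℂ => g p.1 p.2) (f := fun b => (0, b)) b (hg (0,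
          b) trivial)
        (by fun_prop)
    have hge : ∀ b, f b = sg t b * g 0 b := fun b => he (0, b) trivial
    have g1 : ∀ b, g 0 (b + 1) = g 0 b := sg_ne_zero_eq ht (hgd.comp (by fun_prop)) hgd fun b => by
      have := f1 b
      rw [hge, hge, sg_add_one] at this
      linear_combination -this
    have gt : ∀ b, g 0 (b + t) = -g 0 b :=
      sg_ne_zero_eq ht (hgd.comp (by fun_prop)) hgd.neg fun b => by
      have := ft b
      rw [hge, hge, sg_add ht] at this
      refine mul_left_cancel₀ (ee_ne_zero (-(t / 2) - b)) ?_
      linear_combination -this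
    have g2 : g 0 (-(1 / 2)) = 0 := by
      have h1 := eq_of_lattice_periodic ht hgd (fun b => by rw [g1]) (fun b => by rw [gt, norm_neg])
        (-(1 / 2) + t) (-(1 / 2))
      rw [gt] at h1
      linear_combination -(1 / 2) * h1
    have h3 := hge (-(1 / 2))
    rwa [g2, mul_zero, fh] at h3
  · have := hn 0
    rw [hk, neg_zero] at this
    linear_combination (1 / 2) * this

theorem GenJ.mf_mul {f : ℂ → ℂ} (hf : MF k f) (h : GenJ X k' m Φ) :
    GenJ X (k + k') m fun t a b => f t * Φ t a b :=
  ((GenJ.mf hf).mul h).cast rfl (zero_add m)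

theorem IsGen.genJ_of_restrict (hX : IsGen X) {i j : ℕ}
    (base : ∀ (k : ℤ) (Φ : ℂ → ℂ → ℂ → ℂ), WJ k (3 * (i + j)) j Φ →
      (∀ t b : ℂ, 0 < t.im → Φ t 0 b = 0) →
      GenJ X (k - 2 * i) (i + j) fun t a b => fA t a b ^ i * Φ t a b)
    (P : ℕ) : ∀ (q : ℕ) (k : ℤ) (Φ : ℂ → ℂ → ℂ → ℂ) (h : ℂ → ℂ → ℂ), P + q = 3 * i + 4 * j →
      WJ k (3 * (i + j)) j Φ → WJ (k + q) P 0 (fun t _ b => h t b) →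
      (∀ t b : ℂ, 0 < t.im → Φ t 0 b = sg t b ^ q * h t b) →
      GenJ X (k - 2 * i) (i + j) fun t a b => fA t a b ^ i * Φ t a b := by
  induction P with
  | zero =>
    intro q k Φ h hq hΦ hh he
    obtain ⟨α, β, h2, Ψ, h3, h4, h5⟩ := hX.exists_rep i j 0 q (by omega) hq
    obtain ⟨rfl, rfl⟩ : α = 0 ∧ β = 0 := by omega
    have hf := hh.mf
    refine ((base k (fun t a b => Φ t a b - h t 0 * Ψ t a b) (hΦ.sub ((hf.wj.mul h3).cast (by ring)
      (by ring) (by ring))) fun t b ht => ?_).add ((h4.mf_mul hf).cast (by ring) rfl)).congr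
      fun t a b ht => by ring
    rw [he t b ht, h5 t b ht, hh.eq_const 0 b ht]; ring
  | succ P ih =>
    intro q k Φ h hq hΦ hh he
    have red : ∀ (Φ : ℂ → ℂ → ℂ → ℂ) (h : ℂ → ℂ → ℂ), WJ k (3 * (i + j)) j Φ →
        WJ (k + q) (P + 1) 0 (fun t _ b => h t b) →
        (∀ t b : ℂ, 0 < t.im → Φ t 0 b = sg t b ^ q * h t b) →
        (∀ t : ℂ, 0 < t.im → h t 0 = 0) →
        GenJ X (k - 2 * i) (i + j) fun t a b => fA t a b ^ i * Φ t a b := by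
      intro Φ h hΦ hh he h0
      obtain ⟨Q, hQ, eQ⟩ := hh.exists_div_sg fun t a ht => h0 t ht
      refine ih (q + 1) k Φ (fun t b => Q t 0 b) (by omega) hΦ (hQ.restrict.cast (by push_cast; ring)
        rfl rfl) fun t b ht => ?_
      rw [he t b ht, eQ t 0 b ht]; ring
    rcases eq_or_ne P 0 with rfl | hP
    · exact red Φ h hΦ hh he fun t ht => hh.zero_of_index_one ht
    obtain ⟨α, β, h2, Ψ, h3, h4, h5⟩ := hX.exists_rep i j (P + 1) q (by omega) hq
    have hf := hh.mf.smul ((-2 : ℂ) ^ β)⁻¹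
    refine ((red (fun t a b => Φ t a b - ((-2 : ℂ) ^ β)⁻¹ * h t 0 * Ψ t a b) (fun t b => h t b -
      ((-2 : ℂ) ^ β)⁻¹ * h t 0 * (fP t b ^ α * fR t b ^ β)) (hΦ.sub ((hf.wj.mul h3).cast (by ring)
      (by ring) (by ring))) (hh.sub ((hf.wj.mul ((wj_fP.pow_one α).mul (wj_fR.pow_one β))).cast
      (by ring) (by omega) (by ring))) (fun t b ht => ?_) fun t ht => ?_).add
      ((h4.mf_mul hf).cast (by ring) rfl)).congr fun t a b ht => by ring
    · rw [he t b ht, h5 t b ht]; ring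
    · rw [fP_zero ht, fR_zero ht, one_pow, one_mul, mul_right_comm, inv_mul_cancel₀ (by simp)]; ring

theorem IsGen.genJ_aux (hX : IsGen X) (j : ℕ) : ∀ (i : ℕ) (k : ℤ) (Φ : ℂ → ℂ → ℂ → ℂ),
    WJ k (3 * (i + j)) j Φ → GenJ X (k - 2 * i) (i + j) fun t a b => fA t a b ^ i * Φ t a b := by
  induction j with
  | zero =>
    intro i k Φ hΦ
    refine hX.genJ_of_restrict (fun k Φ hΦ h0 => (GenJ.zero _ _).congr fun t a b ht => ?_) _ 0 k Φ _
      rfl hΦ (hΦ.restrict.cast (by simp) (by ring) rfl) fun t b ht => by simp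
    rw [hΦ.eq_restrict a b ht, h0 t b ht, mul_zero]
  | succ j ih =>
    intro i k Φ hΦ
    refine hX.genJ_of_restrict (fun k Φ hΦ h0 => ?_) (3 * i + 4 * (j + 1)) 0 k Φ _
      rfl hΦ (hΦ.restrict.cast (by simp) (by ring) rfl) fun t b ht => by simp
    obtain ⟨Q, hQ, eQ⟩ := hΦ.exists_div_fA h0
    refine ((ih (i + 1) (k + 2) Q (hQ.cast rfl (by ring) rfl)).cast (by push_cast; ring)
      (by ring)).congr fun t a b ht => ?_
    rw [eQ t a b ht]; ring

/-- Every weak Jacobi form of index `m` is a polynomial in the seven forms of index one. -/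
theorem IsGen.genJ (hX : IsGen X) {m : ℕ} (h : WJ k (3 * m) m Φ) : GenJ X k m Φ :=
  ((hX.genJ_aux m 0 k Φ (h.cast rfl (by ring) rfl)).cast (by simp) (by ring)).congr
    fun t a b ht => by simp

end Recursion

section Hecke

variable {k : ℤ} {φ : ℂ → ℂ → ℂ → ℂ}

/-- The action of an integral matrix with rows `(p, q)` and `(r, s)` on functions of three
variables, of weight `k` and index one. -/
def slash (k : ℤ) (φ : ℂ → ℂ → ℂ → ℂ) (p q r s t a b : ℂ) : ℂ :=
  (r * t + s) ^ (-k) * ee (-((p * s - q * r) * r * NN a b / (r * t + s))) *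
    φ ((p * t + q) / (r * t + s)) ((p * s - q * r) * a / (r * t + s)) ((p * s - q * r) * b / (r * t + s))

theorem WJ.S_one (h : WJ k 3 1 φ) {t : ℂ} (a b : ℂ) (ht : 0 < t.im) :
    φ (-1 / t) (a / t) (b / t) = t ^ k * ee (NN a b / t) * φ t a b := by
  rw [h.S t a b ht, NN]
  congr 3
  field_simp
  push_cast
  ring

theorem slash_S_left (h : WJ k 3 1 φ) {p q r s t : ℂ} (a b : ℂ) (hj : r * t + s ≠ 0)
    (hj' : p * t + q ≠ 0) (ht : 0 < ((p * t + q) / (r * t + s)).im) :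
    slash k φ (-r) (-s) p q t a b = slash k φ p q r s t a b := by
  have h1 := h.S_one ((p * s - q * r) * a / (r * t + s)) ((p * s - q * r) * b / (r * t + s)) ht
  rw [slash, slash, show (-r * t + -s) / (p * t + q) = -1 / ((p * t + q) / (r * t + s)) by
      field_simp; ring,
    show (-r * q - -s * p) * a / (p * t + q) =
      (p * s - q * r) * a / (r * t + s) / ((p * t + q) / (r * t + s)) by field_simp; ring,
    show (-r * q - -s * p) * b / (p * t + q) =
      (p * s - q * r) * b / (r * t + s) / ((p * t + q) / (r * t + s)) by field_simp; ring, h1,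
    show -((p * s - q * r) * r * NN a b / (r * t + s)) = -((-r * q - -s * p) * p * NN a b / (p * t + q)) +
      NN ((p * s - q * r) * a / (r * t + s)) ((p * s - q * r) * b / (r * t + s)) /
        ((p * t + q) / (r * t + s)) by rw [NN, NN]; field_simp; ring, ee_add, _root_.zpow_neg,
    _root_.zpow_neg, div_zpow]
  have h2 := zpow_ne_zero k hj
  have h3 := zpow_ne_zero k hj'
  field_simp

theorem slash_T_left (h : WJ k 3 1 φ) {p q r s t : ℂ} (a b : ℂ) (hj : r * t + s ≠ 0)
    (ht : 0 < ((p * t + q) / (r * t + s)).im) :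
    slash k φ (p + r) (q + s) r s t a b = slash k φ p q r s t a b := by
  rw [slash, slash, show ((p + r) * t + (q + s)) / (r * t + s) = (p * t + q) / (r * t + s) + 1 by
    field_simp; ring, h.T _ _ _ ht, show (p + r) * s - (q + s) * r = p * s - q * r by ring]

theorem slash_S_right (k : ℤ) (φ : ℂ → ℂ → ℂ → ℂ) {p q r s t : ℂ} (a b : ℂ) (ht : t ≠ 0)
    (hj : s * t - r ≠ 0) :
    slash k φ p q r s (-1 / t) (a / t) (b / t) =
      t ^ k * ee ((p * s - q * r) * NN a b / t) * slash k φ q (-p) s (-r) t a b := by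
  have e : r * (-1 / t) + s = (s * t + -r) / t := by field_simp; ring
  have hj' : s * t + -r ≠ 0 := by rwa [← sub_eq_add_neg]
  rw [slash, slash, e, show (p * (-1 / t) + q) / ((s * t + -r) / t) = (q * t + -p) / (s * t + -r) by
      field_simp; ring,
    show (p * s - q * r) * (a / t) / ((s * t + -r) / t) = (q * -r - -p * s) * a / (s * t + -r) by
      field_simp; ring,
    show (p * s - q * r) * (b / t) / ((s * t + -r) / t) = (q * -r - -p * s) * b / (s * t + -r) by
      field_simp; ring,
    show -((p * s - q * r) * r * NN (a / t) (b / t) / ((s * t + -r) / t)) =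
      (p * s - q * r) * NN a b / t + -((q * -r - -p * s) * s * NN a b / (s * t + -r)) by
      rw [NN, NN]; field_simp; ring, ee_add, _root_.zpow_neg, _root_.zpow_neg, div_zpow]
  have h2 := zpow_ne_zero k ht
  have h3 := zpow_ne_zero k hj'
  field_simp

theorem slash_T_right (k : ℤ) (φ : ℂ → ℂ → ℂ → ℂ) (p q r s t a b : ℂ) :
    slash k φ p q r s (t + 1) a b = slash k φ p (p + q) r (r + s) t a b := by
  rw [slash, slash]
  ring_nf

theorem int_mul_add_ne_zero {t : ℂ} (ht : 0 < t.im) {r s : ℤ} (h : r ≠ 0 ∨ s ≠ 0) :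
    (r : ℂ) * t + s ≠ 0 := by
  intro h0
  have h1 := congrArg Complex.im h0
  simp at h1
  rcases h1 with h1 | h1
  · subst h1
    simp at h0
    omega
  · exact absurd h1 ht.ne'

theorem im_moebius_pos {t : ℂ} (ht : 0 < t.im) {p q r s : ℤ} (h : 0 < p * s - q * r) :
    0 < (((p : ℂ) * t + q) / (r * t + s)).im := by
  have hj : (r : ℂ) * t + s ≠ 0 := int_mul_add_ne_zero ht (by
    by_contra! h'
    simp [h'] at h)
  have h1 := Complex.normSq_pos.mpr hj
  have h' : (0 : ℝ) < p * s - q * r := by exact_mod_cast h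
  rw [Complex.div_im, ← sub_div]
  refine div_pos ?_ h1
  simp
  nlinarith

/-- The action of an integral matrix. -/
def mslash (k : ℤ) (φ : ℂ → ℂ → ℂ → ℂ) (M : Matrix (Fin 2) (Fin 2) ℤ) (t a b : ℂ) : ℂ :=
  slash k φ (M 0 0) (M 0 1) (M 1 0) (M 1 1) t a b

variable {m : ℤ}

theorem FixedDetMatrix.det_eq (A : FixedDetMatrix (Fin 2) ℤ m) :
    A.1 0 0 * A.1 1 1 - A.1 0 1 * A.1 1 0 = m := by
  rw [← Matrix.det_fin_two, A.2]

theorem mslash_S (h : WJ k 3 1 φ) (hm : 0 < m) (A : FixedDetMatrix (Fin 2) ℤ m) {t : ℂ} (a b : ℂ)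
    (ht : 0 < t.im) : mslash k φ (ModularGroup.S • A).1 t a b = mslash k φ A.1 t a b := by
  have hd := A.det_eq
  have h1 : (ModularGroup.S • A).1 = !![-A.1 1 0, -A.1 1 1; A.1 0 0, A.1 0 1] := by
    rw [FixedDetMatrices.smul_coe]
    ext i j
    fin_cases i <;> fin_cases j <;> simp [ModularGroup.S, Matrix.mul_apply, Fin.sum_univ_two]
  have := slash_S_left h (p := A.1 0 0) (q := A.1 0 1) (r := A.1 1 0) (s := A.1 1 1) a b
    (int_mul_add_ne_zero ht ?_) (int_mul_add_ne_zero ht ?_) (im_moebius_pos ht (by omega))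
  · rw [mslash, h1, mslash, ← this]
    simp
  all_goals
    by_contra! h'
    simp [h'] at hd
    omega

theorem mslash_T (h : WJ k 3 1 φ) (hm : 0 < m) (A : FixedDetMatrix (Fin 2) ℤ m) {t : ℂ} (a b : ℂ)
    (ht : 0 < t.im) : mslash k φ (ModularGroup.T • A).1 t a b = mslash k φ A.1 t a b := by
  have hd := A.det_eq
  have h1 : (ModularGroup.T • A).1 = !![A.1 0 0 + A.1 1 0, A.1 0 1 + A.1 1 1; A.1 1 0,
      A.1 1 1] := by
    rw [FixedDetMatrices.smul_coe]
    ext i j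
    fin_cases i <;> fin_cases j <;> simp [ModularGroup.T, Matrix.mul_apply, Fin.sum_univ_two]
  have := slash_T_left h (p := A.1 0 0) (q := A.1 0 1) (r := A.1 1 0) (s := A.1 1 1) a b
    (int_mul_add_ne_zero ht ?_) (im_moebius_pos ht (by omega))
  · rw [mslash, h1, mslash, ← this]
    simp
  · by_contra! h'
    simp [h'] at hd
    omega

/-- Forms of index one are invariant under the modular group. -/
theorem WJ.mslash_eq (h : WJ k 3 1 φ) (A : FixedDetMatrix (Fin 2) ℤ 1) {t : ℂ} (a b : ℂ)
    (ht : 0 < t.im) : mslash k φ A.1 t a b = φ t a b := by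
  refine FixedDetMatrices.induction_on (C := fun A => mslash k φ A.1 t a b = φ t a b) (A := A)
    one_ne_zero (fun A h1 h2 h3 h4 => ?_) (fun B hB => ?_) (fun B hB => ?_)
  · rw [FixedDetMatrices.reps_one_id A h1 h2 h4, mslash, slash]
    simp [ee_zero]
  · rw [mslash_S h one_pos B a b ht, hB]
  · rw [mslash_T h one_pos B a b ht, hB]

theorem exists_rep_smul (hm : m ≠ 0) (A : FixedDetMatrix (Fin 2) ℤ m) :
    ∃ B ∈ FixedDetMatrices.reps m, ∃ γ : Matrix.SpecialLinearGroup (Fin 2) ℤ, A = γ • B := by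
  refine FixedDetMatrices.induction_on (C := fun A => ∃ B ∈ FixedDetMatrices.reps m,
    ∃ γ : Matrix.SpecialLinearGroup (Fin 2) ℤ, A = γ • B) (A := A) hm
    (fun A h1 h2 h3 h4 => ⟨A, ⟨h1, h2, h3, h4⟩, 1, (one_smul _ _).symm⟩)
    (fun B hB => ?_) (fun B hB => ?_)
  · obtain ⟨C, hC, γ, rfl⟩ := hB
    exact ⟨C, hC, ModularGroup.S * γ, (mul_smul _ _ _).symm⟩
  · obtain ⟨C, hC, γ, rfl⟩ := hB
    exact ⟨C, hC, ModularGroup.T * γ, (mul_smul _ _ _).symm⟩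

theorem mslash_smul (h : WJ k 3 1 φ) (hm : 0 < m) (γ : Matrix.SpecialLinearGroup (Fin 2) ℤ)
    (A : FixedDetMatrix (Fin 2) ℤ m) {t : ℂ} (a b : ℂ)
    (ht : 0 < t.im) : mslash k φ (γ • A).1 t a b = mslash k φ A.1 t a b := by
  have hγ : γ ∈ Subgroup.closure {ModularGroup.S, ModularGroup.T} := by
    rw [SpecialLinearGroup.SL2Z_generators]; trivial
  induction hγ using Subgroup.closure_induction generalizing A with
  | mem x hx =>
    rcases hx with rfl | rfl
    · exact mslash_S h hm A a b ht
    · exact mslash_T h hm A a b ht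
  | one => rw [one_smul]
  | mul x y _ _ hx hy => rw [mul_smul, hx, hy]
  | inv x _ hx => rw [← hx (x⁻¹ • A), smul_inv_smul]

theorem reps_unique {A B : FixedDetMatrix (Fin 2) ℤ m} (hA : A ∈ FixedDetMatrices.reps m)
    (hB : B ∈ FixedDetMatrices.reps m) {γ : Matrix.SpecialLinearGroup (Fin 2) ℤ} (h : A = γ • B) :
    A = B := by
  obtain ⟨a1, a2, a3, a4⟩ := hA
  obtain ⟨b1, b2, b3, b4⟩ := hB
  have hd := γ.det_coe
  rw [Matrix.det_fin_two] at hd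
  have e : ∀ i j, A.1 i j = γ.1 i 0 * B.1 0 j + γ.1 i 1 * B.1 1 j := fun i j => by
    rw [h, FixedDetMatrices.smul_coe, Matrix.mul_apply, Fin.sum_univ_two]
  have e1 := e 1 0
  rw [a1, b1, mul_zero, add_zero, eq_comm, mul_eq_zero, or_iff_left b2.ne'] at e1
  rw [e1, mul_zero, sub_zero] at hd
  have e2 := e 0 0
  rw [b1, mul_zero, add_zero] at e2
  have h00 : γ.1 0 0 = 1 := by
    rcases Int.mul_eq_one_iff_eq_one_or_neg_one.mp hd with h | h
    · exact h.1
    · rw [h.1] at e2; omega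
  have h11 : γ.1 1 1 = 1 := by rw [h00, one_mul] at hd; exact hd
  have e3 := e 1 1
  rw [e1, h11, zero_mul, zero_add, one_mul] at e3
  have e4 := e 0 1
  rw [h00, one_mul] at e4
  have h01 : γ.1 0 1 = 0 := by
    by_contra h0
    have h5 : |B.1 1 1| ≤ |γ.1 0 1 * B.1 1 1| := by
      rw [abs_mul]
      exact le_mul_of_one_le_left (abs_nonneg _) (Int.one_le_abs h0)
    rw [e3] at a4
    rw [abs_of_nonneg a3] at a4
    rw [abs_of_nonneg b3] at b4
    rw [show γ.1 0 1 * B.1 1 1 = A.1 0 1 - B.1 0 1 by omega] at h5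
    have := abs_sub_lt_of_nonneg_of_lt a3 a4 b3 b4
    omega
  rw [h01, zero_mul, add_zero] at e4
  rw [h00, one_mul] at e2
  refine FixedDetMatrices.ext _ _ fun i j => ?_
  fin_cases i <;> fin_cases j
  · exact e2
  · exact e4
  · exact a1.trans b1.symm
  · exact e3

/-- Right multiplication by a unimodular matrix permutes the left orbits. -/
theorem sum_reps_mul (h : WJ k 3 1 φ) (hm : 0 < m) (g : Matrix.SpecialLinearGroup (Fin 2) ℤ) {t : ℂ}
    (a b : ℂ) (ht : 0 < t.im) :
    ∑ A : FixedDetMatrices.reps m, mslash k φ (A.1.1 * g.1) t a b =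
      ∑ A : FixedDetMatrices.reps m, mslash k φ A.1.1 t a b := by
  choose π hπ γ hγ using exists_rep_smul hm.ne'
  let R : FixedDetMatrix (Fin 2) ℤ m → FixedDetMatrix (Fin 2) ℤ m := fun A =>
    ⟨A.1 * g.1, by rw [Matrix.det_mul, A.2, g.2, mul_one]⟩
  have hR : ∀ (x : Matrix.SpecialLinearGroup (Fin 2) ℤ) A, R (x • A) = x • R A := fun x A =>
    FixedDetMatrices.ext' _ _ (by
      change (x • A).1 * g.1 = (x • R A).1
      rw [FixedDetMatrices.smul_coe, FixedDetMatrices.smul_coe, Matrix.mul_assoc])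
  have hRi : Function.Injective R := fun A B hAB => by
    have h1 := congrArg (fun A => A.1 * (g⁻¹).1) hAB
    have h2 : g.1 * (g⁻¹).1 = 1 := by
      rw [← Matrix.SpecialLinearGroup.coe_mul, mul_inv_cancel, Matrix.SpecialLinearGroup.coe_one]
    simp only [R, Matrix.mul_assoc, h2, Matrix.mul_one] at h1
    exact FixedDetMatrices.ext' _ _ h1
  let P : FixedDetMatrices.reps m → FixedDetMatrices.reps m := fun A => ⟨π (R A.1), hπ _⟩
  have hP : Function.Injective P := fun A B hAB => by
    have h1 : π (R A.1) = π (R B.1) := congrArg Subtype.val hAB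
    have h2 : R A.1 = R ((γ (R A.1) * (γ (R B.1))⁻¹) • B.1) := by
      have h3 : (γ (R B.1))⁻¹ • R B.1 = π (R B.1) := by
        rw [inv_smul_eq_iff]; exact hγ _
      rw [hR, mul_smul, h3, ← h1]; exact hγ _
    exact Subtype.ext (reps_unique A.2 B.2 (hRi h2))
  rw [← (Finite.injective_iff_bijective.mp hP).sum_comp fun A => mslash k φ A.1.1 t a b]
  refine Finset.sum_congr rfl fun A _ => ?_
  change mslash k φ (R A.1).1 t a b = mslash k φ (π (R A.1)).1 t a b
  conv_lhs => rw [hγ (R A.1)]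
  exact mslash_smul h hm _ _ a b ht

end Hecke

section HeckeSum

variable {k : ℤ} {φ : ℂ → ℂ → ℂ → ℂ} {l α d : ℕ}

/-- A summand of the Fourier-Jacobi coefficient of index `α * d` of the lift of `φ`. -/
def lc (l : ℕ) (φ : ℂ → ℂ → ℂ → ℂ) (α d : ℕ) (t a b : ℂ) : ℂ :=
  α ^ l * (d : ℂ)⁻¹ * ∑ β ∈ Finset.range d, φ ((α * t + β) / d) (α * a) (α * b)

theorem mslash_rep (hk : k = l + 1) (hd : d ≠ 0) (hα : α ≠ 0) (β : ℕ) (t a b : ℂ) :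
    ((α * d : ℕ) : ℂ) ^ l * mslash k φ !![(α : ℤ), β; 0, d] t a b =
      α ^ l * (d : ℂ)⁻¹ * φ ((α * t + β) / d) (α * a) (α * b) := by
  have hd' : (d : ℂ) ≠ 0 := by exact_mod_cast hd
  simp only [mslash, slash, Matrix.of_apply, Matrix.cons_val', Matrix.cons_val_zero,
    Matrix.cons_val_one, Matrix.cons_val_fin_one, Int.cast_natCast, Int.cast_zero]
  rw [show ∀ z : ℂ, ((α : ℂ) * d - β * 0) * z / (0 * t + d) = α * z by
      intro z; rw [mul_zero, sub_zero, zero_mul, zero_add]; field_simp,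
    show ∀ z : ℂ, ((α : ℂ) * d - β * 0) * z / (0 * t + d) = α * z by
      intro z; rw [mul_zero, sub_zero, zero_mul, zero_add]; field_simp,
    show -(((α : ℂ) * d - β * 0) * 0 * NN a b / (0 * t + d)) = 0 by simp, ee_zero, hk, zero_mul,
    zero_add, _root_.zpow_neg, zpow_add_one₀ hd', zpow_natCast]
  push_cast
  field_simp
  rw [mul_pow]
  ring

theorem sum_lc_eq (hk : k = l + 1) {m : ℕ} (hm : m ≠ 0) (t a b : ℂ) :
    ∑ x ∈ m.divisorsAntidiagonal, lc l φ x.1 x.2 t a b =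
      (m : ℂ) ^ l * ∑ A : FixedDetMatrices.reps (m : ℤ), mslash k φ A.1.1 t a b := by
  simp only [lc, Finset.mul_sum]
  rw [Finset.sum_sigma']
  have hx : ∀ x ∈ m.divisorsAntidiagonal.sigma fun x => Finset.range x.2,
      x.1.1 * x.1.2 = m ∧ x.1.1 ≠ 0 ∧ x.1.2 ≠ 0 ∧ x.2 < x.1.2 := fun x hx => by
    rw [Finset.mem_sigma, Nat.mem_divisorsAntidiagonal, Finset.mem_range] at hx
    refine ⟨hx.1.1, ?_, ?_, hx.2⟩ <;> rintro h <;> simp [h] at hx <;> omega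
  refine Finset.sum_bij (fun x hxm => ⟨⟨!![(x.1.1 : ℤ), x.2; 0, x.1.2], ?_⟩,
      ?_⟩) (fun _ _ => Finset.mem_univ _)
    (fun x hx1 y hy1 h => ?_) (fun A _ => ?_) (fun x hx1 => ?_)
  · rw [Matrix.det_fin_two_of, ← (hx x hxm).1]; push_cast; ring
  · obtain ⟨-, h2, h3, h4⟩ := hx x hxm
    refine ⟨rfl, ?_, ?_, ?_⟩ <;> simp <;> omega
  · have h1 := congrArg (fun A => A.1.1) h
    have h00 := congrFun (congrFun h1 0) 0
    have h01 := congrFun (congrFun h1 0) 1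
    have h11 := congrFun (congrFun h1 1) 1
    simp at h00 h01 h11
    obtain ⟨⟨x1, x2⟩, x3⟩ := x
    obtain ⟨⟨y1, y2⟩, y3⟩ := y
    simp only at h00 h01 h11
    subst h00 h01 h11
    rfl
  · obtain ⟨A, h1, h2, h3, h4⟩ := A
    have hd := A.det_eq
    rw [h1, mul_zero, sub_zero] at hd
    have h5 : 0 < A.1 1 1 := by
      refine (pos_iff_pos_of_mul_pos ?_).mp h2
      rw [hd]; exact_mod_cast Nat.pos_of_ne_zero hm
    rw [abs_of_nonneg h3, abs_of_pos h5] at h4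
    refine ⟨⟨((A.1 0 0).toNat, (A.1 1 1).toNat), (A.1 0 1).toNat⟩, ?_, ?_⟩
    · rw [Finset.mem_sigma, Nat.mem_divisorsAntidiagonal, Finset.mem_range]
      refine ⟨⟨?_, hm⟩, by simp only; omega⟩
      zify
      rw [Int.toNat_of_nonneg h2.le, Int.toNat_of_nonneg h5.le, hd]
    · refine Subtype.ext (FixedDetMatrices.ext _ _ fun i j => ?_)
      fin_cases i <;> fin_cases j <;> simp <;> omega
  · obtain ⟨h1, h2, h3, h4⟩ := hx x hx1
    have h5 := mslash_rep (φ := φ) hk h3 h2 x.2 t a b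
    rw [h1] at h5
    exact h5.symm

theorem WJ.sum_lc_T (h : WJ k 3 1 φ) (hk : k = l + 1) {m : ℕ} (hm : m ≠ 0) {t : ℂ} (a b : ℂ)
    (ht : 0 < t.im) : ∑ x ∈ m.divisorsAntidiagonal, lc l φ x.1 x.2 (t + 1) a b =
      ∑ x ∈ m.divisorsAntidiagonal, lc l φ x.1 x.2 t a b := by
  rw [sum_lc_eq hk hm, sum_lc_eq hk hm,
    ← sum_reps_mul h (by exact_mod_cast Nat.pos_of_ne_zero hm) ModularGroup.T a b ht]
  congr 1
  refine Finset.sum_congr rfl fun A _ => ?_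
  rw [mslash, slash_T_right, mslash]
  simp [ModularGroup.T, Matrix.mul_apply, Fin.sum_univ_two]

theorem WJ.sum_lc_S (h : WJ k 3 1 φ) (hk : k = l + 1) {m : ℕ} (hm : m ≠ 0) {t : ℂ} (a b : ℂ)
    (ht : 0 < t.im) : ∑ x ∈ m.divisorsAntidiagonal, lc l φ x.1 x.2 (-1 / t) (a / t) (b / t) =
      t ^ k * ee (m * NN a b / t) * ∑ x ∈ m.divisorsAntidiagonal, lc l φ x.1 x.2 t a b := by
  rw [sum_lc_eq hk hm, sum_lc_eq hk hm,
    ← sum_reps_mul h (by exact_mod_cast Nat.pos_of_ne_zero hm) ModularGroup.S a b ht, mul_left_comm]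
  congr 1
  rw [Finset.mul_sum]
  refine Finset.sum_congr rfl fun A _ => ?_
  have hd := A.1.det_eq
  have ht0 : t ≠ 0 := ne_zero_of_im_pos ht
  have hj : ((A.1.1 1 1 : ℤ) : ℂ) * t - (A.1.1 1 0 : ℤ) ≠ 0 := by
    have := int_mul_add_ne_zero ht (r := A.1.1 1 1) (s := -A.1.1 1 0) (by
      by_contra! h'
      rw [neg_eq_zero] at h'
      simp [h'] at hd
      omega)
    simpa [sub_eq_add_neg] using this
  have hd' : ((A.1.1 0 0 : ℤ) : ℂ) * (A.1.1 1 1 : ℤ) - (A.1.1 0 1 : ℤ) * (A.1.1 1 0 : ℤ) = m := by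
    exact_mod_cast congrArg (Int.cast : ℤ → ℂ) hd
  rw [mslash, slash_S_right k φ a b ht0 hj, mslash, hd']
  simp [ModularGroup.S, Matrix.mul_apply, Fin.sum_univ_two]

theorem im_mul_im_div {t x y : ℂ} (ht : 0 < t.im) {c d : ℝ} {j : ℂ} (hj : j = c * t + d) (hj0 : j ≠ 0) :
    (c * (x * y) / j).im + (x / j).im * (y / j).im * Complex.normSq j / t.im = x.im * y.im / t.im := by
  obtain ⟨X, rfl⟩ : ∃ X, x = X * j := ⟨x / j, by field_simp⟩
  obtain ⟨Y, rfl⟩ : ∃ Y, y = Y * j := ⟨y / j, by field_simp⟩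
  rw [mul_div_cancel_right₀ _ hj0, mul_div_cancel_right₀ _ hj0,
    show (c : ℂ) * (X * j * (Y * j)) / j = c * (X * Y * j) by field_simp, Complex.normSq_apply]
  have h1 : j.im = c * t.im := by simp [hj]
  simp only [Complex.mul_im, Complex.mul_re, Complex.ofReal_re, Complex.ofReal_im, h1]
  field_simp
  ring

theorem im_NN_div {t a b : ℂ} (ht : 0 < t.im) {c d : ℝ} {j : ℂ} (hj : j = c * t + d) (hj0 : j ≠ 0) :
    (c * NN a b / j).im + ((a / j).im ^ 2 + (a / j).im * (b / j).im + 2 * (b / j).im ^ 2) *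
      Complex.normSq j / t.im = (a.im ^ 2 + a.im * b.im + 2 * b.im ^ 2) / t.im := by
  have h1 := im_mul_im_div (x := a) (y := a) ht hj hj0
  have h2 := im_mul_im_div (x := a) (y := b) ht hj hj0
  have h3 := im_mul_im_div (x := b) (y := b) ht hj hj0
  have e : (c : ℂ) * NN a b / j = c * (a * a) / j + c * (a * b) / j + (c * (b * b) / j + c * (b * b) / j) := by
    rw [NN]; ring
  rw [e, Complex.add_im, Complex.add_im, Complex.add_im]
  linear_combination h1 + h2 + 2 * h3

/-- A bound on a fundamental domain propagates to the upper half plane. -/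
theorem WJ.norm_le (h : WJ k 3 1 φ) (hk : k = l + 1) {C : ℝ}
    (hC : ∀ t a b : ℂ, 1 / 2 ≤ t.im →
      ‖φ t a b‖ ≤ C * Real.exp (2 * Real.pi * ((a.im ^ 2 + a.im * b.im + 2 * b.im ^ 2) / t.im)))
    {t : ℂ} (a b : ℂ) (ht : 0 < t.im) : ‖φ t a b‖ ≤ C * (1 + 1 / t.im) ^ (l + 1) *
      Real.exp (2 * Real.pi * ((a.im ^ 2 + a.im * b.im + 2 * b.im ^ 2) / t.im)) := by
  obtain ⟨g, hg⟩ := ModularGroup.exists_smul_mem_fd ⟨t, ht⟩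
  have h3 := ModularGroup.three_le_four_mul_im_sq_of_mem_fd hg
  have hpos := (g • (⟨t, ht⟩ : UpperHalfPlane)).im_pos
  have h12 : 1 / 2 ≤ (g • (⟨t, ht⟩ : UpperHalfPlane)).im := by nlinarith
  set j : ℂ := ((g.1 1 0 : ℤ) : ℂ) * t + (g.1 1 1 : ℤ) with hj
  have hd := g.det_coe
  rw [Matrix.det_fin_two] at hd
  have hcd : g.1 1 0 ≠ 0 ∨ g.1 1 1 ≠ 0 := by
    by_contra! h'
    simp [h'] at hd
  have hj0 : j ≠ 0 := int_mul_add_ne_zero ht hcd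
  have hgt : ((g • (⟨t, ht⟩ : UpperHalfPlane) : UpperHalfPlane) : ℂ) =
      ((g.1 0 0 : ℤ) * t + (g.1 0 1 : ℤ)) / j := by
    rw [UpperHalfPlane.specialLinearGroup_apply]
    simp [hj]
  have hd' : ((g.1 0 0 : ℤ) : ℂ) * (g.1 1 1 : ℤ) - (g.1 0 1 : ℤ) * (g.1 1 0 : ℤ) = 1 := by
    exact_mod_cast congrArg (Int.cast : ℤ → ℂ) hd
  have him : (g • (⟨t, ht⟩ : UpperHalfPlane)).im = t.im / Complex.normSq j := by
    rw [ModularGroup.im_smul_eq_div_normSq]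
    simp [hj, UpperHalfPlane.denom]
  have hjr : j = ((g.1 1 0 : ℤ) : ℝ) * t + ((g.1 1 1 : ℤ) : ℝ) := by rw [hj]; push_cast; rfl
  have key := h.mslash_eq ⟨g.1, g.2⟩ a b ht
  rw [mslash, slash, hd', ← hj, ← hgt, one_mul, one_mul, one_mul] at key
  have hn := Complex.normSq_pos.mpr hj0
  have hC' := hC (g • (⟨t, ht⟩ : UpperHalfPlane) : UpperHalfPlane) (a / j) (b / j) h12
  have hC0 : 0 ≤ C := by
    have := (norm_nonneg _).trans (hC Complex.I 0 0 (by norm_num))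
    simpa using this
  have hjn : ‖j‖⁻¹ ≤ 1 + 1 / t.im := by
    rcases eq_or_ne (g.1 1 0) 0 with hc | hc
    · have h1 : (1 : ℝ) ≤ ‖j‖ := by
        rw [hj, hc]
        simp only [Int.cast_zero, zero_mul, zero_add, Complex.norm_intCast]
        exact_mod_cast Int.one_le_abs (hcd.resolve_left (not_not.mpr hc))
      exact (inv_le_one_of_one_le₀ h1).trans (le_add_of_nonneg_right (by positivity))
    · have h1 : t.im ≤ ‖j‖ := by
        refine le_trans ?_ (Complex.abs_im_le_norm j)
        rw [show j.im = (g.1 1 0 : ℤ) * t.im by simp [hj], abs_mul, abs_of_pos ht]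
        exact le_mul_of_one_le_left ht.le (by exact_mod_cast Int.one_le_abs hc)
      rw [← one_div]
      exact (one_div_le_one_div_of_le ht h1).trans (le_add_of_nonneg_left zero_le_one)
  have hid := im_NN_div (a := a) (b := b) ht hjr hj0
  rw [← key, norm_mul, norm_mul, norm_ee, norm_zpow, hk, _root_.zpow_neg,
    show ((l : ℤ) + 1) = ((l + 1 : ℕ) : ℤ) by push_cast; rfl, zpow_natCast, ← inv_pow]
  rw [UpperHalfPlane.coe_im, him, div_div_eq_mul_div] at hC'
  calc _ ≤ (1 + 1 / t.im) ^ (l + 1) * Real.exp (-2 * Real.pi * (-(((g.1 1 0 : ℤ) : ℂ) * NN a b / j)).im) *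
        (C * Real.exp (2 * Real.pi * (((a / j).im ^ 2 + (a / j).im * (b / j).im + 2 * (b / j).im ^ 2) *
          Complex.normSq j / t.im))) := by gcongr
    _ = _ := by
      rw [← hid, mul_add, Real.exp_add]
      push_cast
      rw [Complex.neg_im]
      ring_nf

end HeckeSum

section Lift

variable {l : ℕ} {C : ℝ} {c : ℂ} {e : ℂ → ℂ} {φ : ℂ → ℂ → ℂ → ℂ}

theorem summable_pow_mul_pow_mul_geometric (l : ℕ) {r : ℝ} (h0 : 0 ≤ r) (h1 : r < 1) :
    Summable fun x : ℕ+ × ℕ+ => (x.1 : ℝ) ^ l * (x.2 : ℝ) ^ (l + 1) * r ^ (x.1 * x.2 : ℕ) := by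
  have hs0 := Real.sqrt_nonneg r
  have hs1 : √r < 1 := by rwa [Real.sqrt_lt' one_pos, one_pow]
  have h2 : Tendsto (fun n : ℕ => (n : ℝ) ^ l * √r ^ n) atTop (𝓝 0) :=
    tendsto_pow_const_mul_const_pow_of_lt_one l hs0 hs1
  obtain ⟨B, hB⟩ := h2.bddAbove_range
  refine Summable.of_nonneg_of_le (fun x => by positivity) (fun x => ?_)
    ((summable_prod_mul_pow 1 (r := √r) (by rwa [Real.norm_of_nonneg hs0])).mul_left B)
  have h3 := hB ⟨(x.1 * x.2 : ℕ), rfl⟩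
  simp only at h3
  push_cast at h3
  calc (x.1 : ℝ) ^ l * (x.2 : ℝ) ^ (l + 1) * r ^ (x.1 * x.2 : ℕ)
      = ((x.1 : ℝ) * x.2) ^ l * √r ^ (x.1 * x.2 : ℕ) * ((x.2 : ℝ) ^ 1 * √r ^ (x.1 * x.2 : ℕ)) := by
        conv_lhs => rw [← Real.sq_sqrt h0]
        rw [mul_pow]
        ring
    _ ≤ _ := by gcongr

/-- The hypotheses under which an index one form can be lifted. -/
structure Liftable (l : ℕ) (C : ℝ) (c : ℂ) (e : ℂ → ℂ) (φ : ℂ → ℂ → ℂ → ℂ) : Prop where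
  wj : WJ ((l : ℤ) + 1) 3 1 φ
  bd : ∀ t a b : ℂ, 1 / 2 ≤ t.im →
    ‖φ t a b‖ ≤ C * Real.exp (2 * Real.pi * ((a.im ^ 2 + a.im * b.im + 2 * b.im ^ 2) / t.im))
  lim : ∀ a b : ℂ, Tendsto (fun t => φ t a b) imInf (𝓝 c)
  mf : MF ((l : ℤ) + 1) e
  hasSum : ∃ e₀ : ℂ, ∀ t : ℂ, 0 < t.im →
    HasSum (fun x : ℕ+ × ℕ+ => c * ((x.1 : ℕ) : ℂ) ^ l * ee ((x.1 : ℕ) * (x.2 : ℕ) * t)) (e t - e₀)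

theorem Liftable.C_nonneg (h : Liftable l C c e φ) : 0 ≤ C := by
  have := (norm_nonneg _).trans (h.bd Complex.I 0 0 (by norm_num))
  simpa using this

theorem im_rep {α d : ℕ} (hd : d ≠ 0) (β : ℕ) (t : ℂ) : ((α * t + β) / d).im = α * t.im / d := by
  rw [show ((α : ℂ) * t + β) / d = ((α / d : ℝ) : ℂ) * t + ((β / d : ℝ) : ℂ) by
    push_cast; field_simp, Complex.add_im, Complex.im_ofReal_mul, Complex.ofReal_im]
  ring

theorem Liftable.norm_lc_le (h : Liftable l C c e φ) {t : ℂ} (a b : ℂ) (ht : 0 < t.im) {α d : ℕ}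
    (hα : α ≠ 0) (hd : d ≠ 0) : ‖lc l φ α d t a b‖ ≤ C * (1 + 1 / t.im) ^ (l + 1) *
      (α ^ l * d ^ (l + 1) *
      Real.exp (2 * Real.pi * ((a.im ^ 2 + a.im * b.im + 2 * b.im ^ 2) / t.im)) ^ (α * d)) := by
  have hα' : (1 : ℝ) ≤ α := by exact_mod_cast Nat.one_le_iff_ne_zero.mpr hα
  have hd' : (1 : ℝ) ≤ d := by exact_mod_cast Nat.one_le_iff_ne_zero.mpr hd
  have hC := h.C_nonneg
  have hterm : ∀ β ∈ Finset.range d, ‖φ ((α * t + β) / d) (α * a) (α * b)‖ ≤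
      C * ((1 + 1 / t.im) * d) ^ (l + 1) *
      Real.exp (2 * Real.pi * ((a.im ^ 2 + a.im * b.im + 2 * b.im ^ 2) / t.im)) ^ (α * d) := by
    intro β _
    have him : ((α * t + β) / d).im = α * t.im / d := im_rep hd β t
    have hpos : 0 < ((α * t + β) / d).im := by rw [him]; positivity
    refine (h.wj.norm_le rfl h.bd (α * a) (α * b) hpos).trans ?_
    rw [him, ← Real.exp_nat_mul]
    have e1 : ((α : ℂ) * a).im = α * a.im := by simp
    have e2 : ((α : ℂ) * b).im = α * b.im := by simp
    have e3 : 2 * Real.pi * ((((α : ℂ) * a).im ^ 2 + ((α : ℂ) * a).im * ((α : ℂ) * b).im +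
        2 * ((α : ℂ) * b).im ^ 2) / (α * t.im / d)) = ((α * d : ℕ) : ℝ) *
        (2 * Real.pi * ((a.im ^ 2 + a.im * b.im + 2 * b.im ^ 2) / t.im)) := by
      rw [e1, e2]; push_cast; field_simp
    rw [e3]
    have e4 : 1 + 1 / (α * t.im / d) ≤ (1 + 1 / t.im) * d := by
      rw [add_mul, one_mul, one_div_div, one_div_mul_eq_div]
      gcongr
      exact le_mul_of_one_le_left ht.le hα'
    gcongr
  rw [lc, norm_mul, norm_mul, norm_pow, norm_inv, Complex.norm_natCast, Complex.norm_natCast]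
  calc _ ≤ (α : ℝ) ^ l * (d : ℝ)⁻¹ * ∑ β ∈ Finset.range d, C * ((1 + 1 / t.im) * d) ^ (l + 1) *
      Real.exp (2 * Real.pi * ((a.im ^ 2 + a.im * b.im + 2 * b.im ^ 2) / t.im)) ^ (α * d) := by
        gcongr
        exact norm_sum_le_of_le _ hterm
    _ = _ := by
        rw [Finset.sum_const, Finset.card_range, nsmul_eq_mul, mul_pow]
        field_simp

/-- The Maass lift. -/
def lift (l : ℕ) (e : ℂ → ℂ) (φ : ℂ → ℂ → ℂ → ℂ) (t a b w : ℂ) : ℂ :=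
  e t + ∑' x : ℕ+ × ℕ+, lc l φ x.1 x.2 t a b * ee ((x.1 : ℕ) * (x.2 : ℕ) * w)

/-- The gap measuring how deep a point is inside the half space. -/
def gap (t a b w : ℂ) : ℝ := w.im - (a.im ^ 2 + a.im * b.im + 2 * b.im ^ 2) / t.im

theorem Om.gap_pos {t a b w : ℂ} (h : Om t a b w) : 0 < gap t a b w := by
  rw [gap, sub_pos, div_lt_iff₀' h.1]
  exact h.2

theorem Liftable.norm_term_le (h : Liftable l C c e φ) {t : ℂ} (a b w : ℂ) (ht : 0 < t.im)
    (x : ℕ+ × ℕ+) : ‖lc l φ x.1 x.2 t a b * ee ((x.1 : ℕ) * (x.2 : ℕ) * w)‖ ≤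
      C * (1 + 1 / t.im) ^ (l + 1) * ((x.1 : ℝ) ^ l * (x.2 : ℝ) ^ (l + 1) *
        Real.exp (-2 * Real.pi * gap t a b w) ^ (x.1 * x.2 : ℕ)) := by
  have h1 := h.norm_lc_le a b ht x.1.ne_zero x.2.ne_zero
  rw [norm_mul]
  have h2 : ‖ee ((x.1 : ℕ) * (x.2 : ℕ) * w)‖ = Real.exp (-2 * Real.pi * w.im) ^ (x.1 * x.2 : ℕ) := by
    rw [norm_ee, ← Real.exp_nat_mul, ← Nat.cast_mul, ← Complex.ofReal_natCast,
        Complex.im_ofReal_mul]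
    congr 1; ring
  rw [h2]
  refine (mul_le_mul_of_nonneg_right h1 (by positivity)).trans_eq ?_
  rw [mul_assoc, mul_assoc _ (_ ^ (_ : ℕ)) (_ ^ (_ : ℕ)), ← mul_pow, ← Real.exp_add]
  congr 5
  rw [gap]; ring

theorem Liftable.summable (h : Liftable l C c e φ) {t a b w : ℂ} (hO : Om t a b w) :
    Summable fun x : ℕ+ × ℕ+ => ‖lc l φ x.1 x.2 t a b * ee ((x.1 : ℕ) * (x.2 : ℕ) * w)‖ :=
  Summable.of_nonneg_of_le (fun _ => norm_nonneg _) (h.norm_term_le a b w hO.1)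
    ((summable_pow_mul_pow_mul_geometric l (Real.exp_pos _).le (by
      rw [Real.exp_lt_one_iff]; nlinarith [hO.gap_pos, Real.pi_pos])).mul_left _)

theorem Liftable.holo_lc (h : Liftable l C c e φ) {t : ℂ} (a b : ℂ) (ht : 0 < t.im) {α d : ℕ}
    (hα : α ≠ 0) (hd : d ≠ 0) :
    DifferentiableAt ℂ (fun p : ℂ × ℂ × ℂ => lc l φ α d p.1 p.2.1 p.2.2) (t, a, b) := by
  have hd' : (d : ℂ) ≠ 0 := by exact_mod_cast hd
  unfold lc
  refine DifferentiableAt.const_mul (DifferentiableAt.fun_sum fun β _ => ?_) _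
  refine h.wj.holo3.comp (f₁ := fun p : ℂ × ℂ × ℂ => (α * p.1 + β) / d)
    (f₂ := fun p : ℂ × ℂ × ℂ => α * p.2.1) (f₃ := fun p : ℂ × ℂ × ℂ => α * p.2.2) (x := (t, a, b))
    ?_ (by fun_prop) (by fun_prop) (by fun_prop)
  rw [im_rep hd]
  positivity

theorem Liftable.holo (h : Liftable l C c e φ) {t a b w : ℂ} (hO : Om t a b w) :
    DifferentiableAt ℂ (fun p : ℂ × ℂ × ℂ × ℂ => lift l e φ p.1 p.2.1 p.2.2.1 p.2.2.2)
      (t, a, b, w) := by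
  have hg : ContinuousAt (fun p : ℂ × ℂ × ℂ × ℂ => gap p.1 p.2.1 p.2.2.1 p.2.2.2) (t, a, b, w) := by
    have := hO.1.ne'
    unfold gap
    fun_prop (disch := assumption)
  have hy : ContinuousAt (fun p : ℂ × ℂ × ℂ × ℂ => p.1.im) (t, a, b, w) := by fun_prop
  have hev := ((hg.eventually_const_lt (half_lt_self hO.gap_pos)).and
    (hy.eventually_const_lt (half_lt_self hO.1)))
  obtain ⟨r, hr, hball⟩ := Metric.eventually_nhds_iff_ball.mp hev
  have hpi := Real.pi_pos
  refine DifferentiableAt.fun_add ?_ ?_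
  · exact DifferentiableAt.comp (g := e) (f := Prod.fst) (t, a, b, w) (h.mf.holo t hO.1)
      differentiableAt_fst
  · refine differentiableAt_of_tendstoUniformlyOn_ball hr (tendstoUniformlyOn_tsum
      (u := fun x : ℕ+ × ℕ+ => C * (1 + 1 / (t.im / 2)) ^ (l + 1) * ((x.1 : ℝ) ^ l * (x.2 : ℝ) ^ (l + 1) *
        Real.exp (-2 * Real.pi * (gap t a b w / 2)) ^ (x.1 * x.2 : ℕ)))
      ((summable_pow_mul_pow_mul_geometric l (Real.exp_pos _).le (by
        rw [Real.exp_lt_one_iff]; nlinarith [hO.gap_pos])).mul_left _)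
      (f := fun (x : ℕ+ × ℕ+) (p : ℂ × ℂ × ℂ × ℂ) =>
        lc l φ x.1 x.2 p.1 p.2.1 p.2.2.1 * ee ((x.1 : ℕ) * (x.2 : ℕ) * p.2.2.2)) fun x p hp => ?_)
      (Eventually.of_forall fun s p hp => DifferentiableAt.fun_sum fun x _ => ?_)
    · obtain ⟨h1, h2⟩ := hball p hp
      have hp0 : 0 < p.1.im := (half_pos hO.1).trans h2
      have ht := hO.1
      have hC := h.C_nonneg
      refine (h.norm_term_le _ _ _ hp0 x).trans ?_
      have e1 : Real.exp (-2 * Real.pi * gap p.1 p.2.1 p.2.2.1 p.2.2.2) ≤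
          Real.exp (-2 * Real.pi * (gap t a b w / 2)) := by
        rw [Real.exp_le_exp]; nlinarith
      gcongr
    · obtain ⟨h1, h2⟩ := hball p hp
      have hp0 : 0 < p.1.im := (half_pos hO.1).trans h2
      have e1 := DifferentiableAt.comp (g := fun p : ℂ × ℂ × ℂ => lc l φ x.1 x.2 p.1 p.2.1 p.2.2)
        (f := fun p : ℂ × ℂ × ℂ × ℂ => (p.1, p.2.1, p.2.2.1)) p
        (h.holo_lc p.2.1 p.2.2.1 hp0 x.1.ne_zero x.2.ne_zero) (by fun_prop)
      exact e1.fun_mul (differentiable_ee.differentiableAt.comp p (by fun_prop))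

end Lift

section LiftLaws

variable {k : ℤ} {l : ℕ} {C : ℝ} {c : ℂ} {e : ℂ → ℂ} {φ : ℂ → ℂ → ℂ → ℂ}

theorem WJ.add_nat_A (h : WJ k 3 1 φ) (n : ℕ) {t : ℂ} (a b : ℂ) (ht : 0 < t.im) :
    φ t (a + n) b = φ t a b := by
  induction n with
  | zero => simp
  | succ n ih => rw [← ih, ← h.A t (a + n) b ht]; push_cast; ring_nf

theorem WJ.add_nat_B (h : WJ k 3 1 φ) (n : ℕ) {t : ℂ} (a b : ℂ) (ht : 0 < t.im) :
    φ t a (b + n) = φ t a b := by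
  induction n with
  | zero => simp
  | succ n ih =>
    have := h.B t a (b + n) ht
    rw [ih, even_three_mul_add 1, one_mul] at this
    rw [← this]; push_cast; ring_nf

theorem WJ.add_nat_mul_A (h : WJ k 3 1 φ) (n : ℕ) {t : ℂ} (a b : ℂ) (ht : 0 < t.im) :
    φ t (a + n * t) b = ee (-(n ^ 2 * t + 2 * n * a + n * b)) * φ t a b := by
  induction n with
  | zero => simp [ee_zero]
  | succ n ih =>
    have := h.HA t (a + n * t) b ht
    rw [ih, ← mul_assoc, ← ee_add] at this
    rw [show a + ((n + 1 : ℕ) : ℂ) * t = a + n * t + t by push_cast; ring, this]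
    congr 2
    push_cast
    ring

theorem WJ.add_nat_mul_B (h : WJ k 3 1 φ) (n : ℕ) {t : ℂ} (a b : ℂ) (ht : 0 < t.im) :
    φ t a (b + n * t) = ee (-(2 * n ^ 2 * t + 4 * n * b + n * a)) * φ t a b := by
  induction n with
  | zero => simp [ee_zero]
  | succ n ih =>
    have := h.HB t a (b + n * t) ht
    rw [ih, even_three_mul_add 1, one_mul, ← mul_assoc, ← ee_add] at this
    rw [show b + ((n + 1 : ℕ) : ℂ) * t = b + n * t + t by push_cast; ring, this]
    congr 2
    push_cast
    ring

variable {α d : ℕ} {t : ℂ}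

theorem im_rep_pos (hα : α ≠ 0) (hd : d ≠ 0) (β : ℕ) (ht : 0 < t.im) : 0 < ((α * t + β) / d).im := by
  rw [im_rep hd]; positivity

theorem WJ.lc_A (h : WJ k 3 1 φ) (hα : α ≠ 0) (hd : d ≠ 0) (a b : ℂ) (ht : 0 < t.im) :
    lc l φ α d t (a + 1) b = lc l φ α d t a b := by
  unfold lc
  congr 1
  refine Finset.sum_congr rfl fun β _ => ?_
  rw [mul_add, mul_one, h.add_nat_A α _ _ (im_rep_pos hα hd β ht)]

theorem WJ.lc_B (h : WJ k 3 1 φ) (hα : α ≠ 0) (hd : d ≠ 0) (a b : ℂ) (ht : 0 < t.im) :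
    lc l φ α d t a (b + 1) = lc l φ α d t a b := by
  unfold lc
  congr 1
  refine Finset.sum_congr rfl fun β _ => ?_
  rw [mul_add, mul_one, h.add_nat_B α _ _ (im_rep_pos hα hd β ht)]

theorem WJ.lc_HA (h : WJ k 3 1 φ) (hα : α ≠ 0) (hd : d ≠ 0) (a b : ℂ) (ht : 0 < t.im) :
    lc l φ α d t (a + t) b = ee (-(α * d * (t + 2 * a + b))) * lc l φ α d t a b := by
  have hd' : (d : ℂ) ≠ 0 := by exact_mod_cast hd
  unfold lc
  rw [mul_left_comm]
  congr 1
  rw [Finset.mul_sum]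
  refine Finset.sum_congr rfl fun β _ => ?_
  have hp := im_rep_pos hα hd β ht
  have e1 : (α : ℂ) * (a + t) = α * a - β + d * ((α * t + β) / d) := by field_simp; ring
  have e2 := h.add_nat_A β (α * a - β) (α * b) hp
  rw [sub_add_cancel] at e2
  rw [e1, h.add_nat_mul_A d _ _ hp, e2]
  congr 1
  rw [← mul_one (ee (-(α * d * _))), ← ee_natCast (d * β), ← ee_add]
  congr 1
  push_cast
  field_simp
  ring

theorem WJ.lc_HB (h : WJ k 3 1 φ) (hα : α ≠ 0) (hd : d ≠ 0) (a b : ℂ) (ht : 0 < t.im) :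
    lc l φ α d t a (b + t) = ee (-(α * d * (a + 4 * b + 2 * t))) * lc l φ α d t a b := by
  have hd' : (d : ℂ) ≠ 0 := by exact_mod_cast hd
  unfold lc
  rw [mul_left_comm]
  congr 1
  rw [Finset.mul_sum]
  refine Finset.sum_congr rfl fun β _ => ?_
  have hp := im_rep_pos hα hd β ht
  have e1 : (α : ℂ) * (b + t) = α * b - β + d * ((α * t + β) / d) := by field_simp; ring
  have e2 := h.add_nat_B β (α * a) (α * b - β) hp
  rw [sub_add_cancel] at e2
  rw [e1, h.add_nat_mul_B d _ _ hp, e2]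
  congr 1
  rw [← mul_one (ee (-(α * d * _))), ← ee_natCast (2 * d * β), ← ee_add]
  congr 1
  push_cast
  field_simp
  ring

theorem WJ.lc_sig (h : WJ k 3 1 φ) (hα : α ≠ 0) (hd : d ≠ 0) (a b : ℂ) (ht : 0 < t.im) :
    lc l φ α d t (-a - b) b = lc l φ α d t a b := by
  unfold lc
  congr 1
  refine Finset.sum_congr rfl fun β _ => ?_
  rw [mul_sub, mul_neg, h.sig _ _ _ (im_rep_pos hα hd β ht)]

theorem WJ.lc_neg (h : WJ k 3 1 φ) (hα : α ≠ 0) (hd : d ≠ 0) (a b : ℂ) (ht : 0 < t.im) :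
    lc l φ α d t (-a) (-b) = (-1) ^ k * lc l φ α d t a b := by
  unfold lc
  rw [mul_left_comm]
  congr 1
  rw [Finset.mul_sum]
  refine Finset.sum_congr rfl fun β _ => ?_
  rw [mul_neg, mul_neg, h.neg _ _ (im_rep_pos hα hd β ht)]

theorem Liftable.hasSum_sigma (h : Liftable l C c e φ) {t a b w : ℂ} (hO : Om t a b w) :
    HasSum (fun n : ℕ+ => (∑ x ∈ (n : ℕ).divisorsAntidiagonal, lc l φ x.1 x.2 t a b) * ee (n * w))
      (lift l e φ t a b w - e t) := by
  have hs := (h.summable hO).of_norm.hasSum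
  rw [← sigmaAntidiagonalEquivProd.hasSum_iff] at hs
  rw [lift, add_sub_cancel_left]
  refine hs.sigma fun n => ?_
  convert! hasSum_fintype _ using 1
  rw [Finset.sum_mul, ← Finset.sum_coe_sort]
  refine Finset.sum_congr rfl fun x _ => ?_
  have := (Nat.mem_divisorsAntidiagonal.mp x.2).1
  simp only [Function.comp, sigmaAntidiagonalEquivProd, divisorsAntidiagonalFactors,
      Equiv.coe_fn_mk,
    PNat.mk_coe, ← this]
  push_cast
  rfl

theorem Om.S {t a b w : ℂ} (hO : Om t a b w) : Om (-1 / t) (a / t) (b / t) (w - NN a b / t) := by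
  have ht := hO.1
  have h0 := ne_zero_of_im_pos ht
  refine ⟨im_neg_one_div ht, ?_⟩
  have h1 := im_NN_div (a := a) (b := b) ht (c := 1) (d := 0) (j := t) (by simp) h0
  have hn := Complex.normSq_pos.mpr h0
  rw [Complex.ofReal_one, one_mul] at h1
  have h2 := hO.gap_pos
  rw [gap, ← h1] at h2
  have h3 : (-1 / t).im = t.im / Complex.normSq t := by
    rw [neg_div, one_div, Complex.neg_im, Complex.inv_im]; ring
  rw [h3, Complex.sub_im, div_mul_eq_mul_div, lt_div_iff₀ hn]
  have h4 : 0 < t.im * (w.im - ((NN a b / t).im + ((a / t).im ^ 2 + (a / t).im * (b / t).im +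
    2 * (b / t).im ^ 2) * Complex.normSq t / t.im)) := mul_pos ht h2
  have h5 : t.im * (w.im - ((NN a b / t).im + ((a / t).im ^ 2 + (a / t).im * (b / t).im +
    2 * (b / t).im ^ 2) * Complex.normSq t / t.im)) = t.im * (w.im - (NN a b / t).im) -
    ((a / t).im ^ 2 + (a / t).im * (b / t).im + 2 * (b / t).im ^ 2) * Complex.normSq t := by
    field_simp
    ring
  linarith

theorem MF.eq_neg_one_zpow_mul {f : ℂ → ℂ} (h : MF k f) (ht : 0 < t.im) : f t = (-1) ^ k * f t := by
  rcases Int.even_or_odd k with hk | hk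
  · rw [hk.neg_one_zpow, one_mul]
  · rw [h.eq_zero_of_odd hk t ht, mul_zero]

end LiftLaws

section LiftSwap

variable {k : ℤ} {l : ℕ} {C : ℝ} {c : ℂ} {e : ℂ → ℂ} {φ : ℂ → ℂ → ℂ → ℂ}

/-- The Fourier expansion of an index one form in its first variable. -/
theorem Liftable.exists_coeff (h : Liftable l C c e φ) (a b : ℂ) :
    ∃ p : ℕ → ℂ, p 0 = c ∧ (∀ t : ℂ, 0 < t.im → HasSum (fun n => p n * ee (n * t)) (φ t a b)) ∧
      ∀ (n : ℕ) (y : ℝ), 0 < y → ‖p n‖ ≤ C * (1 + 1 / y) ^ (l + 1) *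
        Real.exp (2 * Real.pi * ((a.im ^ 2 + a.im * b.im + 2 * b.im ^ 2) / y)) *
        Real.exp (2 * Real.pi * y) ^ n := by
  have hpi := Real.pi_pos
  obtain ⟨F, hF, hFe⟩ := exists_cusp_function (f := fun t => φ t a b) (v := 0) (V := 1)
    (C := C * Real.exp (2 * Real.pi * (a.im ^ 2 + a.im * b.im + 2 * b.im ^ 2)))
    (fun t ht => h.wj.holo3.comp (f₁ := fun t => t) (f₂ := fun _ => a) (f₃ := fun _ => b) ht
      (by fun_prop) (by fun_prop) (by fun_prop)) (fun t ht => h.wj.T t a b ht) fun t ht => by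
      refine (h.bd t a b (by linarith)).trans ?_
      have := h.C_nonneg
      gcongr
      exact div_le_self (nn_nonneg _ _) ht.le
  rw [mul_zero, Real.exp_zero] at hF
  have h0 : (0 : ℂ) ∈ Metric.ball (0 : ℂ) 1 := by simp
  have hF0 : F 0 = c := by
    have h1 := ((hF.differentiableAt (Metric.isOpen_ball.mem_nhds h0)).continuousAt.tendsto).comp
      tendsto_ee_imInf
    refine tendsto_nhds_unique (h1.congr' ?_) (h.lim a b)
    filter_upwards [eventually_imInf 0] with t ht using hFe t ht
  refine ⟨fun n => (n.factorial : ℂ)⁻¹ * iteratedDeriv n F 0, by simp [hF0], fun t ht => ?_,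
    fun n y hy => ?_⟩
  · have h1 : ee t ∈ Metric.ball (0 : ℂ) 1 := by
      have := (ee_mem_ball (w := t) (v := 0)).mpr ht
      simpa using this
    have h2 := Complex.hasSum_taylorSeries_on_ball hF h1
    rw [hFe t ht] at h2
    refine h2.congr_fun ?_
    intro n
    rw [ee_nat_mul]
    simp only [smul_eq_mul, sub_zero]
    ring
  · have hR1 : Real.exp (-2 * Real.pi * y) < 1 := by rw [Real.exp_lt_one_iff]; nlinarith
    have h1 := Complex.norm_iteratedDeriv_le_of_forall_mem_sphere_norm_le (f := F) (c := 0)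
      (R := Real.exp (-2 * Real.pi * y)) (C := C * (1 + 1 / y) ^ (l + 1) *
        Real.exp (2 * Real.pi * ((a.im ^ 2 + a.im * b.im + 2 * b.im ^ 2) / y))) n (Real.exp_pos _)
      (hF.diffContOnCl_ball (Metric.closedBall_subset_ball hR1)) fun z hz => by
        rw [mem_sphere_zero_iff_norm] at hz
        obtain ⟨t, rfl⟩ := exists_ee_eq (q := z) (by
          rintro rfl; rw [norm_zero] at hz; exact (Real.exp_pos _).ne hz)
        rw [norm_ee, Real.exp_eq_exp] at hz
        have ht : t.im = y := by
          refine mul_left_cancel₀ (a := -2 * Real.pi) (by simp [hpi.ne']) hz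
        subst ht
        rw [hFe t hy]
        exact h.wj.norm_le rfl h.bd a b hy
    have h2 : (0 : ℝ) < n.factorial := by exact_mod_cast n.factorial_pos
    rw [norm_mul, norm_inv, Complex.norm_natCast, inv_mul_le_iff₀ h2]
    refine h1.trans_eq ?_
    rw [div_eq_mul_inv, ← inv_pow, ← Real.exp_neg]
    ring_nf

theorem sum_range_ee_mul_div {d : ℕ} (hd : d ≠ 0) (m : ℕ) :
    (d : ℂ)⁻¹ * ∑ β ∈ Finset.range d, ee (m * β / d) = if d ∣ m then 1 else 0 := by
  have hd' : (d : ℂ) ≠ 0 := by exact_mod_cast hd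
  have h1 : ∀ β : ℕ, ee (m * β / d) = ee (m / d) ^ β := fun β => by
    rw [← ee_nat_mul]; congr 1; ring
  simp only [h1]
  split_ifs with hm
  · obtain ⟨j, rfl⟩ := hm
    rw [show ((d * j : ℕ) : ℂ) / d = (j : ℕ) by push_cast; field_simp, ee_natCast]
    simp [hd']
  · have hne : ee (m / d) ≠ 1 := by
      intro h
      rw [ee, Complex.exp_eq_one_iff] at h
      obtain ⟨n, hn⟩ := h
      have h2 : (m : ℂ) = d * n := by
        have h3 : (m : ℂ) / d = n := by
          have := Complex.two_pi_I_ne_zero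
          refine mul_left_cancel₀ this (hn.trans (mul_comm _ _))
        rw [← h3]; field_simp
      have h4 : (m : ℤ) = d * n := by exact_mod_cast h2
      exact hm (Int.natCast_dvd_natCast.mp ⟨n, h4⟩)
    rw [geom_sum_eq hne, ← ee_nat_mul, mul_div_cancel₀ _ hd', ee_natCast]
    simp

theorem hasSum_lc {p : ℕ → ℂ} {α d : ℕ} {t a b : ℂ} (hα : α ≠ 0) (hd : d ≠ 0) (ht : 0 < t.im)
    (hp : ∀ t : ℂ, 0 < t.im → HasSum (fun n => p n * ee (n * t)) (φ t (α * a) (α * b))) :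
    HasSum (fun n : ℕ => α ^ l * p (d * n) * ee (α * n * t)) (lc l φ α d t a b) := by
  have hd' : (d : ℂ) ≠ 0 := by exact_mod_cast hd
  have h1 := (hasSum_sum (s := Finset.range d) fun β _ => hp _ (im_rep_pos hα hd β ht)).mul_left
    ((α : ℂ) ^ l * (d : ℂ)⁻¹)
  have h2 : ∀ m : ℕ, (α : ℂ) ^ l * (d : ℂ)⁻¹ * ∑ β ∈ Finset.range d, p m * ee (m * ((α * t + β) / d)) =
      α ^ l * p m * ee (m * α * t / d) * if d ∣ m then 1 else 0 := by
    intro m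
    rw [← sum_range_ee_mul_div hd]
    simp only [Finset.mul_sum]
    refine Finset.sum_congr rfl fun β _ => ?_
    rw [show (m : ℂ) * ((α * t + β) / d) = m * α * t / d + m * β / d by field_simp, ee_add]
    ring
  simp only [h2] at h1
  have hinj : Function.Injective fun n : ℕ => d * n := fun x y hxy => Nat.eq_of_mul_eq_mul_left
    (Nat.pos_of_ne_zero hd) hxy
  rw [← hinj.hasSum_iff fun x hx => by
    rw [if_neg fun ⟨j, hj⟩ => hx ⟨j, hj.symm⟩, mul_zero]] at h1
  refine h1.congr_fun fun n => ?_
  simp only [Function.comp, dvd_mul_right, if_true, mul_one]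
  congr 2
  push_cast
  field_simp

end LiftSwap

section LiftSymmetric

variable {k : ℤ} {l : ℕ} {C : ℝ} {c : ℂ} {e : ℂ → ℂ} {φ : ℂ → ℂ → ℂ → ℂ}

/-- The lift is symmetric under exchanging its outer variables. -/
theorem Liftable.exists_symm (h : Liftable l C c e φ) (a b : ℂ) :
    ∃ U : ℕ+ → ℕ+ → ℕ+ → ℂ, ∃ e₀ : ℂ, ∀ t w : ℂ, Om t a b w →
      (Summable fun x : (ℕ+ × ℕ+) × ℕ+ => U x.1.1 x.1.2 x.2 *
        ee ((x.1.1 : ℕ) * ((x.2 : ℕ) * t + (x.1.2 : ℕ) * w))) ∧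
      lift l e φ t a b w = e t + e w - e₀ + ∑' x : (ℕ+ × ℕ+) × ℕ+, U x.1.1 x.1.2 x.2 *
        ee ((x.1.1 : ℕ) * ((x.2 : ℕ) * t + (x.1.2 : ℕ) * w)) ∧ ∀ α d n, U α d n = U α n d := by
  choose p hp0 hp1 hp2 using h.exists_coeff
  obtain ⟨e₀, he⟩ := h.hasSum
  refine ⟨fun α d n => ((α : ℕ) : ℂ) ^ l * p ((α : ℕ) * a) ((α : ℕ) * b) (d * n), e₀,
    fun t w hO => ?_⟩
  have hs : Summable fun x : (ℕ+ × ℕ+) × ℕ+ => ((x.1.1 : ℕ) : ℂ) ^ l *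
      p ((x.1.1 : ℕ) * a) ((x.1.1 : ℕ) * b) (x.1.2 * x.2) *
      ee ((x.1.1 : ℕ) * ((x.2 : ℕ) * t + (x.1.2 : ℕ) * w)) := by
    have hw := hO.im_pos
    have ht := hO.1
    have hpi := Real.pi_pos
    have hC := h.C_nonneg
    set N : ℝ := a.im ^ 2 + a.im * b.im + 2 * b.im ^ 2 with hN
    have hN0 : 0 ≤ N := nn_nonneg _ _
    obtain ⟨y, hy1, hy2⟩ : ∃ y, N / w.im < y ∧ y < t.im := exists_between ((div_lt_iff₀ hw).mpr hO.2)
    have hy : 0 < y := lt_of_le_of_lt (by positivity) hy1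
    have hgap : N / y < w.im := by rwa [div_lt_iff₀ hw, ← div_lt_iff₀' hy] at hy1
    have s1 := summable_pow_mul_pow_mul_geometric l
      (r := Real.exp (-2 * Real.pi * (w.im - N / y))) (Real.exp_pos _).le (by
      rw [Real.exp_lt_one_iff]; nlinarith)
    have hr1 : Real.exp (-2 * Real.pi * (t.im - y)) < 1 := by rw [Real.exp_lt_one_iff]; nlinarith
    have s2 : Summable fun n : ℕ+ => Real.exp (-2 * Real.pi * (t.im - y)) ^ (n : ℕ) :=
      summable_pnat_iff_summable_nat (f := fun n => Real.exp (-2 * Real.pi * (t.im - y)) ^ n) |>.mpr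
        (summable_geometric_of_lt_one (Real.exp_pos _).le hr1)
    refine Summable.of_norm_bounded ((s1.mul_of_nonneg s2 (fun x => by positivity)
      fun x => by positivity).mul_left (C * (1 + 1 / y) ^ (l + 1))) fun x => ?_
    obtain ⟨⟨α, d⟩, n⟩ := x
    simp only
    have hα : (1 : ℝ) ≤ α := by exact_mod_cast one_le
    have hd : (1 : ℝ) ≤ d := by exact_mod_cast one_le
    have hn : (1 : ℝ) ≤ n := by exact_mod_cast one_le
    have h1 := hp2 ((α : ℕ) * a) ((α : ℕ) * b) (d * n) ((α : ℕ) * y / d) (by positivity)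
    have e1 : (((α : ℕ) : ℂ) * a).im = α * a.im := by simp
    have e2 : (((α : ℕ) : ℂ) * b).im = α * b.im := by simp
    rw [e1, e2] at h1
    have e4 : 1 + 1 / (α * y / d) ≤ (1 + 1 / y) * d := by
      rw [add_mul, one_mul, one_div_div, one_div_mul_eq_div]
      gcongr
      exact le_mul_of_one_le_left hy.le hα
    have e5 : ‖ee ((α : ℕ) * ((n : ℕ) * t + (d : ℕ) * w))‖ =
        Real.exp (-2 * Real.pi * (α * (n * t.im + d * w.im))) := by
      rw [norm_ee]; congr 2; simp
    rw [norm_mul, norm_mul, norm_pow, Complex.norm_natCast, e5]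
    have e6 : Real.exp (-2 * Real.pi * (t.im - y)) ^ ((α : ℕ) * n : ℕ) ≤
        Real.exp (-2 * Real.pi * (t.im - y)) ^ (n : ℕ) :=
      pow_le_pow_of_le_one (Real.exp_pos _).le hr1.le (Nat.le_mul_of_pos_left _ α.pos)
    calc _ ≤ (α : ℝ) ^ l * (C * ((1 + 1 / y) * d) ^ (l + 1) *
          Real.exp (2 * Real.pi * (((α * a.im) ^ 2 + α * a.im * (α * b.im) + 2 * (α * b.im) ^ 2) /
            (α * y / d))) * Real.exp (2 * Real.pi * (α * y / d)) ^ ((d : ℕ) * n)) *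
          Real.exp (-2 * Real.pi * (α * (n * t.im + d * w.im))) := by
          gcongr
          refine h1.trans ?_
          gcongr
      _ = C * (1 + 1 / y) ^ (l + 1) * ((α : ℝ) ^ l * (d : ℝ) ^ (l + 1) *
          Real.exp (-2 * Real.pi * (w.im - N / y)) ^ ((α : ℕ) * d : ℕ) *
          Real.exp (-2 * Real.pi * (t.im - y)) ^ ((α : ℕ) * n : ℕ)) := by
          rw [mul_pow (1 + 1 / y)]
          simp only [← Real.exp_nat_mul]
          have e7 : 2 * Real.pi * (((α * a.im) ^ 2 + α * a.im * (α * b.im) + 2 * (α * b.im) ^ 2) /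
            (α * y / d)) + ((d : ℕ) * (n : ℕ) : ℕ) * (2 * Real.pi * (α * y / d)) +
            (-2 * Real.pi * (α * (n * t.im + d * w.im))) =
            ((α : ℕ) * (d : ℕ) : ℕ) * (-2 * Real.pi * (w.im - N / y)) +
            ((α : ℕ) * (n : ℕ) : ℕ) * (-2 * Real.pi * (t.im - y)) := by
            rw [hN]
            push_cast
            field_simp
            ring
          have e8 := congrArg Real.exp e7
          simp only [Real.exp_add] at e8
          linear_combination C * (1 + 1 / y) ^ (l + 1) * ((α : ℝ) ^ l * (d : ℝ) ^ (l + 1)) * e8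
      _ ≤ _ := by gcongr
  refine ⟨hs, ?_, fun α d n => by simp only [mul_comm (d : ℕ)]⟩
  have hα : ∀ x : ℕ+ × ℕ+, lc l φ x.1 x.2 t a b * ee ((x.1 : ℕ) * (x.2 : ℕ) * w) =
      c * ((x.1 : ℕ) : ℂ) ^ l * ee ((x.1 : ℕ) * (x.2 : ℕ) * w) + ∑' n : ℕ+, ((x.1 : ℕ) : ℂ) ^ l *
      p ((x.1 : ℕ) * a) ((x.1 : ℕ) * b) (x.2 * n) * ee ((x.1 : ℕ) * ((n : ℕ) * t + (x.2 : ℕ) * w)) := by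
    intro x
    have h1 := hasSum_lc (l := l) x.1.ne_zero x.2.ne_zero hO.1 (hp1 ((x.1 : ℕ) * a) ((x.1 : ℕ) * b))
    have h2 := tsum_zero_pnat_eq_tsum_nat h1.summable
    rw [h1.tsum_eq] at h2
    rw [← h2, add_mul, ← tsum_mul_right]
    congr 1
    · simp only [mul_zero, hp0, Nat.cast_zero, zero_mul, ee_zero, mul_one]
      ring
    · refine tsum_congr fun n => ?_
      rw [mul_add, ee_add]
      ring_nf
  have hw := he w hO.im_pos
  have hs2 := hs.prod
  rw [lift, tsum_congr hα, hw.summable.tsum_add hs2, hw.tsum_eq, hs.tsum_prod]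
  ring

theorem Liftable.swap (h : Liftable l C c e φ) {t a b w : ℂ} (hO : Om t a b w) :
    lift l e φ w a b t = lift l e φ t a b w := by
  obtain ⟨U, e₀, hU⟩ := h.exists_symm a b
  obtain ⟨-, h1, h2⟩ := hU t w hO
  obtain ⟨-, h3, -⟩ := hU w t hO.swap
  rw [h1, h3, add_comm (e w)]
  congr 1
  let σ : (ℕ+ × ℕ+) × ℕ+ ≃ (ℕ+ × ℕ+) × ℕ+ :=
    ⟨fun x => ((x.1.1, x.2), x.1.2), fun x => ((x.1.1, x.2), x.1.2), fun _ => rfl, fun _ => rfl⟩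
  rw [← σ.tsum_eq]
  refine tsum_congr fun x => ?_
  simp only [σ, Equiv.coe_fn_mk]
  rw [h2, add_comm (_ * w)]

theorem Liftable.symForm (h : Liftable l C c e φ) : SymForm ((l : ℤ) + 1) (lift l e φ) where
  holo _ _ _ _ hO := h.holo hO
  T t a b w hO := by
    have hO' : Om (t + 1) a b w := by simpa [Om] using hO
    have h1 := h.hasSum_sigma hO
    have h2 := h.hasSum_sigma hO'
    simp only [h.wj.sum_lc_T rfl (PNat.ne_zero _) a b hO.1] at h2
    have h3 := h1.unique h2
    rw [h.mf.T t hO.1] at h3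
    linear_combination -h3
  A t a b w hO := by
    simp only [lift, h.wj.lc_A (PNat.ne_zero _) (PNat.ne_zero _) a b hO.1]
  B t a b w hO := by
    simp only [lift, h.wj.lc_B (PNat.ne_zero _) (PNat.ne_zero _) a b hO.1]
  HA t a b w hO := by
    simp only [lift, h.wj.lc_HA (PNat.ne_zero _) (PNat.ne_zero _) a b hO.1]
    congr 1
    refine tsum_congr fun x => ?_
    rw [mul_right_comm, ← ee_add, mul_comm]
    congr 2
    ring
  HB t a b w hO := by
    simp only [lift, h.wj.lc_HB (PNat.ne_zero _) (PNat.ne_zero _) a b hO.1]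
    congr 1
    refine tsum_congr fun x => ?_
    rw [mul_right_comm, ← ee_add, mul_comm]
    congr 2
    ring
  S t a b w hO := by
    have h1 := (h.hasSum_sigma hO).mul_left (t ^ ((l : ℤ) + 1))
    have h2 := h.hasSum_sigma hO.S
    simp only [h.wj.sum_lc_S rfl (PNat.ne_zero _) a b hO.1] at h2
    have h3 := h1.unique (h2.congr_fun fun n => by
      have e1 : ee ((n : ℕ) * NN a b / t) * ee ((n : ℕ) * (w - NN a b / t)) = ee ((n : ℕ) * w) := by
        rw [← ee_add]; congr 1; ring
      rw [← e1]
      ring)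
    rw [h.mf.S t hO.1] at h3
    linear_combination -h3
  sig t a b w hO := by
    simp only [lift, h.wj.lc_sig (PNat.ne_zero _) (PNat.ne_zero _) a b hO.1]
  neg t a b w hO := by
    simp only [lift, h.wj.lc_neg (PNat.ne_zero _) (PNat.ne_zero _) a b hO.1]
    rw [mul_add, ← h.mf.eq_neg_one_zpow_mul hO.1, ← tsum_mul_left]
    simp only [mul_assoc]
  swap _ _ _ _ hO := h.swap hO

theorem tendsto_ee_mul_imInf {n : ℕ} (hn : n ≠ 0) : Tendsto (fun w => ee (n * w)) imInf (𝓝 0) := by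
  have := tendsto_ee_imInf.pow n
  rw [zero_pow hn] at this
  exact this.congr fun w => (ee_nat_mul n w).symm

theorem Liftable.tendsto_tsum (h : Liftable l C c e φ) {m : ℕ} (hm : m ≤ 1) {t : ℂ} (a b : ℂ)
    (ht : 0 < t.im) : Tendsto (fun w => (lift l e φ t a b w - e t) * ee (-(m * w))) imInf
      (𝓝 (∑' x : ℕ+ × ℕ+, if (x.1 * x.2 : ℕ) = m then lc l φ x.1 x.2 t a b else 0)) := by
  have hpi := Real.pi_pos
  have hC := h.C_nonneg
  set N : ℝ := (a.im ^ 2 + a.im * b.im + 2 * b.im ^ 2) / t.im with hN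
  have e0 : ∀ (x : ℕ+ × ℕ+) (w : ℂ), ee ((x.1 : ℕ) * (x.2 : ℕ) * w) * ee (-(m * w)) =
      ee (((x.1 * x.2 - m : ℕ) : ℂ) * w) := fun x w => by
    have h1 : m ≤ (x.1 * x.2 : ℕ) := hm.trans (Nat.mul_pos x.1.pos x.2.pos)
    rw [← ee_add, Nat.cast_sub h1]; congr 1; push_cast; ring
  simp only [lift, add_sub_cancel_left, ← tsum_mul_right]
  refine tendsto_tsum_of_dominated_convergence (bound := fun x : ℕ+ × ℕ+ =>
      C * (1 + 1 / t.im) ^ (l + 1) * ((x.1 : ℝ) ^ l * (x.2 : ℝ) ^ (l + 1) *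
        Real.exp (-2 * Real.pi * 1) ^ (x.1 * x.2 : ℕ)) * Real.exp (2 * Real.pi * (1 + N)))
    (((summable_pow_mul_pow_mul_geometric l (Real.exp_pos _).le (by
      rw [Real.exp_lt_one_iff]; nlinarith)).mul_left _).mul_right _) (fun x => ?_) ?_
  · simp only [mul_assoc (lc _ _ _ _ _ _ _), e0]
    split_ifs with hx
    · simp [hx, ee_zero]
    · have h1 : m ≤ (x.1 * x.2 : ℕ) := hm.trans (Nat.mul_pos x.1.pos x.2.pos)
      have := (tendsto_ee_mul_imInf (n := x.1 * x.2 - m) (by omega)).const_mul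
        (lc l φ x.1 x.2 t a b)
      rwa [mul_zero] at this
  · filter_upwards [eventually_imInf (1 + N)] with w hw x
    have h1 := h.norm_term_le a b w ht x
    rw [norm_mul, norm_ee_neg_mul]
    have h0 : 1 ≤ (x.1 * x.2 : ℕ) := Nat.mul_pos x.1.pos x.2.pos
    have hg : gap t a b w = w.im - N := rfl
    have hm' : (m : ℝ) ≤ 1 := by exact_mod_cast hm
    have h2 : Real.exp (-2 * Real.pi * gap t a b w) ^ (x.1 * x.2 : ℕ) *
        Real.exp (2 * Real.pi * m * w.im) ≤
        Real.exp (-2 * Real.pi * 1) ^ (x.1 * x.2 : ℕ) * Real.exp (2 * Real.pi * (1 + N)) := by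
      rw [← Real.exp_nat_mul, ← Real.exp_nat_mul, ← Real.exp_add, ← Real.exp_add, Real.exp_le_exp,
          hg]
      have h3 : (1 : ℝ) ≤ ((x.1 * x.2 : ℕ) : ℝ) := by exact_mod_cast h0
      have hN0 : 0 ≤ N := div_nonneg (nn_nonneg _ _) ht.le
      have h4 : (m : ℝ) * w.im ≤ w.im := by nlinarith
      have h5 : 0 ≤ (((x.1 * x.2 : ℕ) : ℝ) - 1) * (w.im - N - 1) :=
        mul_nonneg (by linarith) (by linarith)
      nlinarith
    refine (mul_le_mul_of_nonneg_right h1 (Real.exp_pos _).le).trans ?_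
    rw [mul_assoc, mul_assoc ((x.1 : ℝ) ^ l * _), mul_assoc (C * _),
      mul_assoc ((x.1 : ℝ) ^ l * (x.2 : ℝ) ^ (l + 1)) (_ ^ _)]
    gcongr

theorem Liftable.lead_zero (h : Liftable l C c e φ) : Lead 0 (lift l e φ) fun t _ _ => e t := by
  intro t a b ht
  have h1 := (h.tendsto_tsum zero_le_one a b ht).add_const (e t)
  have h2 : ∀ x : ℕ+ × ℕ+, (x.1 * x.2 : ℕ) ≠ 0 := fun x => (Nat.mul_pos x.1.pos x.2.pos).ne'
  simp only [if_neg (h2 _), tsum_zero, zero_add] at h1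
  refine h1.congr fun w => ?_
  simp [ee_zero]

theorem Liftable.lead_one (h : Liftable l C c e φ) (he : ∀ t, 0 < t.im → e t = 0) :
    Lead 1 (lift l e φ) φ := by
  intro t a b ht
  have h1 := h.tendsto_tsum le_rfl a b ht
  rw [tsum_eq_single (1, 1) fun x hx => if_neg fun h2 => hx (by
    rw [_root_.mul_eq_one] at h2
    exact Prod.ext (PNat.coe_eq_one_iff.mp h2.1) (PNat.coe_eq_one_iff.mp h2.2))] at h1
  have h2 : lc l φ 1 1 t a b = φ t a b := by simp [lc]
  simp only [PNat.one_coe, mul_one, if_true, h2] at h1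
  refine h1.congr fun w => ?_
  rw [he t ht, sub_zero]

end LiftSymmetric

section CuspBound

variable {k : ℤ} {l : ℕ} {φ : ℂ → ℂ → ℂ → ℂ}

theorem exists_bound_of_tendsto_imInf {f : ℂ → ℂ} {L : ℂ} {y : ℝ}
    (hc : ∀ z : ℂ, y ≤ z.im → ContinuousAt f z) (hp : ∀ z : ℂ, y ≤ z.im → ‖f (z + 1)‖ = ‖f z‖)
    (hL : Tendsto f imInf (𝓝 L)) : ∃ C, ∀ z : ℂ, y ≤ z.im → ‖f z‖ ≤ C := by
  obtain ⟨Y, -, hY⟩ := (atTop_basis.comap Complex.im).eventually_iff.mp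
    (hL.norm.eventually_le_const (lt_add_one _))
  obtain ⟨C, hC⟩ := exists_bound_of_periodic (y₁ := y) (y₂ := Y)
    (fun z h _ => hc z h) (fun z h _ => hp z h)
  refine ⟨max C (‖L‖ + 1), fun z hz => ?_⟩
  rcases le_total z.im Y with h | h
  · exact (hC z hz h).trans (le_max_left _ _)
  · exact (hY h).trans (le_max_right _ _)

theorem exists_bound_DD :
    ∃ C, ∀ t : ℂ, 1 / 2 ≤ t.im → ‖DD t‖ ≤ C * Real.exp (-2 * Real.pi * t.im) := by
  obtain ⟨C, hC⟩ := exists_bound_of_tendsto_imInf (f := fun t => DD t * ee (-t)) (y := 1 / 2)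
    (fun z hz => ((mf_DD.holo z (by linarith)).continuousAt).mul
      (continuous_ee.comp continuous_neg).continuousAt)
    (fun z hz => by
      simp only [mf_DD.T z (by linarith), norm_mul, norm_ee]; simp) tendsto_DD
  refine ⟨C, fun t ht => ?_⟩
  have h := hC t ht
  rw [norm_mul, norm_ee, Complex.neg_im] at h
  calc ‖DD t‖ = ‖DD t‖ * Real.exp (-2 * Real.pi * -t.im) * Real.exp (-2 * Real.pi * t.im) := by
        rw [mul_assoc, ← Real.exp_add]; simp
    _ ≤ _ := by gcongr

theorem WJ.exists_bound_real (h : WJ k 3 1 φ) :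
    ∃ C, ∀ t a b : ℂ, 1 / 2 ≤ t.im → a.im = 0 → b.im = 0 → ‖φ t a b‖ ≤ C := by
  obtain ⟨C₁, Y, h1⟩ := h.W 1
  have hcpt : IsCompact ((Set.Icc (0 : ℝ) 1 ×ℂ Set.Icc (1 / 2 : ℝ) Y) ×ˢ
      (Set.Icc (0 : ℝ) 1 ×ℂ {0}) ×ˢ (Set.Icc (0 : ℝ) 1 ×ℂ {0})) :=
    (isCompact_Icc.reProdIm isCompact_Icc).prod
      ((isCompact_Icc.reProdIm isCompact_singleton).prod
        (isCompact_Icc.reProdIm isCompact_singleton))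
  obtain ⟨C₂, h2⟩ := hcpt.exists_bound_of_continuousOn
    (f := fun p : ℂ × ℂ × ℂ => φ p.1 p.2.1 p.2.2)
    fun p hp => (h.holo p.1 p.2.1 p.2.2 (by have := hp.1.2.1; linarith)).continuousAt.continuousWithinAt
  refine ⟨max C₁ C₂, fun t a b ht ha hb => ?_⟩
  have h0 : 0 < t.im := by linarith
  obtain ⟨t', e1, r1, g1⟩ := exists_re_mem_Icc (P := fun y => 0 < y) (f := fun t => φ t a b)
    (fun z hz => h.T _ _ _ hz) t h0
  rw [← e1] at ht h0
  obtain ⟨a', e2, r2, g2⟩ := exists_re_mem_Icc (P := fun _ => True) (f := fun a => φ t' a b)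
    (fun z _ => h.A _ _ _ h0) a trivial
  obtain ⟨b', e3, r3, g3⟩ := exists_re_mem_Icc (P := fun _ => True) (f := fun b => φ t' a' b)
    (fun z _ => by rw [h.B t' a' z h0, even_three_mul_add 1, one_mul]) b trivial
  rw [← g1, ← g2, ← g3]
  rw [ha] at e2
  rw [hb] at e3
  have hle : ∀ z : ℂ, z.im = 0 → z.re ∈ Set.Icc (0 : ℝ) 1 → ‖z‖ ≤ 1 := fun z h1 h2 =>
    (Complex.norm_le_abs_re_add_abs_im z).trans (by rw [h1, abs_of_nonneg h2.1]; simpa using h2.2)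
  rcases le_total t'.im Y with hy | hy
  · exact (h2 (t', a', b') ⟨⟨r1, ht, hy⟩, ⟨r2, e2⟩, ⟨r3, e3⟩⟩).trans (le_max_right _ _)
  · exact (h1 t' a' b' h0 hy (hle _ e2 r2) (hle _ e3 r3)).trans (le_max_left _ _)

theorem WJ.differentiableAt_A (h : WJ k 3 1 φ) {t : ℂ} (ht : 0 < t.im) (a b : ℂ) :
    DifferentiableAt ℂ (fun z => φ t z b) a :=
  DifferentiableAt.comp (g := fun p : ℂ × ℂ × ℂ => φ p.1 p.2.1 p.2.2) (f := fun z => (t, z, b)) a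
    (h.holo t a b ht) (by fun_prop)

theorem WJ.differentiableAt_B (h : WJ k 3 1 φ) {t : ℂ} (ht : 0 < t.im) (a b : ℂ) :
    DifferentiableAt ℂ (fun z => φ t a z) b :=
  DifferentiableAt.comp (g := fun p : ℂ × ℂ × ℂ => φ p.1 p.2.1 p.2.2) (f := fun z => (t, a, z)) b
    (h.holo t a b ht) (by fun_prop)

/-- Interpolation of a weak Jacobi form over one period parallelogram. -/
theorem WJ.norm_le_strip (h : WJ k 3 1 φ) {C : ℝ} {t : ℂ} (ht : 0 < t.im)
    (hC : ∀ a b : ℂ, a.im = 0 → b.im = 0 → ‖φ t a b‖ ≤ C) {a b : ℂ}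
    (ha : 0 ≤ a.im) (ha' : a.im ≤ t.im) (hb : 0 ≤ b.im) (hb' : b.im ≤ t.im) :
    ‖φ t a b‖ ≤ C * Real.exp (2 * Real.pi * (a.im + (2 + a.im / t.im) * b.im)) := by
  have step : ∀ b : ℂ, b.im = 0 → ‖φ t a b‖ ≤ C * Real.exp (2 * Real.pi * a.im) := by
    intro b hb
    have := norm_le_of_periodic_strip (f := fun z => φ t z b * ee z) (y₁ := 0) (y₂ := t.im) (C := C)
      (fun z _ _ => (h.differentiableAt_A ht z b).fun_mul (differentiable_ee z))
      (fun z _ _ => by simp only [h.A t z b ht, ee_add, ee_one, mul_one])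
      (fun z hz => by
        rw [norm_mul, norm_ee, hz, mul_zero, Real.exp_zero, mul_one]; exact hC z b hz hb)
      (fun z hz => by
        have h1 := h.HA t (z - t) b ht
        rw [sub_add_cancel] at h1
        have h2 : (z - t).im = 0 := by simp [hz]
        rw [h1, norm_mul, norm_mul, norm_ee, norm_ee, mul_right_comm, ← Real.exp_add]
        refine le_trans (le_of_eq ?_) (hC (z - t) b h2 hb)
        convert one_mul _ using 2
        rw [Real.exp_eq_one_iff]
        simp [hz, hb]) a ha ha'
    rw [norm_mul, norm_ee] at this
    calc ‖φ t a b‖ = ‖φ t a b‖ * Real.exp (-2 * Real.pi * a.im) * Real.exp (2 * Real.pi * a.im) := by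
          rw [mul_assoc, ← Real.exp_add]; simp
      _ ≤ _ := by gcongr
  have hyne := ht.ne'
  have := norm_le_of_periodic_strip (f := fun z => φ t a z * ee ((2 + a.im / t.im : ℝ) * z))
    (y₁ := 0) (y₂ := t.im) (C := C * Real.exp (2 * Real.pi * a.im))
    (fun z _ _ => (h.differentiableAt_B ht a z).fun_mul (by
      exact (differentiable_ee.comp (differentiable_id.const_mul _)) z))
    (fun z _ _ => by
      have := h.B t a z ht
      rw [even_three_mul_add 1, one_mul] at this
      simp only [this, norm_mul, norm_ee, Complex.im_ofReal_mul]; simp)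
    (fun z hz => by
      rw [norm_mul, norm_ee, Complex.im_ofReal_mul, hz, mul_zero, mul_zero, Real.exp_zero, mul_one]
      exact step z hz)
    (fun z hz => by
      have h1 := h.HB t a (z - t) ht
      rw [sub_add_cancel, even_three_mul_add 1, one_mul] at h1
      have h2 : (z - t).im = 0 := by simp [hz]
      rw [h1, norm_mul, norm_mul, norm_ee, norm_ee, mul_right_comm, ← Real.exp_add]
      refine le_trans (le_of_eq ?_) (step (z - t) h2)
      convert one_mul _ using 2
      rw [Real.exp_eq_one_iff, Complex.im_ofReal_mul, hz]
      simp [hz]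
      field_simp
      ring) b hb hb'
  rw [norm_mul, norm_ee, Complex.im_ofReal_mul] at this
  calc ‖φ t a b‖ = ‖φ t a b‖ * Real.exp (-2 * Real.pi * ((2 + a.im / t.im) * b.im)) *
        Real.exp (2 * Real.pi * ((2 + a.im / t.im) * b.im)) := by
        rw [mul_assoc, ← Real.exp_add]; simp
    _ ≤ C * Real.exp (2 * Real.pi * a.im) * Real.exp (2 * Real.pi * ((2 + a.im / t.im) * b.im)) := by
        gcongr
    _ = _ := by rw [mul_assoc, ← Real.exp_add, ← mul_add]

theorem WJ.norm_add_mul_self_A (h : WJ k 3 1 φ) {t : ℂ} (ht : 0 < t.im) (a b : ℂ) :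
    ‖φ t (a + t) b‖ * Real.exp (-2 * Real.pi * (((a + t).im ^ 2 + (a + t).im * b.im + 2 * b.im ^ 2) / t.im)) =
    ‖φ t a b‖ * Real.exp (-2 * Real.pi * ((a.im ^ 2 + a.im * b.im + 2 * b.im ^ 2) / t.im)) := by
  have := ht.ne'
  rw [h.HA t a b ht, norm_mul, norm_ee, mul_right_comm, ← Real.exp_add, mul_comm]
  congr 2
  simp
  field_simp
  ring

theorem WJ.norm_add_mul_self_B (h : WJ k 3 1 φ) {t : ℂ} (ht : 0 < t.im) (a b : ℂ) :
    ‖φ t a (b + t)‖ * Real.exp (-2 * Real.pi * ((a.im ^ 2 + a.im * (b + t).im + 2 * (b + t).im ^ 2) / t.im)) =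
    ‖φ t a b‖ * Real.exp (-2 * Real.pi * ((a.im ^ 2 + a.im * b.im + 2 * b.im ^ 2) / t.im)) := by
  have := ht.ne'
  rw [h.HB t a b ht, even_three_mul_add 1, one_mul, norm_mul, norm_ee, mul_right_comm,
    ← Real.exp_add, mul_comm]
  congr 2
  simp
  field_simp
  ring

/-- A function with period `t` takes all its values on the strip `0 ≤ im z ≤ im t`. -/
theorem exists_im_mem_Icc_of_add_self {X : Type*} {t : ℂ} (ht : 0 < t.im) {f : ℂ → X}
    (hf : ∀ z, f (z + t) = f z) (z : ℂ) : ∃ z' : ℂ, 0 ≤ z'.im ∧ z'.im ≤ t.im ∧ f z' = f z := by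
  have hr : z = (z.re - z.im / t.im * t.re : ℝ) + (z.im / t.im : ℝ) * t := by
    apply Complex.ext <;> simp; field_simp
  obtain ⟨x, e1, e2, e3⟩ := exists_re_mem_Icc (P := fun _ => True)
    (f := fun x => f ((z.re - z.im / t.im * t.re : ℝ) + x * t))
    (fun x _ => by rw [add_mul, one_mul, ← add_assoc, hf]) (z.im / t.im : ℝ) trivial
  rw [Complex.ofReal_im] at e1
  refine ⟨(z.re - z.im / t.im * t.re : ℝ) + x * t, ?_, ?_, by rw [e3, ← hr]⟩ <;>
    rw [Complex.add_im, Complex.ofReal_im, Complex.mul_im, e1, zero_mul, zero_add, add_zero]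
  · exact mul_nonneg e2.1 ht.le
  · nlinarith [e2.2]

/-- Multiplying by the discriminant turns a weak Jacobi form into a cusp form. -/
theorem WJ.exists_bound_DD_mul (h : WJ k 3 1 φ) : ∃ C, ∀ t a b : ℂ, 1 / 2 ≤ t.im →
    ‖DD t * φ t a b‖ ≤
      C * Real.exp (2 * Real.pi * ((a.im ^ 2 + a.im * b.im + 2 * b.im ^ 2) / t.im)) := by
  obtain ⟨C, hC⟩ := h.exists_bound_real
  obtain ⟨C', hC'⟩ := exists_bound_DD
  refine ⟨C' * C, fun t a b ht => ?_⟩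
  have h0 : 0 < t.im := by linarith
  have hπ := Real.pi_pos
  have hC0 : 0 ≤ C := (norm_nonneg _).trans (hC t 0 0 ht rfl rfl)
  have hC0' : 0 ≤ C' := nonneg_of_mul_nonneg_left ((norm_nonneg _).trans (hC' t ht)) (Real.exp_pos _)
  set G : ℂ → ℂ → ℝ := fun a b => ‖φ t a b‖ *
    Real.exp (-2 * Real.pi * ((a.im ^ 2 + a.im * b.im + 2 * b.im ^ 2) / t.im)) with hG
  have main : G a b ≤ C * Real.exp (2 * Real.pi * t.im) := by
    obtain ⟨a', a1, a2, a3⟩ := exists_im_mem_Icc_of_add_self h0 (f := fun z => G z b) (fun z => h.norm_add_mul_self_A h0 z b) a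
    obtain ⟨b', b1, b2, b3⟩ := exists_im_mem_Icc_of_add_self h0 (f := G a') (fun z => h.norm_add_mul_self_B h0 a' z) b
    rw [← a3, ← b3]
    refine (mul_le_mul_of_nonneg_right
      (h.norm_le_strip h0 (fun a b ha hb => hC t a b ht ha hb) a1 a2 b1 b2)
      (Real.exp_pos _).le).trans ?_
    rw [mul_assoc, ← Real.exp_add]
    gcongr
    have hsum : 2 * Real.pi * (a'.im + (2 + a'.im / t.im) * b'.im) + -2 * Real.pi *
        ((a'.im ^ 2 + a'.im * b'.im + 2 * b'.im ^ 2) / t.im) =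
        2 * Real.pi * ((a'.im * t.im - a'.im ^ 2 + 2 * b'.im * t.im - 2 * b'.im ^ 2) / t.im) := by
      field_simp; ring
    rw [hsum]
    gcongr
    rw [div_le_iff₀ h0]
    nlinarith [sq_nonneg (a'.im - t.im / 2), sq_nonneg (b'.im - t.im / 2), sq_nonneg t.im]
  have e1 : ‖φ t a b‖ = G a b *
      Real.exp (2 * Real.pi * ((a.im ^ 2 + a.im * b.im + 2 * b.im ^ 2) / t.im)) := by
    rw [hG]; simp only; rw [mul_assoc, ← Real.exp_add]; simp
  rw [norm_mul, e1, ← mul_assoc]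
  refine mul_le_mul_of_nonneg_right ?_ (Real.exp_pos _).le
  calc ‖DD t‖ * G a b ≤ C' * Real.exp (-2 * Real.pi * t.im) * (C * Real.exp (2 * Real.pi * t.im)) :=
        mul_le_mul (hC' t ht) main (mul_nonneg (norm_nonneg _) (Real.exp_pos _).le) (by positivity)
    _ = C' * C * (Real.exp (-2 * Real.pi * t.im) * Real.exp (2 * Real.pi * t.im)) := by ring
    _ = C' * C := by rw [← Real.exp_add]; simp

theorem WJ.liftable (h : WJ k 3 1 φ) (hl : (l : ℤ) + 1 = k + 12) :
    ∃ C, Liftable l C 0 (fun _ => 0) fun t a b => DD t * φ t a b := by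
  obtain ⟨C, hC⟩ := h.exists_bound_DD_mul
  refine ⟨C, (mf_DD.wj.mul h).cast (by rw [hl]; ring) rfl rfl, hC, fun a b => ?_, MF.zero _,
    0, fun t _ => by simp⟩
  obtain ⟨C, Y, hb⟩ := h.W (max ‖a‖ ‖b‖)
  have h1 : Tendsto DD imInf (𝓝 0) := by
    have := tendsto_DD.mul tendsto_ee_imInf
    rw [one_mul] at this
    refine this.congr fun t => ?_
    rw [mul_assoc, ← ee_add, neg_add_cancel, ee_zero, mul_one]
  refine squeeze_zero_norm' (a := fun t => ‖DD t‖ * C) ?_ (by simpa using h1.norm.mul_const C)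
  filter_upwards [eventually_imInf 0, eventually_imInf Y] with t h2 h3
  rw [norm_mul]
  gcongr
  exact hb t a b h2 h3.le (le_max_left _ _) (le_max_right _ _)

end CuspBound

section ThetaFunctions

variable {θ : ℂ → ℂ → ℂ} {t : ℂ}

/-- The three even theta characteristics of genus one. -/
def th₀ (t z : ℂ) : ℂ := jacobiTheta₂ z t

def th₁ (t z : ℂ) : ℂ := jacobiTheta₂ (z + 1 / 2) t

def th₂ (t z : ℂ) : ℂ := ee (t / 8 + z / 2) * jacobiTheta₂ (z + t / 2) t

theorem jacobiTheta₂_quasi (z t : ℂ) :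
    jacobiTheta₂ (z + t) t = ee (-(t / 2 + z)) * jacobiTheta₂ z t := by
  rw [jacobiTheta₂_add_left', ee]
  congr 2
  ring

theorem th₀_T (t z : ℂ) : th₀ (t + 1) z = th₁ t z := by
  refine tsum_congr fun n => ?_
  obtain ⟨m, hm⟩ := Int.even_mul_pred_self n
  have hm' : (n : ℂ) ^ 2 = n + 2 * m := by
    have : (n : ℂ) * (n - 1) = m + m := mod_cast hm
    linear_combination this
  rw [jacobiTheta₂_term, jacobiTheta₂_term, ← Complex.exp_periodic.int_mul (-m)]
  congr 1
  push_cast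
  linear_combination (Real.pi * Complex.I) * hm'

theorem th₁_T (t z : ℂ) : th₁ (t + 1) z = th₀ t z := by
  have := th₀_T t (z + 1 / 2)
  rw [th₀, th₁, add_assoc, add_halves, jacobiTheta₂_add_left] at this
  exact this

theorem th₂_T (t z : ℂ) : th₂ (t + 1) z = ee (1 / 8) * th₂ t z := by
  have := th₁_T t (z + t / 2)
  rw [th₀, th₁] at this
  rw [th₂, th₂, ← this, ← mul_assoc, ← ee_add]
  ring_nf

theorem th₀_S (ht : 0 < t.im) (z : ℂ) :
    th₀ (-1 / t) (z / t) = (-Complex.I * t) ^ (1 / 2 : ℂ) * ee (z ^ 2 / (2 * t)) * th₀ t z := by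
  have h0 : t ≠ 0 := ne_zero_of_im_pos ht
  have h1 : (-Complex.I * t) ^ (1 / 2 : ℂ) ≠ 0 := by
    rw [Ne, Complex.cpow_eq_zero_iff]
    simp [h0]
  rw [th₀, th₀, jacobiTheta₂_functional_equation z t, ee]
  have h2 : (Complex.exp (-Real.pi * Complex.I * z ^ 2 / t)) *
      Complex.exp (2 * Real.pi * Complex.I * (z ^ 2 / (2 * t))) = 1 := by
    rw [← Complex.exp_add, Complex.exp_eq_one_iff]
    exact ⟨0, by field_simp; ring⟩
  rw [mul_assoc, ← mul_assoc _ _ (jacobiTheta₂ (z / t) (-1 / t)), mul_left_comm (Complex.exp _),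
    mul_comm (Complex.exp _), h2]
  field_simp

theorem th₁_S (ht : 0 < t.im) (z : ℂ) :
    th₁ (-1 / t) (z / t) = (-Complex.I * t) ^ (1 / 2 : ℂ) * ee (z ^ 2 / (2 * t)) * th₂ t z := by
  have h0 : t ≠ 0 := ne_zero_of_im_pos ht
  have h := th₀_S ht (z + t / 2)
  rw [th₀, th₀] at h
  rw [th₁, th₂, show z / t + 1 / 2 = (z + t / 2) / t by field_simp, h, mul_assoc, mul_assoc,
    ← mul_assoc (ee _) (ee _), ← ee_add]
  congr 3
  field_simp
  ring

theorem th₂_S (ht : 0 < t.im) (z : ℂ) :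
    th₂ (-1 / t) (z / t) = (-Complex.I * t) ^ (1 / 2 : ℂ) * ee (z ^ 2 / (2 * t)) * th₁ t z := by
  have h0 : t ≠ 0 := ne_zero_of_im_pos ht
  have h := th₀_S ht (z - 1 / 2)
  rw [th₀, th₀, ← jacobiTheta₂_add_left (z - 1 / 2), show z - 1 / 2 + 1 = z + 1 / 2 by ring] at h
  rw [th₁, th₂, show z / t + -1 / t / 2 = (z - 1 / 2) / t by field_simp; ring, h, ← mul_assoc,
    mul_left_comm, ← mul_assoc, mul_assoc (_ ^ _), ← ee_add]
  congr 3
  field_simp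
  ring

theorem exists_bound_jacobiTheta₂ : ∃ C, ∀ t z : ℂ, 1 / 2 ≤ t.im →
    ‖jacobiTheta₂ z t‖ ≤ C * Real.exp (Real.pi * (z.im ^ 2 / t.im)) := by
  have hs := summable_pow_mul_jacobiTheta₂_term_bound (1 / 2) (T := 1 / 2) (by norm_num) 0
  refine ⟨∑' n : ℤ, (|n| : ℝ) ^ 0 * Real.exp (-Real.pi * (1 / 2 * n ^ 2 - 2 * (1 / 2) * |n|)),
    fun t z ht => ?_⟩
  set K := ∑' n : ℤ, (|n| : ℝ) ^ 0 * Real.exp (-Real.pi * (1 / 2 * n ^ 2 - 2 * (1 / 2) * |n|))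
  have h0 : 0 < t.im := by linarith
  have hne := h0.ne'
  have hπ := Real.pi_pos
  obtain ⟨z', h1, h2, h3⟩ := exists_im_mem_Icc_of_add_self h0
    (f := fun z => ‖jacobiTheta₂ z t‖ * Real.exp (-Real.pi * (z.im ^ 2 / t.im))) (fun z => by
      rw [jacobiTheta₂_quasi, norm_mul, norm_ee, mul_right_comm, ← Real.exp_add, mul_comm]
      congr 2
      simp
      field_simp
      ring) z
  have main : ‖jacobiTheta₂ z' t‖ * Real.exp (-Real.pi * (z'.im ^ 2 / t.im)) ≤ K := by
    rw [← Real.norm_of_nonneg (Real.exp_pos _).le, ← Complex.norm_real, ← norm_mul, jacobiTheta₂,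
      ← tsum_mul_right]
    refine tsum_of_norm_bounded hs.hasSum fun n => ?_
    rw [norm_mul, norm_jacobiTheta₂_term, Complex.norm_real,
        Real.norm_of_nonneg (Real.exp_pos _).le,
      ← Real.exp_add, pow_zero, one_mul, Real.exp_le_exp]
    have e1 : -Real.pi * n ^ 2 * t.im - 2 * Real.pi * n * z'.im + -Real.pi * (z'.im ^ 2 / t.im) =
        -Real.pi * (t.im * (n + z'.im / t.im) ^ 2) := by field_simp; ring
    rw [e1, neg_mul, neg_mul, neg_le_neg_iff]
    gcongr
    have e2 : 0 ≤ z'.im / t.im := div_nonneg h1 h0.le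
    have e3 : z'.im / t.im ≤ 1 := (div_le_one h0).mpr h2
    have e4 : |(n : ℝ)| ^ 2 = n ^ 2 := sq_abs _
    have e5 : -|(n : ℝ)| ≤ n := neg_abs_le _
    have e6 : 0 ≤ |(n : ℝ)| := abs_nonneg _
    have e7 : (n : ℝ) ^ 2 - 2 * |(n : ℝ)| ≤ (n + z'.im / t.im) ^ 2 := by nlinarith
    rw [Int.cast_abs]
    nlinarith [sq_nonneg (n + z'.im / t.im)]
  rw [h3] at main
  calc ‖jacobiTheta₂ z t‖ = ‖jacobiTheta₂ z t‖ * Real.exp (-Real.pi * (z.im ^ 2 / t.im)) *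
        Real.exp (Real.pi * (z.im ^ 2 / t.im)) := by rw [mul_assoc, ← Real.exp_add]; simp
    _ ≤ _ := by gcongr

/-- The properties shared by the even theta functions. -/
structure IsTheta (θ : ℂ → ℂ → ℂ) : Prop where
  holo : ∀ t z : ℂ, 0 < t.im → DifferentiableAt ℂ (fun p : ℂ × ℂ => θ p.1 p.2) (t, z)
  A : ∃ ε : ℂ, ε ^ 2 = 1 ∧ ∀ t z, θ t (z + 1) = ε * θ t z
  HA : ∃ ε : ℂ, ε ^ 2 = 1 ∧ ∀ t z, θ t (z + t) = ε * ee (-(t / 2 + z)) * θ t z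
  neg : ∀ t z, θ t (-z) = θ t z
  bd : ∃ C, ∀ t z : ℂ, 1 / 2 ≤ t.im → ‖θ t z‖ ≤ C * Real.exp (Real.pi * (z.im ^ 2 / t.im))

theorem isTheta₀ : IsTheta th₀ where
  holo t z ht := DifferentiableAt.comp (g := fun p : ℂ × ℂ => jacobiTheta₂ p.1 p.2)
    (f := fun p : ℂ × ℂ => (p.2, p.1)) (t, z) (hasFDerivAt_jacobiTheta₂ z ht).differentiableAt
      (by fun_prop)
  A := ⟨1, one_pow 2, fun t z => by rw [th₀, jacobiTheta₂_add_left, one_mul, th₀]⟩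
  HA := ⟨1, one_pow 2, fun t z => by rw [th₀, jacobiTheta₂_quasi, one_mul, th₀]⟩
  neg t z := jacobiTheta₂_neg_left z t
  bd := exists_bound_jacobiTheta₂

theorem isTheta₁ : IsTheta th₁ where
  holo t z ht := DifferentiableAt.comp (g := fun p : ℂ × ℂ => jacobiTheta₂ p.1 p.2)
    (f := fun p : ℂ × ℂ => (p.2 + 1 / 2, p.1)) (t, z)
      (hasFDerivAt_jacobiTheta₂ _ ht).differentiableAt (by fun_prop)
  A := ⟨1, one_pow 2, fun t z => by
    rw [th₁, add_right_comm, jacobiTheta₂_add_left, one_mul, th₁]⟩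
  HA := ⟨-1, by norm_num, fun t z => by
    rw [th₁, add_right_comm, jacobiTheta₂_quasi, th₁,
      show -(t / 2 + (z + 1 / 2)) = -(t / 2 + z) - 1 / 2 by ring, ee_sub, ee_half]
    ring⟩
  neg t z := by
    rw [th₁, th₁, ← jacobiTheta₂_neg_left, ← jacobiTheta₂_add_left]
    ring_nf
  bd := by
    obtain ⟨C, hC⟩ := exists_bound_jacobiTheta₂
    exact ⟨C, fun t z ht => by simpa [th₁] using hC t (z + 1 / 2) ht⟩

theorem isTheta₂ : IsTheta th₂ where
  holo t z ht := by
    refine DifferentiableAt.fun_mul (a := fun p : ℂ × ℂ => ee (p.1 / 8 + p.2 / 2)) ?_ ?_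
    · exact (differentiable_ee _).comp (t, z) (f := fun p : ℂ × ℂ => p.1 / 8 + p.2 / 2)
        (by fun_prop)
    · exact DifferentiableAt.comp (g := fun p : ℂ × ℂ => jacobiTheta₂ p.1 p.2)
        (f := fun p : ℂ × ℂ => (p.2 + p.1 / 2, p.1)) (t, z)
          (hasFDerivAt_jacobiTheta₂ _ ht).differentiableAt (by fun_prop)
  A := ⟨-1, by norm_num, fun t z => by
    rw [th₂, add_right_comm z, jacobiTheta₂_add_left, th₂,
      show t / 8 + (z + 1) / 2 = t / 8 + z / 2 + 1 / 2 by ring, ee_add _ (1 / 2), ee_half]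
    ring⟩
  HA := ⟨1, one_pow 2, fun t z => by
    rw [th₂, add_right_comm z, jacobiTheta₂_quasi, th₂, one_mul, ← mul_assoc, ← mul_assoc, ← ee_add,
      ← ee_add]
    ring_nf⟩
  neg t z := by
    have := jacobiTheta₂_quasi (z - t / 2) t
    rw [show z - t / 2 + t = z + t / 2 by ring] at this
    rw [th₂, th₂, ← jacobiTheta₂_neg_left, this, ← mul_assoc, ← ee_add]
    ring_nf
  bd := by
    obtain ⟨C, hC⟩ := exists_bound_jacobiTheta₂
    refine ⟨C, fun t z ht => ?_⟩
    have h0 : t.im ≠ 0 := by linarith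
    have := hC t (z + t / 2) ht
    rw [th₂, norm_mul, norm_ee]
    calc _ ≤ _ := mul_le_mul_of_nonneg_left this (Real.exp_pos _).le
      _ = _ := by
        rw [mul_left_comm, ← Real.exp_add]
        congr 2
        simp
        field_simp
        ring

end ThetaFunctions

section ThetaLattice

variable {θ : ℂ → ℂ → ℂ} {t : ℂ}

/-- The product of theta functions attached to a characteristic. -/
def thetaProd (θ : ℂ → ℂ → ℂ) (t a b : ℂ) : ℂ := θ t a * θ t (a + b) * θ t b ^ 3 * θ t 0 ^ 3

namespace IsTheta

theorem holo_prod (h : IsTheta θ) (t a b : ℂ) (ht : 0 < t.im) :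
    DifferentiableAt ℂ (fun p : ℂ × ℂ × ℂ => thetaProd θ p.1 p.2.1 p.2.2) (t, a, b) := by
  have key : ∀ f : ℂ × ℂ × ℂ → ℂ, Differentiable ℂ f →
      DifferentiableAt ℂ (fun p : ℂ × ℂ × ℂ => θ p.1 (f p)) (t, a, b) := fun f hf =>
    DifferentiableAt.comp (g := fun p : ℂ × ℂ => θ p.1 p.2) (f := fun p : ℂ × ℂ × ℂ => (p.1, f p))
      (t, a, b) (h.holo t _ ht) (differentiableAt_fst.prodMk (hf _))
  exact (((key _ (by fun_prop)).fun_mul (key (fun p => p.2.1 + p.2.2) (by fun_prop))).fun_mul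
    ((key (fun p => p.2.2) (by fun_prop)).fun_pow 3)).fun_mul ((key (fun _ => 0) (by fun_prop)).fun_pow 3)

theorem prod_A (h : IsTheta θ) (t a b : ℂ) : thetaProd θ t (a + 1) b = thetaProd θ t a b := by
  obtain ⟨ε, hε, h⟩ := h.A
  rw [thetaProd, add_right_comm, h, h, thetaProd]
  linear_combination (θ t a * θ t (a + b) * θ t b ^ 3 * θ t 0 ^ 3) * hε

theorem prod_B (h : IsTheta θ) (t a b : ℂ) : thetaProd θ t a (b + 1) = thetaProd θ t a b := by
  obtain ⟨ε, hε, h⟩ := h.A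
  rw [thetaProd, ← add_assoc, h, h, thetaProd]
  linear_combination (θ t a * θ t (a + b) * θ t b ^ 3 * θ t 0 ^ 3) * (ε ^ 2 + 1) * hε

theorem prod_HA (h : IsTheta θ) (t a b : ℂ) :
    thetaProd θ t (a + t) b = ee (-(t + 2 * a + b)) * thetaProd θ t a b := by
  obtain ⟨ε, hε, h⟩ := h.HA
  rw [thetaProd, add_right_comm, h, h, thetaProd,
    show -(t + 2 * a + b) = -(t / 2 + a) + -(t / 2 + (a + b)) by ring, ee_add]
  linear_combination (ee (-(t / 2 + a)) * ee (-(t / 2 + (a + b))) *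
    (θ t a * θ t (a + b) * θ t b ^ 3 * θ t 0 ^ 3)) * hε

theorem prod_HB (h : IsTheta θ) (t a b : ℂ) :
    thetaProd θ t a (b + t) = ee (-(3 * (t / 2 + b) + (t / 2 + a + b))) * thetaProd θ t a b := by
  obtain ⟨ε, hε, h⟩ := h.HA
  rw [thetaProd, ← add_assoc, h, h, thetaProd,
    show -(3 * (t / 2 + b) + (t / 2 + a + b)) = (3 : ℕ) * -(t / 2 + b) + -(t / 2 + (a + b)) by
      push_cast; ring, ee_add, ee_nat_mul]
  linear_combination (ee (-(t / 2 + b)) ^ 3 * ee (-(t / 2 + (a + b))) *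
    (θ t a * θ t (a + b) * θ t b ^ 3 * θ t 0 ^ 3)) * (ε ^ 2 + 1) * hε

theorem prod_sig (h : IsTheta θ) (t a b : ℂ) : thetaProd θ t (-a - b) b = thetaProd θ t a b := by
  rw [thetaProd, thetaProd, sub_add_cancel, h.neg, show -a - b = -(a + b) by ring, h.neg]
  ring

theorem prod_bd (h : IsTheta θ) : ∃ C, ∀ t a b : ℂ, 1 / 2 ≤ t.im → ‖thetaProd θ t a b‖ ≤
    C * Real.exp (2 * Real.pi * ((a.im ^ 2 + a.im * b.im + 2 * b.im ^ 2) / t.im)) := by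
  obtain ⟨C, hC⟩ := h.bd
  refine ⟨C * C * C ^ 3 * C ^ 3, fun t a b ht => ?_⟩
  have h0 : t.im ≠ 0 := by linarith
  rw [thetaProd, norm_mul, norm_mul, norm_mul, norm_pow, norm_pow]
  have hC0 : 0 ≤ C :=
    nonneg_of_mul_nonneg_left ((norm_nonneg _).trans (hC t 0 ht)) (Real.exp_pos _)
  have h1 := hC t 0 ht
  simp only [Complex.zero_im, zero_pow two_ne_zero, zero_div, mul_zero, Real.exp_zero,
      mul_one] at h1
  calc _ ≤ (C * Real.exp (Real.pi * (a.im ^ 2 / t.im))) *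
        (C * Real.exp (Real.pi * ((a + b).im ^ 2 / t.im))) *
        (C * Real.exp (Real.pi * (b.im ^ 2 / t.im))) ^ 3 * C ^ 3 := by
        gcongr <;> exact hC _ _ ht
    _ = C * C * C ^ 3 * C ^ 3 * (Real.exp (Real.pi * (a.im ^ 2 / t.im)) *
        Real.exp (Real.pi * ((a + b).im ^ 2 / t.im)) * Real.exp (Real.pi * (b.im ^ 2 / t.im)) ^ 3) := by
        ring
    _ = _ := by
        rw [← Real.exp_nat_mul, ← Real.exp_add, ← Real.exp_add, Complex.add_im]
        congr 2
        push_cast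
        field_simp
        ring

theorem tendsto_prod (h : ∀ z, Tendsto (fun t => θ t z) imInf (𝓝 L)) (a b : ℂ) :
    Tendsto (fun t => thetaProd θ t a b) imInf (𝓝 (L * L * L ^ 3 * L ^ 3)) :=
  (((h _).mul (h _)).mul ((h _).pow 3)).mul ((h _).pow 3)

theorem prod_S {θ' : ℂ → ℂ → ℂ} (h : ∀ z, θ' (-1 / t) (z / t) =
      (-Complex.I * t) ^ (1 / 2 : ℂ) * ee (z ^ 2 / (2 * t)) * θ t z) (a b : ℂ) :
    thetaProd θ' (-1 / t) (a / t) (b / t) =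
      t ^ 4 * ee ((3 * b ^ 2 + (a ^ 2 + (a + b) ^ 2)) / (2 * t)) * thetaProd θ t a b := by
  have h0 := h 0
  rw [zero_div, zero_pow two_ne_zero, zero_div, ee_zero, mul_one] at h0
  rw [thetaProd, ← add_div, h, h, h, h0, thetaProd,
    show (3 * b ^ 2 + (a ^ 2 + (a + b) ^ 2)) / (2 * t) =
      (3 : ℕ) * (b ^ 2 / (2 * t)) + (a ^ 2 / (2 * t) + (a + b) ^ 2 / (2 * t)) by
      push_cast; ring, ee_add, ee_add, ee_nat_mul]
  have hs : ((-Complex.I * t) ^ (1 / 2 : ℂ)) ^ 8 = t ^ 4 := by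
    have : ((-Complex.I * t) ^ (1 / 2 : ℂ)) ^ 2 = -Complex.I * t := by
      rw [one_div]
      exact Complex.cpow_nat_inv_pow _ two_ne_zero
    rw [show 8 = 2 * 4 from rfl, pow_mul, this, mul_pow, neg_pow, Complex.I_pow_four]
    norm_num
  rw [← hs]
  ring

end IsTheta

theorem tendsto_ee_ofReal_mul {r : ℝ} (hr : 0 < r) :
    Tendsto (fun w => ee (r * w)) imInf (𝓝 0) := by
  refine tendsto_ee_imInf.comp (tendsto_comap_iff.mpr ?_)
  simp only [Function.comp_def, Complex.im_ofReal_mul]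
  exact tendsto_comap.const_mul_atTop hr

theorem tendsto_th₀ (z : ℂ) : Tendsto (fun t => th₀ t z) imInf (𝓝 1) := by
  have hs := summable_pow_mul_jacobiTheta₂_term_bound |z.im| one_pos 0
  have := tendsto_tsum_of_dominated_convergence (𝓕 := imInf)
    (f := fun t (n : ℤ) => jacobiTheta₂_term n z t) (g := fun n => if n = 0 then 1 else 0) hs
    (fun n => ?_) ?_
  · rw [tsum_ite_eq] at this
    exact this
  · rcases eq_or_ne n 0 with rfl | hn
    · simp [jacobiTheta₂_term]
    · rw [if_neg hn]
      have h0 : 0 < (n : ℝ) ^ 2 / 2 := by positivity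
      have h1 := (tendsto_ee_ofReal_mul h0).const_mul (ee (n * z))
      rw [mul_zero] at h1
      refine h1.congr fun t => ?_
      rw [← ee_add, jacobiTheta₂_term, ee]
      congr 1
      push_cast
      ring
  · filter_upwards [eventually_imInf 1] with t ht n
    rw [pow_zero, one_mul]
    simpa using norm_jacobiTheta₂_term_le one_pos le_rfl ht.le n

theorem tendsto_th₁ (z : ℂ) : Tendsto (fun t => th₁ t z) imInf (𝓝 1) := tendsto_th₀ (z + 1 / 2)

theorem tendsto_th₂ (z : ℂ) : Tendsto (fun t => th₂ t z) imInf (𝓝 0) := by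
  have hs := (summable_jacobiTheta₂_term_iff (z + Complex.I / 2) Complex.I).mpr (by simp)
  have h0 : (0 : ℝ) < 1 / 8 := by norm_num
  have h1 := (tendsto_ee_ofReal_mul h0).const_mul (ee (z / 2))
  rw [mul_zero] at h1
  have h2 := (h1.norm).mul_const (∑' n : ℤ, ‖jacobiTheta₂_term n (z + Complex.I / 2) Complex.I‖)
  rw [norm_zero, zero_mul] at h2
  refine squeeze_zero_norm' ?_ h2
  filter_upwards [eventually_imInf 1] with t ht
  rw [th₂, norm_mul, ← ee_add]
  refine mul_le_mul (le_of_eq ?_) (tsum_of_norm_bounded hs.norm.hasSum fun n => ?_) (norm_nonneg _)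
    (norm_nonneg _)
  · push_cast; ring_nf
  rw [norm_jacobiTheta₂_term, norm_jacobiTheta₂_term, Real.exp_le_exp]
  have h3 : (0 : ℝ) ≤ n ^ 2 + n := by
    have : 0 ≤ n ^ 2 + n := by
      rcases le_or_gt 0 n with h | h
      · positivity
      · nlinarith [mul_nonneg_of_nonpos_of_nonpos h.le (by lia : n + 1 ≤ 0)]
    exact_mod_cast this
  have h4 := mul_nonneg (mul_nonneg Real.pi_pos.le h3) (sub_nonneg.mpr ht.le)
  simp
  nlinarith

/-- Jacobi forms of lattice index built from theta functions. -/
theorem exists_liftable_theta {l : ℕ} {k : ℤ} {m₀ m₁ m₂ e : ℂ → ℂ} {L : ℂ} (hl : (l : ℤ) + 1 = k + 4)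
    (d₀ : ∀ t : ℂ, 0 < t.im → DifferentiableAt ℂ m₀ t)
    (d₁ : ∀ t : ℂ, 0 < t.im → DifferentiableAt ℂ m₁ t)
    (d₂ : ∀ t : ℂ, 0 < t.im → DifferentiableAt ℂ m₂ t)
    (T₀ : ∀ t, m₀ (t + 1) = m₁ t) (T₁ : ∀ t, m₁ (t + 1) = m₀ t) (T₂ : ∀ t, m₂ (t + 1) = m₂ t)
    (S₀ : ∀ t : ℂ, 0 < t.im → m₀ (-1 / t) = t ^ k * m₀ t)
    (S₁ : ∀ t : ℂ, 0 < t.im → m₁ (-1 / t) = t ^ k * m₂ t)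
    (S₂ : ∀ t : ℂ, 0 < t.im → m₂ (-1 / t) = t ^ k * m₁ t)
    (l₀ : Tendsto m₀ imInf (𝓝 1)) (l₁ : Tendsto m₁ imInf (𝓝 1)) (l₂ : Tendsto m₂ imInf (𝓝 L))
    (b₀ : ∃ C, ∀ t : ℂ, 1 / 2 ≤ t.im → ‖m₀ t‖ ≤ C) (b₁ : ∃ C, ∀ t : ℂ, 1 / 2 ≤ t.im → ‖m₁ t‖ ≤ C)
    (b₂ : ∃ C, ∀ t : ℂ, 1 / 2 ≤ t.im → ‖m₂ t‖ ≤ C) (he : MF ((l : ℤ) + 1) e)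
    (hs : ∃ e₀ : ℂ, ∀ t : ℂ, 0 < t.im →
      HasSum (fun x : ℕ+ × ℕ+ => 1 * ((x.1 : ℕ) : ℂ) ^ l * ee ((x.1 : ℕ) * (x.2 : ℕ) * t)) (e t - e₀)) :
    ∃ C φ, Liftable l C 1 e φ := by
  obtain ⟨C₀, hC₀⟩ := b₀
  obtain ⟨C₁, hC₁⟩ := b₁
  obtain ⟨C₂, hC₂⟩ := b₂
  obtain ⟨B₀, hB₀⟩ := isTheta₀.prod_bd
  obtain ⟨B₁, hB₁⟩ := isTheta₁.prod_bd
  obtain ⟨B₂, hB₂⟩ := isTheta₂.prod_bd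
  have hCn : 0 ≤ C₀ ∧ 0 ≤ C₁ ∧ 0 ≤ C₂ := by
    have h : (1 : ℝ) / 2 ≤ Complex.I.im := by norm_num
    exact ⟨(norm_nonneg _).trans (hC₀ _ h), (norm_nonneg _).trans (hC₁ _ h),
      (norm_nonneg _).trans (hC₂ _ h)⟩
  set φ : ℂ → ℂ → ℂ → ℂ := fun t a b => 1 / 2 * (m₀ t * thetaProd th₀ t a b +
    m₁ t * thetaProd th₁ t a b + m₂ t * thetaProd th₂ t a b) with hφ
  have hbd : ∀ t a b : ℂ, 1 / 2 ≤ t.im → ‖φ t a b‖ ≤ (C₀ * B₀ + C₁ * B₁ + C₂ * B₂) *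
      Real.exp (2 * Real.pi * ((a.im ^ 2 + a.im * b.im + 2 * b.im ^ 2) / t.im)) := by
    intro t a b ht
    have key : ∀ {m : ℂ → ℂ} {θ : ℂ → ℂ → ℂ} {C B : ℝ}, 0 ≤ C → ‖m t‖ ≤ C →
        ‖thetaProd θ t a b‖ ≤
          B * Real.exp (2 * Real.pi * ((a.im ^ 2 + a.im * b.im + 2 * b.im ^ 2) / t.im)) →
        ‖m t * thetaProd θ t a b‖ ≤ C * B *
          Real.exp (2 * Real.pi * ((a.im ^ 2 + a.im * b.im + 2 * b.im ^ 2) / t.im)) := by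
      intro m θ C B h0 h1 h2
      rw [norm_mul, mul_assoc]
      exact mul_le_mul h1 h2 (norm_nonneg _) h0
    have k₀ := key hCn.1 (hC₀ t ht) (hB₀ t a b ht)
    have k₁ := key hCn.2.1 (hC₁ t ht) (hB₁ t a b ht)
    have k₂ := key hCn.2.2 (hC₂ t ht) (hB₂ t a b ht)
    have h3 := norm_add₃_le (a := m₀ t * thetaProd th₀ t a b) (b := m₁ t * thetaProd th₁ t a b)
      (c := m₂ t * thetaProd th₂ t a b)
    rw [hφ]
    simp only [norm_mul (1 / 2 : ℂ)]
    norm_num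
    nlinarith [norm_nonneg (m₀ t * thetaProd th₀ t a b + m₁ t * thetaProd th₁ t a b +
      m₂ t * thetaProd th₂ t a b)]
  refine ⟨_, φ, ⟨?_, ?_, ?_, ?_, ?_, ?_, ?_, ?_, ?_⟩, hbd, fun a b => ?_, he, hs⟩
  · intro t a b ht
    have key : ∀ m : ℂ → ℂ, DifferentiableAt ℂ m t →
        DifferentiableAt ℂ (fun p : ℂ × ℂ × ℂ => m p.1) (t, a, b) := fun m hm =>
      DifferentiableAt.comp (g := m) (f := Prod.fst) (t, a, b) hm differentiableAt_fst
    exact ((((key _ (d₀ t ht)).fun_mul (isTheta₀.holo_prod t a b ht)).fun_add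
      ((key _ (d₁ t ht)).fun_mul (isTheta₁.holo_prod t a b ht))).fun_add
      ((key _ (d₂ t ht)).fun_mul (isTheta₂.holo_prod t a b ht))).const_mul _
  · intro t a b ht
    have h8 : ee (1 / 8) ^ 8 = 1 := by rw [← ee_nat_mul]; norm_num [ee_one]
    simp only [hφ, T₀, T₁, T₂, thetaProd, th₀_T, th₁_T, th₂_T]
    linear_combination (1 / 2 * m₂ t * (th₂ t a * th₂ t (a + b) * th₂ t b ^ 3 * th₂ t 0 ^ 3)) * h8
  · intro t a b ht
    simp only [hφ, isTheta₀.prod_A, isTheta₁.prod_A, isTheta₂.prod_A]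
  · intro t a b ht
    rw [even_three_mul_add 1, one_mul]
    simp only [hφ, isTheta₀.prod_B, isTheta₁.prod_B, isTheta₂.prod_B]
  · intro t a b ht
    simp only [hφ, isTheta₀.prod_HA, isTheta₁.prod_HA, isTheta₂.prod_HA, Nat.cast_one, one_mul]
    ring
  · intro t a b ht
    rw [even_three_mul_add 1, one_mul]
    simp only [hφ, isTheta₀.prod_HB, isTheta₁.prod_HB, isTheta₂.prod_HB, Nat.cast_one, one_mul,
      Nat.cast_ofNat]
    ring
  · intro t a b ht
    have h0 := ne_zero_of_im_pos ht
    simp only [hφ, S₀ t ht, S₁ t ht, S₂ t ht, IsTheta.prod_S (th₀_S ht), IsTheta.prod_S (th₁_S ht),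
      IsTheta.prod_S (th₂_S ht), hl, zpow_add₀ h0, Nat.cast_one, one_mul, Nat.cast_ofNat]
    norm_cast
    ring
  · intro t a b ht
    simp only [hφ, isTheta₀.prod_sig, isTheta₁.prod_sig, isTheta₂.prod_sig]
  · intro R
    refine ⟨(C₀ * B₀ + C₁ * B₁ + C₂ * B₂) * Real.exp (2 * Real.pi * (4 * R ^ 2 / (1 / 2))), 1 / 2,
      fun t a b _ ht ha hb => (hbd t a b ht).trans ?_⟩
    have hK : 0 ≤ C₀ * B₀ + C₁ * B₁ + C₂ * B₂ :=
      nonneg_of_mul_nonneg_left ((norm_nonneg _).trans (hbd t a b ht)) (Real.exp_pos _)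
    have ha' := abs_le.mp ((Complex.abs_im_le_norm a).trans ha)
    have hb' := abs_le.mp ((Complex.abs_im_le_norm b).trans hb)
    have hπ := Real.pi_pos
    gcongr
    nlinarith
  · have := (((l₀.mul (IsTheta.tendsto_prod tendsto_th₀ a b)).add
      (l₁.mul (IsTheta.tendsto_prod tendsto_th₁ a b))).add
      (l₂.mul (IsTheta.tendsto_prod tendsto_th₂ a b))).const_mul (1 / 2 : ℂ)
    convert this using 2
    norm_num

theorem hasSum_prod_of_sigma {l : ℕ} {c s t : ℂ} (ht : 0 < t.im) (hc : c ≠ 0)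
    (h : HasSum (fun n : ℕ => c * (ArithmeticFunction.sigma l (n + 1) : ℂ) * ee ((n + 1) * t)) s) :
    HasSum (fun x : ℕ+ × ℕ+ => 1 * ((x.1 : ℕ) : ℂ) ^ l * ee ((x.1 : ℕ) * (x.2 : ℕ) * t)) (s / c) := by
  have hr : ‖ee t‖ < 1 := by
    rw [norm_ee, Real.exp_lt_one_iff]
    nlinarith [Real.pi_pos]
  have h1 := (summable_prod_mul_pow l hr)
  have h2 := tsum_prod_pow_eq_tsum_sigma l hr
  rw [← h1.tsum_prod] at h2
  have h3 := h1.hasSum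
  rw [h2, ← (Equiv.prodComm _ _).hasSum_iff] at h3
  have h4 : ∑' n : ℕ+, (ArithmeticFunction.sigma l n : ℂ) * ee t ^ (n : ℕ) = s / c := by
    rw [tsum_pnat_eq_tsum_succ (f := fun n => (ArithmeticFunction.sigma l n : ℂ) * ee t ^ n),
      eq_div_iff hc, ← h.tsum_eq, ← tsum_mul_right]
    refine tsum_congr fun n => ?_
    rw [← ee_nat_mul]
    push_cast
    ring
  rw [h4] at h3
  refine h3.congr_fun fun x => ?_
  simp only [Function.comp, Equiv.prodComm_apply, Prod.fst_swap, Prod.snd_swap]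
  rw [← ee_nat_mul, one_mul]
  push_cast
  ring_nf

end ThetaLattice

section EisensteinLifts

variable {θ θ' : ℂ → ℂ → ℂ} {t : ℂ}

theorem exists_liftable_four : ∃ C φ, Liftable 3 C 1 (fun t => 1 / 240 * mE4 t) φ := by
  have hb : ∃ C, ∀ t : ℂ, 1 / 2 ≤ t.im → ‖(fun _ : ℂ => (1 : ℂ)) t‖ ≤ C := ⟨1, fun _ _ => by simp⟩
  have hd : ∀ t : ℂ, 0 < t.im → DifferentiableAt ℂ (fun _ : ℂ => (1 : ℂ)) t :=
    fun _ _ => differentiableAt_const _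
  refine exists_liftable_theta (k := 0) (m₀ := fun _ => 1) (m₁ := fun _ => 1) (m₂ := fun _ => 1)
    (by norm_num) hd hd hd (fun _ => rfl) (fun _ => rfl) (fun _ => rfl) ?_ ?_ ?_ tendsto_const_nhds
    tendsto_const_nhds tendsto_const_nhds hb hb hb (mf_mE4.smul _)
    ⟨1 / 240, fun t ht => ?_⟩
  iterate 3 simp
  have := hasSum_prod_of_sigma ht (by norm_num) (hasSum_mE4 ht)
  convert this using 1
  ring

theorem IsTheta.differentiableAt_null_pow (h : IsTheta θ) (ht : 0 < t.im) :
    DifferentiableAt ℂ (fun t => θ t 0 ^ 4) t :=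
  (DifferentiableAt.comp (g := fun p : ℂ × ℂ => θ p.1 p.2) (f := fun t : ℂ => (t, 0)) t
    (h.holo t 0 ht) (by fun_prop)).fun_pow 4

theorem IsTheta.exists_bound_null (h : IsTheta θ) :
    ∃ C, ∀ t : ℂ, 1 / 2 ≤ t.im → ‖θ t 0 ^ 4‖ ≤ C := by
  obtain ⟨C, hC⟩ := h.bd
  refine ⟨C ^ 4, fun t ht => ?_⟩
  rw [norm_pow]
  gcongr
  simpa using hC t 0 ht

theorem theta_null_S (h : ∀ z, θ' (-1 / t) (z / t) =
      (-Complex.I * t) ^ (1 / 2 : ℂ) * ee (z ^ 2 / (2 * t)) * θ t z) :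
    θ' (-1 / t) 0 ^ 4 = -t ^ 2 * θ t 0 ^ 4 := by
  have h0 := h 0
  rw [zero_div, zero_pow two_ne_zero, zero_div, ee_zero, mul_one] at h0
  have hs : ((-Complex.I * t) ^ (1 / 2 : ℂ)) ^ 2 = -Complex.I * t := by
    rw [one_div]
    exact Complex.cpow_nat_inv_pow _ two_ne_zero
  rw [h0, mul_pow, show 4 = 2 * 2 from rfl, pow_mul, hs, mul_pow, neg_sq, Complex.I_sq]
  ring

theorem exists_bound_add {f g : ℂ → ℂ} (hf : ∃ C, ∀ t : ℂ, 1 / 2 ≤ t.im → ‖f t‖ ≤ C)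
    (hg : ∃ C, ∀ t : ℂ, 1 / 2 ≤ t.im → ‖g t‖ ≤ C) :
    ∃ C, ∀ t : ℂ, 1 / 2 ≤ t.im → ‖f t + g t‖ ≤ C := by
  obtain ⟨C, hC⟩ := hf
  obtain ⟨C', hC'⟩ := hg
  exact ⟨C + C', fun t ht => (norm_add_le _ _).trans (add_le_add (hC t ht) (hC' t ht))⟩

theorem exists_bound_neg {f : ℂ → ℂ} (hf : ∃ C, ∀ t : ℂ, 1 / 2 ≤ t.im → ‖f t‖ ≤ C) :
    ∃ C, ∀ t : ℂ, 1 / 2 ≤ t.im → ‖-f t‖ ≤ C := by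
  simpa only [norm_neg] using hf

theorem exists_liftable_six : ∃ C φ, Liftable 5 C 1 (fun t => -1 / 504 * mE6 t) φ := by
  have d₀ := fun (t : ℂ) (ht : 0 < t.im) => isTheta₀.differentiableAt_null_pow ht
  have d₁ := fun (t : ℂ) (ht : 0 < t.im) => isTheta₁.differentiableAt_null_pow ht
  have d₂ := fun (t : ℂ) (ht : 0 < t.im) => isTheta₂.differentiableAt_null_pow ht
  have b₀ := isTheta₀.exists_bound_null
  have b₁ := isTheta₁.exists_bound_null
  have b₂ := isTheta₂.exists_bound_null
  have l₀ := (tendsto_th₀ 0).pow 4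
  have l₁ := (tendsto_th₁ 0).pow 4
  have l₂ := (tendsto_th₂ 0).pow 4
  have h8 : ee (1 / 8) ^ 4 = -1 := by rw [← ee_nat_mul, ← ee_half]; norm_num
  refine exists_liftable_theta (k := 2) (m₀ := fun t => th₁ t 0 ^ 4 + -th₂ t 0 ^ 4)
    (m₁ := fun t => th₀ t 0 ^ 4 + th₂ t 0 ^ 4) (m₂ := fun t => -(th₀ t 0 ^ 4 + th₁ t 0 ^ 4))
    (by norm_num) (fun t ht => (d₁ t ht).fun_add (d₂ t ht).fun_neg)
    (fun t ht => (d₀ t ht).fun_add (d₂ t ht)) (fun t ht => ((d₀ t ht).fun_add (d₁ t ht)).fun_neg)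
    (fun t => ?_) (fun t => ?_) (fun t => ?_) (fun t ht => ?_) (fun t ht => ?_) (fun t ht => ?_)
    (by simpa using l₁.add l₂.neg) (by simpa using l₀.add l₂) (l₀.add l₁).neg
    (exists_bound_add b₁ (exists_bound_neg b₂)) (exists_bound_add b₀ b₂)
    (exists_bound_neg (exists_bound_add b₀ b₁)) (mf_mE6.smul _)
    ⟨-1 / 504, fun t ht => ?_⟩
  · simp only [th₁_T, th₂_T]
    linear_combination -th₂ t 0 ^ 4 * h8
  · simp only [th₀_T, th₂_T]
    linear_combination th₂ t 0 ^ 4 * h8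
  · simp only [th₀_T, th₁_T]
    ring
  · simp only [theta_null_S (th₁_S ht), theta_null_S (th₂_S ht)]
    norm_cast
    ring
  · simp only [theta_null_S (th₀_S ht), theta_null_S (th₂_S ht)]
    norm_cast
    ring
  · simp only [theta_null_S (th₀_S ht), theta_null_S (th₁_S ht)]
    norm_cast
    ring
  have := hasSum_prod_of_sigma ht (by norm_num) (hasSum_mE6 ht)
  convert this using 1
  ring

end EisensteinLifts

section GradedRing

variable {k k' : ℤ} {m m' : ℕ} {F G : ℂ → ℂ → ℂ → ℂ → ℂ} {φ ψ : ℂ → ℂ → ℂ → ℂ}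

theorem SymForm.cast (hF : SymForm k F) (hk : k = k') : SymForm k' F := hk ▸ hF

theorem SymForm.zero (k : ℤ) : SymForm k fun _ _ _ _ => 0 := by
  constructor <;> intros <;> simp

theorem SymForm.one : SymForm 0 fun _ _ _ _ => 1 := by
  constructor <;> intros <;> simp

theorem SymForm.mul (hF : SymForm k F) (hG : SymForm k' G) :
    SymForm (k + k') fun t a b w => F t a b w * G t a b w where
  holo t a b w h := (hF.holo t a b w h).mul (hG.holo t a b w h)
  T t a b w h := by rw [hF.T t a b w h, hG.T t a b w h]
  A t a b w h := by rw [hF.A t a b w h, hG.A t a b w h]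
  B t a b w h := by rw [hF.B t a b w h, hG.B t a b w h]
  HA t a b w h := by rw [hF.HA t a b w h, hG.HA t a b w h]
  HB t a b w h := by rw [hF.HB t a b w h, hG.HB t a b w h]
  S t a b w h := by
    have ht : t ≠ 0 := fun h0 => by simp [Om, h0] at h
    rw [hF.S t a b w h, hG.S t a b w h, zpow_add₀ ht]; ring
  sig t a b w h := by rw [hF.sig t a b w h, hG.sig t a b w h]
  neg t a b w h := by
    rw [hF.neg t a b w h, hG.neg t a b w h, zpow_add₀ (by norm_num)]; ring
  swap t a b w h := by rw [hF.swap t a b w h, hG.swap t a b w h]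

theorem SymForm.add_smul (hF : SymForm k F) (c : ℂ) (hG : SymForm k G) :
    SymForm k fun t a b w => F t a b w + c * G t a b w where
  holo t a b w h := (hF.holo t a b w h).add ((hG.holo t a b w h).const_mul c)
  T t a b w h := by rw [hF.T t a b w h, hG.T t a b w h]
  A t a b w h := by rw [hF.A t a b w h, hG.A t a b w h]
  B t a b w h := by rw [hF.B t a b w h, hG.B t a b w h]
  HA t a b w h := by rw [hF.HA t a b w h, hG.HA t a b w h]
  HB t a b w h := by rw [hF.HB t a b w h, hG.HB t a b w h]
  S t a b w h := by rw [hF.S t a b w h, hG.S t a b w h]; ring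
  sig t a b w h := by rw [hF.sig t a b w h, hG.sig t a b w h]
  neg t a b w h := by rw [hF.neg t a b w h, hG.neg t a b w h]; ring
  swap t a b w h := by rw [hF.swap t a b w h, hG.swap t a b w h]

theorem Lead.mul (hF : Lead m F φ) (hG : Lead m' G ψ) :
    Lead (m + m') (fun t a b w => F t a b w * G t a b w) fun t a b => φ t a b * ψ t a b := by
  intro t a b ht
  refine ((hF t a b ht).mul (hG t a b ht)).congr fun w => ?_
  rw [show -(((m + m' : ℕ) : ℂ) * w) = -(m * w) + -(m' * w) by push_cast; ring, ee_add]
  ring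

theorem Lead.add_smul (hF : Lead m F φ) (c : ℂ) (hG : Lead m G ψ) :
    Lead m (fun t a b w => F t a b w + c * G t a b w) fun t a b => φ t a b + c * ψ t a b := by
  intro t a b ht
  refine ((hF t a b ht).add ((hG t a b ht).const_mul c)).congr fun w => ?_
  ring

theorem Lead.congr (hF : Lead m F φ) (h : ∀ t a b : ℂ, 0 < t.im → ψ t a b = φ t a b) :
    Lead m F ψ := fun t a b ht => by rw [h t a b ht]; exact hF t a b ht

theorem Lead.zero (m : ℕ) : Lead m (fun _ _ _ _ => 0) fun _ _ _ => 0 := fun t a b _ => by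
  simp

theorem LB.mono (h : LB m F) (hm : m' ≤ m) : LB m' F := by
  intro Y Y' R hY
  obtain ⟨v, C, hv⟩ := h Y Y' R hY
  refine ⟨v, C, fun t a b w h1 h2 h3 h4 h5 => ?_⟩
  obtain ⟨hO, hb⟩ := hv t a b w h1 h2 h3 h4 h5
  have hC : 0 ≤ C := nonneg_of_mul_nonneg_left ((norm_nonneg _).trans hb) (Real.exp_pos _)
  refine ⟨hO, hb.trans (mul_le_mul_of_nonneg_left (Real.exp_le_exp.mpr ?_) hC)⟩
  have h1 : (m' : ℝ) * w.im ≤ m * w.im :=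
    mul_le_mul_of_nonneg_right (Nat.cast_le.mpr hm) hO.im_pos.le
  nlinarith [Real.pi_pos]

/-- Pointwise polynomial combinations of the functions `g i`. -/
def PolyIn {ι : Type*} (g : ι → ℂ → ℂ → ℂ → ℂ → ℂ) (F : ℂ → ℂ → ℂ → ℂ → ℂ) : Prop :=
  ∃ P : MvPolynomial ι ℂ, ∀ t a b w, F t a b w = MvPolynomial.eval (fun i => g i t a b w) P

/-- The Jacobi form `ψ` of weight `k` and index `m`, multiplied by the `m`-th power of the
discriminant, is the leading coefficient of a polynomial in `g`. -/
def Good {ι : Type*} (g : ι → ℂ → ℂ → ℂ → ℂ → ℂ) (k : ℤ) (m : ℕ) (ψ : ℂ → ℂ → ℂ → ℂ) : Prop :=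
  (k + 5 * m < 0 → ∀ t a b : ℂ, 0 < t.im → ψ t a b = 0) ∧
    ∃ F, PolyIn g F ∧ SymForm (k + 12 * m) F ∧ Lead m F fun t a b => DD t ^ m * ψ t a b

variable {ι : Type*} {g : ι → ℂ → ℂ → ℂ → ℂ → ℂ}

theorem PolyIn.mul (hF : PolyIn g F) (hG : PolyIn g G) :
    PolyIn g fun t a b w => F t a b w * G t a b w := by
  obtain ⟨P, hP⟩ := hF
  obtain ⟨Q, hQ⟩ := hG
  exact ⟨P * Q, fun t a b w => by simp [hP, hQ]⟩

theorem PolyIn.add_smul (hF : PolyIn g F) (c : ℂ) (hG : PolyIn g G) :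
    PolyIn g fun t a b w => F t a b w + c * G t a b w := by
  obtain ⟨P, hP⟩ := hF
  obtain ⟨Q, hQ⟩ := hG
  exact ⟨P + MvPolynomial.C c * Q, fun t a b w => by simp [hP, hQ]⟩

theorem PolyIn.zero : PolyIn g fun _ _ _ _ => 0 := ⟨0, by simp⟩

theorem polyIn_self (i : ι) : PolyIn g (g i) := ⟨MvPolynomial.X i, by simp⟩

theorem Good.congr (h : Good g k m φ) (hψ : ∀ t a b : ℂ, 0 < t.im → ψ t a b = φ t a b) :
    Good g k m ψ := by
  obtain ⟨h0, F, hF, hF', hl⟩ := h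
  exact ⟨fun hk t a b ht => by rw [hψ t a b ht, h0 hk t a b ht], F, hF, hF',
    hl.congr fun t a b ht => by rw [hψ t a b ht]⟩

theorem Good.add_smul (h : Good g k m φ) (c : ℂ) (h' : Good g k m ψ) :
    Good g k m fun t a b => φ t a b + c * ψ t a b := by
  obtain ⟨h0, F, hF, hF', hl⟩ := h
  obtain ⟨h0', G, hG, hG', hl'⟩ := h'
  refine ⟨fun hk t a b ht => by simp [h0 hk t a b ht, h0' hk t a b ht], _, hF.add_smul c hG,
    hF'.add_smul c hG', (hl.add_smul c hl').congr fun t a b ht => by ring⟩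

theorem Good.mul (h : Good g k m φ) (h' : Good g k' m' ψ) :
    Good g (k + k') (m + m') fun t a b => φ t a b * ψ t a b := by
  obtain ⟨h0, F, hF, hF', hl⟩ := h
  obtain ⟨h0', G, hG, hG', hl'⟩ := h'
  refine ⟨fun hk t a b ht => ?_, _, hF.mul hG, (hF'.mul hG').cast (by push_cast; ring),
    (hl.mul hl').congr fun t a b ht => by ring⟩
  by_cases hk1 : k + 5 * m < 0
  · simp [h0 hk1 t a b ht]
  · simp [h0' (by push_cast at hk; omega) t a b ht]

theorem Good.zero (k : ℤ) (m : ℕ) : Good g k m fun _ _ _ => 0 :=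
  ⟨fun _ _ _ _ _ => rfl, _, PolyIn.zero, SymForm.zero _, by simpa using Lead.zero m⟩

theorem good_of_mf {x y : ι} (h4 : SymForm 4 (g x)) (h6 : SymForm 6 (g y))
    (l4 : Lead 0 (g x) fun t _ _ => 1 / 240 * mE4 t)
    (l6 : Lead 0 (g y) fun t _ _ => -1 / 504 * mE6 t) {f : ℂ → ℂ} (hf : MF k f) :
    Good g k 0 fun t _ _ => f t := by
  have g4 : Good g 4 0 fun t _ _ => 1 / 240 * mE4 t :=
    ⟨fun h => absurd h (by norm_num), _, polyIn_self x, h4, by simpa using l4⟩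
  have g6 : Good g 6 0 fun t _ _ => -1 / 504 * mE6 t :=
    ⟨fun h => absurd h (by norm_num), _, polyIn_self y, h6, by simpa using l6⟩
  refine MF.induction (P := fun k f => Good g k 0 fun t _ _ => f t)
    (fun k f f' h h' => h'.congr fun t _ _ ht => h t ht) (fun k => Good.zero k 0) ?_
    (fun k f f' h h' => (h.add_smul 1 h').congr fun t _ _ _ => by ring)
    (fun k c f h => ((Good.zero k 0).add_smul c h).congr fun t _ _ _ => by ring)
    (fun k f h => ?_) (fun k f h => ?_) hf
  · exact ⟨fun h => absurd h (by norm_num), fun _ _ _ _ => 1, ⟨1, by simp⟩, SymForm.one,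
      fun t a b _ => by simp [ee_zero]⟩
  · refine ((Good.zero (k + 4) 0).add_smul 240 (h.mul g4)).congr fun t _ _ _ => ?_
    ring
  · refine ((Good.zero (k + 6) 0).add_smul (-504) (h.mul g6)).congr fun t _ _ _ => ?_
    ring

theorem GenJ.good {X : Fin 7 → ℂ → ℂ → ℂ → ℂ} {x y : ι} (h4 : SymForm 4 (g x))
    (h6 : SymForm 6 (g y)) (l4 : Lead 0 (g x) fun t _ _ => 1 / 240 * mE4 t)
    (l6 : Lead 0 (g y) fun t _ _ => -1 / 504 * mE6 t)
    (hg : ∀ i, ∃ j, SymForm (genWt i + 12) (g j) ∧ Lead 1 (g j) fun t a b => DD t * X i t a b)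
    (h : GenJ X k m φ) : Good g k m φ := by
  induction h with
  | zero k m => exact Good.zero k m
  | add _ _ h h' => exact (h.add_smul 1 h').congr fun t a b _ => by ring
  | mul _ _ h h' => exact h.mul h'
  | mf hf => exact good_of_mf h4 h6 l4 l6 hf
  | gen i =>
    obtain ⟨j, hj, hl⟩ := hg i
    refine ⟨fun h => absurd h ?_, _, polyIn_self j, by simpa using hj, by simpa using hl⟩
    fin_cases i <;> simp [genWt]
  | congr _ h h' => exact h'.congr h

theorem polyIn_of_good (hg : ∀ k m φ, WJ k (3 * m) m φ → Good g k m φ) (hF : SymForm k F) :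
    ∃ G, PolyIn g G ∧ ∀ t a b w, Om t a b w → F t a b w = G t a b w := by
  have step : ∀ m : ℕ, ∃ G, PolyIn g G ∧ SymForm k (fun t a b w => F t a b w + -1 * G t a b w) ∧
      LB m fun t a b w => F t a b w + -1 * G t a b w := by
    intro m
    induction m with
    | zero =>
      have := hF.add_smul (-1) (SymForm.zero k)
      exact ⟨_, PolyIn.zero, this, this.lb_zero⟩
    | succ m ih =>
      obtain ⟨G, h1, h2, h3⟩ := ih
      obtain ⟨φ, hφ⟩ := h2.exists_lead h3
      obtain ⟨ψ, hψ, hφψ⟩ := h2.exists_wj hφ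
      obtain ⟨-, G', h1', h2', hl⟩ := hg _ _ _ hψ
      have hs := h2.add_smul (-1) (h2'.cast (k' := k) (by ring))
      have e : (fun t a b w => F t a b w + -1 * G t a b w + -1 * G' t a b w) =
          fun t a b w => F t a b w + -1 * (G t a b w + 1 * G' t a b w) := by
        funext t a b w; ring
      have hb := hs.lb_succ (hs.lb_of_lead ((hφ.add_smul (-1) hl))) ((hφ.add_smul (-1) hl).congr
        fun t a b _ => by rw [hφψ]; ring)
      rw [e] at hs hb
      exact ⟨_, h1.add_smul 1 h1', hs, hb⟩
  obtain ⟨G, h1, h2, h3⟩ := step (k.toNat + 1)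
  refine ⟨G, h1, fun t a b w hO => ?_⟩
  suffices ∀ m, LB m fun t a b w => F t a b w + -1 * G t a b w by
    have := h2.eq_zero this hO
    linear_combination this
  intro m
  rcases le_total m (k.toNat + 1) with hm | hm
  · exact h3.mono hm
  induction m, hm using Nat.le_induction with
  | base => exact h3
  | succ m hm ih =>
    obtain ⟨φ, hφ⟩ := h2.exists_lead ih
    obtain ⟨ψ, hψ, hφψ⟩ := h2.exists_wj hφ
    refine h2.lb_succ ih (hφ.congr fun t a b ht => ?_)
    rw [hφψ, (hg _ _ _ hψ).1 (by omega) t a b ht, mul_zero]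

theorem exists_generators : ∃ g : Fin 9 → ℂ → ℂ → ℂ → ℂ → ℂ,
    (∀ i, SymForm ((![4, 6, 7, 8, 9, 10, 10, 11, 12] : Fin 9 → ℕ) i) (g i)) ∧
      ∀ k F, SymForm k F → ∃ G, PolyIn g G ∧ ∀ t a b w, Om t a b w → F t a b w = G t a b w := by
  obtain ⟨X, hX⟩ := exists_isGen
  obtain ⟨C₄, φ₄, h₄⟩ := exists_liftable_four
  obtain ⟨C₆, φ₆, h₆⟩ := exists_liftable_six
  have hl : ∀ i, ∃ G, SymForm (genWt i + 12) G ∧ Lead 1 G fun t a b => DD t * X i t a b := by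
    intro i
    have hi : 0 ≤ genWt i + 11 := by fin_cases i <;> simp [genWt]
    obtain ⟨l, hl⟩ := Int.eq_ofNat_of_zero_le hi
    obtain ⟨C, hC⟩ := (hX.wj i).liftable (l := l) (by linarith)
    exact ⟨_, hC.symForm.cast (by linarith), hC.lead_one fun _ _ => rfl⟩
  choose G hG hG' using hl
  refine ⟨![lift 3 (fun t => 1 / 240 * mE4 t) φ₄, lift 5 (fun t => -1 / 504 * mE6 t) φ₆, G 0, G 1,
    G 2, G 3, G 4, G 5, G 6], fun i => ?_, fun k F hF => polyIn_of_good (fun k m φ hφ =>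
      (hX.genJ hφ).good (x := 0) (y := 1) (h₄.symForm.cast (by norm_num))
      (h₆.symForm.cast (by norm_num)) h₄.lead_zero h₆.lead_zero fun i => ?_) hF⟩
  · fin_cases i
    · exact h₄.symForm.cast (by norm_num)
    · exact h₆.symForm.cast (by norm_num)
    all_goals exact (hG _).cast rfl
  · refine ⟨⟨i + 2, by omega⟩, ?_⟩
    fin_cases i <;> exact ⟨hG _, hG' _⟩

end GradedRing

section HermitianCoordinates

/-- The generator `(1 + √-7) / 2` of the ring of integers. -/
def om : ℂ := omg 7

theorem om_sq : om ^ 2 = om - 2 := by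
  have h : ((Real.sqrt (7 : ℕ) : ℝ) : ℂ) ^ 2 = 7 := by
    rw [← Complex.ofReal_pow, Real.sq_sqrt (by norm_num)]; norm_num
  rw [om, omg]
  linear_combination h * Complex.I ^ 2 / 4 + 7 / 4 * Complex.I_sq

theorem conj_om : (starRingEnd ℂ) om = 1 - om := by
  rw [om, omg]
  simp only [map_div₀, map_add, map_mul, map_one, Complex.conj_I, Complex.conj_ofReal, map_ofNat]
  ring

theorem om_re : om.re = 1 / 2 := by simp [om, omg]

theorem om_im_sq : om.im ^ 2 = 7 / 4 := by
  have h := congrArg Complex.re om_sq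
  simp [pow_two, om_re] at h
  linarith

/-- The point of the Hermitian upper half-space with coordinates `(t, a, b, w)`. -/
def pt (t a b w : ℂ) : Matrix (Fin 2) (Fin 2) ℂ := !![t, a + b * (1 - om); a + b * om, w]

/-- The coordinate `a` of a matrix. -/
def coA (τ : Matrix (Fin 2) (Fin 2) ℂ) : ℂ := (om * τ 0 1 - (1 - om) * τ 1 0) * (1 - 2 * om) / 7

/-- The coordinate `b` of a matrix. -/
def coB (τ : Matrix (Fin 2) (Fin 2) ℂ) : ℂ := (τ 1 0 - τ 0 1) * (1 - 2 * om) / 7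

theorem pt_co (τ : Matrix (Fin 2) (Fin 2) ℂ) : pt (τ 0 0) (coA τ) (coB τ) (τ 1 1) = τ := by
  ext i j
  fin_cases i <;> fin_cases j <;> simp [pt, coA, coB]
  · linear_combination -4 / 7 * τ 0 1 * om_sq
  · linear_combination -4 / 7 * τ 1 0 * om_sq

theorem coA_pt (t a b w : ℂ) : coA (pt t a b w) = a := by
  simp [pt, coA]
  linear_combination -4 / 7 * a * om_sq

theorem coB_pt (t a b w : ℂ) : coB (pt t a b w) = b := by
  simp [pt, coB]
  linear_combination -4 / 7 * b * om_sq

theorem pt_transpose (t a b w : ℂ) : (pt t a b w)ᵀ = pt t (a + b) (-b) w := by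
  ext i j
  fin_cases i <;> fin_cases j <;> simp [pt] <;> ring

/-- The Hermitian imaginary part of `pt t a b w`. -/
theorem imPart_pt (t a b w : ℂ) :
    (Matrix.of fun i j => (pt t a b w i j - (starRingEnd ℂ) (pt t a b w j i)) / (2 * Complex.I)) =
      !![(t.im : ℂ), a.im + b.im * (1 - om); a.im + b.im * om, w.im] := by
  have h : ∀ z : ℂ, (z.im : ℂ) = (z - (starRingEnd ℂ) z) / (2 * Complex.I) := by
    intro z
    rw [Complex.sub_conj]
    have := Complex.I_ne_zero
    push_cast; field_simp
  simp only [h]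
  ext i j
  fin_cases i <;> fin_cases j <;> simp [pt, conj_om] <;> ring

theorem pt_mem_HH2 {t a b w : ℂ} : pt t a b w ∈ HH2 ↔ Om t a b w := by
  rw [HH2, Set.mem_ofPred_eq, imPart_pt]
  have hdet : (t.im : ℂ) * w.im - (a.im + b.im * (1 - om)) * (a.im + b.im * om) =
      ((t.im * w.im - (a.im ^ 2 + a.im * b.im + 2 * b.im ^ 2) : ℝ) : ℂ) := by
    push_cast
    linear_combination (b.im : ℂ) ^ 2 * om_sq
  constructor
  · intro h
    have h1 := h.diag_pos (i := 0)
    have h2 := h.det_pos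
    rw [Matrix.det_fin_two_of, hdet] at h2
    simp only [Matrix.of_apply, Matrix.cons_val', Matrix.cons_val_zero] at h1
    rw [Complex.zero_lt_real] at h1 h2
    exact ⟨h1, by linarith⟩
  · intro ⟨h1, h2⟩
    have h0 : (t.im : ℂ) ≠ 0 := Complex.ofReal_ne_zero.mpr h1.ne'
    have hD : (Matrix.diagonal ![(t.im : ℂ),
        ((t.im * w.im - (a.im ^ 2 + a.im * b.im + 2 * b.im ^ 2)) / t.im : ℝ)]).PosDef := by
      refine Matrix.posDef_diagonal_iff.mpr fun i => ?_
      fin_cases i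
      · exact Complex.zero_lt_real.mpr h1
      · exact Complex.zero_lt_real.mpr (div_pos (by linarith) h1)
    have := hD.conjTranspose_mul_mul_same
      (B := !![1, (a.im + b.im * (1 - om)) / t.im; 0, 1]) ?_
    · convert this using 1
      rw [Complex.ofReal_div, ← hdet]
      ext i j
      fin_cases i <;> fin_cases j <;>
        simp [Matrix.mul_apply, Fin.sum_univ_two, Matrix.diagonal, conj_om] <;> field_simp <;> ring
    · intro x y hxy
      have e0 := congrFun hxy 0
      have e1 := congrFun hxy 1
      simp [Matrix.mulVec, dotProduct, Fin.sum_univ_two] at e0 e1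
      rw [e1] at e0
      ext i
      fin_cases i
      · exact add_right_cancel e0
      · exact e1

theorem exists_pt {τ : Matrix (Fin 2) (Fin 2) ℂ} (h : τ ∈ HH2) :
    ∃ t a b w, Om t a b w ∧ τ = pt t a b w := by
  rw [← pt_co τ] at h
  exact ⟨_, _, _, _, pt_mem_HH2.mp h, (pt_co τ).symm⟩

theorem moebius_eq {M : Matrix (Fin 4) (Fin 4) ℂ} {τ X : Matrix (Fin 2) (Fin 2) ℂ}
    (hd : (blkC M * τ + blkD M).det ≠ 0) (h : X * (blkC M * τ + blkD M) = blkA M * τ + blkB M) :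
    moebius M τ = X := by
  rw [moebius, ← h, Matrix.mul_nonsing_inv_cancel_right _ _ (isUnit_iff_ne_zero.mpr hd)]

end HermitianCoordinates

section Generators

/-- The ring of integers as a subring of `ℂ`. -/
def OK : Subring ℂ where
  carrier := ringInts 7
  zero_mem' := ⟨0, 0, by simp⟩
  one_mem' := ⟨1, 0, by simp⟩
  add_mem' := by
    rintro _ _ ⟨a, b, rfl⟩ ⟨c, d, rfl⟩
    exact ⟨a + c, b + d, by push_cast; ring⟩
  neg_mem' := by
    rintro _ ⟨a, b, rfl⟩
    exact ⟨-a, -b, by push_cast; ring⟩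
  mul_mem' := by
    rintro _ _ ⟨a, b, rfl⟩ ⟨c, d, rfl⟩
    refine ⟨a * c - 2 * (b * d), a * d + b * c + b * d, ?_⟩
    push_cast
    rw [← om]
    linear_combination (b : ℂ) * d * om_sq

theorem mem_OK {z : ℂ} : z ∈ OK ↔ ∃ a b : ℤ, z = a + b * om := Iff.rfl

theorem om_mem : om ∈ OK := ⟨0, 1, by simp [om]⟩

theorem inSU_iff {M : Matrix (Fin 4) (Fin 4) ℂ} : inSU 7 M ↔
    (∀ i j, M i j ∈ OK) ∧ M.det = 1 ∧ Mᵀ * Jmat * M.map (starRingEnd ℂ) = Jmat := Iff.rfl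

theorem conj_mem {z : ℂ} (h : z ∈ OK) : (starRingEnd ℂ) z ∈ OK := by
  obtain ⟨a, b, rfl⟩ := mem_OK.mp h
  simp only [map_add, map_mul, conj_om, map_intCast]
  exact add_mem (intCast_mem _ _) (mul_mem (intCast_mem _ _) (sub_mem (one_mem _) om_mem))

/-- Translation by an integral Hermitian matrix. -/
def trM (n p q m : ℤ) : Matrix (Fin 4) (Fin 4) ℂ :=
  !![1, 0, n, p + q * (1 - om); 0, 1, p + q * om, m; 0, 0, 1, 0; 0, 0, 0, 1]

/-- An elementary unipotent matrix in the Levi subgroup. -/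
def levi (ξ : ℂ) : Matrix (Fin 4) (Fin 4) ℂ :=
  !![1, 0, 0, 0; ξ, 1, 0, 0; 0, 0, 1, -(starRingEnd ℂ) ξ; 0, 0, 0, 1]

/-- The exchange of the two coordinates. -/
def swM : Matrix (Fin 4) (Fin 4) ℂ := !![0, 1, 0, 0; 1, 0, 0, 0; 0, 0, 0, 1; 0, 0, 1, 0]

/-- The change of sign of the second coordinate. -/
def sgM : Matrix (Fin 4) (Fin 4) ℂ := !![1, 0, 0, 0; 0, -1, 0, 0; 0, 0, 1, 0; 0, 0, 0, -1]

/-- The inversion in the first coordinate. -/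
def inM : Matrix (Fin 4) (Fin 4) ℂ := !![0, 0, -1, 0; 0, 1, 0, 0; 1, 0, 0, 0; 0, 0, 0, 1]

theorem inSU_trM (n p q m : ℤ) : inSU 7 (trM n p q m) := by
  have h1 : (p + q * om : ℂ) ∈ OK :=
    add_mem (intCast_mem _ _) (mul_mem (intCast_mem _ _) om_mem)
  have h2 : (p + q * (1 - om) : ℂ) ∈ OK :=
    add_mem (intCast_mem _ _) (mul_mem (intCast_mem _ _) (sub_mem (one_mem _) om_mem))
  refine inSU_iff.mpr ⟨fun i j => ?_, ?_, ?_⟩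
  · fin_cases i <;> fin_cases j <;> simp [trM, h1, h2]
  · simp [trM, Matrix.det_succ_row_zero, Fin.sum_univ_succ, Fin.succAbove]
  · ext i j
    fin_cases i <;> fin_cases j <;>
      simp [trM, Jmat, Matrix.mul_apply, Fin.sum_univ_four, conj_om]

theorem inSU_levi {ξ : ℂ} (h : ξ ∈ OK) : inSU 7 (levi ξ) := by
  refine inSU_iff.mpr ⟨fun i j => ?_, ?_, ?_⟩
  · fin_cases i <;> fin_cases j <;> simp [levi, h, conj_mem]
  · simp [levi, Matrix.det_succ_row_zero, Fin.sum_univ_succ, Fin.succAbove]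
  · ext i j
    fin_cases i <;> fin_cases j <;>
      simp [levi, Jmat, Matrix.mul_apply, Fin.sum_univ_four]

theorem inSU_swM : inSU 7 swM := by
  refine inSU_iff.mpr ⟨fun i j => ?_, ?_, ?_⟩
  · fin_cases i <;> fin_cases j <;> simp [swM]
  · simp [swM, Matrix.det_succ_row_zero, Fin.sum_univ_succ, Fin.succAbove]
  · ext i j
    fin_cases i <;> fin_cases j <;>
      simp [swM, Jmat, Matrix.mul_apply, Fin.sum_univ_four]

theorem inSU_sgM : inSU 7 sgM := by
  refine inSU_iff.mpr ⟨fun i j => ?_, ?_, ?_⟩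
  · fin_cases i <;> fin_cases j <;> simp [sgM]
  · simp [sgM, Matrix.det_succ_row_zero, Fin.sum_univ_succ, Fin.succAbove]
  · ext i j
    fin_cases i <;> fin_cases j <;>
      simp [sgM, Jmat, Matrix.mul_apply, Fin.sum_univ_four]

theorem inSU_inM : inSU 7 inM := by
  refine inSU_iff.mpr ⟨fun i j => ?_, ?_, ?_⟩
  · fin_cases i <;> fin_cases j <;> simp [inM]
  · simp [inM, Matrix.det_succ_row_zero, Fin.sum_univ_succ, Fin.succAbove]
  · ext i j
    fin_cases i <;> fin_cases j <;>
      simp [inM, Jmat, Matrix.mul_apply, Fin.sum_univ_four]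

variable (t a b w : ℂ)

theorem det_trM (n p q m : ℤ) : (blkC (trM n p q m) * pt t a b w + blkD (trM n p q m)).det = 1 := by
  simp [Matrix.det_fin_two, trM, blkC, blkD, pt]

theorem moebius_trM (n p q m : ℤ) :
    moebius (trM n p q m) (pt t a b w) = pt (t + n) (a + p) (b + q) (w + m) := by
  refine moebius_eq (by simp [det_trM]) ?_
  ext i j
  fin_cases i <;> fin_cases j <;> simp [trM, blkA, blkB, blkC, blkD, pt] <;> ring

theorem det_levi (ξ : ℂ) : (blkC (levi ξ) * pt t a b w + blkD (levi ξ)).det = 1 := by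
  simp [Matrix.det_fin_two, levi, blkC, blkD, pt]

theorem moebius_levi_one : moebius (levi 1) (pt t a b w) = pt t (a + t) b (w + 2 * a + b + t) := by
  refine moebius_eq (by simp [det_levi]) ?_
  ext i j
  fin_cases i <;> fin_cases j <;> simp [levi, blkA, blkB, blkC, blkD, pt] <;> ring

theorem moebius_levi_om :
    moebius (levi om) (pt t a b w) = pt t a (b + t) (w + a + 4 * b + 2 * t) := by
  refine moebius_eq (by simp [det_levi]) ?_
  ext i j
  fin_cases i <;> fin_cases j <;> simp [levi, blkA, blkB, blkC, blkD, pt, conj_om]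
  · ring
  · ring
  · linear_combination (2 * b + t) * om_sq

theorem det_swM : (blkC swM * pt t a b w + blkD swM).det = -1 := by
  simp [Matrix.det_fin_two, swM, blkC, blkD, pt]

theorem moebius_swM : moebius swM (pt t a b w) = pt w (a + b) (-b) t := by
  refine moebius_eq (by simp [det_swM]) ?_
  ext i j
  fin_cases i <;> fin_cases j <;> simp [swM, blkA, blkB, blkC, blkD, pt] <;> ring

theorem det_sgM : (blkC sgM * pt t a b w + blkD sgM).det = -1 := by
  simp [Matrix.det_fin_two, sgM, blkC, blkD, pt]

theorem moebius_sgM : moebius sgM (pt t a b w) = pt t (-a) (-b) w := by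
  refine moebius_eq (by simp [det_sgM]) ?_
  ext i j
  fin_cases i <;> fin_cases j <;> simp [sgM, blkA, blkB, blkC, blkD, pt] <;> ring

theorem det_inM : (blkC inM * pt t a b w + blkD inM).det = t := by
  simp [Matrix.det_fin_two, inM, blkC, blkD, pt]

variable {t}

theorem moebius_inM (ht : t ≠ 0) :
    moebius inM (pt t a b w) = pt (-1 / t) (a / t) (b / t) (w - NN a b / t) := by
  refine moebius_eq (by simpa [det_inM] using ht) ?_
  ext i j
  fin_cases i <;> fin_cases j <;> simp [inM, blkA, blkB, blkC, blkD, pt, NN] <;> field_simp <;>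
    ring_nf
  linear_combination -b ^ 2 * om_sq

end Generators

section Correspondence

theorem differentiable_entry (i j : Fin 2) :
    Differentiable ℂ fun τ : Matrix (Fin 2) (Fin 2) ℂ => τ i j :=
  differentiable_pi.mp (differentiable_pi.mp differentiable_id i) j

theorem differentiable_coA : Differentiable ℂ coA := by
  have h := differentiable_entry
  unfold coA
  exact (((h 0 1).const_mul _).sub ((h 1 0).const_mul _)).mul_const _ |>.mul_const _

theorem differentiable_coB : Differentiable ℂ coB := by
  have h := differentiable_entry
  unfold coB
  exact ((h 1 0).sub (h 0 1)).mul_const _ |>.mul_const _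

theorem differentiable_pt :
    Differentiable ℂ fun p : ℂ × ℂ × ℂ × ℂ => pt p.1 p.2.1 p.2.2.1 p.2.2.2 := by
  refine differentiable_pi.mpr fun i => differentiable_pi.mpr fun j => ?_
  fin_cases i <;> fin_cases j <;> simp [pt] <;> fun_prop

theorem om_co_iff {τ : Matrix (Fin 2) (Fin 2) ℂ} :
    Om (τ 0 0) (coA τ) (coB τ) (τ 1 1) ↔ τ ∈ HH2 := by
  rw [← pt_mem_HH2, pt_co]

theorem isOpen_HH2 : IsOpen HH2 := by
  have h : Continuous fun τ : Matrix (Fin 2) (Fin 2) ℂ => (τ 0 0, coA τ, coB τ, τ 1 1) :=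
    (differentiable_entry 0 0).continuous.prodMk (differentiable_coA.continuous.prodMk
      (differentiable_coB.continuous.prodMk (differentiable_entry 1 1).continuous))
  convert isOpen_Om.preimage h using 1
  ext τ
  exact om_co_iff.symm

variable {k : ℕ} {F : Matrix (Fin 2) (Fin 2) ℂ → ℂ} {t a b w : ℂ}

theorem neg_one_pow_mul_self (k : ℕ) (z : ℂ) : (-1) ^ k * ((-1) ^ k * z) = z := by
  rw [← mul_assoc, ← mul_pow]; simp

theorem IsSymHMF.symForm (h : IsSymHMF 7 k F) : SymForm k fun t a b w => F (pt t a b w) := by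
  obtain ⟨⟨hd, hM⟩, hT⟩ := h
  have htr : ∀ (n p q m : ℤ) {t a b w : ℂ}, Om t a b w →
      F (pt (t + n) (a + p) (b + q) (w + m)) = F (pt t a b w) := by
    intro n p q m t a b w hO
    rw [← moebius_trM, hM _ (inSU_trM n p q m) _ (pt_mem_HH2.mpr hO), det_trM, one_pow, one_mul]
  have hsg : ∀ {t a b w : ℂ}, Om t a b w → F (pt t (-a) (-b) w) = (-1) ^ k * F (pt t a b w) := by
    intro t a b w hO
    rw [← moebius_sgM, hM _ inSU_sgM _ (pt_mem_HH2.mpr hO), det_sgM]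
  have hsw : ∀ {t a b w : ℂ}, Om t a b w → F (pt w (a + b) (-b) t) = (-1) ^ k * F (pt t a b w) := by
    intro t a b w hO
    rw [← moebius_swM, hM _ inSU_swM _ (pt_mem_HH2.mpr hO), det_swM]
  have hT' : ∀ {t a b w : ℂ}, Om t a b w → Om t (a + b) (-b) w ∧
      F (pt t (a + b) (-b) w) = (-1) ^ k * F (pt t a b w) := by
    intro t a b w hO
    rw [← pt_transpose, hT _ (pt_mem_HH2.mpr hO)]
    refine ⟨⟨hO.1, ?_⟩, rfl⟩
    have := hO.2
    simp only [Complex.add_im, Complex.neg_im]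
    nlinarith
  refine ⟨fun t a b w hO => ?_, fun t a b w hO => ?_, fun t a b w hO => ?_, fun t a b w hO => ?_,
    fun t a b w hO => ?_, fun t a b w hO => ?_, fun t a b w hO => ?_, fun t a b w hO => ?_,
    fun t a b w hO => ?_, fun t a b w hO => ?_⟩
  · exact DifferentiableAt.comp (g := F)
      (f := fun p : ℂ × ℂ × ℂ × ℂ => pt p.1 p.2.1 p.2.2.1 p.2.2.2) (t, a, b, w)
      (hd.differentiableAt (isOpen_HH2.mem_nhds (pt_mem_HH2.mpr hO))) (differentiable_pt _)
  · simpa using htr 1 0 0 0 hO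
  · simpa using htr 0 1 0 0 hO
  · simpa using htr 0 0 1 0 hO
  · rw [← moebius_levi_one, hM _ (inSU_levi (one_mem _)) _ (pt_mem_HH2.mpr hO), det_levi, one_pow,
      one_mul]
  · rw [← moebius_levi_om, hM _ (inSU_levi om_mem) _ (pt_mem_HH2.mpr hO), det_levi, one_pow,
      one_mul]
  · rw [← moebius_inM _ _ _ (ne_zero_of_im_pos hO.1), hM _ inSU_inM _ (pt_mem_HH2.mpr hO), det_inM,
      zpow_natCast]
  · have h1 := hsg (hT' hO).1
    rw [(hT' hO).2, neg_one_pow_mul_self, neg_neg, neg_add, ← sub_eq_add_neg] at h1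
    exact h1
  · simpa using hsg hO
  · have h1 := (hsw hO.swap).symm.trans (hT' hO).2
    exact mul_left_cancel₀ (pow_ne_zero k (by norm_num)) h1

end Correspondence

section Invariance

/-- `M` preserves the half-space and acts on `F` by the automorphy factor of weight `k`. -/
def ActsOn (k : ℕ) (F : Matrix (Fin 2) (Fin 2) ℂ → ℂ) (M : Matrix (Fin 4) (Fin 4) ℂ) : Prop :=
  ∀ τ ∈ HH2, (blkC M * τ + blkD M).det ≠ 0 ∧ moebius M τ ∈ HH2 ∧
    F (moebius M τ) = (blkC M * τ + blkD M).det ^ k * F τ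

variable {k : ℕ} {F : Matrix (Fin 2) (Fin 2) ℂ → ℂ} {M N : Matrix (Fin 4) (Fin 4) ℂ}

theorem blkA_mul : blkA (M * N) = blkA M * blkA N + blkB M * blkC N := by
  ext i j
  fin_cases i <;> fin_cases j <;>
    simp [blkA, blkB, blkC, Matrix.mul_apply, Fin.sum_univ_four] <;> ring

theorem blkB_mul : blkB (M * N) = blkA M * blkB N + blkB M * blkD N := by
  ext i j
  fin_cases i <;> fin_cases j <;>
    simp [blkA, blkB, blkD, Matrix.mul_apply, Fin.sum_univ_four] <;> ring

theorem blkC_mul : blkC (M * N) = blkC M * blkA N + blkD M * blkC N := by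
  ext i j
  fin_cases i <;> fin_cases j <;>
    simp [blkA, blkC, blkD, Matrix.mul_apply, Fin.sum_univ_four] <;> ring

theorem blkD_mul : blkD (M * N) = blkC M * blkB N + blkD M * blkD N := by
  ext i j
  fin_cases i <;> fin_cases j <;>
    simp [blkB, blkC, blkD, Matrix.mul_apply, Fin.sum_univ_four] <;> ring

theorem ActsOn.mul (hM : ActsOn k F M) (hN : ActsOn k F N) : ActsOn k F (M * N) := by
  intro τ hτ
  obtain ⟨h1, h2, h3⟩ := hN τ hτ
  obtain ⟨h1', h2', h3'⟩ := hM _ h2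
  have e : moebius N τ * (blkC N * τ + blkD N) = blkA N * τ + blkB N := by
    rw [moebius, Matrix.nonsing_inv_mul_cancel_right _ _ (isUnit_iff_ne_zero.mpr h1)]
  have hC : blkC (M * N) * τ + blkD (M * N) =
      (blkC M * moebius N τ + blkD M) * (blkC N * τ + blkD N) := by
    rw [add_mul (blkC M * _), mul_assoc (blkC M), e, blkC_mul, blkD_mul]
    noncomm_ring
  have hA : blkA (M * N) * τ + blkB (M * N) =
      (blkA M * moebius N τ + blkB M) * (blkC N * τ + blkD N) := by
    rw [add_mul (blkA M * _), mul_assoc (blkA M), e, blkA_mul, blkB_mul]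
    noncomm_ring
  have hd : (blkC (M * N) * τ + blkD (M * N)).det ≠ 0 := by
    rw [hC, Matrix.det_mul]
    exact mul_ne_zero h1' h1
  have hm : moebius (M * N) τ = moebius M (moebius N τ) := by
    refine moebius_eq hd ?_
    rw [hC, hA, ← mul_assoc, moebius,
      Matrix.nonsing_inv_mul_cancel_right _ _ (isUnit_iff_ne_zero.mpr h1')]
  rw [hm]
  refine ⟨hd, h2', ?_⟩
  rw [h3', h3, hC, Matrix.det_mul, mul_pow, mul_assoc]

/-- The function on matrices attached to a function of the coordinates. -/
def toF (G : ℂ → ℂ → ℂ → ℂ → ℂ) (τ : Matrix (Fin 2) (Fin 2) ℂ) : ℂ :=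
  G (τ 0 0) (coA τ) (coB τ) (τ 1 1)

variable {G : ℂ → ℂ → ℂ → ℂ → ℂ}

theorem toF_pt (t a b w : ℂ) : toF G (pt t a b w) = G t a b w := by
  rw [toF, coA_pt, coB_pt]; simp [pt]

theorem inv_toF (h : ∀ t a b w, Om t a b w → (blkC M * pt t a b w + blkD M).det ≠ 0 ∧
    ∃ t' a' b' w', moebius M (pt t a b w) = pt t' a' b' w' ∧ Om t' a' b' w' ∧
      G t' a' b' w' = (blkC M * pt t a b w + blkD M).det ^ k * G t a b w) : ActsOn k (toF G) M := by
  intro τ hτ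
  obtain ⟨t, a, b, w, hO, rfl⟩ := exists_pt hτ
  obtain ⟨h1, t', a', b', w', h2, h3, h4⟩ := h t a b w hO
  rw [h2, toF_pt, toF_pt]
  exact ⟨h1, pt_mem_HH2.mpr h3, h4⟩

theorem levi_mul (x y : ℂ) : levi x * levi y = levi (x + y) := by
  ext i j
  fin_cases i <;> fin_cases j <;> simp [levi, Matrix.mul_apply, Fin.sum_univ_four]

theorem levi_zero : levi 0 = 1 := by
  ext i j
  fin_cases i <;> fin_cases j <;> simp [levi]

theorem levi_neg (x : ℂ) : sgM * levi x * sgM = levi (-x) := by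
  ext i j
  fin_cases i <;> fin_cases j <;> simp [levi, sgM, Matrix.mul_apply, Fin.sum_univ_four]

theorem sgM_mul_sgM : sgM * sgM = 1 := by
  ext i j
  fin_cases i <;> fin_cases j <;> simp [sgM, Matrix.mul_apply, Fin.sum_univ_four]

theorem SymForm.inv_trM (hG : SymForm k G) (n p q m : ℤ) : ActsOn k (toF G) (trM n p q m) := by
  refine inv_toF fun t a b w hO => ⟨by simp [det_trM], _, _, _, _, moebius_trM .., ?_, ?_⟩
  · simpa [Om] using hO
  · have h1 : Om t a b (w + m) := by simpa [Om] using hO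
    have h2 : Om t a (b + q) (w + m) := by simpa [Om] using hO
    have h3 : Om t (a + p) (b + q) (w + m) := by simpa [Om] using hO
    rw [det_trM, one_pow, one_mul,
      periodic_add_int (P := fun y => Om (y * Complex.I) (a + p) (b + q) (w + m))
        (f := fun t => G t (a + p) (b + q) (w + m)) (fun z hz => hG.T _ _ _ _ (by simpa [Om] using hz))
        n t (by simpa [Om] using h3),
      periodic_add_int (P := fun y => Om t (y * Complex.I) (b + q) (w + m))
        (f := fun a => G t a (b + q) (w + m)) (fun z hz => hG.A _ _ _ _ (by simpa [Om] using hz))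
        p a (by simpa [Om] using h2),
      periodic_add_int (P := fun y => Om t a (y * Complex.I) (w + m))
        (f := fun b => G t a b (w + m)) (fun z hz => hG.B _ _ _ _ (by simpa [Om] using hz))
        q b (by simpa [Om] using h1),
      periodic_add_int (P := fun y => Om t a b (y * Complex.I))
        (f := fun w => G t a b w) (fun z hz => hG.W _ _ _ _ (by simpa [Om] using hz))
        m w (by simpa [Om] using hO)]

theorem SymForm.inv_sgM (hG : SymForm k G) : ActsOn k (toF G) sgM := by
  refine inv_toF fun t a b w hO => ⟨by simp [det_sgM], _, _, _, _, moebius_sgM .., ?_, ?_⟩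
  · simpa [Om] using hO
  · rw [det_sgM, hG.neg _ _ _ _ hO, zpow_natCast]

theorem SymForm.inv_swM (hG : SymForm k G) : ActsOn k (toF G) swM := by
  refine inv_toF fun t a b w hO => ⟨by simp [det_swM], _, _, _, _, moebius_swM .., ?_⟩
  have h1 : Om w (a + b) (-b) t := by
    refine ⟨hO.im_pos, ?_⟩
    have := hO.2
    simp only [Complex.add_im, Complex.neg_im]
    nlinarith
  have h2 : Om w (-a) (-b) t := by simpa [Om] using hO.swap
  have h3 := hG.sig _ _ _ _ h2
  rw [neg_neg, sub_neg_eq_add, hG.neg _ _ _ _ hO.swap, hG.swap _ _ _ _ hO, zpow_natCast] at h3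
  exact ⟨h1, by rw [det_swM, h3]⟩

theorem SymForm.inv_inM (hG : SymForm k G) : ActsOn k (toF G) inM := by
  refine inv_toF fun t a b w hO => ⟨by rw [det_inM]; exact ne_zero_of_im_pos hO.1, _, _, _, _,
    moebius_inM _ _ _ (ne_zero_of_im_pos hO.1), hO.S, ?_⟩
  rw [det_inM, hG.S _ _ _ _ hO, zpow_natCast]

theorem SymForm.inv_levi (hG : SymForm k G) {ξ : ℂ} (hξ : ξ ∈ OK) : ActsOn k (toF G) (levi ξ) := by
  let S : AddSubgroup ℂ :=
    { carrier := {x | ActsOn k (toF G) (levi x)}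
      zero_mem' := by
        show ActsOn k (toF G) (levi 0)
        rw [levi_zero, ← sgM_mul_sgM]
        exact hG.inv_sgM.mul hG.inv_sgM
      add_mem' := fun {x y} hx hy => by
        show ActsOn k (toF G) (levi (x + y))
        rw [← levi_mul]
        exact ActsOn.mul hx hy
      neg_mem' := fun {x} hx => by
        show ActsOn k (toF G) (levi (-x))
        rw [← levi_neg]
        exact (hG.inv_sgM.mul hx).mul hG.inv_sgM }
  have h1 : (1 : ℂ) ∈ S := by
    refine inv_toF fun t a b w hO => ⟨by simp [det_levi], _, _, _, _, moebius_levi_one .., ?_, ?_⟩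
    · refine ⟨hO.1, ?_⟩
      have := hO.2
      simp only [Complex.add_im, Complex.mul_im, Complex.re_ofNat, Complex.im_ofNat]
      nlinarith
    · rw [det_levi, one_pow, one_mul, hG.HA _ _ _ _ hO]
  have h2 : om ∈ S := by
    refine inv_toF fun t a b w hO => ⟨by simp [det_levi], _, _, _, _, moebius_levi_om .., ?_, ?_⟩
    · refine ⟨hO.1, ?_⟩
      have := hO.2
      simp only [Complex.add_im, Complex.mul_im, Complex.re_ofNat, Complex.im_ofNat]
      nlinarith
    · rw [det_levi, one_pow, one_mul, hG.HB _ _ _ _ hO]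
  obtain ⟨x, y, rfl⟩ := mem_OK.mp hξ
  have h3 : (x + y * om : ℂ) ∈ S := by
    simpa [zsmul_eq_mul] using S.add_mem (S.zsmul_mem h1 x) (S.zsmul_mem h2 y)
  exact h3

end Invariance

section EuclideanDivision

open ComplexConjugate

variable {x y : ℂ}

theorem normSq_add_mul_om (a b : ℤ) :
    Complex.normSq (a + b * om) = ((a ^ 2 + a * b + 2 * b ^ 2 : ℤ) : ℝ) := by
  rw [Complex.normSq_apply]
  simp [om_re]
  linear_combination (b : ℝ) ^ 2 * om_im_sq

theorem exists_normSq_eq (hx : x ∈ OK) : ∃ n : ℕ, Complex.normSq x = n := by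
  obtain ⟨a, b, rfl⟩ := mem_OK.mp hx
  have h0 : 0 ≤ a ^ 2 + a * b + 2 * b ^ 2 := by nlinarith [sq_nonneg (2 * a + b), sq_nonneg b]
  obtain ⟨n, hn⟩ := Int.eq_ofNat_of_zero_le h0
  exact ⟨n, by rw [normSq_add_mul_om, hn]; simp⟩

theorem eq_one_or_eq_neg_one_of_mul_eq_one (hx : x ∈ OK) (hy : y ∈ OK) (h : x * y = 1) :
    x = 1 ∨ x = -1 := by
  obtain ⟨n, hn⟩ := exists_normSq_eq hx
  obtain ⟨m, hm⟩ := exists_normSq_eq hy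
  have h1 : n * m = 1 := by
    have := congrArg Complex.normSq h
    rw [Complex.normSq_mul, hn, hm, Complex.normSq_one] at this
    exact_mod_cast this
  obtain ⟨a, b, rfl⟩ := mem_OK.mp hx
  rw [normSq_add_mul_om, Nat.eq_one_of_mul_eq_one_right h1] at hn
  have h2 : a ^ 2 + a * b + 2 * b ^ 2 = 1 := by exact_mod_cast hn
  have hb : b = 0 := by
    have h3 : b ^ 2 < 1 := by nlinarith [sq_nonneg (2 * a + b)]
    nlinarith [sq_nonneg b, sq_eq_zero_iff.mp (by nlinarith [sq_nonneg b] : b ^ 2 = 0)]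
  subst hb
  rcases mul_self_eq_one_iff.mp (by linarith : a * a = 1) with rfl | rfl <;> simp

theorem exists_int_of_conj_eq (hx : x ∈ OK) (h : conj x = x) : ∃ n : ℤ, x = n := by
  obtain ⟨a, b, rfl⟩ := mem_OK.mp hx
  have h1 := congrArg Complex.im h
  have h2 : om.im ≠ 0 := fun h => by have := om_im_sq; rw [h] at this; norm_num at this
  simp at h1
  have hb : b = 0 := by
    have : (b : ℝ) * om.im = 0 := by linarith
    simpa [h2] using this
  exact ⟨a, by simp [hb]⟩

theorem exists_normSq_add_mul_lt (x : ℂ) (hy : y ≠ 0) :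
    ∃ q ∈ OK, Complex.normSq (x + q * y) < Complex.normSq y := by
  obtain ⟨z, rfl⟩ : ∃ z, x = z * y := ⟨x / y, by field_simp⟩
  set b := round (z.im / om.im)
  set a := round (z.re - b / 2)
  refine ⟨-(a + b * om), neg_mem (mem_OK.mpr ⟨a, b, rfl⟩), ?_⟩
  have h2 : om.im ≠ 0 := fun h => by have := om_im_sq; rw [h] at this; norm_num at this
  rw [← add_mul, Complex.normSq_mul]
  refine mul_lt_of_lt_one_left (Complex.normSq_pos.mpr hy) ?_
  have h3 := abs_le.mp (abs_sub_round (z.im / om.im))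
  have h4 := abs_le.mp (abs_sub_round (z.re - b / 2))
  have h5 : (z.im - b * om.im) ^ 2 ≤ 7 / 16 := by
    have : z.im - b * om.im = (z.im / om.im - b) * om.im := by field_simp
    rw [this, mul_pow, om_im_sq]
    nlinarith
  rw [Complex.normSq_apply]
  simp [om_re]
  nlinarith

theorem exists_int_normSq_add_mul_lt (hy : y ≠ 0) (h : x * conj y = y * conj x) :
    ∃ n : ℤ, Complex.normSq (x + n * y) < Complex.normSq y := by
  obtain ⟨z, rfl⟩ : ∃ z, x = z * y := ⟨x / y, by field_simp⟩
  have hz : conj z = z := by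
    have hy' : conj y ≠ 0 := (map_ne_zero _).mpr hy
    rw [map_mul] at h
    exact mul_right_cancel₀ (mul_ne_zero hy hy') (by linear_combination -h)
  refine ⟨-round z.re, ?_⟩
  rw [← add_mul, Complex.normSq_mul]
  refine mul_lt_of_lt_one_left (Complex.normSq_pos.mpr hy) ?_
  have h4 := abs_le.mp (abs_sub_round z.re)
  rw [Complex.normSq_apply]
  simp [Complex.conj_eq_iff_im.mp hz]
  nlinarith

theorem normSq_descent {α : Type*} {P Q : α → Prop} {f : α → ℂ} (hf : ∀ x, Q x → f x ∈ OK)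
    (h : ∀ x, Q x → (∀ y, Q y → Complex.normSq (f y) < Complex.normSq (f x) → P y) → P x)
    (x : α) (hx : Q x) : P x := by
  obtain ⟨n, hn⟩ := exists_normSq_eq (hf x hx)
  induction n using Nat.strong_induction_on generalizing x with
  | _ n ih =>
    refine h x hx fun y hy hlt => ?_
    obtain ⟨m, hm⟩ := exists_normSq_eq (hf y hy)
    rw [hn, hm] at hlt
    exact ih m (by exact_mod_cast hlt) y hy hm

end EuclideanDivision

section Generation

open ComplexConjugate

variable {M N : Matrix (Fin 4) (Fin 4) ℂ}

/-- The monoid generated by the elementary matrices. -/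
def elementary : Submonoid (Matrix (Fin 4) (Fin 4) ℂ) :=
  Submonoid.closure ({M | ∃ n p q m, M = trM n p q m} ∪ {M | ∃ ξ ∈ OK, M = levi ξ} ∪
    {swM, sgM, inM})

theorem trM_mem (n p q m : ℤ) : trM n p q m ∈ elementary :=
  Submonoid.subset_closure (Or.inl (Or.inl ⟨n, p, q, m, rfl⟩))

theorem levi_mem {ξ : ℂ} (h : ξ ∈ OK) : levi ξ ∈ elementary :=
  Submonoid.subset_closure (Or.inl (Or.inr ⟨ξ, h, rfl⟩))

theorem swM_mem : swM ∈ elementary := Submonoid.subset_closure (Or.inr (by simp))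

theorem sgM_mem : sgM ∈ elementary := Submonoid.subset_closure (Or.inr (by simp))

theorem inM_mem : inM ∈ elementary := Submonoid.subset_closure (Or.inr (by simp))

theorem mem_elementary_of_mul {γ γ' : Matrix (Fin 4) (Fin 4) ℂ} (h : γ * γ' = 1)
    (hγ : γ' ∈ elementary) (hM : M * γ ∈ elementary) : M ∈ elementary := by
  rw [← mul_one M, ← h, ← mul_assoc]
  exact mul_mem hM hγ

theorem swM_mul_swM : swM * swM = 1 := by
  ext i j
  fin_cases i <;> fin_cases j <;> simp [swM, Matrix.mul_apply, Fin.sum_univ_four]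

theorem inM_mul_cube : inM * (inM * inM * inM) = 1 := by
  ext i j
  fin_cases i <;> fin_cases j <;> simp [inM, Matrix.mul_apply, Fin.sum_univ_four]

theorem trM_mul_trM_neg (n : ℤ) : trM n 0 0 0 * trM (-n) 0 0 0 = 1 := by
  ext i j
  fin_cases i <;> fin_cases j <;> simp [trM, Matrix.mul_apply, Fin.sum_univ_four]

theorem Jmat_mul_Jmat : Jmat * Jmat = -1 := by
  ext i j
  fin_cases i <;> fin_cases j <;> simp [Jmat, Matrix.mul_apply, Fin.sum_univ_four]

theorem mem_of_levi_swM {ξ : ℂ} (hξ : ξ ∈ OK) (h : M * (levi ξ * swM) ∈ elementary) :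
    M ∈ elementary := by
  rw [← mul_assoc] at h
  refine mem_elementary_of_mul (γ' := levi (-ξ)) ?_ (levi_mem (neg_mem hξ))
    (mem_elementary_of_mul swM_mul_swM swM_mem h)
  rw [levi_mul, add_neg_cancel, levi_zero]

theorem mem_of_trM_inM (n : ℤ) (h : M * (trM n 0 0 0 * inM) ∈ elementary) : M ∈ elementary := by
  rw [← mul_assoc] at h
  exact mem_elementary_of_mul (trM_mul_trM_neg n) (trM_mem _ _ _ _)
    (mem_elementary_of_mul inM_mul_cube (mul_mem (mul_mem inM_mem inM_mem) inM_mem) h)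

theorem inSU.mul (hM : inSU 7 M) (hN : inSU 7 N) : inSU 7 (M * N) := by
  obtain ⟨h1, h2, h3⟩ := inSU_iff.mp hM
  obtain ⟨h1', h2', h3'⟩ := inSU_iff.mp hN
  refine inSU_iff.mpr ⟨fun i j => ?_, by rw [Matrix.det_mul, h2, h2', one_mul], ?_⟩
  · rw [Matrix.mul_apply]
    exact sum_mem fun l _ => mul_mem (h1 _ _) (h1' _ _)
  · calc (M * N)ᵀ * Jmat * (M * N).map conj = Nᵀ * (Mᵀ * Jmat * M.map conj) * N.map conj := by
          rw [Matrix.transpose_mul, Matrix.map_mul]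
          simp only [Matrix.mul_assoc]
      _ = Jmat := by rw [h3, h3']

theorem inSU.mem (hM : inSU 7 M) (i j : Fin 4) : M i j ∈ OK := (inSU_iff.mp hM).1 i j

theorem inSU.row (hM : inSU 7 M) (i j : Fin 4) :
    M i 2 * conj (M j 0) + M i 3 * conj (M j 1) - M i 0 * conj (M j 2) - M i 1 * conj (M j 3) =
      Jmat i j := by
  have h : (-Jmat * Mᵀ * Jmat) * M.map conj = 1 := by
    rw [Matrix.mul_assoc, Matrix.mul_assoc, ← Matrix.mul_assoc Mᵀ, (inSU_iff.mp hM).2.2,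
      Matrix.neg_mul, Jmat_mul_Jmat, neg_neg]
  have h1 := _root_.mul_eq_one_comm.mp h
  have h2 : M.map conj * Jmat * Mᵀ = Jmat := by
    have h3 := congrArg (fun X => X * Jmat) h1
    simp only [Matrix.mul_assoc, Jmat_mul_Jmat, Matrix.mul_neg, Matrix.neg_mul, neg_neg,
      Matrix.mul_one, Matrix.one_mul] at h3
    rwa [Matrix.mul_assoc]
  have h3 := congrArg conj (congrFun (congrFun h2 i) j)
  have h4 : conj (Jmat i j) = Jmat i j := by fin_cases i <;> fin_cases j <;> simp [Jmat]
  rw [h4] at h3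
  rw [← h3]
  simp [Matrix.mul_apply, Fin.sum_univ_four, Jmat]
  ring

theorem mem_elementary_of_unipotent (hM : inSU 7 M) (h20 : M 2 0 = 0) (h21 : M 2 1 = 0)
    (h30 : M 3 0 = 0) (h31 : M 3 1 = 0) (h32 : M 3 2 = 0) (h22 : M 2 2 = 1) (h33 : M 3 3 = 1) :
    M ∈ elementary := by
  have r30 := hM.row 3 0
  have r31 := hM.row 3 1
  have r20 := hM.row 2 0
  have r21 := hM.row 2 1
  have r00 := hM.row 0 0
  have r01 := hM.row 0 1
  have r11 := hM.row 1 1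
  simp [h20, h21, h30, h31, h32, h33, h22, Jmat] at r30 r31 r20 r21
  have h00 : M 0 0 = 1 := by simpa [r30] using congrArg conj r20
  have h11 : M 1 1 = 1 := by simpa using congrArg conj r31
  simp [h11] at r21
  have h10 : conj (M 1 0) = -M 2 3 := by linear_combination r21
  have h10' : M 1 0 = -conj (M 2 3) := by rw [← Complex.conj_conj (M 1 0), h10, map_neg]
  simp [r30, h00, h11, h10', Jmat] at r00 r01 r11
  obtain ⟨n, hn⟩ := exists_int_of_conj_eq (hM.mem 0 2) (by linear_combination -r00)
  obtain ⟨l, hl⟩ := exists_int_of_conj_eq (x := M 1 3 - M 2 3 * M 1 2)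
    (sub_mem (hM.mem _ _) (mul_mem (hM.mem _ _) (hM.mem _ _)))
    (by rw [map_sub, map_mul]; linear_combination -r11)
  obtain ⟨p, q, hpq⟩ := mem_OK.mp (hM.mem 1 2)
  have h03 : M 0 3 = M 2 3 * n + (p + q * (1 - om)) := by
    rw [hpq, hn] at r01
    simp only [map_add, map_mul, map_intCast, conj_om] at r01
    linear_combination r01
  have h13 : M 1 3 = M 2 3 * (p + q * om) + l := by rw [← hpq, ← hl]; ring
  have e : M = trM n p q l * levi (-conj (M 2 3)) := by
    ext i j
    fin_cases i <;> fin_cases j <;>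
      simp [trM, levi, Matrix.mul_apply, Fin.sum_univ_four, *]
    all_goals try ring
  rw [e]
  exact mul_mem (trM_mem _ _ _ _) (levi_mem (neg_mem (conj_mem (hM.mem _ _))))

theorem mem_elementary_of_blkC_eq_zero (hM : inSU 7 M) (h20 : M 2 0 = 0) (h21 : M 2 1 = 0)
    (h30 : M 3 0 = 0) (h31 : M 3 1 = 0) (h32 : M 3 2 = 0) : M ∈ elementary := by
  have r30 := hM.row 3 0
  have r31 := hM.row 3 1
  have r20 := hM.row 2 0
  simp [h20, h21, h30, h31, h32, Jmat] at r30 r31 r20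
  have h33 : M 3 3 ≠ 0 := left_ne_zero_of_mul_eq_one r31
  have h01 : M 0 1 = 0 := by simpa [h33] using r30
  simp [h01] at r20
  have hsg : ∀ {N}, inSU 7 N → N 2 0 = 0 → N 2 1 = 0 → N 3 0 = 0 → N 3 1 = 0 → N 3 2 = 0 →
      N 2 2 = 1 → (N 3 3 = 1 ∨ N 3 3 = -1) → N ∈ elementary := by
    intro N hN h20 h21 h30 h31 h32 h22 h33
    rcases h33 with h33 | h33
    · exact mem_elementary_of_unipotent hN h20 h21 h30 h31 h32 h22 h33
    · refine mem_elementary_of_mul sgM_mul_sgM sgM_mem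
        (mem_elementary_of_unipotent (hN.mul inSU_sgM) ?_ ?_ ?_ ?_ ?_ ?_ ?_) <;>
      simp [sgM, Matrix.mul_apply, Fin.sum_univ_four, *]
  have h33' := eq_one_or_eq_neg_one_of_mul_eq_one (hM.mem _ _) (conj_mem (hM.mem _ _)) r31
  rcases eq_one_or_eq_neg_one_of_mul_eq_one (hM.mem _ _) (conj_mem (hM.mem _ _)) r20 with h22 | h22
  · exact hsg hM h20 h21 h30 h31 h32 h22 h33'
  · refine mem_elementary_of_mul (γ := swM * sgM * swM) (γ' := swM * sgM * swM) ?_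
      (mul_mem (mul_mem swM_mem sgM_mem) swM_mem)
      (hsg (hM.mul ((inSU_swM.mul inSU_sgM).mul inSU_swM)) ?_ ?_ ?_ ?_ ?_ ?_ ?_)
    · simp only [Matrix.mul_assoc]
      rw [← Matrix.mul_assoc swM swM, swM_mul_swM, Matrix.one_mul, ← Matrix.mul_assoc sgM sgM,
        sgM_mul_sgM, Matrix.one_mul, swM_mul_swM]
    all_goals simp [swM, sgM, Matrix.mul_apply, Fin.sum_univ_four, *]

theorem mem_elementary_of_bottom_row (hM : inSU 7 M)
    (h : M 3 0 = 0 ∧ M 3 1 = 0 ∧ M 3 2 = 0) : M ∈ elementary := by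
  refine normSq_descent (Q := fun M => inSU 7 M ∧ M 3 0 = 0 ∧ M 3 1 = 0 ∧ M 3 2 = 0)
    (f := fun M => M 2 0) (fun M hM => hM.1.mem _ _) ?_ M ⟨hM, h⟩
  rintro M ⟨hM, h30, h31, h32⟩ ih
  have r31 := hM.row 3 1
  have r32 := hM.row 3 2
  simp [h30, h31, h32, Jmat] at r31 r32
  have h21 : M 2 1 = 0 := r32.resolve_left (left_ne_zero_of_mul_eq_one r31)
  by_cases h20 : M 2 0 = 0
  · exact mem_elementary_of_blkC_eq_zero hM h20 h21 h30 h31 h32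
  have r22 := hM.row 2 2
  simp [h21, Jmat] at r22
  obtain ⟨n, hn⟩ := exists_int_normSq_add_mul_lt h20 (sub_eq_zero.mp r22)
  refine mem_of_trM_inM n (ih _ ⟨hM.mul ((inSU_trM n 0 0 0).mul inSU_inM), ?_, ?_, ?_⟩ ?_)
  on_goal 4 => convert hn using 2
  all_goals simp [trM, inM, Matrix.mul_apply, Fin.sum_univ_four, *]
  all_goals ring

theorem mem_elementary_of_bottom_row_left (hM : inSU 7 M) (h : M 3 0 = 0 ∧ M 3 1 = 0) :
    M ∈ elementary := by
  refine normSq_descent (Q := fun M => inSU 7 M ∧ M 3 0 = 0 ∧ M 3 1 = 0)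
    (f := fun M => M 3 2) (fun M hM => hM.1.mem _ _) ?_ M ⟨hM, h⟩
  rintro M ⟨hM, h30, h31⟩ ih
  by_cases h32 : M 3 2 = 0
  · exact mem_elementary_of_bottom_row hM ⟨h30, h31, h32⟩
  obtain ⟨q, hq, hlt⟩ := exists_normSq_add_mul_lt (M 3 3) h32
  have hq' : -conj q ∈ OK := neg_mem (conj_mem hq)
  refine mem_of_levi_swM hq' (ih _ ⟨hM.mul ((inSU_levi hq').mul inSU_swM), ?_, ?_⟩ ?_)
  on_goal 3 => convert hlt using 2
  all_goals simp [levi, swM, Matrix.mul_apply, Fin.sum_univ_four, *]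
  all_goals ring

theorem mem_elementary_of_corner (hM : inSU 7 M) (h : M 3 1 = 0) : M ∈ elementary := by
  refine normSq_descent (Q := fun M => inSU 7 M ∧ M 3 1 = 0)
    (f := fun M => M 3 0) (fun M hM => hM.1.mem _ _) ?_ M ⟨hM, h⟩
  rintro M ⟨hM, h31⟩ ih
  by_cases h30 : M 3 0 = 0
  · exact mem_elementary_of_bottom_row_left hM ⟨h30, h31⟩
  have r33 := hM.row 3 3
  simp [h31, Jmat] at r33
  obtain ⟨n, hn⟩ := exists_int_normSq_add_mul_lt h30 (sub_eq_zero.mp r33)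
  refine mem_of_trM_inM n (ih _ ⟨hM.mul ((inSU_trM n 0 0 0).mul inSU_inM), ?_⟩ ?_)
  on_goal 2 => convert hn using 2
  all_goals simp [trM, inM, Matrix.mul_apply, Fin.sum_univ_four, *]
  all_goals ring

theorem inSU.mem_elementary (hM : inSU 7 M) : M ∈ elementary := by
  refine normSq_descent (Q := inSU 7) (f := fun M => M 3 1) (fun M hM => hM.mem _ _) ?_ M hM
  intro M hM ih
  by_cases h31 : M 3 1 = 0
  · exact mem_elementary_of_corner hM h31
  obtain ⟨q, hq, hlt⟩ := exists_normSq_add_mul_lt (M 3 0) h31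
  refine mem_of_levi_swM hq (ih _ (hM.mul ((inSU_levi hq).mul inSU_swM)) ?_)
  convert hlt using 2
  simp [levi, swM, Matrix.mul_apply, Fin.sum_univ_four]
  ring

end Generation

section Converse

variable {k : ℕ} {G : ℂ → ℂ → ℂ → ℂ → ℂ} {M : Matrix (Fin 4) (Fin 4) ℂ}

theorem SymForm.actsOn (hG : SymForm k G) (hM : inSU 7 M) : ActsOn k (toF G) M := by
  have h := hM.mem_elementary
  clear hM
  induction h using Submonoid.closure_induction with
  | mem x hx =>
    rcases hx with (⟨n, p, q, m, rfl⟩ | ⟨ξ, hξ, rfl⟩) | rfl | rfl | rfl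
    · exact hG.inv_trM n p q m
    · exact hG.inv_levi hξ
    · exact hG.inv_swM
    · exact hG.inv_sgM
    · exact hG.inv_inM
  | one => rw [← sgM_mul_sgM]; exact hG.inv_sgM.mul hG.inv_sgM
  | mul x y _ _ hx hy => exact hx.mul hy

theorem SymForm.isSymHMF (hG : SymForm k G) : IsSymHMF 7 k (toF G) := by
  refine ⟨⟨fun τ hτ => ?_, fun M hM τ hτ => (hG.actsOn hM τ hτ).2.2⟩, fun τ hτ => ?_⟩
  · exact (hG.differentiableAt_comp (om_co_iff.mpr hτ) (differentiable_entry 0 0 τ)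
      (differentiable_coA τ) (differentiable_coB τ)
      (differentiable_entry 1 1 τ)).differentiableWithinAt
  · obtain ⟨t, a, b, w, hO, rfl⟩ := exists_pt hτ
    have h1 : Om t (-a) (-b) w := by simpa [Om] using hO
    have h2 := hG.sig _ _ _ _ h1
    rw [neg_neg, sub_neg_eq_add, hG.neg _ _ _ _ hO, zpow_natCast] at h2
    rw [pt_transpose, toF_pt, toF_pt, h2]

end Converse

/-- For K = ℚ(√-7), the graded ring of symmetric Hermitian modular forms of
degree two is generated by nine symmetric forms of weights 4, 6, 7, 8, 9, 10, 10, 11, 12. -/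
theorem symmetric_graded_ring_generated_seven :
    ∃ g : Fin 9 → (Matrix (Fin 2) (Fin 2) ℂ → ℂ),
      IsSymHMF 7 4 (g 0) ∧ IsSymHMF 7 6 (g 1) ∧ IsSymHMF 7 7 (g 2) ∧
      IsSymHMF 7 8 (g 3) ∧ IsSymHMF 7 9 (g 4) ∧ IsSymHMF 7 10 (g 5) ∧
      IsSymHMF 7 10 (g 6) ∧ IsSymHMF 7 11 (g 7) ∧ IsSymHMF 7 12 (g 8) ∧
      ∀ k : ℕ, ∀ F : Matrix (Fin 2) (Fin 2) ℂ → ℂ, IsSymHMF 7 k F →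
        ∃ P : MvPolynomial (Fin 9) ℂ,
          ∀ τ ∈ HH2, F τ = MvPolynomial.eval (fun i => g i τ) P := by
  obtain ⟨g, hg, hgen⟩ := exists_generators
  refine ⟨fun i => toF (g i), (hg 0).isSymHMF, (hg 1).isSymHMF, (hg 2).isSymHMF, (hg 3).isSymHMF,
    (hg 4).isSymHMF, (hg 5).isSymHMF, (hg 6).isSymHMF, (hg 7).isSymHMF, (hg 8).isSymHMF,
    fun k F hF => ?_⟩
  obtain ⟨G, ⟨P, hP⟩, hFG⟩ := hgen _ _ hF.symForm
  refine ⟨P, fun τ hτ => ?_⟩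
  obtain ⟨t, a, b, w, hO, rfl⟩ := exists_pt hτ
  simp only [toF_pt]
  rw [hFG _ _ _ _ hO, hP]

end
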